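/- Let M be a positive integer and let f be a transcendental meromorphic function in the plane with Schwarzian derivative S_f = 2A such that: (i) f has finitely many critical values and all multiple points of f have multiplicity at most M; (ii) the inverse function of f has finitely many transcendental singularities. If A is transcendental, then f has infinitely many multiple points. -/

import Mathlib

open Filter Set Topology Bornology MeasureTheory

noncomputable section

/-! ### The extended plane and the chordal metric

ℂ∞ is modelled as `Option ℂ`, with `none` denoting the point ∞. -/

/-- The chordal metric χ on the extended complex plane ℂ∞ (`none` = ∞). -/
def chordal : Option ℂ → Option ℂ → ℝ
  | Option.none, Option.none => 0
  | Option.none, Option.some w => 1 / Real.sqrt (1 + ‖w‖ ^ 2)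
  | Option.some z, Option.none => 1 / Real.sqrt (1 + ‖z‖ ^ 2)
  | Option.some z, Option.some w =>
      ‖z - w‖ / Real.sqrt ((1 + ‖z‖ ^ 2) * (1 + ‖w‖ ^ 2))

/-! ### Meromorphic functions in the plane -/

/-- `f` is meromorphic on the plane with pole set `P`: poles form a discrete closed set,
`f` is analytic off `P`, and `|f| → ∞` at each point of `P`. -/
def MeroPlane (f : ℂ → ℂ) (P : Set ℂ) : Prop :=
  (∀ K : Set ℂ, IsCompact K → (P ∩ K).Finite) ∧
  (∀ z ∉ P, AnalyticAt ℂ f z) ∧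
  ∀ p ∈ P, Tendsto (fun z => ‖f z‖) (nhdsWithin p Pᶜ) atTop

/-- `f` coincides with a rational function away from its poles. -/
def RationalFn (f : ℂ → ℂ) (P : Set ℂ) : Prop :=
  ∃ p q : Polynomial ℂ, q ≠ 0 ∧ ∀ z ∉ P, q.eval z ≠ 0 → f z = p.eval z / q.eval z

/-- `f` is a transcendental meromorphic function in the plane, with pole set `P`. -/
def TranscMeroPlane (f : ℂ → ℂ) (P : Set ℂ) : Prop :=
  MeroPlane f P ∧ ¬ RationalFn f P

/-- `f` has a pole of order `m` at `z₀`. -/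
def PoleOrder (f : ℂ → ℂ) (z₀ : ℂ) (m : ℕ) : Prop :=
  0 < m ∧ ∃ g : ℂ → ℂ, AnalyticAt ℂ g z₀ ∧ g z₀ ≠ 0 ∧
    ∀ᶠ z in nhdsWithin z₀ {z₀}ᶜ, f z = g z / (z - z₀) ^ m

/-- `f` has a zero of order `m` at `z₀`. -/
def ZeroOrder (f : ℂ → ℂ) (z₀ : ℂ) (m : ℕ) : Prop :=
  0 < m ∧ ∃ g : ℂ → ℂ, AnalyticAt ℂ g z₀ ∧ g z₀ ≠ 0 ∧
    ∀ᶠ z in nhds z₀, f z = (z - z₀) ^ m * g z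

/-- `z₀` is a multiple point of `f` of multiplicity `μ`: either a pole of `f` of order `μ ≥ 2`,
or a point of analyticity where `f'` has a zero of order `μ - 1`. -/
def MultiplePointWithMult (f : ℂ → ℂ) (z₀ : ℂ) (μ : ℕ) : Prop :=
  2 ≤ μ ∧ (PoleOrder f z₀ μ ∨ (AnalyticAt ℂ f z₀ ∧ ZeroOrder (deriv f) z₀ (μ - 1)))

/-- `z₀` is a multiple point of `f`. -/
def MultiplePoint (f : ℂ → ℂ) (z₀ : ℂ) : Prop :=
  ∃ μ, MultiplePointWithMult f z₀ μ

open scoped Classical in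
/-- The value of `f` at `z` as an element of ℂ∞, given the pole set `P`. -/
def valueAt (f : ℂ → ℂ) (P : Set ℂ) (z : ℂ) : Option ℂ :=
  if z ∈ P then none else some (f z)

/-- The set of critical values of `f` in ℂ∞ (values at multiple points). -/
def CriticalValues (f : ℂ → ℂ) (P : Set ℂ) : Set (Option ℂ) :=
  {w | ∃ z, MultiplePoint f z ∧ w = valueAt f P z}

/-! ### Transcendental singularities of the inverse function -/

/-- A path tending to infinity on which `f → a`; such a path determines a transcendental
singularity of `f⁻¹` over `a`. -/
def AsymptoticPath (f : ℂ → ℂ) (P : Set ℂ) (a : Option ℂ) (γ : ℝ → ℂ) : Prop :=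
  ContinuousOn γ (Ici 0) ∧
  Tendsto (fun t => ‖γ t‖) atTop atTop ∧
  Tendsto (fun t => chordal (valueAt f P (γ t)) a) atTop (nhds 0)

/-- `C` is a connected component of the set `S`. -/
def IsComponentOf (C S : Set ℂ) : Prop :=
  ∃ x ∈ S, C = connectedComponentIn S x

/-- The paths `γ₁`, `γ₂`, with asymptotic values `a₁`, `a₂` respectively, determine
distinct transcendental singularities of `f⁻¹`. -/
def DistinctSingularities (f : ℂ → ℂ) (P : Set ℂ) (a₁ a₂ : Option ℂ) (γ₁ γ₂ : ℝ → ℂ) : Prop :=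
  a₁ ≠ a₂ ∨ ∃ t : ℝ, 0 < t ∧ ∃ C₁ C₂ : Set ℂ,
    IsComponentOf C₁ {z | chordal (valueAt f P z) a₁ < t} ∧
    IsComponentOf C₂ {z | chordal (valueAt f P z) a₂ < t} ∧
    Disjoint C₁ C₂ ∧
    IsBounded (γ₁ '' Ici 0 \ C₁) ∧ IsBounded (γ₂ '' Ici 0 \ C₂)

/-- The inverse function of `f` has finitely many transcendental singularities: there is a
bound `n` on the size of any family of pairwise distinct transcendental singularities. -/
def FinitelyManyTranscSing (f : ℂ → ℂ) (P : Set ℂ) : Prop :=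
  ∃ n : ℕ, ∀ m : ℕ, ∀ a : Fin m → Option ℂ, ∀ γ : Fin m → ℝ → ℂ,
    (∀ i, AsymptoticPath f P (a i) (γ i)) →
    (∀ i j, i ≠ j → DistinctSingularities f P (a i) (a j) (γ i) (γ j)) →
    m ≤ n

/-- The Schwarzian derivative `S_f = f'''/f' - (3/2)(f''/f')²`. -/
def schwarzian (f : ℂ → ℂ) (z : ℂ) : ℂ :=
  deriv (deriv (deriv f)) z / deriv f z - (3 / 2) * (deriv (deriv f) z / deriv f z) ^ 2

/-- `w` is a singular value of `f⁻¹`: a critical value or an asymptotic value of `f`. -/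
def SingularValue (f : ℂ → ℂ) (P : Set ℂ) (w : Option ℂ) : Prop :=
  w ∈ CriticalValues f P ∨ ∃ γ : ℝ → ℂ, AsymptoticPath f P w γ

/-! ### Nevanlinna theory -/

open scoped Classical in
/-- The order of the pole of `f` at `z` (junk value `0` if there is no pole). -/
def poleOrderAt (f : ℂ → ℂ) (z : ℂ) : ℕ :=
  if h : ∃ m, PoleOrder f z m then h.choose else 0

/-- `n(t, f)`: the number of poles of `f` of modulus at most `t`, counted with multiplicity. -/
def nCount (f : ℂ → ℂ) (t : ℝ) : ℕ :=
  ∑ᶠ z ∈ {w : ℂ | ‖w‖ ≤ t}, poleOrderAt f z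

/-- `N(r, f)`: the integrated counting function of the poles of `f`. -/
def nevN (f : ℂ → ℂ) (r : ℝ) : ℝ :=
  (nCount f 0 : ℝ) * Real.log r + ∫ t in (0:ℝ)..r, ((nCount f t : ℝ) - (nCount f 0 : ℝ)) / t

/-- `m(r, f)`: the Nevanlinna proximity function. -/
def nevm (f : ℂ → ℂ) (r : ℝ) : ℝ :=
  (1 / (2 * Real.pi)) * ∫ θ in (0:ℝ)..(2 * Real.pi),
    Real.log (max 1 (‖f (r * Complex.exp (θ * Complex.I))‖))

/-- `T(r, f)`: the Nevanlinna characteristic. -/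
def nevT (f : ℂ → ℂ) (r : ℝ) : ℝ := nevm f r + nevN f r

/-- The order of growth `ρ(f) = limsup_{r→∞} log T(r,f)/log r`, as an extended real. -/
def growthOrder (f : ℂ → ℂ) : EReal :=
  Filter.limsup (fun r : ℝ => ((Real.log (nevT f r) / Real.log r : ℝ) : EReal)) atTop

/-- ∞ is a Borel exceptional value of `f`. -/
def BorelExceptionalInfty (f : ℂ → ℂ) : Prop :=
  Filter.limsup (fun r : ℝ => ((Real.log (nevN f r) / Real.log r : ℝ) : EReal)) atTop <
  Filter.limsup (fun r : ℝ => ((Real.log (nevT f r) / Real.log r : ℝ) : EReal)) atTop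

/-! ### Meromorphic functions near infinity and the Wiman-Valiron property -/

/-- `A` is meromorphic in `R ≤ |z| < ∞` with pole set `P`. -/
def MeroAnnulus (A : ℂ → ℂ) (R : ℝ) (P : Set ℂ) : Prop :=
  P ⊆ {z : ℂ | R ≤ ‖z‖} ∧
  (∀ K : Set ℂ, IsCompact K → (P ∩ K).Finite) ∧
  (∀ z : ℂ, R < ‖z‖ → z ∉ P → AnalyticAt ℂ A z) ∧
  ∀ p ∈ P, Tendsto (fun z => ‖A z‖) (nhdsWithin p Pᶜ) atTop

/-- `A` (meromorphic near ∞ with pole set `P`) has an essential singularity at infinity: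
it is not the case that the poles are bounded and `A(z) ~ c zⁿ` as `z → ∞`. -/
def EssSingAtInfty (A : ℂ → ℂ) (P : Set ℂ) : Prop :=
  ¬ (IsBounded P ∧ ∃ (n : ℤ) (c : ℂ), c ≠ 0 ∧
      Tendsto (fun z : ℂ => A z / z ^ n)
        (Filter.comap (fun z : ℂ => ‖z‖) atTop ⊓ Filter.principal Pᶜ) (nhds c))

/-- The logarithmic rectangle `D(z_r, L)` of Definition 2.1. -/
def WVDisk (z₀ : ℂ) (Nr phir L : ℝ) : Set ℂ :=
  {z : ℂ | ∃ τ : ℂ, z = z₀ * Complex.exp τ ∧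
    |τ.re| ≤ L * phir / Nr ∧ |τ.im| ≤ L * phir / Nr}

/-- Data witnessing the Wiman-Valiron property for `A`, meromorphic in `R ≤ |z| < ∞`:
an unbounded set `F1 ⊆ [R,∞)`, functions `N : F1 → [2,∞)`, `phi : F1 → [1,∞)` and points
`zr r` with `|zr r| = r`, such that `N(r) → ∞`, `phi(r)/N(r) → 0`, `phi(r)/log N(r) → ∞`,
`phi(r) = o(log⁺ |A(zr r)|)`, and `A(z) ~ (z/zr r)^{N(r)} A(zr r)` on `D(zr r, 8)`,
uniformly as `r → ∞` in `F1`.  (For `z = zr r · e^τ` one has `(z/zr r)^{N(r)} = e^{N(r)τ}`.) -/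
structure WVData (A : ℂ → ℂ) (R : ℝ) where
  F1 : Set ℝ
  N : ℝ → ℝ
  phi : ℝ → ℝ
  zr : ℝ → ℂ
  F1_sub : F1 ⊆ Ici R
  F1_unbounded : ∀ c : ℝ, ∃ r ∈ F1, c < r
  N_ge : ∀ r ∈ F1, 2 ≤ N r
  phi_ge : ∀ r ∈ F1, 1 ≤ phi r
  N_tendsto : Tendsto N (atTop ⊓ Filter.principal F1) atTop
  phi_over_N : Tendsto (fun r => phi r / N r) (atTop ⊓ Filter.principal F1) (nhds 0)
  phi_over_logN : Tendsto (fun r => phi r / Real.log (N r)) (atTop ⊓ Filter.principal F1) atTop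
  zr_abs : ∀ r ∈ F1, ‖zr r‖ = r
  phi_small : Tendsto (fun r => phi r / Real.log (max 1 (‖A (zr r)‖)))
      (atTop ⊓ Filter.principal F1) (nhds 0)
  approx : ∀ ε : ℝ, 0 < ε → ∀ᶠ r in atTop ⊓ Filter.principal F1, ∀ τ : ℂ,
      |τ.re| ≤ 8 * phi r / N r → |τ.im| ≤ 8 * phi r / N r →
      ‖A (zr r * Complex.exp τ) - Complex.exp ((N r : ℂ) * τ) * A (zr r)‖
        ≤ ε * ‖Complex.exp ((N r : ℂ) * τ) * A (zr r)‖

/-- `A` has the Wiman-Valiron property (Definition 2.1). -/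
def HasWVProp (A : ℂ → ℂ) (R : ℝ) : Prop := Nonempty (WVData A R)

/-- The point `w_r = z_r exp(-4 phi(r)/N(r))`. -/
def WVwr {A : ℂ → ℂ} {R : ℝ} (W : WVData A R) (r : ℝ) : ℂ :=
  W.zr r * Complex.exp (((-(4 * W.phi r / W.N r) : ℝ) : ℂ))

/-- The quantity `Z_r = |2 z_r A(z_r)^{1/2} / (N(r)+2)|`. -/
def WVZr {A : ℂ → ℂ} {R : ℝ} (W : WVData A R) (r : ℝ) : ℝ :=
  2 * r * Real.sqrt (‖A (W.zr r)‖) / (W.N r + 2)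

/-- The data of an analytic branch `sqA r` of `A^{1/2}` on `D(z_r, 4)` together with the
primitive `Z r` of `A^{1/2}` with `Z r (w_r) = 2 w_r A(w_r)^{1/2}/(N+2)`; this encodes
`Z(z) = 2 w_r A(w_r)^{1/2}/(N+2) + ∫_{w_r}^z A(t)^{1/2} dt`. -/
def IsZData {A : ℂ → ℂ} {R : ℝ} (W : WVData A R) (sqA Z : ℝ → ℂ → ℂ) (r : ℝ) : Prop :=
  (∀ z ∈ WVDisk (W.zr r) (W.N r) (W.phi r) 4,
      (sqA r z) ^ 2 = A z ∧ AnalyticAt ℂ (sqA r) z ∧ HasDerivAt (Z r) (sqA r z) z) ∧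
  Z r (WVwr W r) = 2 * WVwr W r * sqA r (WVwr W r) / ((W.N r : ℂ) + 2)

/-- The closed logarithmic rectangle `J₁ = {Z : |log|Z/Z_r|| ≤ phi(r), |arg Z| ≤ π/4}`. -/
def J1 (Zr phir : ℝ) : Set ℂ :=
  {w : ℂ | w ≠ 0 ∧ |Real.log (‖w‖ / Zr)| ≤ phir ∧ |Complex.arg w| ≤ Real.pi / 4}

/-! ### ε-sets -/

/-- An ε-set: a countable union of discs `B(b_j, ρ_j)` with `|b_j| → ∞` and
`Σ ρ_j/|b_j| < ∞`. -/
def IsEpsilonSet (E : Set ℂ) : Prop :=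
  ∃ (b : ℕ → ℂ) (ρ : ℕ → ℝ), (∀ j, 0 ≤ ρ j) ∧
    Tendsto (fun j => ‖b j‖) atTop atTop ∧
    Summable (fun j => ρ j / ‖b j‖) ∧
    E = ⋃ j, Metric.ball (b j) (ρ j)


section
def GoodSet (h : ℂ → ℂ) (P : Set ℂ) : Set ℂ := {z | z ∉ P ∧ deriv h z ≠ 0}

def Nonsing (h : ℂ → ℂ) (P : Set ℂ) (c : ℂ) : Prop :=
  (∀ z ∉ P, h z = c → deriv h z ≠ 0) ∧
  ∀ γ : ℝ → ℂ, ContinuousOn γ (Ici 0) → (∀ t, 0 ≤ t → γ t ∉ P) →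
    Tendsto (fun t => ‖γ t‖) atTop atTop → ¬ Tendsto (fun t => h (γ t)) atTop (𝓝 c)

theorem MeroPlane.isClosed {h : ℂ → ℂ} {P : Set ℂ} (hm : MeroPlane h P) : IsClosed P := by
  rw [← isOpen_compl_iff, Metric.isOpen_iff]
  intro z hz
  have hf := hm.1 (Metric.closedBall z 1) (isCompact_closedBall z 1)
  have : IsOpen (P ∩ Metric.closedBall z 1)ᶜ := hf.isClosed.isOpen_compl
  obtain ⟨e, he, h2⟩ := Metric.isOpen_iff.1 this z (fun h => hz h.1)
  refine ⟨min e 1, lt_min he one_pos, fun w hw hP => ?_⟩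
  have h3 := h2 (Metric.ball_subset_ball (min_le_left _ _) hw)
  exact h3 ⟨hP, Metric.ball_subset_closedBall (Metric.ball_subset_ball (min_le_right _ _) hw)⟩

theorem MeroPlane.contAt {h : ℂ → ℂ} {P : Set ℂ} (hm : MeroPlane h P) {z : ℂ} (hz : z ∉ P) :
    ContinuousAt h z := (hm.2.1 z hz).continuousAt

theorem MeroPlane.isOpen_good {h : ℂ → ℂ} {P : Set ℂ} (hm : MeroPlane h P) :
    IsOpen (GoodSet h P) := by
  rw [isOpen_iff_mem_nhds]
  rintro z ⟨hz, hd⟩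
  have h1 : ContinuousAt (deriv h) z := (hm.2.1 z hz).deriv.continuousAt
  filter_upwards [hm.isClosed.isOpen_compl.mem_nhds hz, h1.eventually_ne hd] with w a b
  exact ⟨a, b⟩

theorem MeroPlane.localHomeo {h : ℂ → ℂ} {P : Set ℂ} (hm : MeroPlane h P) :
    IsLocalHomeomorphOn h (GoodSet h P) := by
  rintro z ⟨hz, hd⟩
  have h1 := (hm.2.1 z hz).hasStrictDerivAt
  exact ⟨(h1.hasStrictFDerivAt_equiv hd).toOpenPartialHomeomorph h,
    (h1.hasStrictFDerivAt_equiv hd).mem_toOpenPartialHomeomorph_source, rfl⟩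

theorem MeroPlane.localHomeo_sub {h : ℂ → ℂ} {P : Set ℂ} (hm : MeroPlane h P) :
    IsLocalHomeomorph (fun z : GoodSet h P => h z) := by
  rw [isLocalHomeomorph_iff_isLocalHomeomorphOn_univ]
  exact hm.localHomeo.comp (hm.isOpen_good.isOpenEmbedding_subtypeVal.isLocalHomeomorph.isLocalHomeomorphOn)
    (fun z _ => z.2)

theorem lift_unique {X : Type*} [TopologicalSpace X] {h : ℂ → ℂ} {P : Set ℂ} (hm : MeroPlane h P)
    {s : Set X} (hs : IsPreconnected s) {G₁ G₂ : X → ℂ} (h1 : ContinuousOn G₁ s)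
    (h2 : ContinuousOn G₂ s) (g1 : ∀ x ∈ s, G₁ x ∈ GoodSet h P) (g2 : ∀ x ∈ s, G₂ x ∈ GoodSet h P)
    (he : ∀ x ∈ s, h (G₁ x) = h (G₂ x)) {a : X} (ha : a ∈ s) (hG : G₁ a = G₂ a) :
    ∀ x ∈ s, G₁ x = G₂ x := by
  intro x hx
  have : PreconnectedSpace s := isPreconnected_iff_preconnectedSpace.1 hs
  let F₁ : s → GoodSet h P := fun x => ⟨G₁ x, g1 x x.2⟩
  let F₂ : s → GoodSet h P := fun x => ⟨G₂ x, g2 x x.2⟩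
  have c1 : Continuous F₁ := (continuousOn_iff_continuous_domRestrict.1 h1).subtype_mk _
  have c2 : Continuous F₂ := (continuousOn_iff_continuous_domRestrict.1 h2).subtype_mk _
  have := (T2Space.isSeparatedMap (fun z : GoodSet h P => h z)).eq_of_comp_eq
    hm.localHomeo_sub.isLocallyInjective c1 c2 (funext fun x => he x x.2) ⟨a, ha⟩
    (Subtype.ext hG)
  exact congrArg Subtype.val (congrFun this ⟨x, hx⟩)

/-- a lift of `p` on `[0,b]` starting at `z0` -/
def LiftTo (h : ℂ → ℂ) (P : Set ℂ) (p : ℝ → ℂ) (z0 : ℂ) (b : ℝ) (γ : ℝ → ℂ) : Prop :=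
  ContinuousOn γ (Icc 0 b) ∧ γ 0 = z0 ∧ ∀ t ∈ Icc 0 b, γ t ∉ P ∧ h (γ t) = p t

/-- extension step: partial lift on `[0,b)` extends past `b`. -/
theorem lift_step {h : ℂ → ℂ} {P : Set ℂ} (hm : MeroPlane h P) {p : ℝ → ℂ}
    (hp : ContinuousOn p (Icc 0 1)) (hn : ∀ t ∈ Icc (0:ℝ) 1, Nonsing h P (p t)) {z0 : ℂ}
    {b : ℝ} (hb0 : 0 < b) (hb : b ≤ 1) {γ : ℝ → ℂ}
    (hγ : ∀ t, 0 ≤ t → t < b → LiftTo h P p z0 t γ) :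
    ∃ δ > 0, ∃ γ', LiftTo h P p z0 (min (b + δ) 1) γ' := by
  have hγc : ContinuousOn γ (Ico 0 b) := by
    intro t ht
    have := (hγ ((t + b)/2) (by linarith [ht.1, ht.2]) (by linarith [ht.2])).1 t
      ⟨ht.1, by linarith [ht.2]⟩
    refine this.mono_of_mem_nhdsWithin ?_
    rw [mem_nhdsWithin]
    refine ⟨Iio ((t+b)/2), isOpen_Iio, by simp only [mem_Iio]; linarith [ht.2], ?_⟩
    rintro x ⟨h1, h2⟩
    exact ⟨h2.1, le_of_lt h1⟩
  have hbm : b ∈ Icc (0:ℝ) 1 := ⟨hb0.le, hb⟩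
  have hpb : ∀ V ∈ 𝓝 (p b), ∃ η > 0, ∀ t ∈ Icc (0:ℝ) 1, |t - b| < η → p t ∈ V := by
    intro V hV
    have := hp b hbm hV
    obtain ⟨η, h0, h1⟩ := Metric.mem_nhdsWithin_iff.1 this
    exact ⟨η, h0, fun t ht h2 => h1 ⟨by simpa [Real.dist_eq] using h2, ht⟩⟩
  -- bounded subsequence
  have hfreq : ∃ B : ℝ, ∀ η > 0, ∃ t, 0 ≤ t ∧ t < b ∧ b - t < η ∧ ‖γ t‖ ≤ B := by
    by_contra! hcon
    set φ : ℝ → ℝ := fun t => b - b / (1 + t) with hφ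
    have hφ0 : ∀ t, 0 ≤ t → 0 ≤ φ t ∧ φ t < b := by
      intro t ht
      have h1 : 0 < b / (1+t) := by positivity
      have h2 : b / (1+t) ≤ b := div_le_self hb0.le (by linarith)
      constructor <;> simp only [hφ] <;> linarith
    have hφl : ∀ η > 0, ∀ᶠ t in atTop, b - φ t < η := by
      intro η hη
      filter_upwards [eventually_gt_atTop (b/η), eventually_ge_atTop 0] with t ht ht0
      simp only [hφ, sub_sub_cancel]
      rw [div_lt_iff₀ (by linarith)]
      rw [div_lt_iff₀ hη] at ht
      nlinarith
    refine (hn b hbm).2 (fun t => γ (φ t)) ?_ ?_ ?_ ?_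
    · refine hγc.comp ?_ (fun t ht => ⟨(hφ0 t ht).1, (hφ0 t ht).2⟩)
      have : ∀ x ∈ Ici (0:ℝ), 1 + x ≠ 0 := fun x hx => by
        have : (0:ℝ) ≤ x := hx
        positivity
      simp only [hφ]
      fun_prop (disch := assumption)
    · intro t ht
      exact ((hγ _ (hφ0 t ht).1 (hφ0 t ht).2).2.2 _ ⟨(hφ0 t ht).1, le_rfl⟩).1
    · rw [tendsto_atTop]
      intro B
      obtain ⟨η, hη, h1⟩ := hcon B
      filter_upwards [hφl η hη, eventually_ge_atTop 0] with t ht ht0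
      exact (h1 _ (hφ0 t ht0).1 (hφ0 t ht0).2 ht).le
    · rw [tendsto_nhds]
      intro V hV hVb
      obtain ⟨η, hη, h1⟩ := hpb V (hV.mem_nhds hVb)
      filter_upwards [hφl η hη, eventually_ge_atTop 0] with t ht ht0
      have h2 := hφ0 t ht0
      have h3 := ((hγ _ h2.1 h2.2).2.2 _ ⟨h2.1, le_rfl⟩).2
      simp only [mem_preimage, h3]
      refine h1 _ ⟨h2.1, by linarith⟩ ?_
      rw [abs_sub_comm, abs_of_nonneg (by linarith)]; exact ht
  obtain ⟨B, hB⟩ := hfreq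
  choose τ hτ using fun n : ℕ => hB (1/((n:ℝ)+1)) (by positivity)
  obtain ⟨zs, -, φ, hφm, hφt⟩ := (isCompact_closedBall (0:ℂ) B).tendsto_subseq
    (x := fun n => γ (τ n)) (fun n => by simpa using (hτ n).2.2.2)
  have hτP : ∀ n, γ (τ n) ∉ P ∧ h (γ (τ n)) = p (τ n) := fun n =>
    (hγ _ (hτ n).1 (hτ n).2.1).2.2 _ ⟨(hτ n).1, le_rfl⟩
  have hτb : Tendsto τ atTop (𝓝 b) := by
    have h1 := tendsto_one_div_add_atTop_nhds_zero_nat (𝕜 := ℝ)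
    rw [tendsto_iff_norm_sub_tendsto_zero]
    refine squeeze_zero (fun _ => norm_nonneg _) (fun n => ?_) h1
    rw [Real.norm_eq_abs, abs_sub_comm, abs_of_nonneg (by linarith [(hτ n).2.1])]
    exact (hτ n).2.2.1.le
  have hpl : Tendsto (fun n => h (γ (τ (φ n)))) atTop (𝓝 (p b)) := by
    have : Tendsto (fun n => p (τ (φ n))) atTop (𝓝 (p b)) := by
      have h1 : Tendsto τ atTop (𝓝[Icc 0 1] b) := tendsto_nhdsWithin_iff.2
        ⟨hτb, Eventually.of_forall fun n => ⟨(hτ n).1, by linarith [(hτ n).2.1]⟩⟩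
      exact Tendsto.comp (hp b hbm) (h1.comp hφm.tendsto_atTop)
    refine this.congr fun n => ((hτP _).2).symm
  have hzs : zs ∉ P := by
    intro hz
    have h1 : Tendsto (fun n => γ (τ (φ n))) atTop (𝓝[Pᶜ] zs) := tendsto_nhdsWithin_iff.2
      ⟨hφt, Eventually.of_forall fun n => (hτP _).1⟩
    have h2 := (hm.2.2 zs hz).comp h1
    exact not_tendsto_nhds_of_tendsto_atTop h2 _ hpl.norm
  have hhz : h zs = p b := tendsto_nhds_unique ((hm.contAt hzs).tendsto.comp hφt) hpl
  have hd := (hn b hbm).1 zs hzs hhz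
  obtain ⟨e0, he0, rfl⟩ := hm.localHomeo zs ⟨hzs, hd⟩
  -- restrict to complement of P
  set e := e0.restrOpen Pᶜ hm.isClosed.isOpen_compl with he
  have hes : zs ∈ e.source := by simp [he, he0, hzs]
  have hesP : ∀ z ∈ e.source, z ∉ P := by intro z hz; simp [he] at hz; exact hz.2
  have hee : ∀ z, e z = e0 z := fun z => rfl
  have het : e.target ∈ 𝓝 (p b) := by
    rw [← hhz]; exact e.open_target.mem_nhds (e.map_source hes)
  obtain ⟨η, hη, hηV⟩ := hpb _ het
  have h1 : ∀ᶠ n in atTop, γ (τ (φ n)) ∈ e.source := hφt (e.open_source.mem_nhds hes)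
  have h2 : ∀ᶠ n in atTop, |τ (φ n) - b| < η := by
    have := (hτb.comp hφm.tendsto_atTop).sub_const b
    rw [sub_self] at this
    have := this.abs
    rw [abs_zero] at this
    exact this.eventually (gt_mem_nhds hη)
  obtain ⟨n, hn1, hn2⟩ := (h1.and h2).exists
  set t1 := τ (φ n) with ht1
  have ht10 := (hτ (φ n)).1
  have ht1b := (hτ (φ n)).2.1
  rw [abs_sub_comm, abs_of_nonneg (by linarith)] at hn2
  refine ⟨η/2, by positivity, fun t => if t ≤ t1 then γ t else e.symm (p t), ?_, ?_, ?_⟩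
  · have hin : ∀ t ∈ Icc t1 (min (b+η/2) 1), p t ∈ e.target := by
      intro t ht
      have : t ≤ b + η/2 := ht.2.trans (min_le_left _ _)
      refine hηV t ⟨ht10.trans ht.1, ht.2.trans (min_le_right _ _)⟩ ?_
      rw [abs_lt]; constructor <;> linarith [ht.1]
    have hpe : γ t1 = e.symm (p t1) := by
      have := e.left_inv hn1
      rw [← this, hee, (hτP (φ n)).2]
    refine ContinuousOn.if ?_ ?_ ?_
    · rintro a ⟨ha, ha2⟩
      have : a = t1 := by
        have := frontier_le_subset_eq continuous_id continuous_const ha2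
        simpa using this
      rw [this, hpe]
    · refine (hγ t1 ht10 ht1b).1.mono ?_
      rintro x ⟨hx, hx2⟩
      refine ⟨hx.1, ?_⟩
      have : closure {a : ℝ | a ≤ t1} = {a | a ≤ t1} := isClosed_Iic.closure_eq
      rw [this] at hx2; exact hx2
    · refine (e.continuousOn_symm.comp (hp.mono ?_) hin).mono ?_
      · rintro x ⟨hx, hx2⟩
        exact ⟨ht10.trans hx, hx2.trans (min_le_right _ _)⟩
      · rintro x ⟨hx, hx2⟩
        have : closure {a : ℝ | ¬ a ≤ t1} ⊆ Ici t1 := by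
          refine closure_minimal ?_ isClosed_Ici
          intro y hy; exact (not_le.1 hy).le
        exact ⟨this hx2, hx.2⟩
  · show (if (0:ℝ) ≤ t1 then γ 0 else e.symm (p 0)) = z0
    rw [if_pos (show (0:ℝ) ≤ t1 from ht10)]; exact (hγ t1 ht10 ht1b).2.1
  · intro t ht
    by_cases h3 : t ≤ t1
    · simp only [h3, if_true]; exact (hγ t1 ht10 ht1b).2.2 t ⟨ht.1, h3⟩
    · simp only [h3, if_false]
      push Not at h3
      have h4 : p t ∈ e.target := by
        have : t ≤ b + η/2 := ht.2.trans (min_le_left _ _)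
        refine hηV t ⟨ht.1, ht.2.trans (min_le_right _ _)⟩ ?_
        rw [abs_lt]; constructor <;> linarith
      exact ⟨hesP _ (e.map_target h4), e.right_inv h4⟩

theorem path_lift {h : ℂ → ℂ} {P : Set ℂ} (hm : MeroPlane h P) {p : ℝ → ℂ}
    (hp : ContinuousOn p (Icc 0 1)) (hn : ∀ t ∈ Icc (0:ℝ) 1, Nonsing h P (p t)) {z0 : ℂ}
    (hz0 : z0 ∉ P) (hz : h z0 = p 0) : ∃ γ, LiftTo h P p z0 1 γ := by
  have mono : ∀ {a b γ}, a ≤ b → LiftTo h P p z0 b γ → LiftTo h P p z0 a γ := by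
    intro a b γ hab ⟨h1, h2, h3⟩
    exact ⟨h1.mono (Icc_subset_Icc_right hab), h2, fun t ht => h3 t ⟨ht.1, ht.2.trans hab⟩⟩
  have good : ∀ {b γ}, b ≤ 1 → LiftTo h P p z0 b γ → ∀ t ∈ Icc 0 b, γ t ∈ GoodSet h P := by
    intro b γ hb hl t ht
    exact ⟨(hl.2.2 t ht).1, (hn t ⟨ht.1, ht.2.trans hb⟩).1 _ (hl.2.2 t ht).1 (hl.2.2 t ht).2⟩
  set T : Set ℝ := {b | b ∈ Icc (0:ℝ) 1 ∧ ∃ γ, LiftTo h P p z0 b γ} with hT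
  have h0T : (0:ℝ) ∈ T := ⟨⟨le_rfl, zero_le_one⟩, fun _ => z0, continuousOn_const, rfl, fun t ht => by
    have : t = 0 := le_antisymm ht.2 ht.1
    subst this; exact ⟨hz0, hz⟩⟩
  have hbd : BddAbove T := ⟨1, fun b hb => hb.1.2⟩
  set b := sSup T with hb
  have hb0 : 0 ≤ b := le_csSup hbd h0T
  have hb1 : b ≤ 1 := csSup_le ⟨0, h0T⟩ fun b hb => hb.1.2
  have hlt : ∀ t, 0 ≤ t → t < b → t ∈ T := by
    intro t ht htb
    obtain ⟨c, hc, htc⟩ := exists_lt_of_lt_csSup ⟨0, h0T⟩ htb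
    obtain ⟨γ, hγ⟩ := hc.2
    exact ⟨⟨ht, by linarith⟩, γ, mono htc.le hγ⟩
  -- canonical lift
  choose! γ hγ using fun t (ht : t ∈ T) => ht.2
  have huniq : ∀ t ∈ T, ∀ s, 0 ≤ s → s ≤ t → γ s s = γ t s := by
    intro t ht s hs hst
    have hsT : s ∈ T := ⟨⟨hs, hst.trans ht.1.2⟩, γ t, mono hst (hγ t ht)⟩
    have hm2 := mono hst (hγ t ht)
    refine lift_unique hm isPreconnected_Icc (hγ s hsT).1 hm2.1 (good hsT.1.2 (hγ s hsT))
      (good hsT.1.2 hm2) ?_ (a := (0:ℝ)) ⟨le_rfl, hs⟩ ?_ s ⟨hs, le_rfl⟩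
    · intro x hx; rw [((hγ s hsT).2.2 x hx).2, (hm2.2.2 x hx).2]
    · rw [(hγ s hsT).2.1, hm2.2.1]
  have hlift : ∀ t ∈ T, LiftTo h P p z0 t (fun s => γ s s) := by
    intro t ht
    have h1 := hγ t ht
    refine ⟨h1.1.congr fun s hs => huniq t ht s hs.1 hs.2, ?_, fun s hs => ?_⟩
    · show γ 0 0 = z0
      rw [huniq t ht 0 le_rfl ht.1.1]; exact h1.2.1
    · show γ s s ∉ P ∧ h (γ s s) = _
      rw [huniq t ht s hs.1 hs.2]; exact h1.2.2 s hs
  have h1T : (1:ℝ) ∈ T := by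
    rcases hb0.eq_or_lt with hbz | hbp
    · -- b = 0 : need a small extension; use the local homeomorphism through lift_step for shifted path
      exfalso
      have hd := (hn 0 ⟨le_rfl, zero_le_one⟩).1 z0 hz0 hz
      obtain ⟨e0, he0, rfl⟩ := hm.localHomeo z0 ⟨hz0, hd⟩
      set e := e0.restrOpen Pᶜ hm.isClosed.isOpen_compl with he
      have hes : z0 ∈ e.source := by simp [he, he0, hz0]
      have hesP : ∀ z ∈ e.source, z ∉ P := by intro z hz; simp [he] at hz; exact hz.2
      have het : e.target ∈ 𝓝 (p 0) := by
        rw [← hz]; exact e.open_target.mem_nhds (e.map_source hes)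
      obtain ⟨η, hη, hV⟩ := Metric.mem_nhdsWithin_iff.1 (hp 0 ⟨le_rfl, zero_le_one⟩ het)
      have hV' : ∀ t ∈ Icc 0 (min (η/2) 1), p t ∈ e.target := by
        intro t ht
        have h5 : t ≤ η/2 := ht.2.trans (min_le_left _ _)
        exact hV ⟨by simp [abs_of_nonneg ht.1]; linarith, ht.1, ht.2.trans (min_le_right _ _)⟩
      have : min (η/2) 1 ∈ T := by
        refine ⟨⟨by positivity, min_le_right _ _⟩, fun t => e.symm (p t), ?_, ?_, ?_⟩
        · exact e.continuousOn_symm.comp (hp.mono (Icc_subset_Icc_right (min_le_right _ _))) hV'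
        · show e.symm (p 0) = z0
          rw [← hz]; exact e.left_inv hes
        · intro t ht
          exact ⟨hesP _ (e.map_target (hV' t ht)), e.right_inv (hV' t ht)⟩
      have h6 := le_csSup hbd this
      rw [← hb, ← hbz] at h6
      have : 0 < min (η/2) 1 := by positivity
      linarith
    · obtain ⟨δ, hδ, γ', hγ'⟩ := lift_step hm hp hn hbp hb1
        (fun t ht htb => hlift t (hlt t ht htb))
      have hmT : min (b+δ) 1 ∈ T := ⟨⟨le_min (by linarith) zero_le_one, min_le_right _ _⟩, γ', hγ'⟩
      have h7 := le_csSup hbd hmT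
      rw [← hb] at h7
      rcases min_le_iff.1 h7 with h8 | h8
      · linarith
      · rwa [min_eq_right (by linarith)] at hmT
  exact h1T.2

theorem lift2 {h : ℂ → ℂ} {P : Set ℂ} (hm : MeroPlane h P) {U : Set ℂ} (hU : Convex ℝ U)
    {p : ℂ → ℂ} (hp : ContinuousOn p U) (hn : ∀ u ∈ U, Nonsing h P (p u)) {u0 : ℂ} (hu0 : u0 ∈ U)
    {z0 : ℂ} (hz0 : z0 ∉ P) (hz : h z0 = p u0) :
    ∃ G : ℂ → ℂ, ContinuousOn G U ∧ G u0 = z0 ∧ ∀ u ∈ U, G u ∈ GoodSet h P ∧ h (G u) = p u := by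
  have hseg : ∀ u ∈ U, ∀ t ∈ Icc (0:ℝ) 1, u0 + (t:ℂ) * (u - u0) ∈ U := by
    intro u hu t ht
    have := hU.add_smul_sub_mem hu0 hu ht
    simpa using this
  have hcont : ∀ u, Continuous fun t : ℝ => u0 + (t:ℂ) * (u - u0) := fun u => by fun_prop
  have := fun u (hu : u ∈ U) => path_lift hm (p := fun t : ℝ => p (u0 + (t:ℂ) * (u - u0)))
    (hp.comp (hcont u).continuousOn (fun t ht => hseg u hu t ht))
    (fun t ht => hn _ (hseg u hu t ht)) hz0 (by simp [hz])
  choose! γ hγ using this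
  have hmem : ∀ (t : unitInterval) (u : U), γ u t ∈ GoodSet h P := by
    intro t u
    have := (hγ u u.2).2.2 t t.2
    exact ⟨this.1, (hn _ (hseg u u.2 t t.2)).1 _ this.1 this.2⟩
  let g : unitInterval × U → GoodSet h P := fun x => ⟨γ x.2 x.1, hmem x.1 x.2⟩
  let f : C(unitInterval × U, ℂ) := ⟨fun x => p (u0 + ((x.1:ℝ):ℂ) * (x.2 - u0)), by
    refine hp.comp_continuous ?_ (fun x => hseg x.2 x.2.2 x.1 x.1.2)
    fun_prop⟩
  have hc : Continuous g := by
    refine hm.localHomeo_sub.continuous_lift (T2Space.isSeparatedMap _) f ?_ ?_ ?_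
    · funext x
      exact ((hγ x.2 x.2.2).2.2 x.1 x.1.2).2
    · have : (fun u : U => g (0, u)) = fun _ => ⟨z0, hz0, (hn u0 hu0).1 z0 hz0 hz⟩ := by
        funext u
        apply Subtype.ext
        exact (hγ u u.2).2.1
      rw [this]; exact continuous_const
    · intro u
      refine Continuous.subtype_mk ?_ _
      exact (hγ u u.2).1.comp_continuous continuous_subtype_val (fun t => t.2)
  refine ⟨fun u => γ u 1, ?_, ?_, ?_⟩
  · rw [continuousOn_iff_continuous_domRestrict]
    have : Continuous fun u : U => (g (1, u) : ℂ) := by fun_prop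
    exact this
  · have h1 := hγ u0 hu0
    have : ∀ t ∈ Icc (0:ℝ) 1, γ u0 t = z0 := by
      refine lift_unique hm isPreconnected_Icc h1.1 continuousOn_const
        (fun t ht => hmem ⟨t, ht⟩ ⟨u0, hu0⟩) (fun t ht => ⟨hz0, (hn u0 hu0).1 z0 hz0 hz⟩) ?_
        (a := (0:ℝ)) ⟨le_rfl, zero_le_one⟩ h1.2.1
      intro t ht
      rw [(h1.2.2 t ht).2]; simp [hz]
    exact this 1 ⟨zero_le_one, le_rfl⟩
  · intro u hu
    refine ⟨hmem 1 ⟨u, hu⟩, ?_⟩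
    have := ((hγ u hu).2.2 1 ⟨zero_le_one, le_rfl⟩).2
    simpa using this
end

section
structure Nice (F : ℂ → ℂ) (P : Set ℂ) (Sing : Set ℂ) (M : ℕ) : Prop where
  mero : MeroPlane F P
  nonsing : ∀ c ∉ Sing, Nonsing F P c
  simple : ∀ p ∈ P, ∃ q : ℂ → ℂ, AnalyticAt ℂ q p ∧ q p = 0 ∧ deriv q p ≠ 0 ∧
    ∀ᶠ z in 𝓝[≠] p, F z = 1 / q z
  noinf : ∀ γ : ℝ → ℂ, ContinuousOn γ (Ici 0) → Tendsto (fun t => ‖γ t‖) atTop atTop →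
    ¬ ∀ B : ℝ, ∀ᶠ t in atTop, γ t ∈ P ∨ B < ‖F (γ t)‖
  mult : ∀ z ∉ P, ∃ k : ℕ, 1 ≤ k ∧ k ≤ M ∧ ∃ g : ℂ → ℂ, AnalyticAt ℂ g z ∧ g z ≠ 0 ∧
    ∀ᶠ w in 𝓝 z, F w = F z + (w - z) ^ k * g w

def HL (r : ℝ) : Set ℂ := {u | u.re < Real.log r}

theorem HL_convex (r : ℝ) : Convex ℝ (HL r) := convex_halfSpace_re_lt _
theorem HL_open (r : ℝ) : IsOpen (HL r) := isOpen_lt Complex.continuous_re continuous_const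

theorem HL_norm {r : ℝ} (hr : 0 < r) {u : ℂ} : u ∈ HL r ↔ ‖Complex.exp u‖ < r := by
  rw [Complex.norm_exp, HL]
  exact Real.lt_log_iff_exp_lt hr

/-- lift of `a + exp` on the half plane `re u < log r` -/
structure TractLift (F : ℂ → ℂ) (P : Set ℂ) (a : ℂ) (r : ℝ) (G : ℂ → ℂ) : Prop where
  cont : ContinuousOn G (HL r)
  good : ∀ u ∈ HL r, G u ∈ GoodSet F P
  eq : ∀ u ∈ HL r, F (G u) = a + Complex.exp u

def ProperLift (r : ℝ) (G : ℂ → ℂ) : Prop :=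
  ∀ B : ℝ, ∃ ρ : ℝ, ∀ u ∈ HL r, u.re < ρ → B < ‖G u‖

def Isol (Sing : Set ℂ) (a : ℂ) (r : ℝ) : Prop :=
  0 < r ∧ ∀ c, 0 < ‖c - a‖ → ‖c - a‖ < r → c ∉ Sing

variable {F : ℂ → ℂ} {P Sing : Set ℂ} {M : ℕ} {a : ℂ} {r : ℝ}

theorem exists_tractLift (hN : Nice F P Sing M) (hI : Isol Sing a r) {z u : ℂ} (hz : z ∉ P)
    (hu : u ∈ HL r) (hF : F z = a + Complex.exp u) : ∃ G, TractLift F P a r G ∧ G u = z := by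
  obtain ⟨G, h1, h2, h3⟩ := lift2 hN.mero (HL_convex r) (p := fun u => a + Complex.exp u)
    (by fun_prop) (fun v hv => hN.nonsing _ (hI.2 _ (by simp) (by simpa using (HL_norm hI.1).1 hv)))
    hu hz hF
  exact ⟨G, ⟨h1, fun v hv => (h3 v hv).1, fun v hv => (h3 v hv).2⟩, h2⟩

theorem TractLift.shift {G : ℂ → ℂ} (hG : TractLift F P a r G) (k : ℤ) :
    TractLift F P a r (fun u => G (u + k * (2 * Real.pi * Complex.I))) := by
  have h1 : ∀ u ∈ HL r, u + k * (2 * Real.pi * Complex.I) ∈ HL r := by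
    intro u hu
    simpa [HL] using hu
  refine ⟨hG.cont.comp (by fun_prop) h1, fun u hu => hG.good _ (h1 u hu), fun u hu => ?_⟩
  rw [hG.eq _ (h1 u hu), Complex.exp_periodic.int_mul k u]

theorem TractLift.uniq (hm : MeroPlane F P) {G₁ G₂ : ℂ → ℂ} (h1 : TractLift F P a r G₁)
    (h2 : TractLift F P a r G₂) {u : ℂ} (hu : u ∈ HL r) (he : G₁ u = G₂ u) :
    ∀ v ∈ HL r, G₁ v = G₂ v :=
  lift_unique hm (HL_convex r).isPreconnected h1.cont h2.cont h1.good h2.good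
    (fun v hv => by rw [h1.eq v hv, h2.eq v hv]) hu he

theorem TractLift.isOpen_image (hm : MeroPlane F P) (hr : 0 < r) {G : ℂ → ℂ} (hG : TractLift F P a r G) :
    IsOpen (G '' HL r) := by
  rw [isOpen_iff_mem_nhds]
  rintro z ⟨u, hu, rfl⟩
  set z := G u with hzdef
  have hzg := hG.good u hu
  have hFz := hG.eq u hu
  have hFa : F z - a = Complex.exp u := by rw [hFz]; ring
  set ψ : ℂ → ℂ := fun z' => u + Complex.log ((F z' - a) / (F z - a)) with hψ
  have hψz : ψ z = u := by
    simp only [hψ]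
    rw [div_self (by rw [hFa]; exact Complex.exp_ne_zero _)]; simp
  have hc : ∀ᶠ z' in 𝓝 z, (F z' - a) / (F z - a) ∈ Complex.slitPlane := by
    have : ContinuousAt (fun z' => (F z' - a) / (F z - a)) z :=
      ((hm.contAt hzg.1).sub continuousAt_const).div_const _
    refine this (Complex.isOpen_slitPlane.mem_nhds ?_)
    show (F z - a) / (F z - a) ∈ Complex.slitPlane
    rw [div_self (by rw [hFa]; exact Complex.exp_ne_zero _)]
    simp
  have hψu : ∀ᶠ z' in 𝓝 z, ψ z' ∈ HL r := by
    have : ContinuousAt ψ z := by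
      refine continuousAt_const.add (ContinuousAt.clog ?_ ?_)
      · exact ((hm.contAt hzg.1).sub continuousAt_const).div_const _
      · rw [div_self (by rw [hFa]; exact Complex.exp_ne_zero _)]; simp
    refine this ((HL_open r).mem_nhds ?_)
    rw [hψz]; exact hu
  have hall := (hc.and (hψu.and (hm.isOpen_good.mem_nhds hzg)))
  obtain ⟨e, he, hball⟩ := Metric.eventually_nhds_iff_ball.1 hall
  have hψc : ContinuousOn ψ (Metric.ball z e) := by
    refine continuousOn_const.add (ContinuousOn.clog ?_ fun x hx => (hball x hx).1)
    refine (ContinuousOn.sub ?_ continuousOn_const).div_const _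
    exact fun x hx => (hm.contAt (hball x hx).2.2.1).continuousWithinAt
  have hmaps : MapsTo ψ (Metric.ball z e) (HL r) := fun x hx => (hball x hx).2.1
  have key := lift_unique hm (convex_ball z e).isPreconnected (G₁ := fun z' => G (ψ z'))
    (G₂ := fun z' => z') (hG.cont.comp hψc hmaps) continuousOn_id
    (fun x hx => hG.good _ (hmaps hx)) (fun x hx => (hball x hx).2.2) (fun x hx => by
      rw [hG.eq _ (hmaps hx)]
      simp only [hψ]
      rw [Complex.exp_add, Complex.exp_log (Complex.slitPlane_ne_zero (hball x hx).1), ← hFa,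
        mul_div_cancel₀ _ (by rw [hFa]; exact Complex.exp_ne_zero _)]
      ring) (Metric.mem_ball_self he) (by simp only [hψz]; exact hzdef.symm)
  filter_upwards [Metric.ball_mem_nhds z he] with x hx
  exact ⟨ψ x, hmaps hx, key x hx⟩

theorem comp_lemma (hN : Nice F P Sing M) (hI : Isol Sing a r) {G : ℂ → ℂ}
    (hG : TractLift F P a r G) (hp : ProperLift r G) {C : Set ℂ} (hC : IsPreconnected C)
    (hCs : ∀ z ∈ C, z ∉ P ∧ ‖F z - a‖ < r) (hne : (C ∩ G '' HL r).Nonempty) :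
    C ⊆ G '' HL r := by
  refine hC.subset_of_closure_inter_subset (hG.isOpen_image hN.mero hI.1) hne ?_
  rintro z ⟨hzc, hzC⟩
  obtain ⟨hzP, hzr⟩ := hCs z hzC
  by_cases hFa : F z = a
  · exfalso
    obtain ⟨ρ, hρ⟩ := hp (‖z‖ + 1)
    have h1 : ∀ᶠ w in 𝓝 z, ‖w‖ < ‖z‖ + 1 :=
      continuous_norm.continuousAt.eventually (gt_mem_nhds (by linarith))
    have h2 : ∀ᶠ w in 𝓝 z, ‖F w - a‖ < Real.exp ρ := by
      have : ContinuousAt (fun w => ‖F w - a‖) z := ((hN.mero.contAt hzP).sub continuousAt_const).norm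
      refine this.eventually (gt_mem_nhds ?_)
      simp [hFa, Real.exp_pos]
    obtain ⟨w, ⟨hw1, hw2⟩, ⟨u, hu, rfl⟩⟩ := mem_closure_iff_nhds.1 hzc _ (h1.and h2)
    have h3 : u.re < ρ := by
      simp only [hG.eq u hu, add_sub_cancel_left, Complex.norm_exp] at hw2
      exact Real.exp_lt_exp.1 hw2
    have := hρ u hu h3
    have hw1' : ‖G u‖ < ‖z‖ + 1 := hw1
    linarith
  · have h0 : F z - a ≠ 0 := sub_ne_zero.2 hFa
    obtain ⟨G', hG', hz'⟩ := exists_tractLift hN hI (u := Complex.log (F z - a)) hzP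
      ((HL_norm hI.1).2 (by rwa [Complex.exp_log h0])) (by rw [Complex.exp_log h0]; ring)
    have hmem : G' '' HL r ∈ 𝓝 z := (hG'.isOpen_image hN.mero hI.1).mem_nhds
      ⟨_, ((HL_norm hI.1).2 (by rwa [Complex.exp_log h0])), hz'⟩
    obtain ⟨w, ⟨u', hu', h1⟩, ⟨u, hu, h2⟩⟩ := mem_closure_iff_nhds.1 hzc _ hmem
    have h3 : Complex.exp u' = Complex.exp u := by
      have := hG'.eq u' hu'
      rw [h1, ← h2, hG.eq u hu] at this
      exact (add_left_cancel this).symm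
    obtain ⟨n, hn⟩ := Complex.exp_eq_exp_iff_exists_int.1 h3.symm
    have h4 := TractLift.uniq hN.mero hG' (hG.shift n) hu' (by show G' u' = G _; rw [← hn, h1, h2])
    have hl := ((HL_norm hI.1).2 (by rwa [Complex.exp_log h0]) : Complex.log (F z - a) ∈ HL r)
    refine ⟨Complex.log (F z - a) + n * (2 * Real.pi * Complex.I), by simpa [HL] using hl, ?_⟩
    exact (h4 _ hl).symm.trans hz'

/-- k-th power local coordinate -/
theorem local_power {z : ℂ} {k : ℕ} (hk : 1 ≤ k) {g : ℂ → ℂ} (hg : AnalyticAt ℂ g z) (h0 : g z ≠ 0) :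
    ∃ e : OpenPartialHomeomorph ℂ ℂ, z ∈ e.source ∧ e z = 0 ∧
      ∀ w ∈ e.source, (e w) ^ k = (w - z) ^ k * g w := by
  set ψ : ℂ → ℂ := fun w => (w - z) * Complex.exp ((Complex.log (g z) + Complex.log (g w / g z)) / k)
    with hψ
  have hk0 : (k:ℂ) ≠ 0 := by exact_mod_cast (by omega : k ≠ 0)
  have hl : AnalyticAt ℂ (fun w => Complex.exp ((Complex.log (g z) + Complex.log (g w / g z)) / k)) z := by
    have h1 : AnalyticAt ℂ (fun w => Complex.log (g w / g z)) z := by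
      refine AnalyticAt.clog (hg.div_const) ?_
      rw [div_self h0]; simp
    have h2 : AnalyticAt ℂ (fun w => (Complex.log (g z) + Complex.log (g w / g z)) / k) z :=
      (analyticAt_const.add h1).div_const
    exact h2.cexp
  have hψa : AnalyticAt ℂ ψ z := (analyticAt_id.sub analyticAt_const).mul hl
  have hd : HasStrictDerivAt ψ (Complex.exp ((Complex.log (g z) + Complex.log (g z / g z)) / k)) z := by
    have h0' : HasStrictDerivAt (fun w : ℂ => w - z) 1 z := (hasStrictDerivAt_id z).sub_const z
    have h1 := HasStrictDerivAt.mul h0' hl.hasStrictDerivAt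
    convert! h1 using 1
    simp
  have hd0 := Complex.exp_ne_zero ((Complex.log (g z) + Complex.log (g z / g z)) / k)
  set e0 := (hd.hasStrictFDerivAt_equiv hd0).toOpenPartialHomeomorph ψ
  have he0 : z ∈ e0.source := (hd.hasStrictFDerivAt_equiv hd0).mem_toOpenPartialHomeomorph_source
  have hne : {w | g w ≠ 0} ∈ 𝓝 z := hg.continuousAt.eventually_ne h0
  obtain ⟨V, hV, hVo, hzV⟩ := mem_nhds_iff.1 hne
  refine ⟨e0.restrOpen V hVo, by simp [he0, hzV], ?_, ?_⟩
  · show ψ z = 0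
    simp [hψ]
  · intro w hw
    have hwV : w ∈ V := by simp at hw; exact hw.2
    have hgw : g w ≠ 0 := hV hwV
    show (ψ w) ^ k = _
    simp only [hψ]
    rw [mul_pow, ← Complex.exp_nat_mul, mul_div_cancel₀ _ hk0, Complex.exp_add, Complex.exp_log h0,
      Complex.exp_log (div_ne_zero hgw h0), mul_div_cancel₀ _ h0]

theorem dichotomy (hN : Nice F P Sing M) (hI : Isol Sing a r) {G : ℂ → ℂ}
    (hG : TractLift F P a r G) {u0 : ℂ} (hu0 : u0 ∈ HL r)
    (hk : ∀ k : ℕ, 1 ≤ k → k ≤ M → G (u0 + k * (2 * Real.pi * Complex.I)) ≠ G u0) :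
    ProperLift r G := by
  by_contra hcon
  unfold ProperLift at hcon
  push Not at hcon
  obtain ⟨B, hB⟩ := hcon
  choose u huH hur huB using fun n : ℕ => hB (-(n:ℝ))
  obtain ⟨zs, -, φ, hφm, hφt⟩ := (isCompact_closedBall (0:ℂ) B).tendsto_subseq
    (x := fun n => G (u n)) (fun n => by simpa using huB n)
  have hexp : Tendsto (fun n => Complex.exp (u n)) atTop (𝓝 0) := by
    rw [tendsto_zero_iff_norm_tendsto_zero]
    simp only [Complex.norm_exp]
    refine Real.tendsto_exp_atBot.comp (tendsto_atBot_mono (fun n => (hur n).le) ?_)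
    exact tendsto_neg_atTop_atBot.comp tendsto_natCast_atTop_atTop
  have hFl : Tendsto (fun n => F (G (u (φ n)))) atTop (𝓝 a) := by
    have : Tendsto (fun n => a + Complex.exp (u (φ n))) atTop (𝓝 (a + 0)) :=
      tendsto_const_nhds.add (hexp.comp hφm.tendsto_atTop)
    rw [add_zero] at this
    exact this.congr fun n => (hG.eq _ (huH _)).symm
  have hzs : zs ∉ P := by
    intro hz
    have h1 : Tendsto (fun n => G (u (φ n))) atTop (𝓝[Pᶜ] zs) := tendsto_nhdsWithin_iff.2
      ⟨hφt, Eventually.of_forall fun n => (hG.good _ (huH _)).1⟩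
    exact not_tendsto_nhds_of_tendsto_atTop ((hN.mero.2.2 zs hz).comp h1) _ hFl.norm
  have hFz : F zs = a := tendsto_nhds_unique ((hN.mero.contAt hzs).tendsto.comp hφt) hFl
  obtain ⟨k, hk1, hkM, g, hga, hg0, hgF⟩ := hN.mult zs hzs
  obtain ⟨e, hze, hez, hek⟩ := local_power hk1 hga hg0
  have hk0 : (k:ℂ) ≠ 0 := by exact_mod_cast (by omega : k ≠ 0)
  -- good neighbourhood
  have hW : ∀ᶠ w in 𝓝 zs, w ∈ e.source ∧ w ∉ P ∧ F w = a + (e w)^k := by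
    filter_upwards [e.open_source.mem_nhds hze, hN.mero.isClosed.isOpen_compl.mem_nhds hzs, hgF]
      with w h1 h2 h3
    exact ⟨h1, h2, by rw [h3, hek w h1, hFz]⟩
  have hV : ∀ᶠ ξ in 𝓝 (0:ℂ), ξ ∈ e.target ∧ e.symm ξ ∉ P ∧ F (e.symm ξ) = a + ξ ^ k := by
    have ht : e.target ∈ 𝓝 (0:ℂ) := by
      rw [← hez]; exact e.open_target.mem_nhds (e.map_source hze)
    have hc : Tendsto e.symm (𝓝 0) (𝓝 zs) := by
      have := e.continuousAt_symm (e.map_source hze)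
      rw [ContinuousAt, e.left_inv hze, hez] at this
      exact this
    filter_upwards [ht, hc.eventually hW] with ξ h1 h2
    exact ⟨h1, h2.2.1, by rw [h2.2.2, e.right_inv h1]⟩
  obtain ⟨δ, hδ, hδV⟩ := Metric.eventually_nhds_iff_ball.1 hV
  -- choose n
  have hn1 : ∀ᶠ n in atTop, G (u (φ n)) ∈ e.source ∧ F (G (u (φ n))) = a + (e (G (u (φ n))))^k := by
    filter_upwards [hφt.eventually hW] with n hn
    exact ⟨hn.1, hn.2.2⟩
  have hn2 : ∀ᶠ n in atTop, (u (φ n)).re < k * Real.log δ := by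
    have : Tendsto (fun n => -((φ n : ℕ):ℝ)) atTop atBot :=
      tendsto_neg_atTop_atBot.comp (tendsto_natCast_atTop_atTop.comp hφm.tendsto_atTop)
    filter_upwards [this.eventually (eventually_lt_atBot (k * Real.log δ))] with n hn
    exact (hur _).trans hn
  obtain ⟨n, ⟨hns, hnF⟩, hnre⟩ := (hn1.and hn2).exists
  set v := u (φ n) with hv
  have hvH : v ∈ HL r := huH _
  set ω := e (G v) * Complex.exp (-(v / k)) with hω
  have hωk : ω ^ k = 1 := by
    rw [hω, mul_pow, ← Complex.exp_nat_mul]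
    have h1 : (e (G v)) ^ k = Complex.exp v := by
      rw [hG.eq v hvH] at hnF; exact (add_left_cancel hnF).symm
    rw [h1, ← Complex.exp_add]
    rw [mul_neg, mul_div_cancel₀ _ hk0]; simp
  have hωn : ‖ω‖ = 1 := by
    have : ‖ω‖ ^ k = 1 := by rw [← norm_pow, hωk, norm_one]
    exact (pow_eq_one_iff_of_nonneg (norm_nonneg _) (by omega)).1 this
  set D : Set ℂ := {u | u.re < k * Real.log δ} ∩ HL r with hD
  have hDconv : Convex ℝ D := (convex_halfSpace_re_lt _).inter (HL_convex r)
  have hb : ∀ w ∈ D, ω * Complex.exp (w / k) ∈ Metric.ball (0:ℂ) δ := by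
    intro w hw
    rw [mem_ball_zero_iff, norm_mul, hωn, one_mul, Complex.norm_exp, ← Real.lt_log_iff_exp_lt hδ]
    have : (w / (k:ℂ)).re = w.re / k := by
      rw [show (k:ℂ) = ((k:ℝ):ℂ) by simp, Complex.div_ofReal_re]
    rw [this, div_lt_iff₀ (by exact_mod_cast hk1), mul_comm]
    exact hw.1
  have hsame : ∀ w ∈ D, G w = e.symm (ω * Complex.exp (w / k)) := by
    have hFF : ∀ w ∈ D, F (e.symm (ω * Complex.exp (w / k))) = a + Complex.exp w := by
      intro w hw
      rw [(hδV _ (hb w hw)).2.2, mul_pow, hωk, one_mul, ← Complex.exp_nat_mul, mul_div_cancel₀ _ hk0]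
    refine lift_unique hN.mero hDconv.isPreconnected (hG.cont.mono inter_subset_right) ?_
      (fun w hw => hG.good w hw.2) ?_ ?_ (a := v) ⟨hnre, hvH⟩ ?_
    · refine e.continuousOn_symm.comp (by fun_prop) (fun w hw => (hδV _ (hb w hw)).1)
    · intro w hw
      refine ⟨(hδV _ (hb w hw)).2.1, (hN.nonsing _ (hI.2 (a + Complex.exp w) (by simp) ?_)).1 _
        (hδV _ (hb w hw)).2.1 (hFF w hw)⟩
      simpa using (HL_norm hI.1).1 hw.2
    · intro w hw
      rw [hG.eq w hw.2, hFF w hw]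
    · rw [hω, mul_assoc, ← Complex.exp_add]
      simp [e.left_inv hns]
  have hper : G (v + k * (2 * Real.pi * Complex.I)) = G v := by
    have hv' : v + k * (2 * Real.pi * Complex.I) ∈ D := by
      refine ⟨?_, ?_⟩
      · simpa using hnre
      · simpa [HL] using hvH
    rw [hsame _ hv', hsame v ⟨hnre, hvH⟩, add_div, mul_div_cancel_left₀ _ hk0, Complex.exp_add,
      Complex.exp_two_pi_mul_I, mul_one]
  have h9 := TractLift.uniq hN.mero (hG.shift k) hG hvH (by push_cast; exact hper) u0 hu0
  exact hk k hk1 hkM (by push_cast at h9; exact h9)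
end

section
open scoped Classical in
def mobF (α β γ δ : ℂ) (F : ℂ → ℂ) (P : Set ℂ) (z : ℂ) : ℂ :=
  if z ∈ P then α / γ else (α * F z + β) / (γ * F z + δ)

def mobP (γ δ : ℂ) (F : ℂ → ℂ) (P : Set ℂ) : Set ℂ :=
  {z | (z ∈ P ∧ γ = 0) ∨ (z ∉ P ∧ γ * F z + δ = 0)}

theorem finite_of_isolated {P : Set ℂ} (h : ∀ z, ∀ᶠ w in 𝓝[≠] z, w ∉ P) (K : Set ℂ)
    (hK : IsCompact K) : (P ∩ K).Finite := by
  by_contra hinf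
  obtain ⟨z, -, hz⟩ := Set.Infinite.exists_accPt_of_subset_isCompact hinf hK inter_subset_right
  rw [accPt_iff_frequently_nhdsNE] at hz
  obtain ⟨w, h1, h2⟩ := (hz.and_eventually (h z)).exists
  exact h2 h1.1

theorem MeroPlane.isolated {F : ℂ → ℂ} {P : Set ℂ} (hm : MeroPlane F P) (z : ℂ) :
    ∀ᶠ w in 𝓝[≠] z, w ∉ P := by
  have hf := hm.1 (Metric.closedBall z 1) (isCompact_closedBall z 1)
  have : ((P ∩ Metric.closedBall z 1) \ {z}).Finite := hf.subset sdiff_subset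
  have h1 : ((P ∩ Metric.closedBall z 1) \ {z})ᶜ ∈ 𝓝 z :=
    this.isClosed.isOpen_compl.mem_nhds (by simp)
  rw [eventually_nhdsWithin_iff]
  filter_upwards [h1, Metric.closedBall_mem_nhds z one_pos] with w hw hb hne hP
  exact hw ⟨⟨hP, hb⟩, hne⟩

theorem mob_hasDerivAt {α β γ δ : ℂ} {φ : ℂ → ℂ} {φ' z : ℂ} (h : HasDerivAt φ φ' z)
    (h0 : γ * φ z + δ ≠ 0) :
    HasDerivAt (fun w => (α * φ w + β) / (γ * φ w + δ))
      ((α * δ - β * γ) * φ' / (γ * φ z + δ) ^ 2) z := by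
  have h1 := (h.const_mul α).add_const β
  have h2 := (h.const_mul γ).add_const δ
  convert! h1.div h2 h0 using 1
  ring

/-- local representation near any point -/
structure LocRep (h : ℂ → ℂ) (Ph : Set ℂ) (α β γ δ : ℂ) (φ : ℂ → ℂ) (z : ℂ) : Prop where
  an : AnalyticAt ℂ φ z
  det : α * δ - β * γ ≠ 0
  iso : ∀ᶠ w in 𝓝[≠] z, φ w ≠ φ z
  memP : ∀ᶠ w in 𝓝 z, (w ∈ Ph ↔ γ * φ w + δ = 0)
  val : ∀ᶠ w in 𝓝 z, w ∉ Ph → h w = (α * φ w + β) / (γ * φ w + δ)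

variable {F : ℂ → ℂ} {P Sing : Set ℂ} {M : ℕ}

theorem Nice.iso (hN : Nice F P Sing M) {z : ℂ} (hz : z ∉ P) : ∀ᶠ w in 𝓝[≠] z, F w ≠ F z := by
  obtain ⟨k, hk1, hkM, g, hga, hg0, hgF⟩ := hN.mult z hz
  rw [eventually_nhdsWithin_iff]
  filter_upwards [hgF, hga.continuousAt.eventually_ne hg0] with w h1 h2 h3 h4
  rw [h1] at h4
  have : (w - z)^k * g w = 0 := by simpa using h4
  rcases mul_eq_zero.1 this with h | h
  · exact h3 (by simpa [sub_eq_zero] using pow_eq_zero_iff (by omega : k ≠ 0) |>.1 h)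
  · exact h2 h

theorem locRep_fin (hN : Nice F P Sing M) {α β γ δ : ℂ} (hdet : α * δ - β * γ ≠ 0) {z : ℂ}
    (hz : z ∉ P) : LocRep (mobF α β γ δ F P) (mobP γ δ F P) α β γ δ F z := by
  refine ⟨hN.mero.2.1 z hz, hdet, hN.iso hz, ?_, ?_⟩ <;>
  filter_upwards [hN.mero.isClosed.isOpen_compl.mem_nhds hz] with w hw
  · have : w ∉ P := hw
    simp [mobP, this]
  · have : w ∉ P := hw
    simp [mobF, this]

theorem locRep_pole (hN : Nice F P Sing M) {α β γ δ : ℂ} (hdet : α * δ - β * γ ≠ 0) {z : ℂ}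
    (hz : z ∈ P) : ∃ q : ℂ → ℂ, q z = 0 ∧ deriv q z ≠ 0 ∧ (∀ᶠ w in 𝓝[≠] z, F w = 1 / q w) ∧
      LocRep (mobF α β γ δ F P) (mobP γ δ F P) β α δ γ q z := by
  obtain ⟨q, hqa, hq0, hqd, hqF⟩ := hN.simple z hz
  have hiso : ∀ᶠ w in 𝓝[≠] z, q w ≠ q z := hqa.hasStrictDerivAt.hasDerivAt.eventually_ne hqd
  have hqF' := eventually_nhdsWithin_iff.1 hqF
  have hiso' := eventually_nhdsWithin_iff.1 hiso
  have hP' := eventually_nhdsWithin_iff.1 (hN.mero.isolated z)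
  refine ⟨q, hq0, hqd, hqF, hqa, by intro h; apply hdet; linear_combination -h, hiso, ?_, ?_⟩
  · filter_upwards [hqF', hiso', hP'] with w h1 h2 h3
    by_cases hwz : w = z
    · subst hwz; simp [mobP, hz, hq0]
    · have h2 := h2 hwz
      rw [hq0] at h2
      simp only [mobP, mem_ofPred_eq, h3 hwz, false_and, not_false_eq_true, true_and, false_or, h1 hwz]
      constructor
      · intro h
        field_simp at h
        linear_combination h
      · intro h; field_simp; linear_combination h
  · filter_upwards [hqF', hiso', hP'] with w h1 h2 h3 h4
    by_cases hwz : w = z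
    · subst hwz; simp [mobF, hz, hq0]
    · have h2 := h2 hwz
      rw [hq0] at h2
      simp only [mobF, h3 hwz, if_false, h1 hwz]
      rw [← mul_div_mul_right _ _ h2]
      congr 1 <;> field_simp <;> ring

theorem exists_locRep (hN : Nice F P Sing M) {α β γ δ : ℂ} (hdet : α * δ - β * γ ≠ 0) (z : ℂ) :
    ∃ φ α' β' γ' δ', LocRep (mobF α β γ δ F P) (mobP γ δ F P) α' β' γ' δ' φ z := by
  by_cases hz : z ∈ P
  · obtain ⟨q, -, -, -, h⟩ := locRep_pole hN hdet hz
    exact ⟨q, _, _, _, _, h⟩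
  · exact ⟨F, _, _, _, _, locRep_fin hN hdet hz⟩

theorem LocRep.isolated {h : ℂ → ℂ} {Ph : Set ℂ} {α β γ δ : ℂ} {φ : ℂ → ℂ} {z : ℂ}
    (hl : LocRep h Ph α β γ δ φ z) : ∀ᶠ w in 𝓝[≠] z, w ∉ Ph := by
  have han : AnalyticAt ℂ (fun w => γ * φ w + δ) z := (analyticAt_const.mul hl.an).add analyticAt_const
  have hm := hl.memP.filter_mono (nhdsWithin_le_nhds (s := {z}ᶜ))
  rcases han.eventually_eq_zero_or_eventually_ne_zero with h1 | h1
  · exfalso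
    have h2 := h1.filter_mono (nhdsWithin_le_nhds (s := {z}ᶜ))
    obtain ⟨w, hw1, hw2⟩ := (h2.and hl.iso).exists
    have h3 := h1.self_of_nhds
    have : γ * (φ w - φ z) = 0 := by linear_combination hw1 - h3
    rcases mul_eq_zero.1 this with hg | hg
    · apply hl.det
      subst hg
      have : δ = 0 := by linear_combination h3
      simp [this]
    · exact hw2 (sub_eq_zero.1 hg)
  · filter_upwards [h1, hm] with w a b
    rwa [b]

theorem LocRep.ev_not {h : ℂ → ℂ} {Ph : Set ℂ} {α β γ δ : ℂ} {φ : ℂ → ℂ} {z : ℂ}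
    (hl : LocRep h Ph α β γ δ φ z) (hz : z ∉ Ph) :
    (∀ᶠ w in 𝓝 z, γ * φ w + δ ≠ 0 ∧ w ∉ Ph) ∧ ∀ᶠ w in 𝓝 z, h w = (α * φ w + β) / (γ * φ w + δ) := by
  have h0 : γ * φ z + δ ≠ 0 := fun h => hz (hl.memP.self_of_nhds.2 h)
  have hc : ContinuousAt (fun w => γ * φ w + δ) z :=
    (continuousAt_const.mul hl.an.continuousAt).add continuousAt_const
  have h1 := hc.eventually_ne h0
  constructor
  · filter_upwards [h1, hl.memP] with w a b
    exact ⟨a, by rwa [b]⟩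
  · filter_upwards [h1, hl.memP, hl.val] with w a b c
    exact c (by rwa [b])

theorem LocRep.analyticAt {h : ℂ → ℂ} {Ph : Set ℂ} {α β γ δ : ℂ} {φ : ℂ → ℂ} {z : ℂ}
    (hl : LocRep h Ph α β γ δ φ z) (hz : z ∉ Ph) : AnalyticAt ℂ h z := by
  obtain ⟨h1, h2⟩ := hl.ev_not hz
  refine AnalyticAt.congr ?_ (h2.mono fun w hw => hw.symm)
  exact ((analyticAt_const.mul hl.an).add analyticAt_const).div
    ((analyticAt_const.mul hl.an).add analyticAt_const) h1.self_of_nhds.1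

theorem LocRep.deriv_ne {h : ℂ → ℂ} {Ph : Set ℂ} {α β γ δ : ℂ} {φ : ℂ → ℂ} {z : ℂ}
    (hl : LocRep h Ph α β γ δ φ z) (hz : z ∉ Ph) (hd : deriv φ z ≠ 0) : deriv h z ≠ 0 := by
  obtain ⟨h1, h2⟩ := hl.ev_not hz
  have h3 := h1.self_of_nhds.1
  rw [Filter.EventuallyEq.deriv_eq h2, (mob_hasDerivAt hl.an.differentiableAt.hasDerivAt h3).deriv]
  exact div_ne_zero (mul_ne_zero hl.det hd) (pow_ne_zero _ h3)

theorem mob_mero (hN : Nice F P Sing M) {α β γ δ : ℂ} (hdet : α * δ - β * γ ≠ 0) :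
    MeroPlane (mobF α β γ δ F P) (mobP γ δ F P) := by
  refine ⟨finite_of_isolated fun z => ?_, fun z hz => ?_, fun p hp => ?_⟩
  · obtain ⟨φ, _, _, _, _, h⟩ := exists_locRep hN hdet z
    exact h.isolated
  · obtain ⟨φ, _, _, _, _, h⟩ := exists_locRep hN hdet z
    exact h.analyticAt hz
  · obtain ⟨φ, α', β', γ', δ', h⟩ := exists_locRep hN hdet p
    have h0 : γ' * φ p + δ' = 0 := h.memP.self_of_nhds.1 hp
    have hnum : α' * φ p + β' ≠ 0 := by
      intro h1
      by_cases hg : γ' = 0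
      · subst hg
        have : δ' = 0 := by linear_combination h0
        exact h.det (by simp [this])
      · apply h.det
        have : γ' * (α' * δ' - β' * γ') = 0 := by linear_combination γ' * α' * h0 - γ' ^ 2 * h1
        exact (mul_eq_zero.1 this).resolve_left hg
    have hc1 : Tendsto (fun w => α' * φ w + β') (𝓝[(mobP γ δ F P)ᶜ] p) (𝓝 (α' * φ p + β')) :=
      ((continuousAt_const.mul h.an.continuousAt).add continuousAt_const).tendsto.mono_left nhdsWithin_le_nhds
    have hc2 : Tendsto (fun w => γ' * φ w + δ') (𝓝[(mobP γ δ F P)ᶜ] p) (𝓝[≠] 0) := by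
      refine tendsto_nhdsWithin_iff.2 ⟨?_, ?_⟩
      · rw [← h0]
        exact ((continuousAt_const.mul h.an.continuousAt).add continuousAt_const).tendsto.mono_left nhdsWithin_le_nhds
      · rw [eventually_nhdsWithin_iff]
        filter_upwards [h.memP] with w h1 h2 h3
        exact h2 (h1.2 h3)
    have hinv := (tendsto_inv₀_nhdsNE_zero).comp hc2
    have h3 : Tendsto (fun w => ‖(α' * φ w + β')‖ * ‖(γ' * φ w + δ')⁻¹‖) (𝓝[(mobP γ δ F P)ᶜ] p) atTop :=
      Tendsto.pos_mul_atTop (norm_pos_iff.2 hnum) hc1.norm (tendsto_norm_cobounded_atTop.comp hinv)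
    refine h3.congr' ?_
    filter_upwards [self_mem_nhdsWithin, nhdsWithin_le_nhds h.val] with w h4 h5
    rw [h5 h4, div_eq_mul_inv, norm_mul]

theorem Nonsing.ev {h : ℂ → ℂ} {c : ℂ} (hn : Nonsing h P c) {γ : ℝ → ℂ}
    (hc : ContinuousOn γ (Ici 0)) (hP : ∀ᶠ t in atTop, γ t ∉ P)
    (ht : Tendsto (fun t => ‖γ t‖) atTop atTop) : ¬ Tendsto (fun t => h (γ t)) atTop (𝓝 c) := by
  intro h1
  obtain ⟨T, hT⟩ := eventually_atTop.1 hP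
  have hs : Tendsto (fun t : ℝ => t + max T 0) atTop atTop := tendsto_atTop_add_const_right _ _ tendsto_id
  refine hn.2 (fun t => γ (t + max T 0)) ?_ ?_ (ht.comp hs) (h1.comp hs)
  · refine hc.comp (by fun_prop) ?_
    intro t ht
    have : (0:ℝ) ≤ t := ht
    have := le_max_right T 0
    simp only [mem_Ici]; linarith
  · intro t ht
    refine hT _ ?_
    have := le_max_left T 0
    linarith

theorem mob_nonsing (hN : Nice F P Sing M) {α β γ δ : ℂ} (hdet : α * δ - β * γ ≠ 0) {v : ℂ}
    (hv : ∀ a ∈ Sing, v * (γ * a + δ) ≠ α * a + β) :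
    Nonsing (mobF α β γ δ F P) (mobP γ δ F P) v := by
  constructor
  · intro z hz hval
    by_cases hzP : z ∈ P
    · obtain ⟨q, -, hqd, -, h⟩ := locRep_pole hN hdet hzP
      exact h.deriv_ne hz hqd
    · refine (locRep_fin hN hdet hzP).deriv_ne hz ?_
      have h0 : γ * F z + δ ≠ 0 := fun h => hz (Or.inr ⟨hzP, h⟩)
      refine (hN.nonsing (F z) fun hS => hv _ hS ?_).1 z hzP rfl
      rw [← hval]; simp [mobF, hzP, h0]
  · intro γ' hc hP ht hlim
    have hrel : ∀ t, 0 ≤ t → γ' t ∉ P →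
        F (γ' t) * (mobF α β γ δ F P (γ' t) * γ - α) = β - mobF α β γ δ F P (γ' t) * δ := by
      intro t h0 h1
      have h2 : γ * F (γ' t) + δ ≠ 0 := fun h => hP t h0 (Or.inr ⟨h1, h⟩)
      have h3 : mobF α β γ δ F P (γ' t) * (γ * F (γ' t) + δ) = α * F (γ' t) + β := by
        simp only [mobF, h1, if_false]
        exact div_mul_cancel₀ _ h2
      linear_combination h3
    have hpole : ∀ t, 0 ≤ t → γ' t ∈ P → mobF α β γ δ F P (γ' t) * γ - α = 0 := by
      intro t h0 h1
      have : γ ≠ 0 := fun h => hP t h0 (Or.inl ⟨h1, h⟩)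
      simp only [mobF, h1, if_true]
      field_simp; simp
    have hden : Tendsto (fun t => mobF α β γ δ F P (γ' t) * γ - α) atTop (𝓝 (v * γ - α)) :=
      (hlim.mul_const γ).sub_const α
    have hnum : Tendsto (fun t => β - mobF α β γ δ F P (γ' t) * δ) atTop (𝓝 (β - v * δ)) :=
      (hlim.mul_const δ).const_sub β
    by_cases hva : v * γ - α = 0
    · have hnz : β - v * δ ≠ 0 := by
        intro h
        apply hdet
        linear_combination -δ * hva - γ * h
      refine hN.noinf γ' hc ht fun B => ?_
      rw [hva] at hden
      have e1 : ∀ᶠ t in atTop, ‖β - v * δ‖ / 2 < ‖β - mobF α β γ δ F P (γ' t) * δ‖ :=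
        hnum.norm.eventually (lt_mem_nhds (by have := norm_pos_iff.2 hnz; linarith))
      have hpos : 0 < ‖β - v * δ‖ / 2 := by have := norm_pos_iff.2 hnz; linarith
      have e2 : ∀ᶠ t in atTop, ‖mobF α β γ δ F P (γ' t) * γ - α‖ < ‖β - v * δ‖ / 2 / (|B| + 1) := by
        have := hden.norm
        rw [norm_zero] at this
        exact this.eventually (gt_mem_nhds (by positivity))
      filter_upwards [e1, e2, eventually_ge_atTop 0] with t h1 h2 h3
      by_cases hp : γ' t ∈ P
      · exact Or.inl hp
      · right
        rw [← hrel t h3 hp, norm_mul] at h1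
        rw [lt_div_iff₀ (by positivity)] at h2
        by_contra hB
        push Not at hB
        have : ‖F (γ' t)‖ ≤ |B| + 1 := hB.trans ((le_abs_self B).trans (by linarith))
        nlinarith [norm_nonneg (mobF α β γ δ F P (γ' t) * γ - α)]
    · have hd := hden.eventually_ne hva
      have hS : (β - v * δ) / (v * γ - α) ∉ Sing := by
        intro h
        apply hv _ h
        field_simp
        ring
      refine (hN.nonsing _ hS).ev hc ?_ ht ?_
      · filter_upwards [hd, eventually_ge_atTop 0] with t h1 h2 h3
        exact h1 (hpole t h2 h3)
      · refine (hnum.div hden hva).congr' ?_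
        filter_upwards [hd, eventually_ge_atTop 0] with t h1 h2
        rw [Pi.div_apply, ← hrel t h2 (fun h3 => h1 (hpole t h2 h3))]
        field_simp
end

section
def zz (z0 : ℂ) (N : ℝ) (s : ℂ) : ℂ := z0 * Complex.exp (s / N)

theorem one_sub_pow_bound {y : ℝ} (hy : |y| ≤ 1/2) : Real.exp (-y - 2*y^2) ≤ 1 - y := by
  have h1 := abs_le.1 hy
  have h2 : 0 < 1 - y := by linarith
  rw [← Real.le_log_iff_exp_le h2]
  refine le_trans ?_ (Real.one_sub_inv_le_log_of_pos h2)
  rw [← sub_nonneg]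
  have : 1 - (1-y)⁻¹ - (-y - 2*y^2) = y^2 * (1 - 2*y) / (1-y) := by field_simp; ring
  rw [this]
  apply div_nonneg (mul_nonneg (sq_nonneg _) (by linarith)) h2.le

theorem box_low {a d t1 K : ℝ} {m k : ℕ} (ha : 0 ≤ a) (hXts : 0 < d) (hdX : d ≤ 2*t1) (ht10 : 1 < t1)
    (hm : 4*K+1 < m) (hk4 : (k:ℝ) ≤ 4 * K * t1) (hk2' : 2 ≤ k)
    (e1 : Real.exp (m * t1) * t1^k ≤ a * d^k) : Real.exp t1 ≤ a * d^2 / t1^2 := by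
  have e2 : d^k ≤ d^2 * (2*t1)^(k-2) := by
    rw [← Nat.add_sub_cancel' hk2', pow_add]
    simp only [Nat.add_sub_cancel_left]
    gcongr
  have e3 : Real.exp (m * t1) * t1^k ≤ a * d^2 * (2^k * t1^(k-2)) := by
    calc _ ≤ a * d^k := e1
      _ ≤ a * (d^2 * (2*t1)^(k-2)) := by gcongr
      _ = a * d^2 * (2^(k-2) * t1^(k-2)) := by rw [mul_pow]; ring
      _ ≤ _ := by gcongr <;> [norm_num; omega]
  have e4 : t1^k = t1^2 * t1^(k-2) := by rw [← pow_add, Nat.add_sub_cancel' hk2']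
  have e5 : Real.exp (m * t1) * t1^2 ≤ a * d^2 * 2^k := by
    rw [e4] at e3
    have hp : 0 < t1^(k-2) := by positivity
    refine le_of_mul_le_mul_right ?_ hp
    linarith
  have e6 : (2:ℝ)^k ≤ Real.exp (4 * K * t1) := by
    calc (2:ℝ)^k ≤ (Real.exp 1)^k := by
          gcongr; have := Real.add_one_le_exp 1; linarith
      _ = Real.exp k := by rw [← Real.exp_nat_mul, mul_one]
      _ ≤ _ := Real.exp_le_exp.2 hk4
  have e7 : Real.exp t1 * Real.exp (4 * K * t1) ≤ Real.exp (m * t1) := by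
    rw [← Real.exp_add]; apply Real.exp_le_exp.2; nlinarith
  rw [le_div_iff₀ (by positivity)]
  have hp : 0 < Real.exp (4 * K * t1) := Real.exp_pos _
  refine le_of_mul_le_mul_right ?_ hp
  calc Real.exp t1 * t1^2 * Real.exp (4*K*t1) = (Real.exp t1 * Real.exp (4 * K * t1)) * t1^2 := by ring
    _ ≤ Real.exp (m * t1) * t1^2 := by gcongr
    _ ≤ _ := e5
    _ ≤ _ := by gcongr

theorem box_lam {a d t1 K k n Λ l : ℝ} (hApos : 0 < a) (hXts : 0 < d) (ht10 : 1 < t1) (hk0 : 0 < k) (hK1 : 1 ≤ K)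
    (hk4 : k ≤ 4 * K * t1) (q4 : (16*K^2) * (|Λ|+1) < t1) (hn : 1 ≤ n)
    (hl : l = a * n^2 / (k/d)^2) (hlow : Real.exp t1 ≤ a * d^2 / t1^2) : Λ ≤ l := by
  have h1 : l = a * d^2 * n^2 / k^2 := by
    rw [hl]; field_simp
  have h2 : Real.exp t1 * t1^2 ≤ a * d^2 := by
    rwa [le_div_iff₀ (by positivity)] at hlow
  have h3 : 1 ≤ n^2 := one_le_pow₀ hn
  have h4 : Real.exp t1 * t1^2 / k^2 ≤ l := by
    rw [h1]
    apply div_le_div_of_nonneg_right _ (by positivity)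
    exact h2.trans (le_mul_of_one_le_right (by positivity) h3)
  have h5 : Real.exp t1 * t1^2 / (4*K*t1)^2 ≤ Real.exp t1 * t1^2 / k^2 := by gcongr
  have h6 : Real.exp t1 * t1^2 / (4*K*t1)^2 = Real.exp t1 / (16*K^2) := by field_simp; ring
  have h7 : |Λ| ≤ Real.exp t1 / (16*K^2) := by
    rw [le_div_iff₀ (by positivity)]
    have := Real.quadratic_le_exp_of_nonneg (by linarith : 0 ≤ t1)
    have hh : 0 ≤ |Λ| := abs_nonneg _
    nlinarith [sq_nonneg K]
  linarith [le_abs_self Λ]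

theorem box_AB {a d t1 B : ℝ} (hApos : 0 < a) (hXts : 0 < d) (hdX : d ≤ 2*t1) (ht10 : 1 < t1) (q2 : |B| + 1 < t1)
    (hlow : Real.exp t1 ≤ a * d^2 / t1^2) : B < a := by
  have h1 : a * d^2 / t1^2 ≤ 4 * a := by
    rw [div_le_iff₀ (by positivity)]
    have : d^2 ≤ (2*t1)^2 := by gcongr
    nlinarith
  have h2 : t1 + 1 + t1^2/2 ≤ Real.exp t1 := by
    have := Real.quadratic_le_exp_of_nonneg (by linarith : 0 ≤ t1); linarith
  have h3 := le_abs_self B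
  nlinarith [sq_nonneg (t1-3)]

theorem box_max {A : ℂ → ℂ} {R0 : ℝ} (hA : ∀ z : ℂ, R0 < ‖z‖ → AnalyticAt ℂ A z)
    (hT : ∀ (m : ℕ) (ρ : ℝ), ∃ z : ℂ, ρ < ‖z‖ ∧ ‖z‖ ^ m < ‖A z‖)
    {ρ1 Λ K Q0 : ℝ} (hρR : R0 < ρ1) (hρ11 : 1 < ρ1) (hK1 : 1 ≤ K) :
    ∃ (zs : ℂ) (k : ℕ) (d : ℝ), 0 < d ∧ Q0 < k ∧ ρ1 * Real.exp 1 < ‖zs‖ ∧ K ≤ k / d ∧ A zs ≠ 0 ∧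
      Λ ≤ ‖A zs‖ * ‖zs‖^2 / (k/d)^2 ∧ ∀ z : ℂ, ρ1 ≤ ‖z‖ → Real.log ‖z‖ ≤ Real.log ‖zs‖ + d →
        ‖A z‖ * (Real.log ‖zs‖ + d - Real.log ‖z‖)^k ≤ ‖A zs‖ * d^k := by
  -- annuli
  have hann : ∀ b : ℝ, IsCompact {z : ℂ | ρ1 ≤ ‖z‖ ∧ ‖z‖ ≤ b} := by
    intro b
    refine (isCompact_closedBall (0:ℂ) b).of_isClosed_subset ?_ ?_
    · exact (isClosed_le continuous_const continuous_norm).inter (isClosed_le continuous_norm continuous_const)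
    · intro z hz; simpa using hz.2
  have hAc : ∀ b : ℝ, ContinuousOn A {z : ℂ | ρ1 ≤ ‖z‖ ∧ ‖z‖ ≤ b} := fun b z hz =>
    (hA z (hρR.trans_le hz.1)).continuousAt.continuousWithinAt
  obtain ⟨B, hB⟩ := (hann (ρ1 * Real.exp 1)).exists_bound_of_continuousOn (hAc _)
  -- choice of z1
  obtain ⟨m, hm⟩ := exists_nat_gt (4 * K + 1)
  set Q := max (max (Real.log ρ1) (|B| + 1)) (max (1/K + 1) (max ((16*K^2) * (|Λ|+1)) Q0)) with hQ
  obtain ⟨z1, hz1, hz1A⟩ := hT m (Real.exp Q)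
  have hz10 : 0 < ‖z1‖ := (Real.exp_pos _).trans hz1
  set t1 := Real.log ‖z1‖ with ht1
  have hzt : ‖z1‖ = Real.exp t1 := (Real.exp_log hz10).symm
  have hQt : Q < t1 := by rw [hzt] at hz1; exact Real.exp_lt_exp.1 hz1
  have q1 : Real.log ρ1 < t1 := lt_of_le_of_lt ((le_max_left _ _).trans (le_max_left _ _)) hQt
  have q2 : |B| + 1 < t1 := lt_of_le_of_lt ((le_max_right _ _).trans (le_max_left _ _)) hQt
  have q3 : 1/K + 1 < t1 := lt_of_le_of_lt ((le_max_left _ _).trans (le_max_right _ _)) hQt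
  have q4 : (16*K^2) * (|Λ|+1) < t1 := lt_of_le_of_lt ((le_max_left _ _).trans ((le_max_right _ _).trans (le_max_right _ _))) hQt
  have q6 : Q0 < t1 := lt_of_le_of_lt ((le_max_right _ _).trans ((le_max_right _ _).trans (le_max_right _ _))) hQt
  have ht10 : 1 < t1 := by have : 0 < 1/K := by positivity
                           linarith
  set X := 2 * t1 with hX
  obtain ⟨k, hk1, hk2⟩ : ∃ k : ℕ, K * X ≤ k ∧ (k:ℝ) < K * X + 1 :=
    ⟨⌈K * X⌉₊, Nat.le_ceil _, Nat.ceil_lt_add_one (by positivity)⟩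
  have hkt : t1 ≤ k := by nlinarith
  have hk4 : (k:ℝ) ≤ 4 * K * t1 := by nlinarith
  have hk0 : (0:ℝ) < k := by linarith
  -- maximise
  have hne : z1 ∈ {z : ℂ | ρ1 ≤ ‖z‖ ∧ ‖z‖ ≤ Real.exp X} := by
    refine ⟨?_, ?_⟩
    · rw [hzt]; exact ((Real.log_lt_iff_lt_exp (by linarith)).1 q1).le
    · rw [hzt]; exact Real.exp_le_exp.2 (by linarith)
  obtain ⟨zs, ⟨hzs1, hzs2⟩, hmax⟩ := (hann (Real.exp X)).exists_isMaxOn ⟨z1, hne⟩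
    (f := fun z => ‖A z‖ * (X - Real.log ‖z‖)^k) (by
      refine (hAc _).norm.mul ((continuousOn_const.sub ?_).pow _)
      refine ContinuousOn.log continuous_norm.continuousOn ?_
      intro z hz h0
      have := hz.1
      linarith)
  have hzs0 : 0 < ‖zs‖ := by linarith
  set ts := Real.log ‖zs‖ with hts
  have hzst : ‖zs‖ = Real.exp ts := (Real.exp_log hzs0).symm
  have hts0 : 0 ≤ ts := Real.log_nonneg (by linarith)
  have htsX : ts ≤ X := by rw [hzst] at hzs2; exact Real.exp_le_exp.1 hzs2
  have hΦ : ‖z1‖^m * t1^k < ‖A zs‖ * (X - ts)^k := by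
    have h1 : ‖A z1‖ * (X - Real.log ‖z1‖)^k ≤ ‖A zs‖ * (X - ts)^k := hmax hne
    rw [← ht1, show X - t1 = t1 by rw [hX]; ring] at h1
    refine lt_of_lt_of_le ?_ h1
    exact mul_lt_mul_of_pos_right hz1A (by positivity)
  have hXts : 0 < X - ts := by
    rcases (sub_nonneg.2 htsX).eq_or_lt with h | h
    · exfalso
      have hkn : k ≠ 0 := by
        intro h0
        rw [h0] at hk0; simp at hk0
      rw [← h, zero_pow hkn, mul_zero] at hΦ
      have : 0 ≤ ‖z1‖^m * t1^k := by positivity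
      linarith
    · exact h
  set d := X - ts with hd
  have hdX : d ≤ 2 * t1 := by linarith
  set N := k / d with hN
  have hNK : K ≤ N := by
    rw [hN, le_div_iff₀ hXts]
    have : K * d ≤ K * X := mul_le_mul_of_nonneg_left (by linarith) (by linarith)
    linarith
  have hN0 : 0 < N := by linarith
  -- lower bounds
  have hk2' : 2 ≤ k := by
    have : (2:ℝ) ≤ k := by nlinarith
    exact_mod_cast this
  have hlow : Real.exp t1 ≤ ‖A zs‖ * d^2 / t1^2 := by
    refine box_low (norm_nonneg _) hXts hdX ht10 hm hk4 hk2' ?_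
    have := hΦ.le
    rwa [hzt, ← Real.exp_nat_mul] at this
  have hAz : ‖A zs‖ ≠ 0 := by
    intro h
    rw [h] at hlow; simp at hlow
    linarith [Real.exp_pos t1]
  have hA0 : A zs ≠ 0 := by simpa using hAz
  have hApos : 0 < ‖A zs‖ := norm_pos_iff.2 hA0
  have hAB : B < ‖A zs‖ := box_AB hApos hXts hdX ht10 q2 hlow
  have hfar : ρ1 * Real.exp 1 < ‖zs‖ := by
    by_contra h
    push Not at h
    have := hB zs ⟨hzs1, h⟩
    linarith
  set l := ‖A zs‖ * ‖zs‖^2 / N^2 with hl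
  have hl0 : 0 < l := by positivity
  have hlΛ : Λ ≤ l := box_lam hApos hXts ht10 hk0 hK1 hk4 q4 (by linarith) hl hlow
  refine ⟨zs, k, d, hXts, ?_, hfar, hNK, hA0, hlΛ, ?_⟩
  · linarith
  · intro z hz1 hz2
    have hz0 : 0 < ‖z‖ := by linarith
    have h1 : ‖A z‖ * (X - Real.log ‖z‖)^k ≤ ‖A zs‖ * (X - ts)^k := hmax ⟨hz1, by
      rw [← Real.log_le_iff_le_exp hz0]; linarith⟩
    rw [show ts + d - Real.log ‖z‖ = X - Real.log ‖z‖ by rw [hd]; ring]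
    exact h1

theorem box_loc {A : ℂ → ℂ} {ρ1 η L1 d N : ℝ} {k : ℕ} {zs : ℂ} (hXts : 0 < d) (hη0 : 0 < η) (hL1 : 0 < L1)
    (hρ11 : 1 < ρ1) (hN : N = k / d) (hKL : 2 * L1 ≤ N) (hk0 : (0:ℝ) < k) (q5 : 4 * L1 + 4 < k)
    (h6 : 8 * L1^2/η ≤ k) (hfar : ρ1 * Real.exp 1 < ‖zs‖)
    (hmax : ∀ z : ℂ, ρ1 ≤ ‖z‖ → Real.log ‖z‖ ≤ Real.log ‖zs‖ + d →
        ‖A z‖ * (Real.log ‖zs‖ + d - Real.log ‖z‖)^k ≤ ‖A zs‖ * d^k) :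
    ∀ s : ℂ, ‖s‖ ≤ 2 * L1 → ρ1 < ‖zz zs N s‖ ∧ ‖A (zz zs N s)‖ ≤ ‖A zs‖ * Real.exp (s.re + η) := by
  have hN0 : 0 < N := by linarith
  have hzs0 : 0 < ‖zs‖ := lt_trans (by positivity) hfar
  set ts := Real.log ‖zs‖ with hts
  have hzst : ‖zs‖ = Real.exp ts := (Real.exp_log hzs0).symm
  intro s hs
  have hre : |s.re| ≤ 2 * L1 := (Complex.abs_re_le_norm s).trans hs
  have hre' := abs_le.1 hre
  have hzn : ‖zz zs N s‖ = Real.exp (ts + s.re / N) := by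
    rw [zz, norm_mul, Complex.norm_exp, Complex.div_ofReal_re, hzst, Real.exp_add]
  have hbig : ρ1 < ‖zz zs N s‖ := by
    rw [hzn, Real.exp_add, ← hzst]
    have h1 : Real.exp (-1) ≤ Real.exp (s.re / N) := by
      apply Real.exp_le_exp.2
      rw [le_div_iff₀ hN0]; linarith
    calc ρ1 = ρ1 * Real.exp 1 * Real.exp (-1) := by rw [mul_assoc, ← Real.exp_add]; simp
      _ < ‖zs‖ * Real.exp (-1) := by gcongr
      _ ≤ _ := by gcongr
  refine ⟨hbig, ?_⟩
  set y := s.re / k with hy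
  have hyk : |y| ≤ 1/2 := by
    rw [hy, abs_div, abs_of_pos hk0, div_le_iff₀ hk0]; linarith
  have hyy := abs_le.1 hyk
  have hlog : ts + d - Real.log ‖zz zs N s‖ = d * (1 - y) := by
    rw [hzn, Real.log_exp, hN, hy]; field_simp; ring
  have h1 := hmax (zz zs N s) hbig.le (by
    have h1 : 0 ≤ ts + d - Real.log ‖zz zs N s‖ := by
      rw [hlog]; apply mul_nonneg hXts.le; linarith
    linarith)
  rw [hlog, mul_pow] at h1
  have h2 : ‖A (zz zs N s)‖ * (1-y)^k ≤ ‖A zs‖ := by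
    have : 0 < d^k := by positivity
    refine le_of_mul_le_mul_right ?_ this
    linarith
  have h3 : Real.exp (-s.re - η) ≤ (1-y)^k := by
    calc Real.exp (-s.re - η) ≤ Real.exp (k * (-y - 2*y^2)) := by
          apply Real.exp_le_exp.2
          have e1 : k * y = s.re := by rw [hy]; field_simp
          have e2 : k * (2 * y^2) ≤ η := by
            rw [hy, div_pow]
            have : (k:ℝ) * (2 * (s.re^2 / k^2)) = 2 * s.re^2 / k := by field_simp
            rw [this, div_le_iff₀ hk0]
            have h5 : s.re^2 ≤ (2*L1)^2 := sq_le_sq' hre'.1 hre'.2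
            rw [div_le_iff₀ hη0] at h6
            nlinarith
          nlinarith
      _ = (Real.exp (-y - 2*y^2))^k := by rw [← Real.exp_nat_mul]
      _ ≤ _ := by gcongr; exact one_sub_pow_bound hyk
  have h4 : ‖A (zz zs N s)‖ * Real.exp (-s.re - η) ≤ ‖A zs‖ := by
    refine le_trans ?_ h2
    gcongr
  calc ‖A (zz zs N s)‖ = ‖A (zz zs N s)‖ * Real.exp (-s.re - η) * Real.exp (s.re + η) := by
        rw [mul_assoc, ← Real.exp_add]; simp
    _ ≤ _ := by gcongr

theorem box_lemma {A : ℂ → ℂ} {R0 : ℝ} (hA : ∀ z : ℂ, R0 < ‖z‖ → AnalyticAt ℂ A z)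
    (hT : ∀ (m : ℕ) (ρ : ℝ), ∃ z : ℂ, ρ < ‖z‖ ∧ ‖z‖ ^ m < ‖A z‖)
    {L ε Λ ρ0 : ℝ} (hL : 0 < L) (hε : 0 < ε) :
    ∃ (z0 : ℂ) (N l : ℝ), z0 ≠ 0 ∧ Λ ≤ N ∧ 0 < N ∧ Λ ≤ l ∧ 0 < l ∧ ∀ s : ℂ, ‖s‖ ≤ L →
      ρ0 < ‖zz z0 N s‖ ∧
      ‖(zz z0 N s)^2 * A (zz z0 N s) / (N:ℂ)^2 - l * Complex.exp s‖ ≤ ε * l * Real.exp s.re := by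
  set L1 := L + 4 with hL1
  set ρ1 := max (max R0 ρ0) 1 + 1 with hρ1
  have hρR : R0 < ρ1 := by have := le_max_left (max R0 ρ0) 1; have := le_max_left R0 ρ0; linarith
  have hρρ : ρ0 < ρ1 := by have := le_max_left (max R0 ρ0) 1; have := le_max_right R0 ρ0; linarith
  have hρ11 : 1 < ρ1 := by have := le_max_right (max R0 ρ0) 1; linarith
  set η := min 1 (ε / 48) with hη
  have hη0 : 0 < η := by positivity
  set K := max (max Λ 1) (max (2 * L1) (8 * L1 / ε)) with hK
  have hKΛ : Λ ≤ K := (le_max_left _ _).trans (le_max_left _ _)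
  have hK1 : 1 ≤ K := (le_max_right _ _).trans (le_max_left _ _)
  have hKL : 2 * L1 ≤ K := (le_max_left _ _).trans (le_max_right _ _)
  have hKe : 8 * L1 / ε ≤ K := (le_max_right _ _).trans (le_max_right _ _)
  obtain ⟨zs, k, d, hXts, hkQ, hfar, hNK, hA0, hlΛ, hmax⟩ := box_max hA hT (Λ := Λ) (K := K) (Q0 := 4 * L1 + 4 + 8 * L1^2/η) hρR hρ11 hK1
  have hL10 : 0 < L1 := by linarith
  have hq : 0 < 8 * L1^2/η := by positivity
  have hk0 : (0:ℝ) < k := by linarith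
  have hApos : 0 < ‖A zs‖ := norm_pos_iff.2 hA0
  have hzs0 : 0 < ‖zs‖ := lt_trans (by positivity) hfar
  set N := k / d with hN
  have hN0 : 0 < N := by linarith
  set l := ‖A zs‖ * ‖zs‖^2 / N^2 with hl
  have hl0 : 0 < l := by positivity
  have hloc := box_loc hXts hη0 hL10 hρ11 hN (hKL.trans hNK) hk0 (by linarith) (by linarith) hfar hmax
  -- g
  set g : ℂ → ℂ := fun s => A (zz zs N s) * Complex.exp (-s) / A zs - 1 with hg
  have hgd : DifferentiableOn ℂ g (Metric.ball 0 (2 * L1)) := by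
    intro s hs
    rw [mem_ball_zero_iff] at hs
    have h1 := (hA _ (hρR.trans (hloc s hs.le).1)).differentiableAt
    have h2 : DifferentiableAt ℂ (fun s => zz zs N s) s := by unfold zz; fun_prop
    have h3 : DifferentiableAt ℂ (fun s => A (zz zs N s)) s := DifferentiableAt.comp s h1 h2
    exact ((h3.mul (by fun_prop)).div_const _ |>.sub_const _).differentiableWithinAt
  have hgre : MapsTo g (Metric.ball 0 (2 * L1)) {z | z.re ≤ 2 * η} := by
    intro s hs
    rw [mem_ball_zero_iff] at hs
    have h1 := (hloc s hs.le).2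
    have h2 : ‖A (zz zs N s) * Complex.exp (-s) / A zs‖ ≤ Real.exp η := by
      rw [norm_div, norm_mul, Complex.norm_exp, div_le_iff₀ hApos, Complex.neg_re]
      calc ‖A (zz zs N s)‖ * Real.exp (-s.re) ≤ ‖A zs‖ * Real.exp (s.re + η) * Real.exp (-s.re) := by gcongr
        _ = _ := by rw [mul_assoc, ← Real.exp_add]; ring_nf
    have h3 := Complex.re_le_norm (A (zz zs N s) * Complex.exp (-s) / A zs)
    have h4 : Real.exp η ≤ 1 + 2 * η := by
      have := Real.abs_exp_sub_one_le (x := η) (by rw [abs_of_pos hη0]; exact min_le_left _ _)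
      rw [abs_of_pos hη0] at this
      linarith [(abs_le.1 this).2]
    simp only [hg, mem_ofPred_eq, Complex.sub_re, Complex.one_re]
    linarith
  have hg0 : g 0 = 0 := by simp [hg, zz, hA0]
  have hgb : ∀ s : ℂ, ‖s‖ ≤ L1 → ‖g s‖ ≤ 4 * η := by
    intro s hs
    have hs' : s ∈ Metric.ball (0:ℂ) (2 * L1) := by rw [mem_ball_zero_iff]; linarith
    have h1 := Complex.borelCaratheodory_zero (by positivity : (0:ℝ) < 2 * η) hgd hgre (by positivity) hs' hg0
    refine h1.trans ?_
    rw [div_le_iff₀ (by linarith)]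
    nlinarith
  -- phase
  set al := Complex.arg (A zs * zs^2) with hal
  have halb : |al| ≤ 4 := (Complex.abs_arg_le_pi _).trans (by linarith [Real.pi_le_four])
  have hpol : A zs * zs^2 = (‖A zs‖ * ‖zs‖^2 : ℝ) * Complex.exp (al * Complex.I) := by
    have := Complex.norm_mul_exp_arg_mul_I (A zs * zs^2)
    rw [norm_mul, norm_pow] at this
    rw [hal]; exact this.symm
  refine ⟨zs * Complex.exp (-(al * Complex.I) / N), N, l, ?_, hKΛ.trans hNK, hN0, hlΛ, hl0, ?_⟩
  · exact mul_ne_zero (norm_pos_iff.1 hzs0) (Complex.exp_ne_zero _)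
  intro s hs
  set s' := s - al * Complex.I with hs'
  have hs'n : ‖s'‖ ≤ L1 := by
    calc ‖s'‖ ≤ ‖s‖ + ‖(al:ℂ) * Complex.I‖ := norm_sub_le _ _
      _ = ‖s‖ + |al| := by simp
      _ ≤ _ := by linarith
  have hzeq : zz (zs * Complex.exp (-(al * Complex.I) / N)) N s = zz zs N s' := by
    simp only [zz]; rw [mul_assoc, ← Complex.exp_add, hs']; congr 2; ring
  rw [hzeq]
  refine ⟨hρρ.trans (hloc s' (by linarith)).1, ?_⟩
  set τ := 2 * s' / N with hτ
  have hτn : ‖τ‖ ≤ 2 * L1 / N := by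
    rw [hτ, norm_div, norm_mul]; simp only [Complex.norm_ofNat, Complex.norm_real, Real.norm_eq_abs, abs_of_pos hN0]
    gcongr
  have hτ1 : 2 * L1 / N ≤ 1 := by rw [div_le_iff₀ hN0]; linarith
  have hτε : 2 * L1 / N ≤ ε / 4 := by
    rw [div_le_iff₀ hε] at hKe
    rw [div_le_iff₀ hN0]; nlinarith
  have hNc : (N:ℂ) ≠ 0 := by exact_mod_cast hN0.ne'
  have hmain : (zz zs N s')^2 * A (zz zs N s') / (N:ℂ)^2 = l * Complex.exp s * ((1 + g s') * Complex.exp τ) := by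
    have h1 : A (zz zs N s') = A zs * Complex.exp s' * (1 + g s') := by
      simp only [hg, add_sub_cancel]
      rw [Complex.exp_neg]
      field_simp [Complex.exp_ne_zero]
    have h2 : (zz zs N s')^2 = zs^2 * Complex.exp τ := by
      rw [zz, mul_pow, ← Complex.exp_nat_mul, hτ]; congr 2; push_cast; ring
    have h3 : (l:ℂ) = ((‖A zs‖ * ‖zs‖^2 : ℝ) : ℂ) / (N:ℂ)^2 := by rw [hl]; push_cast; ring
    have h4 : Complex.exp s = Complex.exp (al * Complex.I) * Complex.exp s' := by
      rw [← Complex.exp_add, hs']; congr 1; ring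
    rw [h1, h2, h3, h4]
    calc zs ^ 2 * Complex.exp τ * (A zs * Complex.exp s' * (1 + g s')) / (N:ℂ) ^ 2
        = (A zs * zs^2) * (Complex.exp τ * Complex.exp s' * (1 + g s')) / (N:ℂ)^2 := by ring
      _ = _ := by rw [hpol]; ring
  rw [hmain]
  have hfin : ‖(1 + g s') * Complex.exp τ - 1‖ ≤ ε := by
    have h1 : (1 + g s') * Complex.exp τ - 1 = g s' * Complex.exp τ + (Complex.exp τ - 1) := by ring
    have h2 : ‖Complex.exp τ - 1‖ ≤ 2 * ‖τ‖ := Complex.norm_exp_sub_one_le (hτn.trans hτ1)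
    have h3 : ‖Complex.exp τ‖ ≤ 3 := by
      have : Complex.exp τ = (Complex.exp τ - 1) + 1 := by ring
      rw [this]
      refine (norm_add_le _ _).trans ?_
      rw [norm_one]; linarith
    rw [h1]
    refine (norm_add_le _ _).trans ?_
    rw [norm_mul]
    have h4 := hgb s' hs'n
    have h5 : η ≤ ε / 48 := min_le_right _ _
    have h6 : ‖g s'‖ * ‖Complex.exp τ‖ ≤ (4 * η) * 3 := mul_le_mul h4 h3 (norm_nonneg _) (by positivity)
    linarith
  calc ‖(l:ℂ) * Complex.exp s * ((1 + g s') * Complex.exp τ) - l * Complex.exp s‖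
      = ‖(l:ℂ) * Complex.exp s * ((1 + g s') * Complex.exp τ - 1)‖ := by congr 1; ring
    _ = l * Real.exp s.re * ‖(1 + g s') * Complex.exp τ - 1‖ := by
        rw [norm_mul, norm_mul, Complex.norm_exp, Complex.norm_real, Real.norm_of_nonneg hl0.le]
    _ ≤ l * Real.exp s.re * ε := by gcongr
    _ = _ := by ring
end

section
/-! general lemmas -/

theorem cont_ind {Q : ℝ → Prop} (h0 : Q 0) (hop : ∀ t ∈ Icc (0:ℝ) 1, Q t → ∀ᶠ t' in 𝓝 t, Q t')
    (hcl : ∀ t ∈ Ioc (0:ℝ) 1, (∀ t', 0 ≤ t' → t' < t → Q t') → Q t) : ∀ t ∈ Icc (0:ℝ) 1, Q t := by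
  by_contra hcon
  push Not at hcon
  obtain ⟨t0, ht0, hq0⟩ := hcon
  set S := {t | t ∈ Icc (0:ℝ) 1 ∧ ¬ Q t} with hS
  have hbd : BddBelow S := ⟨0, fun t ht => ht.1.1⟩
  have hne : S.Nonempty := ⟨t0, ht0, hq0⟩
  set i := sInf S with hi
  have hi0 : 0 ≤ i := le_csInf hne fun t ht => ht.1.1
  have hi1 : i ≤ 1 := (csInf_le hbd (show t0 ∈ S from ⟨ht0, hq0⟩)).trans ht0.2
  have hlt : ∀ t', 0 ≤ t' → t' < i → Q t' := by
    intro t' h1 h2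
    by_contra h
    exact absurd (csInf_le hbd (show t' ∈ S from ⟨⟨h1, by linarith⟩, h⟩)) (not_le.2 h2)
  have hQi : Q i := by
    rcases hi0.eq_or_lt with h | h
    · rw [← h]; exact h0
    · exact hcl i ⟨h, hi1⟩ hlt
  obtain ⟨ε, hε, hb⟩ := Metric.eventually_nhds_iff.1 (hop i ⟨hi0, hi1⟩ hQi)
  obtain ⟨t, htS, htl⟩ := exists_lt_of_csInf_lt hne (show sInf S < i + ε by linarith)
  have hti : i ≤ t := csInf_le hbd htS
  refine htS.2 (hb ?_)
  rw [Real.dist_eq, abs_of_nonneg (by linarith)]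
  linarith

theorem solve {v : ℂ → ℂ} {w0 c y : ℂ} {R : ℝ} (hc : c ≠ 0) (hR : 0 < R)
    (hv : ∀ w ∈ Metric.closedBall w0 R, DifferentiableAt ℂ v w ∧ ‖deriv v w - c‖ ≤ ‖c‖ / 4)
    (hy : ‖y - v w0‖ ≤ ‖c‖ * R / 2) : ∃ w ∈ Metric.closedBall w0 R, v w = y := by
  have happ : ApproximatesLinearOn v ((ContinuousLinearEquiv.smulLeft (Units.mk0 c hc) : ℂ ≃L[ℂ] ℂ) : ℂ →L[ℂ] ℂ)
      (Metric.closedBall w0 R) (‖c‖₊ / 4) := by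
    intro x hx x' hx'
    have h := (convex_closedBall w0 R).norm_image_sub_le_of_norm_deriv_le (𝕜 := ℂ) (f := fun w => v w - c * w)
      (C := ‖c‖/4) (fun w hw => (hv w hw).1.sub (by fun_prop)) (fun w hw => ?_) hx' hx
    · have e : v x - v x' - c * (x - x') = (v x - c * x) - (v x' - c * x') := by ring
      change ‖v x - v x' - c * (x - x')‖ ≤ _
      rw [e]
      simpa using h
    · rw [show (fun w => v w - c * w) = v - (fun w => c * w) from rfl, deriv_sub (hv w hw).1 (by fun_prop)]
      have : deriv (fun w : ℂ => c * w) w = c := by simp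
      rw [this]; exact (hv w hw).2
  have hs := happ.surjOn_closedBall_of_nonlinearRightInverse
    (ContinuousLinearEquiv.toNonlinearRightInverse _) hR.le Subset.rfl
  have hnn : ((ContinuousLinearEquiv.toNonlinearRightInverse (ContinuousLinearEquiv.smulLeft (Units.mk0 c hc) : ℂ ≃L[ℂ] ℂ)).nnnorm : ℝ) ≤ ‖c‖⁻¹ := by
    change ‖_‖ ≤ _
    refine ContinuousLinearMap.opNorm_le_bound _ (by positivity) fun x => ?_
    change ‖c⁻¹ * x‖ ≤ _
    rw [norm_mul, norm_inv]
  have hcn : 0 < ‖c‖ := norm_pos_iff.2 hc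
  have hpos : 0 < ((ContinuousLinearEquiv.toNonlinearRightInverse (ContinuousLinearEquiv.smulLeft (Units.mk0 c hc) : ℂ ≃L[ℂ] ℂ)).nnnorm : ℝ) := by
    rcases (NNReal.coe_nonneg ((ContinuousLinearEquiv.toNonlinearRightInverse (ContinuousLinearEquiv.smulLeft (Units.mk0 c hc) : ℂ ≃L[ℂ] ℂ)).nnnorm)).eq_or_lt with h | h
    · exfalso
      have h1 := (ContinuousLinearEquiv.toNonlinearRightInverse (ContinuousLinearEquiv.smulLeft (Units.mk0 c hc) : ℂ ≃L[ℂ] ℂ)).bound' 1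
      rw [← h] at h1
      have h2 : ‖c⁻¹ * (1:ℂ)‖ ≤ 0 * ‖(1:ℂ)‖ := h1
      rw [mul_one, norm_inv, zero_mul] at h2
      have : 0 < ‖c‖⁻¹ := by positivity
      linarith
    · exact h
  refine hs ?_
  rw [Metric.mem_closedBall, dist_eq_norm]
  refine hy.trans ?_
  have h1 := inv_anti₀ hpos hnn
  rw [inv_inv] at h1
  have h2 : ((‖c‖₊ / 4 : NNReal) : ℝ) = ‖c‖ / 4 := by simp
  rw [h2]
  nlinarith

theorem exists_log_ball {f : ℂ → ℂ} {c : ℂ} {r : ℝ} (hr : 0 < r)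
    (hf : ∀ w ∈ Metric.ball c r, DifferentiableAt ℂ f w ∧ f w ≠ 0) :
    ∃ v : ℂ → ℂ, ∀ w ∈ Metric.ball c r, HasDerivAt v (deriv f w / f w) w ∧ Complex.exp (v w) = f w := by
  have hd : DifferentiableOn ℂ f (Metric.ball c r) := fun w hw => (hf w hw).1.differentiableWithinAt
  have hc : c ∈ Metric.ball c r := Metric.mem_ball_self hr
  have hq : DifferentiableOn ℂ (fun w => deriv f w / f w) (Metric.ball c r) :=
    (hd.deriv Metric.isOpen_ball).div hd fun w hw => (hf w hw).2
  obtain ⟨v, hv⟩ := hq.isExactOn_ball.with_val_at c (Complex.log (f c))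
  refine ⟨v, fun w hw => ⟨hv.2 w hw, ?_⟩⟩
  have hk : ∀ x ∈ Metric.ball c r, HasDerivAt (fun x => f x * Complex.exp (-v x)) 0 x := by
    intro x hx
    have h1 := (hf x hx).1.hasDerivAt.mul ((hv.2 x hx).neg.cexp)
    convert! h1 using 1
    field_simp [(hf x hx).2]
    ring
  have hconst := (convex_ball c r).is_const_of_fderivWithin_eq_zero (𝕜 := ℂ) (f := fun x => f x * Complex.exp (-v x))
    (fun x hx => (hk x hx).differentiableAt.differentiableWithinAt) (fun x hx => by
      rw [fderivWithin_of_isOpen Metric.isOpen_ball hx]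
      ext
      simp [(hk x hx).deriv]) hw hc
  simp only [hv.1, Complex.exp_neg, Complex.exp_log (hf c hc).2] at hconst
  rw [mul_inv_cancel₀ (hf c hc).2] at hconst
  have h3 := Complex.exp_ne_zero (v w)
  field_simp at hconst
  exact hconst.symm

/-! pre-Schwarzian -/

def preS (h : ℂ → ℂ) (z : ℂ) : ℂ := deriv (deriv h) z / deriv h z

structure SA (φ A : ℂ → ℂ) (z : ℂ) : Prop where
  an : AnalyticAt ℂ φ z
  ne : deriv φ z ≠ 0
  pre : HasDerivAt (preS φ) (preS φ z ^ 2 / 2 + 2 * A z) z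

theorem SA_of_schwarzian {φ A : ℂ → ℂ} {z : ℂ} (h : AnalyticAt ℂ φ z) (hd : deriv φ z ≠ 0)
    (hs : schwarzian φ z = 2 * A z) : SA φ A z := by
  refine ⟨h, hd, ?_⟩
  have h1 := (h.deriv.deriv.differentiableAt.hasDerivAt).div h.deriv.differentiableAt.hasDerivAt hd
  refine HasDerivAt.congr_deriv (f := preS φ) h1 ?_
  rw [← hs, schwarzian, preS]
  field_simp
  ring

theorem SA_mob {φ A h : ℂ → ℂ} {z α β γ δ : ℂ} (hφ : SA φ A z) (hdet : α * δ - β * γ ≠ 0)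
    (h0 : γ * φ z + δ ≠ 0) (hh : h =ᶠ[𝓝 z] fun w => (α * φ w + β) / (γ * φ w + δ)) :
    SA h A z ∧ deriv h z = (α * δ - β * γ) * deriv φ z / (γ * φ z + δ)^2 ∧
      preS h z = preS φ z - 2 * γ * deriv φ z / (γ * φ z + δ) := by
  have han := hφ.an
  have hden : AnalyticAt ℂ (fun w => γ * φ w + δ) z := (analyticAt_const.mul han).add analyticAt_const
  have hne : ∀ᶠ w in 𝓝 z, γ * φ w + δ ≠ 0 := hden.continuousAt.eventually_ne h0
  have hne2 : ∀ᶠ w in 𝓝 z, deriv φ w ≠ 0 := han.deriv.continuousAt.eventually_ne hφ.ne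
  have hd1 : deriv h =ᶠ[𝓝 z] fun w => (α * δ - β * γ) * deriv φ w / (γ * φ w + δ)^2 := by
    filter_upwards [hh.eventuallyEq_nhds, hne, han.eventually_analyticAt] with w h1 h2 h3
    rw [h1.deriv_eq, (mob_hasDerivAt h3.differentiableAt.hasDerivAt h2).deriv]
  have hd2 : preS h =ᶠ[𝓝 z] fun w => preS φ w - 2 * γ * deriv φ w / (γ * φ w + δ) := by
    filter_upwards [hd1.eventuallyEq_nhds, hne, han.eventually_analyticAt, hne2] with w h1 h2 h3 h4
    have h5 := h3.deriv.differentiableAt.hasDerivAt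
    have h6 := h3.differentiableAt.hasDerivAt
    have h7 := (h5.const_mul (α * δ - β * γ)).div (((h6.const_mul γ).add_const δ).pow 2) (pow_ne_zero 2 h2)
    have h8 : deriv (deriv h) w = _ := h1.deriv_eq.trans h7.deriv
    rw [preS, h8, h1.eq_of_nhds, preS]
    simp only [Pi.pow_apply]
    field_simp
    push_cast
    ring
  have hdz := hd1.eq_of_nhds
  refine ⟨⟨?_, ?_, ?_⟩, hdz, hd2.eq_of_nhds⟩
  · exact (((analyticAt_const.mul han).add analyticAt_const).div hden h0).congr hh.symm
  · rw [hdz]; exact div_ne_zero (mul_ne_zero hdet hφ.ne) (pow_ne_zero _ h0)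
  · have h5 := han.deriv.differentiableAt.hasDerivAt
    have h6 := han.differentiableAt.hasDerivAt
    have h7 := hφ.pre.sub ((h5.const_mul (2*γ)).div ((h6.const_mul γ).add_const δ) h0)
    have h8 : HasDerivAt (preS h) _ z := h7.congr_of_eventuallyEq hd2
    refine h8.congr_deriv ?_
    have h9 : deriv (deriv φ) z = preS φ z * deriv φ z := by rw [preS]; field_simp [hφ.ne]
    rw [hd2.eq_of_nhds, h9]
    field_simp
    ring

structure Setup (F A : ℂ → ℂ) (P Sing : Set ℂ) (M : ℕ) (R0 : ℝ) : Prop where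
  nice : Nice F P Sing M
  Aan : ∀ z : ℂ, R0 < ‖z‖ → AnalyticAt ℂ A z
  reg : ∀ z : ℂ, R0 < ‖z‖ → z ∉ P → deriv F z ≠ 0 ∧ schwarzian F z = 2 * A z

section
variable {F A : ℂ → ℂ} {P Sing : Set ℂ} {M : ℕ} {R0 : ℝ}

theorem Setup.SA_fin (hS : Setup F A P Sing M R0) {z : ℂ} (hz : R0 < ‖z‖) (hp : z ∉ P) : SA F A z :=
  SA_of_schwarzian (hS.nice.mero.2.1 z hp) (hS.reg z hz hp).1 (hS.reg z hz hp).2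

theorem Setup.SA_pole (hS : Setup F A P Sing M R0) {z : ℂ} (hz : R0 < ‖z‖) (hp : z ∈ P) {q : ℂ → ℂ}
    (hq : AnalyticAt ℂ q z) (hqd : deriv q z ≠ 0) (hF : ∀ᶠ w in 𝓝[≠] z, F w = 1 / q w) : SA q A z := by
  refine ⟨hq, hqd, ?_⟩
  have hpa : AnalyticAt ℂ (preS q) z := hq.deriv.deriv.div hq.deriv hqd
  refine hpa.differentiableAt.hasDerivAt.congr_deriv ?_
  have hR : ∀ᶠ w : ℂ in 𝓝 z, R0 < ‖w‖ := continuousAt_const.eventually_lt continuous_norm.continuousAt hz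
  have hev : ∀ᶠ w in 𝓝[≠] z, deriv (preS q) w = preS q w ^ 2 / 2 + 2 * A w := by
    have hF2 : ∀ᶠ w in 𝓝[≠] z, ∀ᶠ y in 𝓝 w, F y = 1 / q y := by
      rw [eventually_nhdsWithin_iff] at hF ⊢
      filter_upwards [hF.eventually_nhds] with w h1 h2
      filter_upwards [h1, isOpen_ne.mem_nhds h2] with y h3 h4
      exact h3 h4
    have hq0 : ∀ᶠ w in 𝓝[≠] z, q w ≠ q z := hq.hasStrictDerivAt.hasDerivAt.eventually_ne hqd
    have hqz : q z = 0 := by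
      by_contra h0
      have ht := hS.nice.mero.2.2 z hp
      have hc : Tendsto (fun w => ‖1 / q w‖) (𝓝[≠] z) (𝓝 ‖1 / q z‖) :=
        ((continuousAt_const.div hq.continuousAt h0).norm).tendsto.mono_left nhdsWithin_le_nhds
      have h1 : 𝓝[≠] z ≤ 𝓝[Pᶜ] z := by
        rw [nhdsWithin, nhdsWithin]
        refine le_inf inf_le_left ?_
        rw [le_principal_iff]
        exact hS.nice.mero.isolated z
      have h2 : Tendsto (fun w => ‖F w‖) (𝓝[≠] z) atTop := ht.mono_left h1
      have h3 := hc.congr' (hF.mono fun w hw => by rw [← hw])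
      exact not_tendsto_nhds_of_tendsto_atTop h2 _ h3
    filter_upwards [hF2, hq0, hR.filter_mono nhdsWithin_le_nhds, hS.nice.mero.isolated z] with w h1 h2 h3 h4
    rw [hqz] at h2
    have hFw : F w = 1 / q w := h1.self_of_nhds
    have hsa := SA_mob (h := q) (α := 0) (β := 1) (γ := 1) (δ := 0) (hS.SA_fin h3 h4) (by norm_num)
      (by rw [hFw]; simpa using h2) (by
        filter_upwards [h1] with y hy
        rw [hy]; simp)
    exact hsa.1.pre.deriv
  have hc1 : ContinuousAt (deriv (preS q)) z := hpa.deriv.continuousAt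
  have hc2 : ContinuousAt (fun w => preS q w ^ 2 / 2 + 2 * A w) z :=
    ((hpa.continuousAt.pow 2).div_const 2).add (continuousAt_const.mul (hS.Aan z hz).continuousAt)
  exact tendsto_nhds_unique_of_eventuallyEq (hc1.tendsto.mono_left nhdsWithin_le_nhds)
    (hc2.tendsto.mono_left nhdsWithin_le_nhds) hev

theorem Setup.SA_mobF (hS : Setup F A P Sing M R0) {α β γ δ z : ℂ} (hdet : α * δ - β * γ ≠ 0)
    (hz : R0 < ‖z‖) (hp : z ∉ mobP γ δ F P) : SA (mobF α β γ δ F P) A z := by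
  by_cases hzP : z ∈ P
  · obtain ⟨q, hq0, hqd, hqF, h⟩ := locRep_pole hS.nice hdet hzP
    obtain ⟨h1, h2⟩ := h.ev_not hp
    exact (SA_mob (hS.SA_pole hz hzP h.an hqd hqF) h.det h1.self_of_nhds.1 h2).1
  · have h := locRep_fin hS.nice hdet hzP
    obtain ⟨h1, h2⟩ := h.ev_not hp
    exact (SA_mob (hS.SA_fin hz hzP) h.det h1.self_of_nhds.1 h2).1

theorem Setup.jet (hS : Setup F A P Sing M R0) {z d1 d2 : ℂ} (hz : R0 < ‖z‖) (hd1 : d1 ≠ 0) :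
    ∃ α β γ δ : ℂ, α * δ - β * γ ≠ 0 ∧ z ∉ mobP γ δ F P ∧ mobF α β γ δ F P z = 1 ∧
      deriv (mobF α β γ δ F P) z = d1 ∧ preS (mobF α β γ δ F P) z = d2 := by
  have key : ∀ {φ : ℂ → ℂ}, SA φ A z → ∃ a b c d : ℂ, a * d - b * c ≠ 0 ∧ c * φ z + d = 1 ∧ a * φ z + b = 1 ∧
      (a * d - b * c) * deriv φ z = d1 ∧ preS φ z - 2 * c * deriv φ z = d2 := by
    intro φ hφ
    have hne := hφ.ne
    set c := (preS φ z - d2) / (2 * deriv φ z) with hc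
    set a := c + d1 / deriv φ z with ha
    have e : a * (1 - c * φ z) - (1 - a * φ z) * c = d1 / deriv φ z := by rw [ha]; ring
    refine ⟨a, 1 - a * φ z, c, 1 - c * φ z, ?_, by ring, by ring, ?_, ?_⟩
    · rw [e]; exact div_ne_zero hd1 hne
    · rw [e]; field_simp
    · rw [hc]; field_simp; ring
  by_cases hzP : z ∈ P
  · obtain ⟨q, hqa, hq0, hqd, hqF⟩ := hS.nice.simple z hzP
    obtain ⟨a, b, c, d, hdet, e1, e2, e3, e4⟩ := key (hS.SA_pole hz hzP hqa hqd hqF)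
    have hdet' : b * c - a * d ≠ 0 := fun h => hdet (by linear_combination -h)
    obtain ⟨q', hq0', hqd', hqF', h⟩ := locRep_pole hS.nice hdet' hzP
    have hqq : q' =ᶠ[𝓝 z] q := by
      filter_upwards [eventually_nhdsWithin_iff.1 hqF, eventually_nhdsWithin_iff.1 hqF'] with w h1 h2
      by_cases hw : w = z
      · rw [hw, hq0, hq0']
      · have h3 := h1 hw
        rw [h2 hw] at h3
        simpa using h3
    have hp : z ∉ mobP d c F P := by
      intro hcon
      have := h.memP.self_of_nhds.1 hcon
      rw [hqq.eq_of_nhds, e1] at this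
      exact one_ne_zero this
    obtain ⟨h1, h2⟩ := h.ev_not hp
    have h2' : mobF b a d c F P =ᶠ[𝓝 z] fun w => (a * q w + b) / (c * q w + d) := by
      filter_upwards [h2, hqq] with w h3 h4
      rw [h3, h4]
    have h3 := SA_mob (hS.SA_pole hz hzP hqa hqd hqF) hdet (by rw [e1]; exact one_ne_zero) h2'
    refine ⟨b, a, d, c, hdet', hp, ?_, ?_, ?_⟩
    · rw [h2'.eq_of_nhds, e1, e2]; simp
    · rw [h3.2.1, e1, e3]; simp
    · rw [h3.2.2, e1, ← e4]; simp
  · obtain ⟨a, b, c, d, hdet, e1, e2, e3, e4⟩ := key (hS.SA_fin hz hzP)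
    have h := locRep_fin hS.nice hdet hzP
    have hp : z ∉ mobP c d F P := by
      rintro (h | h)
      · exact hzP h.1
      · rw [e1] at h; exact one_ne_zero h.2
    obtain ⟨h1, h2⟩ := h.ev_not hp
    have h3 := SA_mob (hS.SA_fin hz hzP) h.det h1.self_of_nhds.1 h2
    refine ⟨a, b, c, d, hdet, hp, ?_, ?_, ?_⟩
    · rw [h2.self_of_nhds, e1, e2]; simp
    · rw [h3.2.1, e1, e3]; simp
    · rw [h3.2.2, e1, ← e4]; simp
end
end

section
theorem riccati_ray {hh hh1 p η : ℂ → ℂ} {Bad : Set ℂ} {κ ε0 : ℝ} (hκ : 0 < κ)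
    (hcl : IsClosed Bad) (hε0 : 0 ≤ ε0) (hε : ε0 * Real.exp (3*κ) ≤ 1/2)
    (hd : ∀ w, ‖w‖ < κ → w ∉ Bad → HasDerivAt hh (hh1 w) w ∧ HasDerivAt hh1 (p w * hh1 w) w ∧
      HasDerivAt p (p w ^ 2 / 2 + 2 + η w) w)
    (hη : ∀ w, ‖w‖ < κ → ‖η w‖ ≤ ε0)
    (hbad : ∀ w ∈ Bad, Tendsto (fun z => ‖hh z‖) (𝓝[Badᶜ] w) atTop)
    (h0 : (0:ℂ) ∉ Bad) (i1 : hh1 0 = 2 * Complex.I) (i2 : p 0 = 2 * Complex.I) :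
    ∀ w, ‖w‖ < κ → w ∉ Bad ∧ ‖p w - 2 * Complex.I‖ ≤ ε0 * Real.exp (3*κ) ∧ ‖hh1 w‖ ≤ 2 * Real.exp (3*κ) := by
  intro ζ hζ
  have hn : ∀ t : ℝ, 0 ≤ t → t ≤ 1 → ‖(t:ℂ) * ζ‖ < κ := by
    intro t ht0 ht1
    rw [norm_mul, Complex.norm_real, Real.norm_of_nonneg ht0]
    nlinarith [norm_nonneg ζ]
  have hpath : ∀ t : ℝ, HasDerivAt (fun t : ℝ => (t:ℂ) * ζ) ζ t := fun t => by
    simpa using (Complex.ofRealCLM.hasDerivAt (x := t)).mul_const ζ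
  have hpc : Continuous (fun t : ℝ => (t:ℂ) * ζ) := by fun_prop
  -- bounds on an initial good segment
  have hb : ∀ T : ℝ, 0 ≤ T → T ≤ 1 → (∀ t, 0 ≤ t → t ≤ T → (t:ℂ) * ζ ∉ Bad ∧ ‖p (t * ζ) - 2 * Complex.I‖ < 1) →
      ∀ t, 0 ≤ t → t ≤ T → ‖p (t * ζ) - 2 * Complex.I‖ ≤ ε0 * Real.exp (3*κ) ∧ ‖hh1 (t*ζ)‖ ≤ 2 * Real.exp (3*κ) := by
    intro T hT0 hT1 hg t ht0 htT
    have hcomp : ∀ {f : ℂ → ℂ} {f' : ℂ} {t : ℝ}, HasDerivAt f f' (t * ζ) → HasDerivAt (fun t : ℝ => f (t*ζ)) (f' * ζ) t :=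
      fun {f f' t} h => h.comp t (hpath t)
    have hx : 3 * κ * (t - 0) ≤ 3 * κ := by nlinarith
    constructor
    · have := norm_le_gronwallBound_of_norm_deriv_right_le (f := fun t : ℝ => p (t*ζ) - 2 * Complex.I)
        (f' := fun t : ℝ => (p (t*ζ) ^ 2 / 2 + 2 + η (t*ζ)) * ζ) (δ := 0) (K := 3*κ) (ε := κ * ε0) (a := 0) (b := T)
        (fun x hx => ((hcomp (hd _ (hn x hx.1 (hx.2.trans hT1)) (hg x hx.1 hx.2).1).2.2).continuousAt.sub continuousAt_const).continuousWithinAt)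
        (fun x hx => ((hcomp (hd _ (hn x hx.1 (hx.2.le.trans hT1)) (hg x hx.1 hx.2.le).1).2.2).sub_const _).hasDerivWithinAt)
        (by simp [i2]) (fun x hx => ?_) t ⟨ht0, htT⟩
      · refine this.trans ?_
        rw [gronwallBound_of_K_ne_0 (by positivity)]
        simp only [zero_mul, zero_add]
        have e1 : κ * ε0 / (3*κ) = ε0 / 3 := by field_simp
        rw [e1]
        have e2 : Real.exp (3 * κ * (t-0)) ≤ Real.exp (3*κ) := Real.exp_le_exp.2 hx
        nlinarith [Real.exp_pos (3*κ)]
      · set e := p (x*ζ) - 2 * Complex.I with he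
        have e1 : p (x*ζ) ^ 2 / 2 + 2 + η (x*ζ) = e * (e + 4 * Complex.I) / 2 + η (x*ζ) := by
          rw [he]; ring_nf; rw [Complex.I_sq]; ring
        have hlt := (hg x hx.1 hx.2.le).2
        rw [← he] at hlt
        have h4 : ‖e + 4 * Complex.I‖ ≤ 6 := by
          refine (norm_add_le _ _).trans ?_
          simp; linarith
        rw [e1, norm_mul]
        have h5 : ‖e * (e + 4 * Complex.I) / 2 + η (x*ζ)‖ ≤ 3 * ‖e‖ + ε0 := by
          refine (norm_add_le _ _).trans (add_le_add ?_ (hη _ (hn x hx.1 (hx.2.le.trans hT1))))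
          rw [norm_div, norm_mul]; simp
          nlinarith [norm_nonneg e]
        calc _ ≤ (3 * ‖e‖ + ε0) * κ := mul_le_mul h5 hζ.le (norm_nonneg _) (by positivity)
          _ = _ := by ring
    · have := norm_le_gronwallBound_of_norm_deriv_right_le (f := fun t : ℝ => hh1 (t*ζ))
        (f' := fun t : ℝ => (p (t*ζ) * hh1 (t*ζ)) * ζ) (δ := 2) (K := 3*κ) (ε := 0) (a := 0) (b := T)
        (fun x hx => (hcomp (hd _ (hn x hx.1 (hx.2.trans hT1)) (hg x hx.1 hx.2).1).2.1).continuousAt.continuousWithinAt)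
        (fun x hx => (hcomp (hd _ (hn x hx.1 (hx.2.le.trans hT1)) (hg x hx.1 hx.2.le).1).2.1).hasDerivWithinAt)
        (by simp [i1]) (fun x hx => ?_) t ⟨ht0, htT⟩
      · refine this.trans ?_
        rw [gronwallBound_ε0]
        gcongr
      · have hlt := (hg x hx.1 hx.2.le).2
        have h4 : ‖p (x*ζ)‖ ≤ 3 := by
          have : p (x*ζ) = (p (x*ζ) - 2 * Complex.I) + 2 * Complex.I := by ring
          rw [this]
          refine (norm_add_le _ _).trans ?_
          simp; linarith
        rw [norm_mul, norm_mul]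
        calc _ ≤ (3 * ‖hh1 (x*ζ)‖) * κ := by gcongr
          _ = _ := by ring
  have hgood : ∀ t ∈ Icc (0:ℝ) 1, (t:ℂ) * ζ ∉ Bad ∧ ‖p (t * ζ) - 2 * Complex.I‖ < 1 := by
    apply cont_ind
    · simp [h0, i2]
    · intro t ht hq
      have h1 : ∀ᶠ t' : ℝ in 𝓝 t, (t':ℂ) * ζ ∉ Bad :=
        hpc.continuousAt.eventually (hcl.isOpen_compl.mem_nhds hq.1)
      have h2 : ContinuousAt (fun t : ℝ => ‖p (t * ζ) - 2 * Complex.I‖) t := by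
        have := (hd _ (hn t ht.1 ht.2) hq.1).2.2.continuousAt
        have h3 : ContinuousAt (fun t : ℝ => p (t*ζ)) t :=
          ContinuousAt.comp (f := fun t : ℝ => (t:ℂ)*ζ) (g := p) this hpc.continuousAt
        exact (h3.sub continuousAt_const).norm
      exact h1.and (h2.eventually_lt continuousAt_const hq.2)
    · intro t ht hq
      have hbt : ∀ t', 0 ≤ t' → t' < t → ‖p (t' * ζ) - 2 * Complex.I‖ ≤ ε0 * Real.exp (3*κ) ∧ ‖hh1 (t'*ζ)‖ ≤ 2 * Real.exp (3*κ) :=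
        fun t' h1 h2 => hb t' h1 (h2.le.trans ht.2) (fun t'' h3 h4 => hq t'' h3 (lt_of_le_of_lt h4 h2)) t' h1 le_rfl
      have hhb : ∀ t', 0 ≤ t' → t' < t → ‖hh (t' * ζ) - hh 0‖ ≤ 2 * Real.exp (3*κ) * κ := by
        intro t' h1 h2
        have := norm_image_sub_le_of_norm_deriv_le_segment' (f := fun t : ℝ => hh (t*ζ)) (f' := fun t : ℝ => hh1 (t*ζ) * ζ)
          (a := 0) (b := t') (C := 2 * Real.exp (3*κ) * κ) (fun x hx => by
            have h3 := (hd _ (hn x hx.1 (hx.2.trans (h2.le.trans ht.2))) (hq x hx.1 (lt_of_le_of_lt hx.2 h2)).1).1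
            exact (h3.comp x (hpath x)).hasDerivWithinAt) (fun x hx => by
            rw [norm_mul]
            exact mul_le_mul (hbt x hx.1 (hx.2.trans h2)).2 hζ.le (norm_nonneg _) (by positivity)) t' ⟨h1, le_rfl⟩
        simp only [Complex.ofReal_zero, zero_mul, sub_zero] at this
        refine this.trans ?_
        have : 0 ≤ 2 * Real.exp (3*κ) * κ := by positivity
        nlinarith [ht.2]
      have hne : (𝓝[<] t).NeBot := inferInstance
      have hev : ∀ᶠ t' in 𝓝[<] t, 0 ≤ t' ∧ t' < t := by
        have : Ioo 0 t ∈ 𝓝[<] t := Ioo_mem_nhdsLT ht.1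
        filter_upwards [this] with t' h using ⟨h.1.le, h.2⟩
      have hT : Tendsto (fun t' : ℝ => (t':ℂ) * ζ) (𝓝[<] t) (𝓝 (t * ζ)) :=
        hpc.continuousAt.tendsto.mono_left nhdsWithin_le_nhds
      have hnb : (t:ℂ) * ζ ∉ Bad := by
        intro hbd
        have h1 := hbad _ hbd
        have h2 : Tendsto (fun t' : ℝ => (t':ℂ) * ζ) (𝓝[<] t) (𝓝[Badᶜ] (t * ζ)) :=
          tendsto_nhdsWithin_iff.2 ⟨hT, hev.mono fun t' h => (hq t' h.1 h.2).1⟩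
        have h3 := (h1.comp h2).eventually_gt_atTop (‖hh 0‖ + 2 * Real.exp (3*κ) * κ)
        obtain ⟨t', h4, h5⟩ := (h3.and hev).exists
        have h6 := hhb t' h5.1 h5.2
        have h7 := norm_le_norm_add_norm_sub (hh 0) (hh (t' * ζ))
        simp only [Function.comp] at h4
        rw [norm_sub_rev] at h7
        linarith
      refine ⟨hnb, ?_⟩
      have h3 : ContinuousAt p (t*ζ) := (hd _ (hn t ht.1.le ht.2) hnb).2.2.continuousAt
      have h4 : Tendsto (fun t' : ℝ => ‖p (t' * ζ) - 2 * Complex.I‖) (𝓝[<] t) (𝓝 ‖p (t * ζ) - 2 * Complex.I‖) :=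
        ((h3.tendsto.comp hT).sub tendsto_const_nhds).norm
      have h5 := le_of_tendsto h4 (hev.mono fun t' h => (hbt t' h.1 h.2).1)
      linarith
  have h1 := hgood 1 ⟨zero_le_one, le_rfl⟩
  have h2 := hb 1 zero_le_one le_rfl (fun t h1 h2 => hgood t ⟨h1, h2⟩) 1 zero_le_one le_rfl
  simp only [Complex.ofReal_one, one_mul] at h1 h2
  exact ⟨h1.1, h2⟩

/-- hh close to exp(2iw) -/
theorem near_exp {hh hh1 p : ℂ → ℂ} {κ ε0 ε1 : ℝ} (hκ : 0 < κ) (hε0 : 0 ≤ ε0)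
    (hsm : 8 * (1 + κ)^2 * Real.exp (10*κ) * ε0 ≤ ε1) (hε1 : ε1 ≤ 1)
    (hd : ∀ w, ‖w‖ < κ → HasDerivAt hh (hh1 w) w ∧ HasDerivAt hh1 (p w * hh1 w) w)
    (hb : ∀ w, ‖w‖ < κ → ‖p w - 2 * Complex.I‖ ≤ ε0 * Real.exp (3*κ) ∧ ‖hh1 w‖ ≤ 2 * Real.exp (3*κ))
    (i0 : hh 0 = 1) (i1 : hh1 0 = 2 * Complex.I) :
    ∀ w, ‖w‖ < κ → ‖hh w * Complex.exp (-(2 * Complex.I * w)) - 1‖ ≤ 1/2 ∧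
      ‖hh1 w / hh w - 2 * Complex.I‖ ≤ ε1 := by
  have hconv := convex_ball (0:ℂ) κ
  have h0 : (0:ℂ) ∈ Metric.ball (0:ℂ) κ := Metric.mem_ball_self hκ
  set Y : ℂ → ℂ := fun w => hh1 w - 2 * Complex.I * hh w with hY
  set δ := 2 * κ * Real.exp (6*κ) * ε0 with hδ
  have hδ0 : 0 ≤ δ := by positivity
  have hYd : ∀ w, ‖w‖ < κ → HasDerivAt Y ((p w - 2 * Complex.I) * hh1 w) w := by
    intro w hw
    refine ((hd w hw).2.sub ((hd w hw).1.const_mul (2 * Complex.I))).congr_deriv ?_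
    ring
  have hYb : ∀ w, ‖w‖ < κ → ‖Y w‖ ≤ δ := by
    intro w hw
    have := hconv.norm_image_sub_le_of_norm_hasDerivWithin_le (𝕜 := ℂ) (f := Y) (f' := fun w => (p w - 2 * Complex.I) * hh1 w)
      (C := 2 * ε0 * Real.exp (6*κ)) (fun x hx => (hYd x (by simpa using hx)).hasDerivWithinAt) (fun x hx => by
        have h1 := hb x (by simpa using hx)
        rw [norm_mul]
        calc _ ≤ (ε0 * Real.exp (3*κ)) * (2 * Real.exp (3*κ)) := mul_le_mul h1.1 h1.2 (norm_nonneg _) (by positivity)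
          _ = 2 * ε0 * (Real.exp (3*κ) * Real.exp (3*κ)) := by ring
          _ = _ := by rw [← Real.exp_add]; ring_nf) h0 (by simpa using hw : w ∈ Metric.ball (0:ℂ) κ)
    have hY0 : Y 0 = 0 := by simp [hY, i0, i1]
    rw [hY0, sub_zero, sub_zero] at this
    refine this.trans ?_
    calc _ ≤ 2 * ε0 * Real.exp (6*κ) * κ := by gcongr
      _ = δ := by rw [hδ]; ring
  have hen : ∀ w : ℂ, ‖w‖ < κ → ‖Complex.exp (-(2 * Complex.I * w))‖ ≤ Real.exp (2*κ) := by
    intro w hw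
    rw [Complex.norm_exp]
    apply Real.exp_le_exp.2
    have : (-(2 * Complex.I * w)).re ≤ ‖-(2 * Complex.I * w)‖ := Complex.re_le_norm _
    refine this.trans ?_
    simp; linarith
  have hgd : ∀ w, ‖w‖ < κ → HasDerivAt (fun w => hh w * Complex.exp (-(2 * Complex.I * w))) (Y w * Complex.exp (-(2 * Complex.I * w))) w := by
    intro w hw
    have h1 : HasDerivAt (fun w : ℂ => Complex.exp (-(2 * Complex.I * w))) (Complex.exp (-(2 * Complex.I * w)) * (-(2 * Complex.I * 1))) w :=
      (((hasDerivAt_id w).const_mul (2 * Complex.I)).neg).cexp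
    refine ((hd w hw).1.mul h1).congr_deriv ?_
    simp only [hY]; ring
  have hexp8 : δ * Real.exp (2*κ) * 4 * (1+κ) ≤ ε1 := by
    refine le_trans ?_ hsm
    rw [hδ]
    have e1 : 2 * κ * Real.exp (6*κ) * ε0 * Real.exp (2*κ) * 4 * (1+κ) = 8 * (κ * (1+κ)) * (Real.exp (6*κ) * Real.exp (2*κ)) * ε0 := by ring
    rw [e1, ← Real.exp_add]
    gcongr
    · nlinarith
    · linarith
  intro w hw
  have hg : ‖hh w * Complex.exp (-(2 * Complex.I * w)) - 1‖ ≤ 1/2 := by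
    have := hconv.norm_image_sub_le_of_norm_hasDerivWithin_le (𝕜 := ℂ) (f := fun w => hh w * Complex.exp (-(2 * Complex.I * w)))
      (C := δ * Real.exp (2*κ)) (fun x hx => (hgd x (by simpa using hx)).hasDerivWithinAt) (fun x hx => by
        have hx' : ‖x‖ < κ := by simpa using hx
        rw [norm_mul]
        exact mul_le_mul (hYb x hx') (hen x hx') (norm_nonneg _) hδ0) h0 (by simpa using hw : w ∈ Metric.ball (0:ℂ) κ)
    simp only [i0, mul_zero, neg_zero, Complex.exp_zero, mul_one, sub_zero] at this
    refine this.trans ?_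
    have h2 : 0 ≤ δ * Real.exp (2*κ) := by positivity
    have : δ * Real.exp (2*κ) * ‖w‖ ≤ δ * Real.exp (2*κ) * κ := by gcongr
    nlinarith
  refine ⟨hg, ?_⟩
  have hlow : 1/2 ≤ ‖hh w‖ * Real.exp (2*κ) := by
    have h1 : 1 - ‖hh w * Complex.exp (-(2 * Complex.I * w)) - 1‖ ≤ ‖hh w * Complex.exp (-(2 * Complex.I * w))‖ := by
      have := norm_sub_norm_le (1:ℂ) (1 - hh w * Complex.exp (-(2 * Complex.I * w)))
      rw [norm_sub_rev (1:ℂ) (hh w * _), norm_one] at this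
      simpa using this
    rw [norm_mul] at h1
    have h2 := mul_le_mul_of_nonneg_left (hen w hw) (norm_nonneg (hh w))
    linarith
  have hpos : 0 < ‖hh w‖ := by
    by_contra h
    have : ‖hh w‖ = 0 := le_antisymm (not_lt.1 h) (norm_nonneg _)
    rw [this] at hlow; norm_num at hlow
  have hne : hh w ≠ 0 := norm_pos_iff.1 hpos
  have e : hh1 w / hh w - 2 * Complex.I = Y w / hh w := by simp only [hY]; field_simp
  rw [e, norm_div, div_le_iff₀ hpos]
  refine (hYb w hw).trans ?_
  have h2 : 0 ≤ δ * Real.exp (2*κ) := by positivity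
  have h3 : δ * Real.exp (2*κ) * 4 ≤ ε1 := by nlinarith
  have h4 : δ * (1/2) ≤ δ * (‖hh w‖ * Real.exp (2*κ)) := mul_le_mul_of_nonneg_left hlow hδ0
  have h5 : (δ * Real.exp (2*κ) * 4) * ‖hh w‖ ≤ ε1 * ‖hh w‖ := by gcongr
  have h6 : 0 ≤ δ * Real.exp (2*κ) * ‖hh w‖ := by positivity
  nlinarith
end

section
def ee (l : ℝ) (s : ℂ) : ℂ := (Real.sqrt l : ℂ) * Complex.exp (s / 2)

theorem ee_ne {l : ℝ} (hl : 0 < l) (s : ℂ) : ee l s ≠ 0 :=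
  mul_ne_zero (by exact_mod_cast (Real.sqrt_pos.2 hl).ne') (Complex.exp_ne_zero _)

theorem ee_sq {l : ℝ} (hl : 0 < l) (s : ℂ) : ee l s ^ 2 = l * Complex.exp s := by
  rw [ee, mul_pow, ← Complex.exp_nat_mul, ← Complex.ofReal_pow, Real.sq_sqrt hl.le]
  congr 2; push_cast; ring

theorem ee_norm {l : ℝ} (s : ℂ) : ‖ee l s‖ = Real.sqrt l * Real.exp (s.re / 2) := by
  rw [ee, norm_mul, Complex.norm_exp, Complex.norm_real, Real.norm_of_nonneg (Real.sqrt_nonneg _)]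
  congr 2
  have : s / 2 = s / ((2:ℝ):ℂ) := by push_cast; rfl
  rw [this, Complex.div_ofReal_re]

theorem zz_hasDerivAt (z0 : ℂ) (N : ℝ) (s : ℂ) : HasDerivAt (zz z0 N) (zz z0 N s / N) s := by
  have h := (((hasDerivAt_id s).div_const (N:ℂ)).cexp).const_mul z0
  refine HasDerivAt.congr_deriv (f := zz z0 N) h ?_
  simp [zz]; ring

structure BoxData (A : ℂ → ℂ) (R0 L ε : ℝ) (z0 : ℂ) (N l : ℝ) : Prop where
  z0ne : z0 ≠ 0
  Npos : 0 < N
  lpos : 0 < l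
  big : ∀ s : ℂ, ‖s‖ ≤ L → R0 < ‖zz z0 N s‖
  app : ∀ s : ℂ, ‖s‖ ≤ L →
    ‖(zz z0 N s)^2 * A (zz z0 N s) / (N:ℂ)^2 - l * Complex.exp s‖ ≤ ε * l * Real.exp s.re

section
variable {F A : ℂ → ℂ} {P Sing : Set ℂ} {M : ℕ} {R0 : ℝ}

theorem eta_bound {L ε : ℝ} {z0 : ℂ} {N l κ d : ℝ} {s1 : ℂ} (hB : BoxData A R0 L ε z0 N l)
    (hs1 : ‖s1‖ ≤ L - 1) (hN : 1 ≤ N) (hε : ε ≤ d) (hd1 : d ≤ 1) (h1 : κ ≤ d * ‖ee l s1‖)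
    (h2 : 1 ≤ d * ‖ee l s1‖) {w : ℂ} (hw : ‖w‖ < κ) :
    ‖s1 + w / ee l s1‖ ≤ L ∧ ‖2 * A (zz z0 N (s1 + w / ee l s1)) * ((1 / (N * ee l s1)) * zz z0 N (s1 + w / ee l s1))^2
      - (1 / (N * ee l s1))^2 / 2 - 2‖ ≤ 12 * d := by
  have hene := ee_ne hB.lpos s1
  have hep : 0 < ‖ee l s1‖ := norm_pos_iff.2 hene
  have hd0 : 0 < d := by
    by_contra h
    nlinarith
  set t := w / ee l s1 with ht
  have htn : ‖t‖ ≤ d := by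
    rw [ht, norm_div, div_le_iff₀ hep]; linarith
  have hsL : ‖s1 + t‖ ≤ L := (norm_add_le _ _).trans (by linarith)
  refine ⟨hsL, ?_⟩
  have happ := hB.app _ hsL
  set s := s1 + t with hs
  set z := zz z0 N s with hz
  have hNc : (N:ℂ) ≠ 0 := by exact_mod_cast hB.Npos.ne'
  have hl0 : 0 < l := hB.lpos
  have hlc : (l:ℂ) ≠ 0 := by exact_mod_cast hl0.ne'
  have e1 : A z * (1 / (N * ee l s1) * z)^2 - Complex.exp t = (z^2 * A z / (N:ℂ)^2 - l * Complex.exp s) / (l * Complex.exp s1) := by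
    have : (1 / (N * ee l s1) * z)^2 = z^2 / ((N:ℂ)^2 * (l * Complex.exp s1)) := by
      rw [← ee_sq hl0]; field_simp
    rw [this, hs, Complex.exp_add]
    field_simp [Complex.exp_ne_zero]
  have e2 : ‖A z * (1 / (N * ee l s1) * z)^2 - Complex.exp t‖ ≤ ε * Real.exp t.re := by
    rw [e1, norm_div, norm_mul, Complex.norm_exp, Complex.norm_real, Real.norm_of_nonneg hl0.le, div_le_iff₀ (by positivity)]
    refine happ.trans (le_of_eq ?_)
    rw [hs, Complex.add_re, Real.exp_add]; ring
  have e3 : ‖Complex.exp t - 1‖ ≤ 2 * ‖t‖ := Complex.norm_exp_sub_one_le (by linarith)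
  have e4 : Real.exp t.re ≤ 3 := by
    rw [← Complex.norm_exp]
    have : Complex.exp t = (Complex.exp t - 1) + 1 := by ring
    rw [this]
    refine (norm_add_le _ _).trans ?_
    rw [norm_one]; linarith
  have e5 : ‖1 / ((N:ℂ) * ee l s1)‖ ≤ d := by
    rw [norm_div, norm_one, norm_mul, Complex.norm_real, Real.norm_of_nonneg hB.Npos.le, div_le_iff₀ (by positivity)]
    have : d * ‖ee l s1‖ ≤ d * (N * ‖ee l s1‖) := by
      apply mul_le_mul_of_nonneg_left _ hd0.le
      nlinarith
    linarith
  have e6 : 2 * A z * (1 / (N * ee l s1) * z)^2 - (1 / (N * ee l s1))^2 / 2 - 2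
      = 2 * (A z * (1 / (N * ee l s1) * z)^2 - Complex.exp t) + 2 * (Complex.exp t - 1) - (1 / (N * ee l s1))^2 / 2 := by ring
  rw [e6]
  refine (norm_sub_le _ _).trans ?_
  have e7 : ‖(1 / ((N:ℂ) * ee l s1))^2 / 2‖ ≤ d := by
    rw [norm_div, norm_pow]; simp only [Complex.norm_ofNat]
    nlinarith [norm_nonneg (1 / ((N:ℂ) * ee l s1))]
  have e8 := norm_add_le (2 * (A z * (1 / (N * ee l s1) * z)^2 - Complex.exp t)) (2 * (Complex.exp t - 1))
  rw [norm_mul, norm_mul, Complex.norm_ofNat] at e8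
  have e9 : ε * Real.exp t.re ≤ d * 3 := mul_le_mul hε e4 (Real.exp_pos _).le hd0.le
  linarith

theorem LC1 (hS : Setup F A P Sing M R0) {L ε : ℝ} {z0 : ℂ} {N l κ d ε1 : ℝ} {s1 : ℂ} (hB : BoxData A R0 L ε z0 N l)
    (hs1 : ‖s1‖ ≤ L - 1) (hN : 1 ≤ N) (hε : ε ≤ d) (hd1 : d ≤ 1) (hκ : 0 < κ) (h1 : κ ≤ d * ‖ee l s1‖)
    (h2 : 1 ≤ d * ‖ee l s1‖) (h3 : 8 * (1 + κ)^2 * Real.exp (10*κ) * (12 * d) ≤ ε1) (hε1 : ε1 ≤ 1) :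
    ∃ α β γ δ : ℂ, α * δ - β * γ ≠ 0 ∧ ∀ w : ℂ, ‖w‖ < κ → zz z0 N (s1 + w / ee l s1) ∉ mobP γ δ F P ∧
      deriv (mobF α β γ δ F P) (zz z0 N (s1 + w / ee l s1)) ≠ 0 ∧
      ∃ D, HasDerivAt (fun w => mobF α β γ δ F P (zz z0 N (s1 + w / ee l s1))) (D * mobF α β γ δ F P (zz z0 N (s1 + w / ee l s1))) w ∧
        ‖D - 2 * Complex.I‖ ≤ ε1 ∧
        ‖mobF α β γ δ F P (zz z0 N (s1 + w / ee l s1)) * Complex.exp (-(2 * Complex.I * w)) - 1‖ ≤ 1/2 := by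
  have hene := ee_ne hB.lpos s1
  have hep : 0 < ‖ee l s1‖ := norm_pos_iff.2 hene
  have hd0 : 0 < d := by
    by_contra h
    nlinarith
  have hNc : (N:ℂ) ≠ 0 := by exact_mod_cast hB.Npos.ne'
  set c : ℂ := 1 / (N * ee l s1) with hc
  have hc0 : c ≠ 0 := by rw [hc]; exact one_div_ne_zero (mul_ne_zero hNc hene)
  set σ : ℂ → ℂ := fun w => zz z0 N (s1 + w / ee l s1) with hσ
  have hσd : ∀ w, HasDerivAt σ (c * σ w) w := by
    intro w
    have := (zz_hasDerivAt z0 N (s1 + w / ee l s1)).comp w (((hasDerivAt_id w).div_const (ee l s1)).const_add s1)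
    refine HasDerivAt.congr_deriv (f := σ) this ?_
    simp only [hσ, hc]; field_simp
  have hσ0 : ∀ w, σ w ≠ 0 := fun w => mul_ne_zero hB.z0ne (Complex.exp_ne_zero _)
  have hσc : Continuous σ := continuous_iff_continuousAt.2 fun w => (hσd w).continuousAt
  have hbig : ∀ w, ‖w‖ < κ → R0 < ‖σ w‖ := fun w hw => hB.big _ (eta_bound hB hs1 hN hε hd1 h1 h2 hw).1
  obtain ⟨α, β, γ, δ, hdet, hp0, i0, i1, i2⟩ := hS.jet (z := σ 0) (d1 := 2 * Complex.I / (c * σ 0)) (d2 := (2 * Complex.I - c) / (c * σ 0))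
    (hbig 0 (by simpa using hκ)) (by simp [hc0, hσ0])
  refine ⟨α, β, γ, δ, hdet, ?_⟩
  set h := mobF α β γ δ F P with hh
  set Ph := mobP γ δ F P with hPh
  have hm : MeroPlane h Ph := mob_mero hS.nice hdet
  set g : ℂ → ℂ := fun w => h (σ w) with hg
  set g1 : ℂ → ℂ := fun w => deriv h (σ w) * (c * σ w) with hg1
  set p : ℂ → ℂ := fun w => preS h (σ w) * (c * σ w) + c with hp
  set η : ℂ → ℂ := fun w => 2 * A (σ w) * (c * σ w)^2 - c^2/2 - 2 with hη
  have hder : ∀ w, ‖w‖ < κ → w ∉ σ ⁻¹' Ph → HasDerivAt g (g1 w) w ∧ HasDerivAt g1 (p w * g1 w) w ∧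
      HasDerivAt p (p w ^ 2 / 2 + 2 + η w) w := by
    intro w hw hwP
    have hsa := hS.SA_mobF hdet (hbig w hw) hwP
    refine ⟨?_, ?_, ?_⟩
    · exact hsa.an.differentiableAt.hasDerivAt.comp w (hσd w)
    · have := (hsa.an.deriv.differentiableAt.hasDerivAt.comp w (hσd w)).mul ((hσd w).const_mul c)
      refine HasDerivAt.congr_deriv (f := g1) this ?_
      have e : deriv (deriv h) (σ w) = preS h (σ w) * deriv h (σ w) := by
        rw [preS]; exact (div_mul_cancel₀ _ hsa.ne).symm
      simp only [hp, hg1, Function.comp]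
      rw [e]; ring
    · have := ((hsa.pre.comp w (hσd w)).mul ((hσd w).const_mul c)).add_const c
      refine HasDerivAt.congr_deriv (f := p) this ?_
      simp only [hp, hη, Function.comp]
      ring
  have hR := riccati_ray (hh := g) (hh1 := g1) (p := p) (η := η) (Bad := σ ⁻¹' Ph) (κ := κ) (ε0 := 12 * d) hκ
    (hm.isClosed.preimage hσc) (by positivity) (by
      have e1 : Real.exp (3*κ) ≤ Real.exp (10*κ) := Real.exp_le_exp.2 (by linarith)
      have e2 : 1 ≤ (1+κ)^2 := by nlinarith
      have e3 : 12 * d * Real.exp (3*κ) ≤ (1+κ)^2 * (12 * d * Real.exp (10*κ)) := by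
        calc 12 * d * Real.exp (3*κ) ≤ 12 * d * Real.exp (10*κ) := by gcongr
          _ ≤ _ := le_mul_of_one_le_left (by positivity) e2
      nlinarith) hder
    (fun w hw => (eta_bound hB hs1 hN hε hd1 h1 h2 hw).2) (fun w hw => by
      have ht := hm.2.2 (σ w) hw
      refine ht.comp ?_
      refine tendsto_nhdsWithin_iff.2 ⟨hσc.continuousAt.tendsto.mono_left nhdsWithin_le_nhds, ?_⟩
      filter_upwards [self_mem_nhdsWithin] with y hy using hy) hp0
    (by simp only [hg1]; rw [i1]; field_simp [hσ0 0])
    (by simp only [hp]; rw [i2, div_mul_cancel₀ _ (mul_ne_zero hc0 (hσ0 0))]; ring)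
  have hE := near_exp (hh := g) (hh1 := g1) (p := p) (κ := κ) (ε0 := 12*d) (ε1 := ε1) hκ (by positivity) h3 hε1
    (fun w hw => ⟨(hder w hw (hR w hw).1).1, (hder w hw (hR w hw).1).2.1⟩) (fun w hw => (hR w hw).2) i0
    (by simp only [hg1]; rw [i1]; field_simp [hσ0 0])
  intro w hw
  have hne : g w ≠ 0 := by
    intro h0
    have := (hE w hw).1
    rw [h0] at this
    norm_num at this
  refine ⟨(hR w hw).1, (hS.SA_mobF hdet (hbig w hw) (hR w hw).1).ne, g1 w / g w, ?_, (hE w hw).2, (hE w hw).1⟩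
  have := (hder w hw (hR w hw).1).1
  refine this.congr_deriv ?_
  change _ = g1 w / g w * g w
  field_simp

theorem LC2 (hN : Nice F P Sing M) {α β γ δ : ℂ} (hdet : α * δ - β * γ ≠ 0) {σ : ℂ → ℂ} {κ ρ : ℝ} (hκ : 20 ≤ κ)
    (hρ : 2 * Real.exp (-2*(κ-17)) < ρ) (hσc : Continuous σ) (hinj : InjOn σ (Metric.ball 0 κ)) {sg : ℝ} (hsg : sg = 1 ∨ sg = -1)
    (hw : ∀ w : ℂ, ‖w‖ < κ → σ w ∉ mobP γ δ F P ∧ deriv (mobF α β γ δ F P) (σ w) ≠ 0 ∧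
      ∃ D, HasDerivAt (fun w => mobF α β γ δ F P (σ w)) (D * mobF α β γ δ F P (σ w)) w ∧
        ‖D - 2 * sg * Complex.I‖ ≤ 1/2 ∧ mobF α β γ δ F P (σ w) ≠ 0 ∧
        ‖mobF α β γ δ F P (σ w)‖ ≤ 2 * Real.exp (-2*sg*w.im)) :
    ∃ a ∈ Sing, ∃ v : ℂ, ‖v‖ < ρ ∧ v * (γ * a + δ) = α * a + β := by
  by_contra hcon
  push Not at hcon
  set h := mobF α β γ δ F P with hh
  set Ph := mobP γ δ F P with hPh
  have hm : MeroPlane h Ph := mob_mero hN hdet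
  set w0 : ℂ := sg * (κ - 9 : ℝ) * Complex.I with hw0
  have hsg2 : sg * sg = 1 := by rcases hsg with h | h <;> rw [h] <;> norm_num
  have hsga : |sg| = 1 := by rcases hsg with h | h <;> rw [h] <;> norm_num
  have hw0n : ‖w0‖ = κ - 9 := by
    rw [hw0, norm_mul, norm_mul, Complex.norm_real, Complex.norm_real, Complex.norm_I, Real.norm_eq_abs, Real.norm_eq_abs, hsga,
      abs_of_nonneg (by linarith)]; ring
  have hball : ∀ w ∈ Metric.ball w0 8, ‖w‖ < κ := by
    intro w hw
    rw [mem_ball_iff_norm] at hw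
    have := norm_le_norm_add_norm_sub w0 w
    rw [norm_sub_rev] at hw
    linarith
  have hsmall : ∀ w ∈ Metric.ball w0 8, ‖h (σ w)‖ < ρ := by
    intro w hw'
    obtain ⟨-, -, D, -, -, -, hb⟩ := hw w (hball w hw')
    refine lt_of_le_of_lt (hb.trans ?_) hρ
    gcongr 2 * ?_
    apply Real.exp_le_exp.2
    rw [mem_ball_iff_norm] at hw'
    have h1 := (Complex.abs_im_le_norm (w - w0)).trans hw'.le
    have h2 : w0.im = sg * (κ - 9) := by rw [hw0]; simp
    rw [Complex.sub_im, h2] at h1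
    have h3 : |sg * (w.im - sg * (κ-9))| ≤ 8 := by rw [abs_mul, hsga, one_mul]; exact h1
    have h4 := (abs_le.1 h3).1
    have h5 : sg * (w.im - sg * (κ-9)) = sg * w.im - (κ - 9) := by linear_combination (-(κ-9)) * hsg2
    rw [h5] at h4
    nlinarith
  obtain ⟨v, hv⟩ := exists_log_ball (f := fun w => h (σ w)) (c := w0) (r := 8) (by norm_num) (fun w hw' => by
    obtain ⟨-, -, D, hD, -, hne, -⟩ := hw w (hball w hw')
    exact ⟨hD.differentiableAt, hne⟩)
  have hcn : ‖(2 * sg * Complex.I : ℂ)‖ = 2 := by simp [hsga]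
  obtain ⟨w', hw', hvw⟩ := solve (v := v) (w0 := w0) (c := 2 * sg * Complex.I) (y := v w0 + 2 * Real.pi * Complex.I) (R := 7)
    (by rw [← norm_pos_iff, hcn]; norm_num) (by norm_num) (fun w hw' => by
      have hwb : w ∈ Metric.ball w0 8 := Metric.closedBall_subset_ball (by norm_num) hw'
      obtain ⟨-, -, D, hD, hD2, hne, -⟩ := hw w (hball w hwb)
      refine ⟨(hv w hwb).1.differentiableAt, ?_⟩
      rw [(hv w hwb).1.deriv, hD.deriv, hcn, mul_div_cancel_right₀ _ hne]
      linarith) (by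
      rw [hcn, add_sub_cancel_left]
      simp [abs_of_pos Real.pi_pos]
      linarith [Real.pi_lt_d2])
  have hwb' : w' ∈ Metric.ball w0 8 := Metric.closedBall_subset_ball (by norm_num) hw'
  have hwb0 : w0 ∈ Metric.ball w0 8 := Metric.mem_ball_self (by norm_num)
  have heq : h (σ w') = h (σ w0) := by
    rw [← (hv w' hwb').2, ← (hv w0 hwb0).2, hvw, Complex.exp_add, Complex.exp_two_pi_mul_I, mul_one]
  have hne' : w' ≠ w0 := by
    intro h0
    rw [h0] at hvw
    have : (2 * Real.pi * Complex.I : ℂ) = 0 := by linear_combination -hvw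
    simp [Real.pi_ne_zero] at this
  obtain ⟨G, hGc, hG0, hG⟩ := lift2 hm (convex_ball (0:ℂ) ρ) (p := id) continuousOn_id (fun u hu => mob_nonsing hN hdet fun a ha =>
    hcon a ha u (by simpa using hu)) (u0 := h (σ w0)) (by simpa using hsmall w0 hwb0) (z0 := σ w0) (hw w0 (hball w0 hwb0)).1 rfl
  have hcont : ContinuousOn (fun w => h (σ w)) (Metric.ball w0 8) := fun w hw' => by
    obtain ⟨-, -, D, hD, -, hne, -⟩ := hw w (hball w hw')
    exact hD.continuousAt.continuousWithinAt
  have hu := lift_unique hm (convex_ball w0 8).isPreconnected (G₁ := fun w => G (h (σ w))) (G₂ := σ)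
    (hGc.comp hcont fun w hw' => by simpa using hsmall w hw') hσc.continuousOn
    (fun w hw' => (hG _ (by simpa using hsmall w hw')).1) (fun w hw' => ⟨(hw w (hball w hw')).1, (hw w (hball w hw')).2.1⟩)
    (fun w hw' => (hG _ (by simpa using hsmall w hw')).2) hwb0 hG0
  have h1 := hu w' hwb'
  have h2 := hu w0 hwb0
  simp only [heq] at h1
  exact hne' (hinj (by simpa using hball w' hwb') (by simpa using hball w0 hwb0) (h1.symm.trans h2))
end
end

section
open scoped Classical in
def kf (a b : ℂ) (F : ℂ → ℂ) (P : Set ℂ) (z : ℂ) : ℂ := if z ∈ P then 1 else (F z - a) / (F z - b)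

def EE (l : ℝ) (s : ℂ) : ℂ := 2 * Complex.I * ee l s

theorem mobF_inv (α β γ δ : ℂ) (F : ℂ → ℂ) (P : Set ℂ) (z : ℂ) :
    mobF γ δ α β F P z = (mobF α β γ δ F P z)⁻¹ := by
  unfold mobF; split_ifs <;> rw [inv_div]

theorem zz_inj {z0 : ℂ} (h0 : z0 ≠ 0) {N L : ℝ} (hN : 0 < N) (hL : L < N) {s t : ℂ} (hs : ‖s‖ ≤ L) (ht : ‖t‖ ≤ L)
    (h : zz z0 N s = zz z0 N t) : s = t := by
  have h1 := mul_left_cancel₀ h0 h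
  obtain ⟨n, hn⟩ := Complex.exp_eq_exp_iff_exists_int.1 h1
  have hNc : (N:ℂ) ≠ 0 := by exact_mod_cast hN.ne'
  have h2 : s - t = N * (n * (2 * Real.pi * Complex.I)) := by
    field_simp at hn
    linear_combination hn
  have h3 : ‖s - t‖ = N * (|(n:ℝ)| * (2 * Real.pi)) := by
    rw [h2]; simp [abs_of_pos hN, abs_of_pos Real.pi_pos]
  have h4 := norm_sub_le s t
  have hn0 : n = 0 := by
    by_contra hne
    have : (1:ℝ) ≤ |(n:ℝ)| := by exact_mod_cast Int.one_le_abs hne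
    have h5 : 6 ≤ |(n:ℝ)| * (2 * Real.pi) := by nlinarith [Real.pi_gt_three]
    nlinarith
  rw [hn0] at h2
  simp at h2
  exact sub_eq_zero.1 h2

section
variable {F A : ℂ → ℂ} {P Sing : Set ℂ} {M : ℕ} {R0 : ℝ}

theorem LC3 (hS : Setup F A P Sing M R0) {L ε : ℝ} {z0 : ℂ} {N l κ d ε1 ρ : ℝ} {s1 : ℂ} (hB : BoxData A R0 L ε z0 N l)
    (hs1 : ‖s1‖ ≤ L - 1) (hN : 1 ≤ N) (hLN : L < N) (hε : ε ≤ d) (hd1 : d ≤ 1) (hκ : 20 ≤ κ) (h1 : κ ≤ d * ‖ee l s1‖)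
    (h2 : 1 ≤ d * ‖ee l s1‖) (h3 : 8 * (1 + κ)^2 * Real.exp (10*κ) * (12 * d) ≤ ε1) (hε1 : ε1 ≤ 1/2)
    (hρ : 2 * Real.exp (-2*(κ-17)) < ρ) (hρ1 : ρ ≤ 1) :
    ∃ α β γ δ a b va vb : ℂ, α * δ - β * γ ≠ 0 ∧ a ∈ Sing ∧ b ∈ Sing ∧ ‖va‖ < ρ ∧ ‖vb‖ < ρ ∧
      va * (γ * a + δ) = α * a + β ∧ vb * (α * b + β) = γ * b + δ ∧
      ∀ w : ℂ, ‖w‖ < κ → zz z0 N (s1 + w / ee l s1) ∉ mobP γ δ F P ∧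
      ∃ D, HasDerivAt (fun w => mobF α β γ δ F P (zz z0 N (s1 + w / ee l s1))) (D * mobF α β γ δ F P (zz z0 N (s1 + w / ee l s1))) w ∧
        ‖D - 2 * Complex.I‖ ≤ ε1 ∧ mobF α β γ δ F P (zz z0 N (s1 + w / ee l s1)) ≠ 0 ∧
        ‖mobF α β γ δ F P (zz z0 N (s1 + w / ee l s1))‖ ≤ 2 * Real.exp (-2*w.im) ∧
        ‖(mobF α β γ δ F P (zz z0 N (s1 + w / ee l s1)))⁻¹‖ ≤ 2 * Real.exp (2*w.im) := by
  obtain ⟨α, β, γ, δ, hdet, hw⟩ := LC1 hS hB hs1 hN hε hd1 (by linarith : 0 < κ) h1 h2 h3 (by linarith)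
  have hene := ee_ne hB.lpos s1
  have hep : 0 < ‖ee l s1‖ := norm_pos_iff.2 hene
  have hd0 : 0 < d := by
    by_contra h
    nlinarith
  set σ : ℂ → ℂ := fun w => zz z0 N (s1 + w / ee l s1) with hσ
  have hσc : Continuous σ := by
    rw [hσ]; unfold zz; fun_prop
  have hinj : InjOn σ (Metric.ball 0 κ) := by
    intro w hw w' hw' he
    have hb : ∀ w : ℂ, w ∈ Metric.ball (0:ℂ) κ → ‖s1 + w / ee l s1‖ ≤ L := fun w hw =>
      (eta_bound hB hs1 hN hε hd1 h1 h2 (by simpa using hw)).1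
    have := zz_inj hB.z0ne hB.Npos hLN (hb w hw) (hb w' hw') he
    have := add_left_cancel this
    exact (div_left_inj' hene).1 this
  have hnb : ∀ w : ℂ, ‖w‖ < κ → mobF α β γ δ F P (σ w) ≠ 0 ∧ ‖mobF α β γ δ F P (σ w)‖ ≤ 2 * Real.exp (-2*w.im) ∧
      ‖(mobF α β γ δ F P (σ w))⁻¹‖ ≤ 2 * Real.exp (2*w.im) := by
    intro w hwk
    obtain ⟨-, -, D, -, -, hb⟩ := hw w hwk
    change ‖mobF α β γ δ F P (σ w) * _ - 1‖ ≤ _ at hb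
    set x := mobF α β γ δ F P (σ w) with hx
    have e0 : ‖x * Complex.exp (-(2 * Complex.I * w))‖ = ‖x‖ * Real.exp (2 * w.im) := by
      rw [norm_mul, Complex.norm_exp]; simp
    have e1 := norm_sub_norm_le (x * Complex.exp (-(2 * Complex.I * w))) 1
    have e2 := norm_sub_norm_le 1 (x * Complex.exp (-(2 * Complex.I * w)))
    rw [norm_sub_rev] at e2
    rw [e0, norm_one] at e1 e2
    have ep := Real.exp_pos (2 * w.im)
    have em : Real.exp (-2 * w.im) * Real.exp (2 * w.im) = 1 := by
      rw [← Real.exp_add]; simp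
    have ep2 := Real.exp_pos (-2 * w.im)
    have hx0 : x ≠ 0 := by
      intro h
      have h0 : ‖x‖ = 0 := by rw [h, norm_zero]
      rw [h0] at e2; linarith
    refine ⟨hx0, ?_, ?_⟩
    · have : ‖x‖ * Real.exp (2*w.im) ≤ 2 * Real.exp (-2*w.im) * Real.exp (2*w.im) := by
        rw [mul_assoc, em]; linarith
      exact le_of_mul_le_mul_right this ep
    · rw [norm_inv, inv_le_iff_one_le_mul₀ (norm_pos_iff.2 hx0)]
      linarith
  obtain ⟨a, ha, va, hva, hva2⟩ := LC2 hS.nice hdet (σ := σ) hκ hρ hσc hinj (sg := 1) (Or.inl rfl) (fun w hwk => by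
    obtain ⟨q1, q2, D, q3, q4, -⟩ := hw w hwk
    exact ⟨q1, q2, D, q3, by simpa using q4.trans hε1, (hnb w hwk).1, by simpa using (hnb w hwk).2.1⟩)
  obtain ⟨b, hb, vb, hvb, hvb2⟩ := LC2 hS.nice (α := γ) (β := δ) (γ := α) (δ := β) (by contrapose! hdet; linear_combination -hdet) (σ := σ)
      hκ hρ hσc hinj (sg := -1) (Or.inr rfl) (fun w hwk => by
    obtain ⟨q1, q2, D, q3, q4, -⟩ := hw w hwk
    obtain ⟨n1, n2, n3⟩ := hnb w hwk
    have efun : mobF γ δ α β F P = fun z => (mobF α β γ δ F P z)⁻¹ := funext fun z => mobF_inv _ _ _ _ _ _ _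
    refine ⟨?_, ?_, -D, ?_, ?_, ?_, ?_⟩
    · rintro (⟨hp, h0⟩ | ⟨hp, h0⟩)
      · apply n1; simp [mobF, hp, h0]
      · apply n1; simp [mobF, hp, h0]
    · have hdf := (differentiableAt_of_deriv_ne_zero q2).hasDerivAt
      rw [efun]
      rw [(hdf.fun_inv n1).deriv]
      exact div_ne_zero (neg_ne_zero.2 q2) (pow_ne_zero _ n1)
    · rw [efun]
      refine (q3.fun_inv n1).congr_deriv ?_
      change -(D * mobF α β γ δ F P (σ w)) / (mobF α β γ δ F P (σ w))^2 = -D * (mobF α β γ δ F P (σ w))⁻¹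
      generalize mobF α β γ δ F P (σ w) = x at n1
      field_simp
    · have : -D - 2 * ((-1:ℝ):ℂ) * Complex.I = -(D - 2 * Complex.I) := by push_cast; ring
      rw [this, norm_neg]; exact q4.trans hε1
    · rw [efun]; exact inv_ne_zero n1
    · rw [efun]; refine n3.trans (le_of_eq ?_)
      congr 2; ring)
  refine ⟨α, β, γ, δ, a, b, va, vb, hdet, ha, hb, hva, hvb, hva2, hvb2, fun w hwk => ?_⟩
  obtain ⟨q1, q2, D, q3, q4, -⟩ := hw w hwk
  exact ⟨q1, D, q3, q4, hnb w hwk⟩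

theorem kf_eq {α β γ δ a b va vb : ℂ} {z : ℂ} (hz : z ∉ mobP γ δ F P) (hdet : α * δ - β * γ ≠ 0)
    (ha : va * (γ * a + δ) = α * a + β) (hb : vb * (α * b + β) = γ * b + δ)
    (h1 : mobF α β γ δ F P z ≠ va) (h2 : vb * mobF α β γ δ F P z ≠ 1) :
    α - va * γ ≠ 0 ∧ (z ∉ P → F z ≠ a ∧ F z ≠ b) ∧
    kf a b F P z = (γ - vb * α) / (α - va * γ) * ((mobF α β γ δ F P z - va) / (1 - vb * mobF α β γ δ F P z)) := by
  have n1 : α - va * γ ≠ 0 := by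
    intro h
    have h' : β - va * δ = 0 := by linear_combination -ha - a * h
    apply hdet
    linear_combination δ * h - γ * h'
  have n2 : γ - vb * α ≠ 0 := by
    intro h
    have h' : δ - vb * β = 0 := by linear_combination -hb - b * h
    apply hdet
    linear_combination α * h' - β * h
  refine ⟨n1, ?_, ?_⟩
  · intro hp
    have hg : γ * F z + δ ≠ 0 := fun h => hz (Or.inr ⟨hp, h⟩)
    simp only [mobF, hp, if_false] at h1 h2
    refine ⟨fun h => h1 ?_, fun h => h2 ?_⟩
    · rw [div_eq_iff hg, h, ha]
    · rw [← mul_div_assoc, div_eq_one_iff_eq hg, h, hb]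
  · by_cases hp : z ∈ P
    · have hg : γ ≠ 0 := fun h => hz (Or.inl ⟨hp, h⟩)
      simp only [mobF, kf, hp, if_true]
      have e1 : α / γ - va = (α - va * γ) / γ := by field_simp
      have e2 : 1 - vb * (α / γ) = (γ - vb * α) / γ := by field_simp
      rw [e1, e2, div_div_div_cancel_right₀ hg]
      generalize α - va * γ = x at n1
      generalize γ - vb * α = y at n2
      field_simp
    · have hg : γ * F z + δ ≠ 0 := fun h => hz (Or.inr ⟨hp, h⟩)
      simp only [mobF, kf, hp, if_false]
      have e1 : (α * F z + β) / (γ * F z + δ) - va = (α - va * γ) * (F z - a) / (γ * F z + δ) := by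
        rw [eq_div_iff hg, sub_mul, div_mul_cancel₀ _ hg]; linear_combination -ha
      have e2 : 1 - vb * ((α * F z + β) / (γ * F z + δ)) = (γ - vb * α) * (F z - b) / (γ * F z + δ) := by
        rw [eq_div_iff hg, sub_mul, mul_assoc, div_mul_cancel₀ _ hg]; linear_combination -hb
      rw [e1, e2, div_div_div_cancel_right₀ hg, mul_div_mul_comm, ← mul_assoc]
      generalize α - va * γ = x at n1
      generalize γ - vb * α = y at n2
      generalize (F z - a) / (F z - b) = t
      field_simp

theorem X_bound {x y : ℂ} {r : ℝ} (hr : r ≤ 1/2) (hx : ‖x‖ ≤ r) (hy : ‖y‖ ≤ r) :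
    ‖(1 - x*y) / ((1 - x) * (1 - y)) - 1‖ ≤ 16 * r := by
  have hx1 : 1/2 ≤ ‖1 - x‖ := by
    have := norm_sub_norm_le 1 x; rw [norm_one] at this; linarith
  have hy1 : 1/2 ≤ ‖1 - y‖ := by
    have := norm_sub_norm_le 1 y; rw [norm_one] at this; linarith
  have nx : 1 - x ≠ 0 := by rw [← norm_pos_iff]; linarith
  have ny : 1 - y ≠ 0 := by rw [← norm_pos_iff]; linarith
  have e : (1 - x*y) / ((1 - x) * (1 - y)) - 1 = (x + y - 2 * (x * y)) / ((1 - x) * (1 - y)) := by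
    field_simp; ring
  have hr0 : 0 ≤ r := (norm_nonneg x).trans hx
  rw [e, norm_div, norm_mul, div_le_iff₀ (by positivity)]
  have e1 : ‖x + y - 2 * (x * y)‖ ≤ r + r + 2 * (r * (1/2)) := by
    refine (norm_sub_le _ _).trans ?_
    have := norm_add_le x y
    have e3 : ‖2 * (x * y)‖ ≤ 2 * (r * (1/2)) := by
      rw [norm_mul, norm_mul, Complex.norm_ofNat]
      have := mul_le_mul hx (hy.trans hr) (norm_nonneg _) hr0
      linarith
    linarith
  have e2 : 1/4 ≤ ‖1 - x‖ * ‖1 - y‖ := by nlinarith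
  nlinarith

end
end

section
structure Bx (F : ℂ → ℂ) (P Sing : Set ℂ) (M : ℕ) (z0 : ℂ) (N l L κ ε : ℝ) : Prop where
  nice : Nice F P Sing M
  lpos : 0 < l
  inj : ∀ s t : ℂ, ‖s‖ ≤ L → ‖t‖ ≤ L → zz z0 N s = zz z0 N t → s = t
  good : ∀ s : ℂ, ‖s‖ ≤ L → zz z0 N s ∉ P → zz z0 N s ∈ GoodSet F P
  lc : ∀ s1 : ℂ, ‖s1‖ ≤ L → ∃ a ∈ Sing, ∃ b ∈ Sing, a ≠ b ∧ ∀ s : ℂ, ‖s - s1‖ * ‖ee l s1‖ < κ →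
    (zz z0 N s ∉ P → F (zz z0 N s) ≠ a ∧ F (zz z0 N s) ≠ b) ∧
    ∃ D, HasDerivAt (fun s => kf a b F P (zz z0 N s)) (D * kf a b F P (zz z0 N s)) s ∧ ‖D - EE l s‖ ≤ ε * ‖EE l s‖

section
variable {F A : ℂ → ℂ} {P Sing : Set ℂ} {M : ℕ} {R0 : ℝ}

theorem kk_deriv {g : ℂ → ℂ} {s D C va vb : ℂ} {r : ℝ} (hr : r ≤ 1/2) (hg : HasDerivAt g (D * g s) s) (h0 : g s ≠ 0)
    (h1 : ‖va / g s‖ ≤ r) (h2 : ‖vb * g s‖ ≤ r) :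
    ∃ X, HasDerivAt (fun s => C * ((g s - va) / (1 - vb * g s))) (D * X * (C * ((g s - va) / (1 - vb * g s)))) s ∧ ‖X - 1‖ ≤ 16 * r := by
  refine ⟨_, ?_, X_bound hr h1 h2⟩
  have hx1 : 1 - va / g s ≠ 0 := by
    intro h
    have : va / g s = 1 := by linear_combination -h
    rw [this, norm_one] at h1; linarith
  have hy1 : 1 - vb * g s ≠ 0 := by
    intro h
    have : vb * g s = 1 := by linear_combination -h
    rw [this, norm_one] at h2; linarith
  have hd := ((hg.sub_const va).fun_div ((hg.const_mul vb).const_sub 1) hy1).const_mul C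
  refine hd.congr_deriv ?_
  have hx2 : g s - va ≠ 0 := by
    intro h; apply hx1; rw [sub_eq_zero] at h ⊢; rw [← h, div_self h0]
  have e : 1 - va / g s = (g s - va) / g s := by field_simp
  have e2 : va / g s * (vb * g s) = va * vb := by field_simp
  rw [e, e2]
  generalize hgs : g s = x at *
  field_simp
  ring

theorem LC4 (hS : Setup F A P Sing M R0) {L ε : ℝ} {z0 : ℂ} {N l κ d ε1 ρ κ2 : ℝ} {s1 : ℂ} (hB : BoxData A R0 L ε z0 N l)
    (hs1 : ‖s1‖ ≤ L - 1) (hN : 1 ≤ N) (hLN : L < N) (hε : ε ≤ d) (hd1 : d ≤ 1) (hκ : 20 ≤ κ) (h1 : κ ≤ d * ‖ee l s1‖)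
    (h2 : 1 ≤ d * ‖ee l s1‖) (h3 : 8 * (1 + κ)^2 * Real.exp (10*κ) * (12 * d) ≤ ε1) (hε1 : ε1 ≤ 1/2)
    (hρ : 2 * Real.exp (-2*(κ-17)) < ρ) (hρ1 : ρ < 1) (hκ2 : κ2 ≤ κ) (hρ2 : 2 * Real.exp (2*κ2) * ρ ≤ 1/2) :
    ∃ a ∈ Sing, ∃ b ∈ Sing, a ≠ b ∧ ∀ s : ℂ, ‖s - s1‖ * ‖ee l s1‖ < κ2 →
    (zz z0 N s ∉ P → F (zz z0 N s) ≠ a ∧ F (zz z0 N s) ≠ b) ∧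
    ∃ D, HasDerivAt (fun s => kf a b F P (zz z0 N s)) (D * kf a b F P (zz z0 N s)) s ∧
      ‖D - EE l s‖ ≤ (ε1 * 9 + 64 * Real.exp (2*κ2) * ρ + d) * ‖EE l s‖ := by
  obtain ⟨α, β, γ, δ, a, b, va, vb, hdet, ha, hb, hva, hvb, hva2, hvb2, hw⟩ := LC3 hS hB hs1 hN hLN hε hd1 hκ h1 h2 h3 hε1 hρ hρ1.le
  have hene := ee_ne hB.lpos s1
  have hep : 0 < ‖ee l s1‖ := norm_pos_iff.2 hene
  have hd0 : 0 < d := by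
    by_contra h
    nlinarith
  refine ⟨a, ha, b, hb, ?_, ?_⟩
  · rintro rfl
    have e1 : (1 - va * vb) * (γ * a + δ) = 0 := by linear_combination -hvb2 - vb * hva2
    have e2 : 1 - va * vb ≠ 0 := by
      intro h
      have : va * vb = 1 := by linear_combination -h
      have h5 : ‖va‖ * ‖vb‖ = 1 := by rw [← norm_mul, this, norm_one]
      nlinarith [norm_nonneg va, norm_nonneg vb]
    have e3 := (mul_eq_zero.1 e1).resolve_left e2
    apply hdet
    rw [e3, mul_zero] at hva2
    linear_combination α * e3 + γ * hva2
  set hh : ℂ → ℂ := fun s => mobF α β γ δ F P (zz z0 N s) with hhh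
  -- transfer to s
  have hs : ∀ s : ℂ, ‖s - s1‖ * ‖ee l s1‖ < κ2 → zz z0 N s ∉ mobP γ δ F P ∧ hh s ≠ 0 ∧
      ‖va / hh s‖ ≤ 2 * Real.exp (2*κ2) * ρ ∧ ‖vb * hh s‖ ≤ 2 * Real.exp (2*κ2) * ρ ∧
      ∃ D, HasDerivAt hh (D * ee l s1 * hh s) s ∧ ‖D - 2 * Complex.I‖ ≤ ε1 := by
    intro s hs
    set w := (s - s1) * ee l s1 with hwd
    have hwn : ‖w‖ < κ2 := by rw [hwd, norm_mul]; exact hs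
    obtain ⟨q1, D, q2, q3, q4, q5, q6⟩ := hw w (hwn.trans_le hκ2)
    have es : s1 + w / ee l s1 = s := by rw [hwd, mul_div_cancel_right₀ _ hene]; ring
    rw [es] at q1 q2 q4 q5 q6
    have him := abs_le.1 ((Complex.abs_im_le_norm w).trans hwn.le)
    have x1 : Real.exp (-2*w.im) ≤ Real.exp (2*κ2) := Real.exp_le_exp.2 (by linarith)
    have x2 : Real.exp (2*w.im) ≤ Real.exp (2*κ2) := Real.exp_le_exp.2 (by linarith)
    have hρ0 : 0 ≤ ρ := (norm_nonneg va).trans hva.le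
    refine ⟨q1, q4, ?_, ?_, D, ?_, q3⟩
    · rw [div_eq_mul_inv, norm_mul]
      have := mul_le_mul hva.le (q6.trans (mul_le_mul_of_nonneg_left x2 zero_le_two)) (norm_nonneg _) hρ0
      linarith
    · rw [norm_mul]
      have := mul_le_mul hvb.le (q5.trans (mul_le_mul_of_nonneg_left x1 zero_le_two)) (norm_nonneg _) hρ0
      linarith
    · have hin : HasDerivAt (fun s => (s - s1) * ee l s1) (ee l s1) s := by
        simpa using ((hasDerivAt_id s).sub_const s1).mul_const (ee l s1)
      have := HasDerivAt.comp s (h₂ := fun w => mobF α β γ δ F P (zz z0 N (s1 + w / ee l s1))) q2 hin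
      have hf : hh = (fun w => mobF α β γ δ F P (zz z0 N (s1 + w / ee l s1))) ∘ (fun s => (s - s1) * ee l s1) := by
        funext t
        simp only [Function.comp, mul_div_cancel_right₀ _ hene, hhh]
        congr 2; ring
      rw [hf]
      refine this.congr_deriv ?_
      rw [← hf]; ring
  intro s hsκ
  obtain ⟨p1, p2, p3, p4, D, p5, p6⟩ := hs s hsκ
  have hkf : ∀ s : ℂ, ‖s - s1‖ * ‖ee l s1‖ < κ2 → α - va * γ ≠ 0 ∧ (zz z0 N s ∉ P → F (zz z0 N s) ≠ a ∧ F (zz z0 N s) ≠ b) ∧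
      kf a b F P (zz z0 N s) = (γ - vb * α) / (α - va * γ) * ((hh s - va) / (1 - vb * hh s)) := by
    intro s hsκ
    obtain ⟨p1, p2, p3, p4, D, p5, p6⟩ := hs s hsκ
    refine kf_eq p1 hdet hva2 hvb2 ?_ ?_
    · intro h
      have : ‖va / hh s‖ = 1 := by rw [← h]; change ‖hh s / hh s‖ = 1; rw [div_self p2, norm_one]
      linarith
    · intro h
      change vb * hh s = 1 at h
      rw [h, norm_one] at p4; linarith
  refine ⟨(hkf s hsκ).2.1, ?_⟩
  obtain ⟨X, hX, hX1⟩ := kk_deriv (C := (γ - vb * α) / (α - va * γ)) hρ2 p5 p2 p3 p4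
  refine ⟨D * ee l s1 * X, ?_, ?_⟩
  · rw [(hkf s hsκ).2.2]
    refine hX.congr_of_eventuallyEq ?_
    have : ∀ᶠ t in 𝓝 s, ‖t - s1‖ * ‖ee l s1‖ < κ2 := by
      have hc : ContinuousAt (fun t : ℂ => ‖t - s1‖ * ‖ee l s1‖) s := by fun_prop
      exact hc.eventually_lt continuousAt_const hsκ
    filter_upwards [this] with t ht using (hkf t ht).2.2
  · have hst : ‖s1 - s‖ ≤ d := by
      rw [norm_sub_rev]
      have : ‖s - s1‖ * ‖ee l s1‖ ≤ d * ‖ee l s1‖ := by linarith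
      exact le_of_mul_le_mul_right this hep
    have eq1 : ee l s1 = ee l s * Complex.exp ((s1 - s)/2) := by
      rw [ee, ee, mul_assoc, ← Complex.exp_add]; congr 2; ring
    have hn2 : ‖(s1 - s)/2‖ ≤ d/2 := by rw [norm_div]; simp only [Complex.norm_ofNat]; linarith
    have hexp : ‖Complex.exp ((s1 - s)/2) - 1‖ ≤ d := (Complex.norm_exp_sub_one_le (by linarith)).trans (by linarith)
    set y := Complex.exp ((s1 - s)/2) with hy
    have hyn : ‖y‖ ≤ 2 := by
      have := norm_le_norm_add_norm_sub 1 y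
      rw [norm_one, norm_sub_rev] at this; linarith
    have hXn : ‖X‖ ≤ 9 := by
      have := norm_le_norm_add_norm_sub 1 X
      rw [norm_one, norm_sub_rev] at this; linarith
    have e : D * ee l s1 * X - EE l s = ((D - 2 * Complex.I) * y * X) * ee l s + (y * (X - 1) + (y - 1)) * EE l s := by
      rw [eq1, EE]; ring
    have hEn : ‖EE l s‖ = 2 * ‖ee l s‖ := by rw [EE]; simp
    rw [e]
    refine (norm_add_le _ _).trans ?_
    rw [norm_mul, norm_mul _ (EE l s), norm_mul, norm_mul]
    have t1 : ‖D - 2 * Complex.I‖ * ‖y‖ * ‖X‖ ≤ ε1 * 2 * 9 := by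
      have : 0 ≤ ε1 := (norm_nonneg _).trans p6
      gcongr
    have t2 : ‖y * (X - 1) + (y - 1)‖ ≤ 2 * (16 * (2 * Real.exp (2*κ2) * ρ)) + d := by
      refine (norm_add_le _ _).trans ?_
      rw [norm_mul]
      have := mul_le_mul hyn hX1 (norm_nonneg _) zero_le_two
      linarith
    have t3 := mul_le_mul_of_nonneg_right t1 (norm_nonneg (ee l s))
    have t4 := mul_le_mul_of_nonneg_right t2 (norm_nonneg (EE l s))
    have : (ε1 * 9 + 64 * Real.exp (2*κ2) * ρ + d) * ‖EE l s‖ = ε1 * 2 * 9 * ‖ee l s‖ + (2 * (16 * (2 * Real.exp (2*κ2) * ρ)) + d) * ‖EE l s‖ := by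
      rw [hEn]; ring
    linarith

theorem BOX (hS : Setup F A P Sing M R0) (hT : ∀ (m : ℕ) (ρ : ℝ), ∃ z : ℂ, ρ < ‖z‖ ∧ ‖z‖ ^ m < ‖A z‖)
    {κ2 ε2 L Λ0 : ℝ} (hε2 : 0 < ε2) (hL : 0 < L) :
    ∃ (z0 : ℂ) (N l : ℝ), z0 ≠ 0 ∧ 0 < N ∧ Λ0 ≤ N ∧ Λ0 ≤ l ∧ Bx F P Sing M z0 N l L κ2 ε2 := by
  set ρ := min (1/2) (min (1 / (4 * Real.exp (2*κ2))) (ε2 / (256 * Real.exp (2*κ2)))) with hρ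
  have hE := Real.exp_pos (2*κ2)
  have hρ0 : 0 < ρ := by rw [hρ]; positivity
  have hr1 : ρ ≤ 1/2 := min_le_left _ _
  have hr2 : 2 * Real.exp (2*κ2) * ρ ≤ 1/2 := by
    have : ρ ≤ 1 / (4 * Real.exp (2*κ2)) := (min_le_right _ _).trans (min_le_left _ _)
    rw [le_div_iff₀ (by positivity)] at this; linarith
  have hr3 : 64 * Real.exp (2*κ2) * ρ ≤ ε2 / 4 := by
    have : ρ ≤ ε2 / (256 * Real.exp (2*κ2)) := (min_le_right _ _).trans (min_le_right _ _)
    rw [le_div_iff₀ (by positivity)] at this; linarith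
  obtain ⟨κ, hκ20, hκ2, hκρ⟩ : ∃ κ : ℝ, 20 ≤ κ ∧ κ2 ≤ κ ∧ 2 * Real.exp (-2*(κ-17)) < ρ := by
    have ht : Tendsto (fun κ : ℝ => 2 * Real.exp (-2*(κ-17))) atTop (𝓝 (2 * 0)) := by
      refine Tendsto.const_mul 2 (Real.tendsto_exp_atBot.comp ?_)
      refine Tendsto.const_mul_atTop_of_neg (by norm_num) ?_
      exact tendsto_atTop_add_const_right _ _ tendsto_id
    rw [mul_zero] at ht
    obtain ⟨κ, h1, h2, h3⟩ := ((eventually_ge_atTop 20).and ((eventually_ge_atTop κ2).and (ht.eventually_lt_const hρ0))).exists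
    exact ⟨κ, h1, h2, h3⟩
  set ε1 := min (1/2) (ε2 / 36) with hε1
  have hε10 : 0 < ε1 := by rw [hε1]; positivity
  have hκ0 : 0 < κ := by linarith
  set Q := 8 * (1 + κ)^2 * Real.exp (10*κ) * 12 with hQ
  have hQ0 : 0 < Q := by rw [hQ]; positivity
  set d := min (min 1 (ε2/4)) (ε1 / Q) with hd
  have hd0 : 0 < d := by rw [hd]; positivity
  have hd1 : d ≤ 1 := (min_le_left _ _).trans (min_le_left _ _)
  have hd2 : d ≤ ε2/4 := (min_le_left _ _).trans (min_le_right _ _)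
  have hd3 : 8 * (1 + κ)^2 * Real.exp (10*κ) * (12 * d) ≤ ε1 := by
    have : d ≤ ε1 / Q := min_le_right _ _
    rw [le_div_iff₀ hQ0] at this
    calc _ = d * Q := by rw [hQ]; ring
      _ ≤ _ := this
  set T := κ / d * Real.exp (L/2) with hTd
  obtain ⟨z0, N, l, hz0, hNΛ, hN, hlΛ, hl, hbx⟩ := box_lemma hS.Aan hT (L := L + 1) (ε := d)
    (Λ := max (max Λ0 (T^2)) (L + 2)) (ρ0 := R0) (by linarith) hd0
  have hB : BoxData A R0 (L+1) d z0 N l := ⟨hz0, hN, hl, fun s hs => (hbx s hs).1, fun s hs => (hbx s hs).2⟩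
  have hLN : L + 1 < N := by have := (le_max_right _ _).trans hNΛ; linarith
  refine ⟨z0, N, l, hz0, hN, ((le_max_left _ _).trans (le_max_left _ _)).trans hNΛ, ((le_max_left _ _).trans (le_max_left _ _)).trans hlΛ, hS.nice, hl, fun s t hs ht h =>
    zz_inj hz0 hN hLN (by linarith) (by linarith) h, fun s hs hp => ⟨hp, (hS.reg _ (hB.big s (by linarith)) hp).1⟩, ?_⟩
  intro s1 hs1
  have hT2 : T^2 ≤ l := ((le_max_right _ _).trans (le_max_left _ _)).trans hlΛ
  have hT0 : 0 ≤ T := by positivity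
  have hTs : T ≤ Real.sqrt l := Real.le_sqrt_of_sq_le hT2
  have hκd : κ ≤ d * ‖ee l s1‖ := by
    rw [ee_norm]
    have hre := (abs_le.1 ((Complex.abs_re_le_norm s1).trans hs1)).1
    have e1 : Real.exp (-(L/2)) ≤ Real.exp (s1.re/2) := Real.exp_le_exp.2 (by linarith)
    have e2 : T * Real.exp (-(L/2)) ≤ Real.sqrt l * Real.exp (s1.re/2) := mul_le_mul hTs e1 (Real.exp_pos _).le (Real.sqrt_nonneg _)
    have e3 : T * Real.exp (-(L/2)) = κ / d := by
      rw [hTd, mul_assoc, ← Real.exp_add]; simp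
    rw [e3, div_le_iff₀ hd0] at e2
    linarith
  obtain ⟨a, ha, b, hb, hab, h⟩ := LC4 hS hB (by linarith) (by linarith) hLN le_rfl hd1 hκ20 hκd (by linarith) hd3 (min_le_left _ _) hκρ (by linarith) hκ2 hr2
  refine ⟨a, ha, b, hb, hab, fun s hs => ⟨(h s hs).1, ?_⟩⟩
  obtain ⟨D, h1, h2⟩ := (h s hs).2
  refine ⟨D, h1, h2.trans ?_⟩
  have : ε1 ≤ ε2/36 := min_le_right _ _
  gcongr
  linarith

end
end

section
def Hd (F : ℂ → ℂ) (z0 : ℂ) (N : ℝ) (s : ℂ) : ℂ := deriv F (zz z0 N s) * (zz z0 N s / N)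

def e3 : ℝ := 1 / 10^8

def Zt (l : ℝ) (s : ℂ) : ℂ := 4 * Complex.I * ee l s

theorem ee_hasDerivAt (l : ℝ) (s : ℂ) : HasDerivAt (ee l) (ee l s / 2) s := by
  have h := (((hasDerivAt_id s).div_const (2:ℂ)).cexp).const_mul (Real.sqrt l : ℂ)
  refine HasDerivAt.congr_deriv (f := ee l) h ?_
  simp [ee]; ring

theorem Zt_hasDerivAt (l : ℝ) (s : ℂ) : HasDerivAt (Zt l) (EE l s) s := by
  refine HasDerivAt.congr_deriv (f := Zt l) ((ee_hasDerivAt l s).const_mul (4 * Complex.I)) ?_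
  rw [EE]; ring

theorem EE_norm (l : ℝ) (s : ℂ) : ‖EE l s‖ = 2 * (Real.sqrt l * Real.exp (s.re/2)) := by
  rw [EE, norm_mul, ee_norm]; simp

theorem EE_pos {l : ℝ} (hl : 0 < l) (s : ℂ) : 0 < ‖EE l s‖ := by
  rw [EE_norm]; have := Real.sqrt_pos.2 hl; positivity

theorem EE_cont (l : ℝ) : Continuous (EE l) := by
  unfold EE ee; fun_prop

theorem zz_cont (z0 : ℂ) (N : ℝ) : Continuous (zz z0 N) := by
  unfold zz; fun_prop

structure Cx (F : ℂ → ℂ) (P Sing : Set ℂ) (M : ℕ) (z0 : ℂ) (N l L κ ε r g Dm : ℝ) : Prop where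
  bx : Bx F P Sing M z0 N l L κ ε
  rpos : 0 < r
  gpos : 0 < g
  gap : ∀ a ∈ Sing, ∀ b ∈ Sing, a ≠ b → g ≤ ‖a - b‖ ∧ ‖a - b‖ ≤ Dm
  hrg : r ≤ g * (e3 / 4)
  hrD : 64 * Dm * r ≤ g ^ 2
  hε : ε ≤ e3 / 4
  κpos : 0 < κ

def Deep (F : ℂ → ℂ) (P : Set ℂ) (z0 : ℂ) (N l r : ℝ) (a : ℂ) (σ : ℝ) (s : ℂ) : Prop :=
  zz z0 N s ∉ P ∧ F (zz z0 N s) ≠ a ∧ ‖F (zz z0 N s) - a‖ < r ∧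
    ‖Hd F z0 N s / (F (zz z0 N s) - a) - σ * EE l s‖ ≤ e3 * ‖EE l s‖

section
variable {F : ℂ → ℂ} {P Sing : Set ℂ} {M : ℕ} {z0 : ℂ} {N l L κ ε r g Dm : ℝ}

theorem F_hasDerivAt (hm : MeroPlane F P) {s : ℂ} (hs : zz z0 N s ∉ P) :
    HasDerivAt (fun s => F (zz z0 N s)) (Hd F z0 N s) s :=
  (hm.2.1 _ hs).differentiableAt.hasDerivAt.comp s (zz_hasDerivAt z0 N s)

theorem Hd_cont (hm : MeroPlane F P) {s : ℂ} (hs : zz z0 N s ∉ P) : ContinuousAt (Hd F z0 N) s := by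
  have h1 : ContinuousAt (deriv F) (zz z0 N s) := (hm.2.1 _ hs).deriv.continuousAt
  have h2 := (zz_cont z0 N).continuousAt (x := s)
  exact (ContinuousAt.comp (f := zz z0 N) (g := deriv F) h1 h2).mul (h2.div_const _)

theorem P_ev (hm : MeroPlane F P) {s : ℂ} (hs : zz z0 N s ∉ P) : ∀ᶠ t in 𝓝 s, zz z0 N t ∉ P :=
  (zz_cont z0 N).continuousAt.eventually (hm.isClosed.isOpen_compl.eventually_mem hs)

/-- formula from LC at points where kf has the right logarithmic derivative -/
theorem kf_formula (hm : MeroPlane F P) {s a b D : ℂ} (hs : zz z0 N s ∉ P) (ha : F (zz z0 N s) ≠ b)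
    (hD : HasDerivAt (fun s => kf a b F P (zz z0 N s)) (D * kf a b F P (zz z0 N s)) s) (hab : a ≠ b) :
    Hd F z0 N s = (F (zz z0 N s) - a) * (F (zz z0 N s) - b) / (a - b) * D := by
  have h1 := F_hasDerivAt (N := N) hm hs
  have hb : F (zz z0 N s) - b ≠ 0 := sub_ne_zero.2 ha
  have h2 := (h1.sub_const a).fun_div (h1.sub_const b) hb
  have h3 := hD.congr_of_eventuallyEq (f := fun s => kf a b F P (zz z0 N s)) (f₁ := fun s => (F (zz z0 N s) - a) / (F (zz z0 N s) - b)) (by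
    filter_upwards [P_ev hm hs] with t ht
    simp [kf, ht])
  have h4 := h2.unique h3
  simp only [kf, hs, if_false] at h4
  have hab' : a - b ≠ 0 := sub_ne_zero.2 hab
  have h5 : Hd F z0 N s * (a - b) = D * (F (zz z0 N s) - a) * (F (zz z0 N s) - b) := by
    field_simp at h4
    have h6 : Hd F z0 N s * (a - b) = (F (zz z0 N s) - b) * D * (F (zz z0 N s) - a) := by linear_combination h4
    rw [h6]; ring
  rw [div_mul_eq_mul_div, eq_div_iff hab', h5]; ring

theorem Cx.formula (hC : Cx F P Sing M z0 N l L κ ε r g Dm) {s : ℂ} (hs : ‖s‖ ≤ L) (hp : zz z0 N s ∉ P) :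
    ∃ a ∈ Sing, ∃ b ∈ Sing, ∃ D, a ≠ b ∧ F (zz z0 N s) ≠ a ∧ F (zz z0 N s) ≠ b ∧ ‖D - EE l s‖ ≤ e3 / 4 * ‖EE l s‖ ∧
      Hd F z0 N s = (F (zz z0 N s) - a) * (F (zz z0 N s) - b) / (a - b) * D ∧ Hd F z0 N s ≠ 0 := by
  obtain ⟨a, ha, b, hb, hab, h⟩ := hC.bx.lc s hs
  obtain ⟨h1, D, h2, h3⟩ := h s (by simpa using hC.κpos)
  obtain ⟨h4, h5⟩ := h1 hp
  have hf := kf_formula hC.bx.nice.mero hp h5 h2 hab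
  have hE := EE_pos hC.bx.lpos s
  have h6 : ‖D - EE l s‖ ≤ e3 / 4 * ‖EE l s‖ := h3.trans (mul_le_mul_of_nonneg_right hC.hε hE.le)
  refine ⟨a, ha, b, hb, D, hab, h4, h5, h6, hf, ?_⟩
  rw [hf]
  refine mul_ne_zero (div_ne_zero (mul_ne_zero (sub_ne_zero.2 h4) (sub_ne_zero.2 h5)) (sub_ne_zero.2 hab)) ?_
  rintro rfl
  rw [zero_sub, norm_neg, e3] at h6
  linarith

theorem gap_aux {x y D E : ℂ} {τ g r : ℝ} (hτ : |τ| = 1) (hg : 0 < g) (hE : 0 < ‖E‖) (hD : ‖D - τ * E‖ ≤ e3/4 * ‖E‖) (hx : ‖x‖ < r)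
    (hy : g ≤ ‖y‖) (hr : r ≤ g * (e3/4)) : ‖(1 + x / y) * D - τ * E‖ ≤ e3 * ‖E‖ := by
  have h1 : ‖x / y‖ ≤ e3/4 := by
    rw [norm_div, div_le_iff₀ (by linarith)]
    have : 0 < e3 := by unfold e3; norm_num
    nlinarith
  have h2 : ‖D‖ ≤ 2 * ‖E‖ := by
    have := norm_le_norm_add_norm_sub (τ * E) D
    rw [norm_sub_rev, norm_mul, Complex.norm_real, Real.norm_eq_abs, hτ] at this
    unfold e3 at hD; linarith
  have e : (1 + x / y) * D - τ * E = (D - τ * E) + x / y * D := by ring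
  rw [e]
  refine (norm_add_le _ _).trans ?_
  rw [norm_mul]
  have := mul_le_mul h1 h2 (norm_nonneg _) (by unfold e3; norm_num)
  have : 0 ≤ e3 * ‖E‖ := by unfold e3; positivity
  linarith

theorem sign_aux {X E : ℂ} {σ τ : ℝ} (hσ : σ = 1 ∨ σ = -1) (hτ : τ = 1 ∨ τ = -1) (hE : 0 < ‖E‖) (h1 : ‖X - τ * E‖ ≤ e3 * ‖E‖)
    (h2 : ‖X - σ * E‖ ≤ 1/2 * ‖E‖) : σ = τ := by
  by_contra hne
  have h3 : ‖((σ - τ : ℝ):ℂ) * E‖ ≤ (1/2 + e3) * ‖E‖ := by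
    have : ((σ - τ : ℝ):ℂ) * E = (X - τ * E) - (X - σ * E) := by push_cast; ring
    rw [this]
    refine (norm_sub_le _ _).trans (by linarith)
  rw [norm_mul, Complex.norm_real, Real.norm_eq_abs] at h3
  have h4 : |σ - τ| = 2 := by
    rcases hσ with rfl | rfl <;> rcases hτ with rfl | rfl <;> first | exact absurd rfl hne | norm_num
  rw [h4] at h3
  unfold e3 at h3
  linarith

theorem Cx.notpair (hC : Cx F P Sing M z0 N l L κ ε r g Dm) {s a a' b' D : ℂ} {σ : ℝ} (hσ : σ = 1 ∨ σ = -1) (ha : a ∈ Sing) (ha' : a' ∈ Sing) (hb' : b' ∈ Sing)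
    (h1 : F (zz z0 N s) ≠ a) (h2 : ‖F (zz z0 N s) - a‖ < r)
    (h3 : ‖Hd F z0 N s / (F (zz z0 N s) - a) - σ * EE l s‖ ≤ 1/2 * ‖EE l s‖) (hab : a' ≠ b') (hD : ‖D - EE l s‖ ≤ e3 / 4 * ‖EE l s‖)
    (hf : Hd F z0 N s = (F (zz z0 N s) - a') * (F (zz z0 N s) - b') / (a' - b') * D) (c1 : a ≠ a') (c2 : a ≠ b') : False := by
  have hE := EE_pos hC.bx.lpos s
  have hab' : a' - b' ≠ 0 := sub_ne_zero.2 hab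
  have hH : F (zz z0 N s) - a ≠ 0 := sub_ne_zero.2 h1
  have g1 := (hC.gap a ha a' ha' c1).1
  have g2 := (hC.gap a ha b' hb' c2).1
  have g3 := (hC.gap a' ha' b' hb' hab).2
  have hr := hC.hrg
  have hr2 : r ≤ g / 2 := by have := hC.gpos; unfold e3 at hr; linarith
  set x := F (zz z0 N s) with hx
  have x1 : g/2 ≤ ‖x - a'‖ := by
    have := norm_sub_norm_le (a - a') (a - x)
    rw [sub_sub_sub_cancel_left, norm_sub_rev a x] at this; linarith
  have x2 : g/2 ≤ ‖x - b'‖ := by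
    have := norm_sub_norm_le (a - b') (a - x)
    rw [sub_sub_sub_cancel_left, norm_sub_rev a x] at this; linarith
  have hDn : ‖EE l s‖ / 2 ≤ ‖D‖ := by
    have := norm_sub_norm_le (EE l s) D
    rw [norm_sub_rev] at this
    unfold e3 at hD; linarith
  have hbig : ‖Hd F z0 N s / (x - a)‖ ≤ 3/2 * ‖EE l s‖ := by
    have := norm_le_norm_add_norm_sub (σ * EE l s) (Hd F z0 N s / (x - a))
    rw [norm_sub_rev, norm_mul, Complex.norm_real, Real.norm_eq_abs] at this
    have : |σ| = 1 := by rcases hσ with rfl | rfl <;> simp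
    nlinarith
  rw [norm_div, div_le_iff₀ (norm_pos_iff.2 hH), hf, norm_mul, norm_div, norm_mul, div_mul_eq_mul_div, div_le_iff₀ (norm_pos_iff.2 hab')] at hbig
  have y1 : g/2 * (g/2) * (‖EE l s‖/2) ≤ ‖x - a'‖ * ‖x - b'‖ * ‖D‖ := by
    have := hC.gpos
    gcongr
  have y2 : 3/2 * ‖EE l s‖ * ‖x - a‖ * ‖a' - b'‖ ≤ 3/2 * ‖EE l s‖ * r * Dm := by
    have := hC.rpos
    gcongr
  have y3 := hC.hrD
  have y4 : g^2 * ‖EE l s‖ ≤ 12 * (Dm * r) * ‖EE l s‖ := by nlinarith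
  have y5 := le_of_mul_le_mul_right y4 hE
  have : 0 < g^2 := by have := hC.gpos; positivity
  nlinarith

theorem Cx.gapL (hC : Cx F P Sing M z0 N l L κ ε r g Dm) {s a : ℂ} {σ : ℝ} (hσ : σ = 1 ∨ σ = -1) (ha : a ∈ Sing) (hs : ‖s‖ ≤ L) (hp : zz z0 N s ∉ P)
    (h1 : F (zz z0 N s) ≠ a) (h2 : ‖F (zz z0 N s) - a‖ < r)
    (h3 : ‖Hd F z0 N s / (F (zz z0 N s) - a) - σ * EE l s‖ ≤ 1/2 * ‖EE l s‖) : Deep F P z0 N l r a σ s := by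
  refine ⟨hp, h1, h2, ?_⟩
  obtain ⟨a', ha', b', hb', D, hab, n1, n2, hD, hf, -⟩ := hC.formula hs hp
  have hE := EE_pos hC.bx.lpos s
  have hab' : a' - b' ≠ 0 := sub_ne_zero.2 hab
  have hH : F (zz z0 N s) - a ≠ 0 := sub_ne_zero.2 h1
  by_cases c1 : a = a'
  · subst c1
    have e : Hd F z0 N s / (F (zz z0 N s) - a) = (1 + (F (zz z0 N s) - a) / (a - b')) * D := by
      rw [hf]; field_simp; ring
    have h4 := gap_aux (τ := 1) (by simp) hC.gpos hE (by simpa using hD) h2 (hC.gap a ha b' hb' hab).1 hC.hrg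
    rw [← e] at h4
    rw [sign_aux hσ (Or.inl rfl) hE h4 h3]; exact h4
  by_cases c2 : a = b'
  · subst c2
    have hab2 : a - a' ≠ 0 := sub_ne_zero.2 c1
    have e : Hd F z0 N s / (F (zz z0 N s) - a) = (1 + (F (zz z0 N s) - a) / (a - a')) * (-D) := by
      rw [hf]; field_simp; ring
    have h4 := gap_aux (τ := -1) (D := -D) (by simp) hC.gpos hE (by
      have : -D - ((-1:ℝ):ℂ) * EE l s = -(D - EE l s) := by push_cast; ring
      rw [this, norm_neg]; exact hD) h2 (hC.gap a ha a' ha' c1).1 hC.hrg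
    rw [← e] at h4
    rw [sign_aux hσ (Or.inr rfl) hE h4 h3]; exact h4
  exact (hC.notpair hσ ha ha' hb' h1 h2 h3 hab hD hf c1 c2).elim

end
end

section
theorem log_norm_deriv {h : ℝ → ℂ} {h' : ℂ} {t : ℝ} (hh : HasDerivAt h h' t) (h0 : h t ≠ 0) :
    HasDerivAt (fun t => Real.log ‖h t‖) ((h' / h t).re) t := by
  have hn : ‖h t‖ ^ 2 ≠ 0 := by have := norm_pos_iff.2 h0; positivity
  have h1 := (hh.norm_sq.log hn).div_const 2
  have h2 : (fun t => Real.log ‖h t‖) = fun t => Real.log (‖h t‖ ^ 2) / 2 := by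
    funext t; rw [Real.log_pow]; push_cast; ring
  rw [h2]
  refine h1.congr_deriv ?_
  rw [Complex.inner, ← Complex.normSq_eq_norm_sq, Complex.div_re]
  simp only [Complex.mul_re, Complex.conj_re, Complex.conj_im]
  have hns : Complex.normSq (h t) ≠ 0 := by rwa [Complex.normSq_eq_norm_sq]
  field_simp
  ring

section
variable {F : ℂ → ℂ} {P Sing : Set ℂ} {M : ℕ} {z0 : ℂ} {N l L κ ε r g Dm : ℝ}

theorem seg_deriv (s1 d : ℂ) (τ : ℝ) : HasDerivAt (fun τ : ℝ => s1 + τ * d) d τ := by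
  have := ((Complex.ofRealCLM.hasDerivAt (x := τ)).mul_const d).const_add s1
  simpa using this

theorem Cx.CL0 (hC : Cx F P Sing M z0 N l L κ ε r g Dm) {a : ℂ} {σ : ℝ} (hσ : σ = 1 ∨ σ = -1) (ha : a ∈ Sing) {s1 d : ℂ}
    (hL : ∀ τ : ℝ, 0 ≤ τ → τ ≤ 1 → ‖s1 + τ * d‖ ≤ L) (hD : Deep F P z0 N l r a σ s1)
    (hb : ∀ τ : ℝ, 0 ≤ τ → τ ≤ 1 → (∀ τ' : ℝ, 0 ≤ τ' → τ' ≤ τ → Deep F P z0 N l r a σ (s1 + τ' * d)) →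
      ‖F (zz z0 N (s1 + τ * d)) - a‖ ≤ r / 2) :
    ∀ τ : ℝ, 0 ≤ τ → τ ≤ 1 → Deep F P z0 N l r a σ (s1 + τ * d) := by
  have hm := hC.bx.nice.mero
  have hcs : Continuous (fun τ : ℝ => s1 + τ * d) := by fun_prop
  suffices h : ∀ t ∈ Icc (0:ℝ) 1, (t ∈ Icc (0:ℝ) 1 → Deep F P z0 N l r a σ (s1 + t * d)) from
    fun τ h1 h2 => h τ ⟨h1, h2⟩ ⟨h1, h2⟩
  refine cont_ind ?_ ?_ ?_
  · intro _; simpa using hD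
  · intro t ht hq
    obtain ⟨q1, q2, q3, q4⟩ := hq ht
    set s := s1 + (t:ℂ) * d with hs
    have hF : ContinuousAt (fun s => F (zz z0 N s)) s := (F_hasDerivAt hm q1).continuousAt
    have hE := EE_pos hC.bx.lpos s
    have hq4 : ContinuousAt (fun s => ‖Hd F z0 N s / (F (zz z0 N s) - a) - σ * EE l s‖) s :=
      (((Hd_cont hm q1).div (hF.sub continuousAt_const) (sub_ne_zero.2 q2)).sub
        (continuousAt_const.mul (EE_cont l).continuousAt)).norm
    have hev : ∀ᶠ s in 𝓝 s, zz z0 N s ∉ P ∧ F (zz z0 N s) ≠ a ∧ ‖F (zz z0 N s) - a‖ < r ∧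
        ‖Hd F z0 N s / (F (zz z0 N s) - a) - σ * EE l s‖ < 1/2 * ‖EE l s‖ := by
      refine (P_ev hm q1).and ((hF.eventually_ne q2).and
        (((hF.sub continuousAt_const).norm.eventually_lt continuousAt_const q3).and
        (hq4.eventually_lt (continuousAt_const.mul (EE_cont l).continuousAt.norm) ?_)))
      unfold e3 at q4; linarith
    filter_upwards [hcs.continuousAt.eventually hev] with t' ⟨w1, w2, w3, w4⟩ ht'
    exact hC.gapL hσ ha (hL t' ht'.1 ht'.2) w1 w2 w3 w4.le
  · intro t ht hq _
    have hq' : ∀ t' : ℝ, 0 ≤ t' → t' < t → Deep F P z0 N l r a σ (s1 + t' * d) := fun t' h1 h2 =>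
      hq t' h1 h2 ⟨h1, (h2.le.trans ht.2)⟩
    have hb' : ∀ t' : ℝ, 0 ≤ t' → t' < t → ‖F (zz z0 N (s1 + t' * d)) - a‖ ≤ r / 2 := fun t' h1 h2 =>
      hb t' h1 (h2.le.trans ht.2) fun t'' h3 h4 => hq' t'' h3 (lt_of_le_of_lt h4 h2)
    have hne : (𝓝[<] t).NeBot := inferInstance
    have hev : ∀ᶠ t' in 𝓝[<] t, 0 ≤ t' ∧ t' < t := by
      have : Ioo 0 t ∈ 𝓝[<] t := Ioo_mem_nhdsLT ht.1
      filter_upwards [this] with t' h using ⟨h.1.le, h.2⟩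
    have hT : Tendsto (fun t' : ℝ => s1 + (t':ℂ) * d) (𝓝[<] t) (𝓝 (s1 + t * d)) :=
      hcs.continuousAt.tendsto.mono_left nhdsWithin_le_nhds
    set s := s1 + (t:ℂ) * d with hs
    have hsL : ‖s‖ ≤ L := hL t ht.1.le ht.2
    have hp : zz z0 N s ∉ P := by
      intro hp
      have h2 : Tendsto (fun t' : ℝ => zz z0 N (s1 + (t':ℂ) * d)) (𝓝[<] t) (𝓝[Pᶜ] (zz z0 N s)) :=
        tendsto_nhdsWithin_iff.2 ⟨(zz_cont z0 N).continuousAt.tendsto.comp hT, hev.mono fun t' h => (hq' t' h.1 h.2).1⟩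
      have h3 := ((hm.2.2 _ hp).comp h2).eventually_gt_atTop (‖a‖ + r)
      obtain ⟨t', h4, h5⟩ := (h3.and hev).exists
      have h6 := hb' t' h5.1 h5.2
      have h7 := norm_le_norm_add_norm_sub a (F (zz z0 N (s1 + t' * d)))
      simp only [Function.comp] at h4
      rw [norm_sub_rev] at h7
      have := hC.rpos
      linarith
    have hF : ContinuousAt (fun s => F (zz z0 N s)) s := (F_hasDerivAt hm hp).continuousAt
    have hTF : Tendsto (fun t' : ℝ => F (zz z0 N (s1 + (t':ℂ) * d))) (𝓝[<] t) (𝓝 (F (zz z0 N s))) := hF.tendsto.comp hT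
    have hTH : Tendsto (fun t' : ℝ => Hd F z0 N (s1 + (t':ℂ) * d)) (𝓝[<] t) (𝓝 (Hd F z0 N s)) := (Hd_cont hm hp).tendsto.comp hT
    have hTE : Tendsto (fun t' : ℝ => EE l (s1 + (t':ℂ) * d)) (𝓝[<] t) (𝓝 (EE l s)) := (EE_cont l).continuousAt.tendsto.comp hT
    have h2 : ‖F (zz z0 N s) - a‖ ≤ r / 2 := le_of_tendsto (hTF.sub_const a).norm (hev.mono fun t' h => hb' t' h.1 h.2)
    have h1 : F (zz z0 N s) ≠ a := by
      intro h0
      obtain ⟨-, -, -, -, -, -, -, -, -, -, hne0⟩ := hC.formula hsL hp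
      have h4 : ‖Hd F z0 N s‖ ≤ 2 * ‖EE l s‖ * ‖F (zz z0 N s) - a‖ := by
        refine le_of_tendsto_of_tendsto hTH.norm ((hTE.norm.const_mul 2).mul (hTF.sub_const a).norm) ?_
        filter_upwards [hev] with t' ht'
        obtain ⟨q1, q2, q3, q4⟩ := hq' t' ht'.1 ht'.2
        have h7 := norm_le_norm_add_norm_sub (σ * EE l (s1 + (t':ℂ) * d)) (Hd F z0 N (s1 + (t':ℂ) * d) / (F (zz z0 N (s1 + (t':ℂ) * d)) - a))
        have hs1 : |σ| = 1 := by rcases hσ with rfl | rfl <;> simp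
        rw [norm_sub_rev, norm_mul, Complex.norm_real, Real.norm_eq_abs, hs1, norm_div] at h7
        have : ‖Hd F z0 N (s1 + (t':ℂ) * d)‖ / ‖F (zz z0 N (s1 + (t':ℂ) * d)) - a‖ ≤ 2 * ‖EE l (s1 + (t':ℂ) * d)‖ := by
          have hE := EE_pos hC.bx.lpos (s1 + (t':ℂ) * d)
          unfold e3 at q4; linarith
        rwa [div_le_iff₀ (norm_pos_iff.2 (sub_ne_zero.2 q2))] at this
      rw [h0, sub_self, norm_zero, mul_zero] at h4
      exact hne0 (norm_le_zero_iff.1 h4)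
    refine ⟨hp, h1, by have := hC.rpos; linarith, ?_⟩
    exact le_of_tendsto_of_tendsto ((hTH.div (hTF.sub_const a) (sub_ne_zero.2 h1)).sub (hTE.const_mul _)).norm (hTE.norm.const_mul _)
      (hev.mono fun t' h => (hq' t' h.1 h.2).2.2.2)

theorem deep_log (hm : MeroPlane F P) {a : ℂ} {σ : ℝ} {s1 d : ℂ} {B B' : ℝ → ℝ} (hB0 : B 0 = 0) (hB : ∀ τ, HasDerivAt B (B' τ) τ)
    {τ : ℝ} (hτ : 0 ≤ τ) (hBE : ∀ τ', 0 ≤ τ' → τ' ≤ τ → ‖EE l (s1 + τ' * d)‖ * ‖d‖ ≤ B' τ')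
    (h : ∀ τ' : ℝ, 0 ≤ τ' → τ' ≤ τ → Deep F P z0 N l r a σ (s1 + τ' * d)) :
    |Real.log ‖F (zz z0 N (s1 + τ * d)) - a‖ - Real.log ‖F (zz z0 N s1) - a‖ - σ * (Zt l (s1 + τ * d) - Zt l s1).re| ≤ e3 * B τ := by
  set φ : ℝ → ℝ := fun τ => Real.log ‖F (zz z0 N (s1 + τ * d)) - a‖ - Real.log ‖F (zz z0 N s1) - a‖ - σ * (Zt l (s1 + τ * d) - Zt l s1).re with hφ
  set φ' : ℝ → ℝ := fun τ => ((Hd F z0 N (s1 + τ * d) / (F (zz z0 N (s1 + τ * d)) - a) - σ * EE l (s1 + τ * d)) * d).re with hφ'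
  have hder : ∀ τ' : ℝ, 0 ≤ τ' → τ' ≤ τ → HasDerivAt φ (φ' τ') τ' := by
    intro t h1 h2
    obtain ⟨q1, q2, q3, q4⟩ := h t h1 h2
    have d1 := ((F_hasDerivAt (N := N) hm q1).comp t (seg_deriv s1 d t)).sub_const a
    have d2 := log_norm_deriv d1 (sub_ne_zero.2 q2)
    have d3 := ((Zt_hasDerivAt l _).comp t (seg_deriv s1 d t)).sub_const (Zt l s1)
    have d4 : HasDerivAt (fun τ : ℝ => (Zt l (s1 + τ * d) - Zt l s1).re) ((EE l (s1 + t * d) * d).re) t :=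
      (Complex.reCLM.hasFDerivAt.comp_hasDerivAt t d3)
    refine ((d2.sub_const (Real.log ‖F (zz z0 N s1) - a‖)).sub (d4.const_mul σ)).congr_deriv ?_
    simp only [hφ', Function.comp]
    rw [sub_mul, Complex.sub_re, mul_assoc (σ:ℂ), Complex.re_ofReal_mul, div_mul_eq_mul_div]
  have hφ0 : φ 0 = 0 := by simp [hφ]
  have := image_norm_le_of_norm_deriv_right_le_deriv_boundary (f := φ) (f' := φ') (a := 0) (b := τ) (B := fun t => e3 * B t) (B' := fun t => e3 * B' t)
    (fun x hx => (hder x hx.1 hx.2).continuousAt.continuousWithinAt) (fun x hx => (hder x hx.1 hx.2.le).hasDerivWithinAt)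
    (by rw [hφ0, hB0]; simp) (fun x => (hB x).const_mul e3) (fun x hx => by
      obtain ⟨q1, q2, q3, q4⟩ := h x hx.1 hx.2.le
      refine (Complex.abs_re_le_norm _).trans ?_
      rw [norm_mul]
      have h1 := mul_le_mul_of_nonneg_right q4 (norm_nonneg d)
      have h2 := hBE x hx.1 hx.2.le
      have : 0 < e3 := by unfold e3; norm_num
      nlinarith) (x := τ) ⟨hτ, le_rfl⟩
  exact this

theorem Cx.CL (hC : Cx F P Sing M z0 N l L κ ε r g Dm) {a : ℂ} {σ : ℝ} (hσ : σ = 1 ∨ σ = -1) (ha : a ∈ Sing) {s1 d : ℂ}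
    (hL : ∀ τ : ℝ, 0 ≤ τ → τ ≤ 1 → ‖s1 + τ * d‖ ≤ L) (hD : Deep F P z0 N l r a σ s1)
    {B B' : ℝ → ℝ} (hB0 : B 0 = 0) (hB : ∀ τ, HasDerivAt B (B' τ) τ)
    (hBE : ∀ τ : ℝ, 0 ≤ τ → τ ≤ 1 → ‖EE l (s1 + τ * d)‖ * ‖d‖ ≤ B' τ)
    (h : ∀ τ : ℝ, 0 ≤ τ → τ ≤ 1 → Real.log ‖F (zz z0 N s1) - a‖ + σ * (Zt l (s1 + τ * d) - Zt l s1).re + e3 * B τ ≤ Real.log (r/2)) :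
    ∀ τ : ℝ, 0 ≤ τ → τ ≤ 1 → Deep F P z0 N l r a σ (s1 + τ * d) ∧
      |Real.log ‖F (zz z0 N (s1 + τ * d)) - a‖ - Real.log ‖F (zz z0 N s1) - a‖ - σ * (Zt l (s1 + τ * d) - Zt l s1).re| ≤ e3 * B τ := by
  have hm := hC.bx.nice.mero
  have hall := hC.CL0 hσ ha hL hD (fun τ h1 h2 hd => by
    have h3 := (abs_le.1 (deep_log hm hB0 hB h1 (fun τ' h3 h4 => hBE τ' h3 (h4.trans h2)) hd)).2
    have h4 := h τ h1 h2
    have hp : 0 < ‖F (zz z0 N (s1 + τ * d)) - a‖ := norm_pos_iff.2 (sub_ne_zero.2 (hd τ h1 le_rfl).2.1)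
    have hr := hC.rpos
    refine (Real.log_le_log_iff hp (by linarith)).1 ?_
    linarith)
  intro τ h1 h2
  exact ⟨hall τ h1 h2, deep_log hm hB0 hB h1 (fun τ' h3 h4 => hBE τ' h3 (h4.trans h2)) (fun τ' h3 h4 => hall τ' h3 (h4.trans h2))⟩

end
end

section
section
variable {F : ℂ → ℂ} {P Sing : Set ℂ} {M : ℕ} {z0 : ℂ} {N l L κ ε r g Dm : ℝ}

theorem EE_exp (l : ℝ) (s1 s : ℂ) : EE l s = EE l s1 * Complex.exp ((s - s1)/2) := by
  unfold EE ee
  rw [show s/2 = s1/2 + (s - s1)/2 by ring, Complex.exp_add]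
  ring_nf

theorem Zt_EE (l : ℝ) (s : ℂ) : Zt l s = 2 * EE l s := by unfold Zt EE; ring

theorem EE_ratio (l : ℝ) {s1 s : ℂ} {ρ : ℝ} (h : ‖s - s1‖ ≤ ρ) : ‖EE l s‖ ≤ ‖EE l s1‖ * Real.exp (ρ/2) := by
  rw [EE_exp l s1 s, norm_mul, Complex.norm_exp]
  gcongr
  have := Complex.re_le_norm (s - s1)
  simp; simp at this; linarith

theorem EE_close (l : ℝ) {s1 s : ℂ} (h : ‖s - s1‖ ≤ 2) : ‖EE l s - EE l s1‖ ≤ ‖EE l s1‖ * ‖s - s1‖ := by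
  have e : EE l s - EE l s1 = EE l s1 * (Complex.exp ((s - s1)/2) - 1) := by rw [EE_exp l s1 s]; ring
  rw [e, norm_mul]
  gcongr
  have h2 : ‖(s - s1)/2‖ = ‖s - s1‖/2 := by simp
  have := Complex.norm_exp_sub_one_le (x := (s-s1)/2) (by rw [h2]; linarith)
  rw [h2] at this; linarith

theorem EE_per (l : ℝ) (s : ℂ) : EE l (s + 4 * Real.pi * Complex.I) = EE l s := by
  rw [EE_exp l s]
  have : (s + 4 * Real.pi * Complex.I - s)/2 = 2 * Real.pi * Complex.I := by ring
  rw [this, Complex.exp_two_pi_mul_I, mul_one]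

theorem Cx.CLball (hC : Cx F P Sing M z0 N l L κ ε r g Dm) {a : ℂ} {σ : ℝ} (hσ : σ = 1 ∨ σ = -1) (ha : a ∈ Sing) {s1 : ℂ} {ρ Mx : ℝ}
    (hL : ∀ s ∈ Metric.ball s1 ρ, ‖s‖ ≤ L) (hD : Deep F P z0 N l r a σ s1) (hMx : ∀ s ∈ Metric.ball s1 ρ, ‖EE l s‖ ≤ Mx)
    (h : Real.log ‖F (zz z0 N s1) - a‖ + 2 * Mx * ρ ≤ Real.log (r/2)) :
    ∀ s ∈ Metric.ball s1 ρ, Deep F P z0 N l r a σ s := by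
  intro s hs
  have hρ : 0 < ρ := Metric.pos_of_mem_ball hs
  have hc : s1 ∈ Metric.ball s1 ρ := Metric.mem_ball_self hρ
  have hM0 : 0 ≤ Mx := (norm_nonneg _).trans (hMx s1 hc)
  have hd : ‖s - s1‖ < ρ := by simpa [dist_eq_norm] using hs
  have hin : ∀ τ : ℝ, 0 ≤ τ → τ ≤ 1 → s1 + τ * (s - s1) ∈ Metric.ball s1 ρ := by
    intro τ h0 h1
    rw [Metric.mem_ball, dist_eq_norm, add_sub_cancel_left, norm_mul, Complex.norm_real, Real.norm_eq_abs, abs_of_nonneg h0]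
    nlinarith [norm_nonneg (s - s1)]
  have := (hC.CL hσ ha (d := s - s1) (fun τ h0 h1 => hL _ (hin τ h0 h1)) hD (B := fun τ => Mx * ρ * τ) (B' := fun _ => Mx * ρ)
    (by simp) (fun τ => by simpa using (hasDerivAt_id τ).const_mul (Mx * ρ))
    (fun τ h0 h1 => mul_le_mul (hMx _ (hin τ h0 h1)) hd.le (norm_nonneg _) hM0) (fun τ h0 h1 => by
      have hz : ‖Zt l (s1 + τ * (s - s1)) - Zt l s1‖ ≤ Mx * ‖s1 + τ * (s - s1) - s1‖ :=
        (convex_ball s1 ρ).norm_image_sub_le_of_norm_hasDerivWithin_le (fun x _ => (Zt_hasDerivAt l x).hasDerivWithinAt) hMx hc (hin τ h0 h1)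
      have h2 : ‖s1 + τ * (s - s1) - s1‖ < ρ := by simpa [dist_eq_norm] using hin τ h0 h1
      have h3 : σ * (Zt l (s1 + τ * (s - s1)) - Zt l s1).re ≤ Mx * ρ := by
        refine (le_abs_self _).trans ?_
        rw [abs_mul, show |σ| = 1 by rcases hσ with rfl | rfl <;> simp, one_mul]
        refine (Complex.abs_re_le_norm _).trans (hz.trans ?_)
        gcongr
      have h4 : e3 * (Mx * ρ * τ) ≤ Mx * ρ := by
        have : Mx * ρ * τ ≤ Mx * ρ := mul_le_of_le_one_right (by positivity) h1
        have h0' : 0 ≤ Mx * ρ * τ := by positivity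
        unfold e3; linarith
      linarith) 1 zero_le_one le_rfl).1
  simpa using this

theorem Cx.deep_ball (hC : Cx F P Sing M z0 N l L κ ε r g Dm) {a : ℂ} {σ : ℝ} (hI : Isol Sing a r) {s1 : ℂ} {ρ : ℝ} (hρ : 0 < ρ)
    (hL : ∀ s ∈ Metric.ball s1 ρ, ‖s‖ ≤ L) (hD : ∀ s ∈ Metric.ball s1 ρ, Deep F P z0 N l r a σ s) :
    ∃ U G : ℂ → ℂ, TractLift F P a r G ∧ ∀ s ∈ Metric.ball s1 ρ, HasDerivAt U (Hd F z0 N s / (F (zz z0 N s) - a)) s ∧ U s ∈ HL r ∧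
      Complex.exp (U s) = F (zz z0 N s) - a ∧ G (U s) = zz z0 N s := by
  have hm := hC.bx.nice.mero
  have hder : ∀ s ∈ Metric.ball s1 ρ, HasDerivAt (fun s => F (zz z0 N s) - a) (Hd F z0 N s) s := fun s hs =>
    (F_hasDerivAt hm (hD s hs).1).sub_const a
  obtain ⟨U, hU⟩ := exists_log_ball (f := fun s => F (zz z0 N s) - a) hρ (fun w hw => ⟨(hder w hw).differentiableAt, sub_ne_zero.2 (hD w hw).2.1⟩)
  have hH : ∀ s ∈ Metric.ball s1 ρ, U s ∈ HL r := fun s hs => (HL_norm hC.rpos).2 (by rw [(hU s hs).2]; exact (hD s hs).2.2.1)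
  have hc : s1 ∈ Metric.ball s1 ρ := Metric.mem_ball_self hρ
  obtain ⟨G, hG, hGu⟩ := exists_tractLift hC.bx.nice hI (hD s1 hc).1 (hH s1 hc) (by rw [(hU s1 hc).2]; ring)
  refine ⟨U, G, hG, fun s hs => ⟨?_, hH s hs, (hU s hs).2, ?_⟩⟩
  · have := (hU s hs).1
    rwa [(hder s hs).deriv] at this
  · refine lift_unique hm (convex_ball s1 ρ).isPreconnected (G₁ := fun s => G (U s)) (G₂ := zz z0 N)
      (hG.cont.comp (fun x hx => (hU x hx).1.continuousAt.continuousWithinAt) hH) (zz_cont z0 N).continuousOn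
      (fun x hx => hG.good _ (hH x hx)) (fun x hx => hC.bx.good x (hL x hx) (hD x hx).1) (fun x hx => ?_) hc hGu s hs
    simp only [hG.eq _ (hH x hx), (hU x hx).2]; ring

theorem Cx.deep_solve (hC : Cx F P Sing M z0 N l L κ ε r g Dm) {a : ℂ} {σ : ℝ} (hσ : σ = 1 ∨ σ = -1) {w0 y : ℂ} {U : ℂ → ℂ}
    (hD : ∀ s ∈ Metric.closedBall w0 (1/10), Deep F P z0 N l r a σ s ∧ HasDerivAt U (Hd F z0 N s / (F (zz z0 N s) - a)) s)
    (hy : ‖y - U w0‖ ≤ ‖EE l w0‖ / 20) : ∃ w ∈ Metric.closedBall w0 (1/10), U w = y := by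
  have hE := EE_pos hC.bx.lpos w0
  have hs1 : |σ| = 1 := by rcases hσ with rfl | rfl <;> simp
  have hn : ‖(σ:ℂ) * EE l w0‖ = ‖EE l w0‖ := by rw [norm_mul, Complex.norm_real, Real.norm_eq_abs, hs1, one_mul]
  refine solve (c := σ * EE l w0) (norm_pos_iff.1 (by rw [hn]; exact hE)) (by norm_num) (fun w hw => ?_) (by rw [hn]; linarith)
  obtain ⟨h1, h2⟩ := hD w hw
  refine ⟨h2.differentiableAt, ?_⟩
  rw [h2.deriv, hn]
  have hd : ‖w - w0‖ ≤ 1/10 := by simpa [dist_eq_norm] using hw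
  have h3 := EE_close l (s1 := w0) (s := w) (by linarith)
  have h4 := norm_le_norm_add_norm_sub (EE l w0) (EE l w)
  rw [norm_sub_rev] at h4
  have h5 : ‖EE l w0‖ * ‖w - w0‖ ≤ ‖EE l w0‖ * (1/10) := by gcongr
  have e : Hd F z0 N w / (F (zz z0 N w) - a) - σ * EE l w0 = (Hd F z0 N w / (F (zz z0 N w) - a) - σ * EE l w) + σ * (EE l w - EE l w0) := by ring
  rw [e]
  refine (norm_add_le _ _).trans ?_
  rw [norm_mul, Complex.norm_real, Real.norm_eq_abs, hs1, one_mul]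
  have := h1.2.2.2
  unfold e3 at this
  linarith

end
end

section
structure Dx (F : ℂ → ℂ) (P Sing : Set ℂ) (M : ℕ) (z0 : ℂ) (N l L κ ε r g Dm : ℝ) : Prop where
  cx : Cx F P Sing M z0 N l L κ ε r g Dm
  big : ∀ s : ℂ, ‖s‖ ≤ L → |Real.log (r/2)| + κ + 7 * M + |Real.log (r * g^2 / (1000 * Dm^2))| ≤ e3 * ‖EE l s‖
  κ1 : 4 ≤ κ
  κ2 : Real.exp (-(κ/32)) * (8 * Dm) ≤ r

section
variable {F : ℂ → ℂ} {P Sing : Set ℂ} {M : ℕ} {z0 : ℂ} {N l L κ ε r g Dm : ℝ}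

theorem Cx.isol (hC : Cx F P Sing M z0 N l L κ ε r g Dm) {a : ℂ} (ha : a ∈ Sing) : Isol Sing a r := by
  refine ⟨hC.rpos, fun c h1 h2 hc => ?_⟩
  have h3 := (hC.gap c hc a ha (fun h => by simp [h] at h1)).1
  have h4 := hC.hrg
  have h5 := hC.gpos
  unfold e3 at h4
  linarith

theorem Dx.big1 (hX : Dx F P Sing M z0 N l L κ ε r g Dm) {s : ℂ} (hs : ‖s‖ ≤ L) :
    -(e3 * ‖EE l s‖) ≤ Real.log (r/2) ∧ κ ≤ e3 * ‖EE l s‖ ∧ 7 * M ≤ e3 * ‖EE l s‖ ∧ -(e3 * ‖EE l s‖) ≤ Real.log (r * g^2 / (1000 * Dm^2)) := by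
  have h1 := hX.big s hs
  have h2 := neg_abs_le (Real.log (r/2))
  have h3 := hX.cx.κpos
  have h4 := abs_nonneg (Real.log (r/2))
  have h5 : (0:ℝ) ≤ M := Nat.cast_nonneg M
  have h6 := neg_abs_le (Real.log (r * g^2 / (1000 * Dm^2)))
  have h7 := abs_nonneg (Real.log (r * g^2 / (1000 * Dm^2)))
  refine ⟨?_, ?_, ?_, ?_⟩ <;> linarith

theorem Dx.SV (hX : Dx F P Sing M z0 N l L κ ε r g Dm) {a : ℂ} {σ : ℝ} (hσ : σ = 1 ∨ σ = -1) (ha : a ∈ Sing) {s1 : ℂ}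
    (hs1 : ‖s1‖ ≤ L - 15) (hD : Deep F P z0 N l r a σ s1) : -Real.log ‖F (zz z0 N s1) - a‖ < 10^5 * ‖EE l s1‖ := by
  by_contra hcon
  push Not at hcon
  have hC := hX.cx
  have hE := EE_pos hC.bx.lpos s1
  have hs : |σ| = 1 := by rcases hσ with rfl | rfl <;> simp
  have hexp : Real.exp (15/2) ≤ 3000 := by
    have h1 : Real.exp (15/2) ≤ Real.exp 8 := Real.exp_le_exp.2 (by norm_num)
    have h2 : Real.exp 8 = (Real.exp 1)^8 := by rw [← Real.exp_nat_mul]; norm_num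
    have h3 : (Real.exp 1)^8 ≤ 2.7182818286^8 := by gcongr; exact Real.exp_one_lt_d9.le
    have h4 : (2.7182818286:ℝ)^8 ≤ 3000 := by norm_num
    linarith
  have hL : ∀ s ∈ Metric.ball s1 15, ‖s‖ ≤ L := by
    intro s hs
    have h1 : ‖s - s1‖ < 15 := by simpa [dist_eq_norm] using hs
    have := norm_le_norm_add_norm_sub s1 s
    rw [norm_sub_rev] at this; linarith
  have hMx : ∀ s ∈ Metric.ball s1 15, ‖EE l s‖ ≤ ‖EE l s1‖ * 3000 := by
    intro s hs
    have h1 : ‖s - s1‖ < 15 := by simpa [dist_eq_norm] using hs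
    refine (EE_ratio l h1.le).trans ?_
    gcongr
  have hD' := hC.CLball hσ ha hL hD hMx (by
    have := (hX.big1 (s := s1) (by linarith)).1
    unfold e3 at this
    linarith)
  obtain ⟨U, G, hG, hU⟩ := hC.deep_ball (hC.isol ha) (by norm_num) hL hD'
  have hpi : Real.pi < 3.15 := Real.pi_lt_d2
  have hpi3 := Real.pi_gt_three
  set w0 := s1 + 4 * Real.pi * Complex.I with hw0
  have hn : ‖w0 - s1‖ = 4 * Real.pi := by
    rw [hw0, add_sub_cancel_left]; simp [abs_of_pos Real.pi_pos]
  have hw0b : w0 ∈ Metric.ball s1 15 := by rw [Metric.mem_ball, dist_eq_norm, hn]; linarith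
  have hc : s1 ∈ Metric.ball s1 15 := Metric.mem_ball_self (by norm_num)
  have hsub : ∀ s ∈ Metric.closedBall w0 (1/10), s ∈ Metric.ball s1 15 ∧ s ≠ s1 := by
    intro s hs
    have h1 : ‖s - w0‖ ≤ 1/10 := by simpa [dist_eq_norm] using hs
    constructor
    · rw [Metric.mem_ball, dist_eq_norm]
      have := norm_sub_le_norm_sub_add_norm_sub s w0 s1
      rw [hn] at this; linarith
    · rintro rfl
      rw [norm_sub_rev, hn] at h1; linarith
  have hdiff : ‖U s1 - U w0‖ ≤ ‖EE l w0‖ / 20 := by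
    have h1 := (convex_ball s1 15).norm_image_sub_le_of_norm_hasDerivWithin_le (f := fun s => U s - σ * Zt l s) (C := e3 * (‖EE l s1‖ * 3000))
      (fun x hx => ((hU x hx).1.sub ((Zt_hasDerivAt l x).const_mul _)).hasDerivWithinAt) (fun x hx => ?_) hw0b hc
    · have hp : EE l w0 = EE l s1 := EE_per l s1
      have e : U s1 - σ * Zt l s1 - (U w0 - σ * Zt l w0) = U s1 - U w0 := by rw [Zt_EE, Zt_EE, hp]; ring
      simp only [e] at h1
      rw [norm_sub_rev s1, hn] at h1
      refine h1.trans ?_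
      rw [hp]
      unfold e3
      nlinarith
    · refine ((hD' x hx).2.2.2).trans ?_
      have : 0 < e3 := by unfold e3; norm_num
      exact mul_le_mul_of_nonneg_left (hMx x hx) this.le
  obtain ⟨w, hw, hUw⟩ := hC.deep_solve hσ (fun s hs => ⟨hD' s (hsub s hs).1, (hU s (hsub s hs).1).1⟩) hdiff
  refine (hsub w hw).2 (hC.bx.inj w s1 (hL _ (hsub w hw).1) (hL _ hc) ?_)
  rw [← (hU w (hsub w hw).1).2.2.2, hUw, (hU s1 hc).2.2.2]

theorem Dx.proper (hX : Dx F P Sing M z0 N l L κ ε r g Dm) {a : ℂ} {σ : ℝ} (hσ : σ = 1 ∨ σ = -1) (ha : a ∈ Sing) {s1 : ℂ}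
    (hs1 : ‖s1‖ ≤ L - 1) (hD : Deep F P z0 N l r a σ s1) (hdep : Real.log ‖F (zz z0 N s1) - a‖ ≤ -‖EE l s1‖) :
    ∃ (u : ℂ) (G : ℂ → ℂ), TractLift F P a r G ∧ ProperLift r G ∧ u ∈ HL r ∧ Complex.exp u = F (zz z0 N s1) - a ∧ G u = zz z0 N s1 := by
  have hC := hX.cx
  have hE := EE_pos hC.bx.lpos s1
  have hL : ∀ s ∈ Metric.ball s1 (1/5), ‖s‖ ≤ L := by
    intro s hs
    have h1 : ‖s - s1‖ < 1/5 := by simpa [dist_eq_norm] using hs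
    have := norm_le_norm_add_norm_sub s1 s
    rw [norm_sub_rev] at this; linarith
  have hMx : ∀ s ∈ Metric.ball s1 (1/5), ‖EE l s‖ ≤ ‖EE l s1‖ * 2 := by
    intro s hs
    have h1 : ‖s - s1‖ < 1/5 := by simpa [dist_eq_norm] using hs
    have h2 := EE_close l (s1 := s1) (s := s) (by linarith)
    have h3 := norm_le_norm_add_norm_sub (EE l s1) (EE l s)
    rw [norm_sub_rev] at h3
    nlinarith
  obtain ⟨b1, -, b3, -⟩ := hX.big1 (s := s1) (by linarith)
  unfold e3 at b1 b3
  have hD' := hC.CLball hσ ha hL hD hMx (by linarith)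
  obtain ⟨U, G, hG, hU⟩ := hC.deep_ball (hC.isol ha) (by norm_num) hL hD'
  have hc : s1 ∈ Metric.ball s1 (1/5) := Metric.mem_ball_self (by norm_num)
  have hsub : ∀ s ∈ Metric.closedBall s1 (1/10), s ∈ Metric.ball s1 (1/5) := fun s hs => Metric.closedBall_subset_ball (by norm_num) hs
  refine ⟨U s1, G, hG, ?_, (hU s1 hc).2.1, (hU s1 hc).2.2.1, (hU s1 hc).2.2.2⟩
  refine dichotomy hC.bx.nice (hC.isol ha) hG (hU s1 hc).2.1 (fun k hk1 hk2 hk => ?_)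
  obtain ⟨w, hw, hUw⟩ := hC.deep_solve (y := U s1 + k * (2 * Real.pi * Complex.I)) hσ (fun s hs => ⟨hD' s (hsub s hs), (hU s (hsub s hs)).1⟩) (by
    rw [add_sub_cancel_left]
    have h1 : ‖(k:ℂ) * (2 * Real.pi * Complex.I)‖ = k * (2 * Real.pi) := by simp [abs_of_pos Real.pi_pos]
    have h2 : (k:ℝ) ≤ M := by exact_mod_cast hk2
    rw [h1]
    nlinarith [Real.pi_lt_d2, Real.pi_pos])
  have h3 : w = s1 := hC.bx.inj w s1 (hL _ (hsub w hw)) (hL _ hc) (by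
    rw [← (hU w (hsub w hw)).2.2.2, hUw, hk, (hU s1 hc).2.2.2])
  rw [h3] at hUw
  have h4 : (k:ℂ) * (2 * Real.pi * Complex.I) = 0 := by
    have := hUw; rw [left_eq_add] at this; exact this
  have hk0 : (k:ℂ) ≠ 0 := by exact_mod_cast (by omega : k ≠ 0)
  exact mul_ne_zero hk0 Complex.two_pi_I_ne_zero h4

end
end

section
def LC (F : ℂ → ℂ) (P : Set ℂ) (z0 : ℂ) (N l κ : ℝ) (a b : ℂ) (σ : ℝ) (s1 : ℂ) : Prop :=
  ∀ s : ℂ, ‖s - s1‖ * ‖EE l s1‖ < κ → (zz z0 N s ∉ P → F (zz z0 N s) ≠ a ∧ F (zz z0 N s) ≠ b) ∧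
    ∃ D, HasDerivAt (fun s => kf a b F P (zz z0 N s)) (D * kf a b F P (zz z0 N s)) s ∧ ‖D - σ * EE l s‖ ≤ e3/4 * ‖EE l s‖

section
variable {F : ℂ → ℂ} {P Sing : Set ℂ} {M : ℕ} {z0 : ℂ} {N l L κ ε r g Dm : ℝ} {a b s1 s : ℂ} {σ : ℝ}

theorem kf_swap (a b z : ℂ) : kf b a F P z = (kf a b F P z)⁻¹ := by
  unfold kf; split_ifs <;> simp

theorem LC.kf_ne (h : LC F P z0 N l κ a b σ s1) (hs : ‖s - s1‖ * ‖EE l s1‖ < κ) : kf a b F P (zz z0 N s) ≠ 0 := by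
  unfold kf
  split_ifs with hp
  · simp
  · exact div_ne_zero (sub_ne_zero.2 ((h s hs).1 hp).1) (sub_ne_zero.2 ((h s hs).1 hp).2)

theorem LC.swap (h : LC F P z0 N l κ a b σ s1) : LC F P z0 N l κ b a (-σ) s1 := by
  intro s hs
  obtain ⟨h1, D, h2, h3⟩ := h s hs
  have h0 := h.kf_ne hs
  refine ⟨fun hp => (h1 hp).symm, -D, ?_, ?_⟩
  · simp only [kf_swap a b]
    refine (h2.fun_inv h0).congr_deriv ?_
    field_simp
  · have : -D - ((-σ:ℝ):ℂ) * EE l s = -(D - σ * EE l s) := by push_cast; ring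
    rw [this, norm_neg]; exact h3

theorem Cx.exLC (hC : Cx F P Sing M z0 N l L κ ε r g Dm) (hs : ‖s1‖ ≤ L) (hσ : σ = 1 ∨ σ = -1) :
    ∃ a ∈ Sing, ∃ b ∈ Sing, a ≠ b ∧ LC F P z0 N l κ a b σ s1 := by
  obtain ⟨a, ha, b, hb, hab, h⟩ := hC.bx.lc s1 hs
  have key : LC F P z0 N l κ a b 1 s1 := by
    intro s hs'
    have hn : ‖EE l s1‖ = 2 * ‖ee l s1‖ := by rw [EE_norm, ee_norm]
    obtain ⟨h1, D, h2, h3⟩ := h s (by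
      rw [hn] at hs'
      have : 0 ≤ ‖s - s1‖ * ‖ee l s1‖ := by positivity
      linarith)
    refine ⟨h1, D, h2, ?_⟩
    simpa using h3.trans (mul_le_mul_of_nonneg_right hC.hε (norm_nonneg _))
  rcases hσ with rfl | rfl
  · exact ⟨a, ha, b, hb, hab, key⟩
  · exact ⟨b, hb, a, ha, hab.symm, key.swap⟩

theorem Cx.pair_deep (hC : Cx F P Sing M z0 N l L κ ε r g Dm) (hσ : σ = 1 ∨ σ = -1) (ha : a ∈ Sing) (hb : b ∈ Sing) (hab : a ≠ b)
    (h : LC F P z0 N l κ a b σ s1) (hs : ‖s - s1‖ * ‖EE l s1‖ < κ) (hp : zz z0 N s ∉ P) (h2 : ‖F (zz z0 N s) - a‖ < r) :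
    Deep F P z0 N l r a σ s := by
  obtain ⟨h1, D, h3, h4⟩ := h s hs
  obtain ⟨n1, n2⟩ := h1 hp
  refine ⟨hp, n1, h2, ?_⟩
  have hf := kf_formula hC.bx.nice.mero hp n2 h3 hab
  have hab' : a - b ≠ 0 := sub_ne_zero.2 hab
  have hH : F (zz z0 N s) - a ≠ 0 := sub_ne_zero.2 n1
  have e : Hd F z0 N s / (F (zz z0 N s) - a) = (1 + (F (zz z0 N s) - a) / (a - b)) * D := by
    rw [hf]; field_simp; ring
  rw [e]
  exact gap_aux (by rcases hσ with rfl | rfl <;> simp) hC.gpos (EE_pos hC.bx.lpos s) h4 h2 (hC.gap a ha b hb hab).1 hC.hrg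

theorem Cx.deep_LC (hC : Cx F P Sing M z0 N l L κ ε r g Dm) (hσ : σ = 1 ∨ σ = -1) (ha : a ∈ Sing) (hs : ‖s1‖ ≤ L)
    (hD : Deep F P z0 N l r a σ s1) : ∃ b ∈ Sing, a ≠ b ∧ LC F P z0 N l κ a b σ s1 := by
  obtain ⟨a', ha', b', hb', hab, h⟩ := hC.exLC hs (Or.inl rfl)
  have h0 : ‖s1 - s1‖ * ‖EE l s1‖ < κ := by simpa using hC.κpos
  have hE := EE_pos hC.bx.lpos s1
  obtain ⟨q1, q2, q3, q4⟩ := hD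
  have q5 : ‖Hd F z0 N s1 / (F (zz z0 N s1) - a) - σ * EE l s1‖ ≤ 1/2 * ‖EE l s1‖ := by unfold e3 at q4; linarith
  by_cases c1 : a = a'
  · subst c1
    have := sign_aux hσ (Or.inl rfl) hE (hC.pair_deep (Or.inl rfl) ha hb' hab h h0 q1 q3).2.2.2 q5
    rw [this]; exact ⟨b', hb', hab, h⟩
  by_cases c2 : a = b'
  · subst c2
    have := sign_aux hσ (Or.inr rfl) hE (hC.pair_deep (Or.inr rfl) ha ha' hab.symm h.swap h0 q1 q3).2.2.2 q5
    rw [this]; exact ⟨a', ha', hab.symm, h.swap⟩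
  obtain ⟨h1, D, h3, h4⟩ := h s1 h0
  exact (hC.notpair hσ ha ha' hb' q2 q3 q5 hab (by simpa using h4) (kf_formula hC.bx.nice.mero q1 (h1 q1).2 h3 hab) c1 c2).elim

theorem Dx.kdeep (hX : Dx F P Sing M z0 N l L κ ε r g Dm) (hσ : σ = 1 ∨ σ = -1) (ha : a ∈ Sing) (hb : b ∈ Sing) (hab : a ≠ b)
    (h : LC F P z0 N l κ a b σ s1) (hs : ‖s - s1‖ * ‖EE l s1‖ < κ) (hk : Real.log ‖kf a b F P (zz z0 N s)‖ ≤ -(κ/16)) :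
    Deep F P z0 N l r a σ s ∧ ‖F (zz z0 N s) - a‖ ≤ r/2 := by
  have hC := hX.cx
  obtain ⟨g1, g2⟩ := hC.gap a ha b hb hab
  have hg := hC.gpos
  have hr := hC.rpos
  have hrg := hC.hrg
  have h0 := norm_pos_iff.2 (h.kf_ne hs)
  have h1 : ‖kf a b F P (zz z0 N s)‖ ≤ Real.exp (-(κ/32)) := by
    rw [Real.log_le_iff_le_exp h0] at hk
    exact hk.trans (Real.exp_le_exp.2 (by linarith [hC.κpos]))
  have h2 : ‖kf a b F P (zz z0 N s)‖ * (8 * Dm) ≤ r := (mul_le_mul_of_nonneg_right h1 (by linarith)).trans hX.κ2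
  have h3 : ‖kf a b F P (zz z0 N s)‖ ≤ 1/8 := by
    unfold e3 at hrg
    by_contra hc
    push Not at hc
    nlinarith
  have hp : zz z0 N s ∉ P := by
    intro hp
    simp [kf, hp] at h3
    norm_num at h3
  obtain ⟨n1, n2⟩ := (h s hs).1 hp
  have hfin : ‖F (zz z0 N s) - a‖ ≤ r/2 := by
    have e : (F (zz z0 N s) - a) * (1 - kf a b F P (zz z0 N s)) = kf a b F P (zz z0 N s) * (a - b) := by
      simp only [kf, hp, if_false]
      have := sub_ne_zero.2 n2
      field_simp
      ring
    have e2 := congrArg norm e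
    rw [norm_mul, norm_mul] at e2
    have h4 : 7/8 ≤ ‖1 - kf a b F P (zz z0 N s)‖ := by
      have := norm_sub_norm_le (1:ℂ) (kf a b F P (zz z0 N s))
      rw [norm_one] at this; linarith
    have h5 : ‖kf a b F P (zz z0 N s)‖ * ‖a - b‖ ≤ ‖kf a b F P (zz z0 N s)‖ * Dm := by gcongr
    nlinarith [norm_nonneg (F (zz z0 N s) - a)]
  exact ⟨hC.pair_deep hσ ha hb hab h hs hp (by linarith), hfin⟩

theorem Dx.move (hX : Dx F P Sing M z0 N l L κ ε r g Dm) (hσ : σ = 1 ∨ σ = -1) (hs1 : ‖s1‖ ≤ L)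
    (h : LC F P z0 N l κ a b σ s1) {d : ℂ} (hd : ‖d‖ * ‖EE l s1‖ < κ) :
    |Real.log ‖kf a b F P (zz z0 N (s1 + d))‖ - Real.log ‖kf a b F P (zz z0 N s1)‖ - σ * (EE l s1 * d).re| ≤ 2 * e3 * ‖EE l s1‖ * ‖d‖ := by
  have hE := EE_pos hX.cx.bx.lpos s1
  have hs : |σ| = 1 := by rcases hσ with rfl | rfl <;> simp
  have hin : ∀ τ ∈ Icc (0:ℝ) 1, ‖(s1 + τ * d) - s1‖ ≤ ‖d‖ := by
    intro τ hτ
    rw [add_sub_cancel_left, norm_mul, Complex.norm_real, Real.norm_eq_abs, abs_of_nonneg hτ.1]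
    exact mul_le_of_le_one_left (norm_nonneg _) hτ.2
  have hd1 : ‖d‖ < e3 := by
    have := (hX.big1 hs1).2.1
    by_contra hc
    push Not at hc
    nlinarith
  have hin2 : ∀ τ ∈ Icc (0:ℝ) 1, ‖(s1 + τ * d) - s1‖ * ‖EE l s1‖ < κ := fun τ hτ =>
    (mul_le_mul_of_nonneg_right (hin τ hτ) hE.le).trans_lt hd
  choose! D hD1 hD2 using fun τ hτ => (h _ (hin2 τ hτ)).2
  have h3 := (convex_Icc (0:ℝ) 1).norm_image_sub_le_of_norm_hasDerivWithin_le
    (f := fun τ : ℝ => Real.log ‖kf a b F P (zz z0 N (s1 + τ * d))‖ - τ * (σ * (EE l s1 * d).re)) (f' := fun τ => ((D τ - σ * EE l s1) * d).re) (C := 2 * e3 * ‖EE l s1‖ * ‖d‖)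
    (fun τ hτ => ?_) (fun τ hτ => ?_) (left_mem_Icc.2 zero_le_one) (right_mem_Icc.2 zero_le_one)
  · simp [-Complex.mul_re] at h3
    refine le_trans (le_of_eq ?_) h3
    congr 1; ring
  · have h4' : HasDerivAt (fun τ : ℝ => kf a b F P (zz z0 N (s1 + τ * d))) (D τ * kf a b F P (zz z0 N (s1 + τ * d)) * d) τ :=
      HasDerivAt.comp (h₂ := fun s => kf a b F P (zz z0 N s)) τ (hD1 τ hτ) (seg_deriv s1 d τ)
    have h4 := log_norm_deriv h4' (h.kf_ne (hin2 τ hτ))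
    refine ((h4.sub ((hasDerivAt_id τ).mul_const (σ * (EE l s1 * d).re))).congr_deriv ?_).hasDerivWithinAt
    have h0 := h.kf_ne (hin2 τ hτ)
    rw [one_mul, sub_mul, Complex.sub_re, mul_assoc (σ:ℂ), Complex.re_ofReal_mul]
    congr 2
    field_simp
  · refine (Complex.abs_re_le_norm _).trans ?_
    rw [norm_mul]
    gcongr
    have h5 := EE_close l (s1 := s1) (s := s1 + τ * d) (by have := hin τ hτ; unfold e3 at hd1; linarith)
    have h6 : ‖EE l s1‖ * ‖s1 + τ * d - s1‖ ≤ ‖EE l s1‖ * e3 := by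
      gcongr; exact (hin τ hτ).trans hd1.le
    have h7 := norm_le_norm_add_norm_sub (EE l s1) (EE l (s1 + τ * d))
    rw [norm_sub_rev] at h7
    have e : D τ - σ * EE l s1 = (D τ - σ * EE l (s1 + τ * d)) + σ * (EE l (s1 + τ * d) - EE l s1) := by ring
    rw [e]
    refine (norm_add_le _ _).trans ?_
    rw [norm_mul, Complex.norm_real, Real.norm_eq_abs, hs, one_mul]
    have := hD2 τ hτ
    unfold e3 at *
    linarith

end
end

section
section
variable {F : ℂ → ℂ} {P Sing : Set ℂ} {M : ℕ} {z0 : ℂ} {N l L κ ε r g Dm : ℝ} {a b s1 s : ℂ} {σ : ℝ}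

theorem mob_alg {a a' b' z δ : ℂ} (hg : 0 < g) (h1 : ‖a - a'‖ ≤ Dm) (h2 : ‖a - b'‖ ≤ Dm) (h3 : g ≤ ‖a' - b'‖) (hb : a - b' ≠ 0)
    (hk : kf a' b' F P z = (a - a') / (a - b') * (1 + δ)) (hδ : Dm * ‖δ‖ ≤ g/2) (hn : z ∉ P → F z ≠ b') :
    z ∉ P ∧ ‖F z - a‖ * g ≤ 2 * Dm^2 * ‖δ‖ := by
  have hq : ‖(a - a') * δ‖ ≤ g/2 := by
    rw [norm_mul]; exact (mul_le_mul_of_nonneg_right h1 (norm_nonneg _)).trans hδ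
  have hp : z ∉ P := by
    intro hp
    simp only [kf, hp, if_true] at hk
    field_simp at hk
    have : a' - b' = (a - a') * δ := by linear_combination hk
    rw [this] at h3; linarith
  refine ⟨hp, ?_⟩
  simp only [kf, hp, if_false] at hk
  have hb2 := sub_ne_zero.2 (hn hp)
  field_simp at hk
  have e : (F z - a) * ((a' - b') - (a - a') * δ) = (a - a') * (a - b') * δ := by linear_combination hk
  have e2 := congrArg norm e
  rw [norm_mul, norm_mul, norm_mul] at e2
  have h5 := norm_sub_norm_le (a' - b') ((a - a') * δ)
  have h6 : ‖a - a'‖ * ‖a - b'‖ * ‖δ‖ ≤ Dm * Dm * ‖δ‖ := by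
    have : 0 ≤ Dm := (norm_nonneg _).trans h1
    gcongr
  nlinarith [norm_nonneg (F z - a)]

set_option maxHeartbeats 1000000 in
theorem Dx.DB (hX : Dx F P Sing M z0 N l L κ ε r g Dm) (ha : a ∈ Sing) (hs1 : ‖s1‖ ≤ L - 15) {G : ℂ → ℂ}
    (hG : TractLift F P a r G) (hp : ProperLift r G) (hz : zz z0 N s1 ∈ G '' HL r) : -Real.log ‖F (zz z0 N s1) - a‖ < 10^5 * ‖EE l s1‖ := by
  have hC := hX.cx
  have hsL : ‖s1‖ ≤ L := by linarith
  obtain ⟨u, hu, hGu⟩ := hz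
  have hzP : zz z0 N s1 ∉ P := by rw [← hGu]; exact (hG.good u hu).1
  have hxe : F (zz z0 N s1) - a = Complex.exp u := by rw [← hGu, hG.eq u hu]; ring
  have hxr : ‖F (zz z0 N s1) - a‖ < r := by rw [hxe]; exact (HL_norm hC.rpos).1 hu
  obtain ⟨a', ha', b', hb', hab, h⟩ := hC.exLC hsL (Or.inl rfl)
  have h0 : ‖s1 - s1‖ * ‖EE l s1‖ < κ := by simpa using hC.κpos
  by_cases c1 : a = a'
  · subst c1
    exact hX.SV (Or.inl rfl) ha hs1 (hC.pair_deep (Or.inl rfl) ha hb' hab h h0 hzP hxr)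
  by_cases c2 : a = b'
  · subst c2
    exact hX.SV (Or.inr rfl) ha hs1 (hC.pair_deep (Or.inr rfl) ha ha' hab.symm h.swap h0 hzP hxr)
  by_contra hcon
  push Not at hcon
  have hE := EE_pos hC.bx.lpos s1
  have hr := hC.rpos
  have hg := hC.gpos
  obtain ⟨g1, d1⟩ := hC.gap a ha a' ha' c1
  obtain ⟨g2, d2⟩ := hC.gap a ha b' hb' c2
  obtain ⟨g3, d3⟩ := hC.gap a' ha' b' hb' hab
  have hDm : 0 < Dm := by linarith
  set x := F (zz z0 N s1) - a with hx
  set E := ‖EE l s1‖ with hEd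
  set η := r * g / (4 * Dm^2) with hη
  have hη0 : 0 < η := by positivity
  have hηr : η * (4 * Dm^2) = r * g := by rw [hη]; field_simp
  obtain ⟨-, bk, -, bb⟩ := hX.big1 hsL
  rw [← hEd] at bk bb
  have hrg := hC.hrg
  have hη1 : η * Dm ≤ g / 4 := by
    unfold e3 at hrg
    have : η * Dm * (4 * Dm) ≤ g/4 * (4 * Dm) := by nlinarith
    exact le_of_mul_le_mul_right this (by linarith)
  have hη2 : η ≤ 1/4 := by
    by_contra hc
    push Not at hc
    nlinarith
  have hxs : ‖x‖ ≤ η * g / 200 := by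
    have h1 : Real.log ‖x‖ ≤ Real.log (r * g^2 / (1000 * Dm^2)) := by unfold e3 at bb; linarith
    have h2 := (Real.log_le_log_iff (by rw [hxe]; exact norm_pos_iff.2 (Complex.exp_ne_zero u)) (by positivity)).1 h1
    have : r * g^2 / (1000 * Dm^2) = η * g / 250 := by rw [hη]; field_simp; ring
    rw [this] at h2
    have : 0 < η * g := by positivity
    linarith
  have hq1 : ∀ y : ℂ, g ≤ ‖y‖ → ‖x / y‖ ≤ η / 200 := by
    intro y hy
    rw [norm_div, div_le_iff₀ (by linarith)]
    have : η * g ≤ η * ‖y‖ := by gcongr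
    linarith
  have hlog : ∀ y : ℂ, g ≤ ‖y‖ → ‖Complex.log (1 + x / y)‖ ≤ η / 100 ∧ 1 + x / y ≠ 0 := by
    intro y hy
    have h1 := hq1 y hy
    have h2 := Complex.norm_log_one_add_half_le_self (z := x / y) (by linarith)
    refine ⟨by linarith, fun h3 => ?_⟩
    have : x / y = -1 := by linear_combination h3
    rw [this, norm_neg, norm_one] at h1; linarith
  obtain ⟨l1, n1⟩ := hlog _ g1
  obtain ⟨l2, n2⟩ := hlog _ g2
  set δ0 := Complex.log (1 + x / (a - b')) - Complex.log (1 + x / (a - a')) with hδ0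
  have hδn : ‖δ0‖ ≤ η / 50 := (norm_sub_le _ _).trans (by linarith)
  have hδe : Complex.exp δ0 = (1 + x / (a - b')) / (1 + x / (a - a')) := by
    rw [hδ0, Complex.exp_sub, Complex.exp_log n1, Complex.exp_log n2]
  set R := η / (8 * E) with hR
  have hR0 : 0 < R := by positivity
  have hRE : R * E = η / 8 := by rw [hR]; field_simp
  have hR1 : R ≤ e3 := by
    by_contra hc
    push Not at hc
    have : e3 * E < R * E := by gcongr
    have := hX.κ1
    linarith
  have hin : ∀ s ∈ Metric.ball s1 (2*R), ‖s - s1‖ * E < κ := by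
    intro s hs
    have h1 : ‖s - s1‖ < 2 * R := by simpa [dist_eq_norm] using hs
    have := hX.κ1
    nlinarith
  obtain ⟨V, hV⟩ := exists_log_ball (f := fun s => kf a' b' F P (zz z0 N s)) (c := s1) (r := 2 * R) (by positivity)
    (fun w hw => ⟨((h w (hin w hw)).2.choose_spec.1).differentiableAt, h.kf_ne (hin w hw)⟩)
  have hsub : ∀ s ∈ Metric.closedBall s1 R, s ∈ Metric.ball s1 (2*R) := fun s hs => Metric.closedBall_subset_ball (by linarith) hs
  have hVd : ∀ s ∈ Metric.closedBall s1 R, DifferentiableAt ℂ V s ∧ ‖deriv V s - EE l s1‖ ≤ E / 4 := by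
    intro s hs
    obtain ⟨D, hD1, hD2⟩ := (h s (hin s (hsub s hs))).2
    have h1 := (hV s (hsub s hs)).1
    refine ⟨h1.differentiableAt, ?_⟩
    rw [h1.deriv, hD1.deriv, mul_div_cancel_right₀ _ (h.kf_ne (hin s (hsub s hs)))]
    have h2 : ‖s - s1‖ ≤ R := by simpa [dist_eq_norm] using hs
    have h3 := EE_close l (s1 := s1) (s := s) (by unfold e3 at hR1; linarith)
    have h5 : ‖EE l s1‖ * ‖s - s1‖ ≤ E * e3 := by
      gcongr; exact h2.trans hR1
    have h7 := norm_le_norm_add_norm_sub (EE l s1) (EE l s)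
    rw [norm_sub_rev] at h7
    have h8 := norm_sub_le_norm_sub_add_norm_sub D (EE l s) (EE l s1)
    rw [Complex.ofReal_one, one_mul] at hD2
    unfold e3 at *
    linarith
  have hc1 : s1 ∈ Metric.closedBall s1 R := Metric.mem_closedBall_self hR0.le
  obtain ⟨s', hs', hVs'⟩ := solve (y := V s1 + δ0) (norm_pos_iff.1 hE) hR0 hVd (by
    rw [add_sub_cancel_left, ← hEd, mul_comm, hRE]; linarith)
  have hk1 : kf a' b' F P (zz z0 N s1) * Complex.exp δ0 = (a - a') / (a - b') := by
    have e1 : F (zz z0 N s1) - a' = (a - a') * (1 + x / (a - a')) := by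
      have := sub_ne_zero.2 c1
      field_simp; rw [hx]; ring
    have e2 : F (zz z0 N s1) - b' = (a - b') * (1 + x / (a - b')) := by
      have := sub_ne_zero.2 c2
      field_simp; rw [hx]; ring
    simp only [kf, hzP, if_false, hδe]
    rw [e1, e2]
    have h8 := sub_ne_zero.2 c1
    have h9 := sub_ne_zero.2 c2
    clear_value x
    generalize 1 + x / (a - a') = p at n1 ⊢
    generalize 1 + x / (a - b') = q at n2 ⊢
    field_simp
  have hks : ∀ s ∈ Metric.closedBall s1 R, kf a' b' F P (zz z0 N s) = (a - a') / (a - b') * (1 + (Complex.exp (V s - V s1 - δ0) - 1)) := by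
    intro s hs
    rw [← hk1, ← (hV s1 (hsub s1 hc1)).2, ← (hV s (hsub s hs)).2, add_sub_cancel, ← Complex.exp_add, ← Complex.exp_add]
    congr 1; ring
  have hsm : ∀ s ∈ Metric.closedBall s1 R, ‖Complex.exp (V s - V s1 - δ0) - 1‖ ≤ η / 2 := by
    intro s hs
    have h1 := (convex_closedBall s1 R).norm_image_sub_le_of_norm_deriv_le (f := V) (C := 5/4 * E) (fun x hx => (hVd x hx).1) (fun x hx => by
      have := norm_le_norm_add_norm_sub (EE l s1) (deriv V x)
      rw [norm_sub_rev] at this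
      linarith [(hVd x hx).2]) hc1 hs
    have h2 : ‖s - s1‖ ≤ R := by simpa [dist_eq_norm] using hs
    have h3 : 5/4 * E * ‖s - s1‖ ≤ 5/4 * E * R := by gcongr
    have h4 := norm_sub_le (V s - V s1) δ0
    have h5 := Complex.norm_exp_sub_one_le (x := V s - V s1 - δ0) (by nlinarith)
    nlinarith
  have hall : ∀ s ∈ Metric.closedBall s1 R, zz z0 N s ∉ P ∧ ‖F (zz z0 N s) - a‖ * g ≤ 2 * Dm^2 * ‖Complex.exp (V s - V s1 - δ0) - 1‖ := fun s hs =>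
    mob_alg hg d1 d2 g3 (sub_ne_zero.2 c2) (hks s hs) (by have := hsm s hs; nlinarith) (fun hp => ((h s (hin s (hsub s hs))).1 hp).2)
  have hcl := comp_lemma hC.bx.nice (hC.isol ha) hG hp (C := zz z0 N '' Metric.closedBall s1 R)
    (((convex_closedBall s1 R).isPreconnected).image _ (zz_cont z0 N).continuousOn) (by
      rintro _ ⟨s, hs, rfl⟩
      refine ⟨(hall s hs).1, ?_⟩
      have h1 := (hall s hs).2
      have h2 := hsm s hs
      have h3 : 2 * Dm^2 * ‖Complex.exp (V s - V s1 - δ0) - 1‖ ≤ 2 * Dm^2 * (η/2) := by gcongr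
      by_contra hc
      push Not at hc
      nlinarith) ⟨_, ⟨s1, hc1, rfl⟩, ⟨u, hu, hGu⟩⟩
  obtain ⟨v, hv, hGv⟩ := hcl ⟨s', hs', rfl⟩
  have h1 := (hall s' hs').2
  rw [hVs', show V s1 + δ0 - V s1 - δ0 = 0 by ring, Complex.exp_zero, sub_self, norm_zero, mul_zero, ← hGv, hG.eq v hv, add_sub_cancel_left] at h1
  have := norm_pos_iff.2 (Complex.exp_ne_zero v)
  nlinarith

end
end

section
def yj (j : ℕ) : ℝ := Real.pi + 2 * Real.pi * j
def pt (x : ℝ) (j : ℕ) : ℂ := (x : ℂ) + (yj j : ℂ) * Complex.I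
def sg (j : ℕ) : ℝ := (-1) ^ j
def en (l x : ℝ) : ℝ := 2 * (Real.sqrt l * Real.exp (x / 2))

theorem sg_or (j : ℕ) : sg j = 1 ∨ sg j = -1 := neg_one_pow_eq_or ℝ j

theorem sg_sq (j : ℕ) : sg j * sg j = 1 := by rcases sg_or j with h | h <;> rw [h] <;> norm_num

theorem pt_re (x : ℝ) (j : ℕ) : (pt x j).re = x := by simp [pt]
theorem pt_im (x : ℝ) (j : ℕ) : (pt x j).im = yj j := by simp [pt]

theorem yj_nonneg (j : ℕ) : 0 ≤ yj j := by unfold yj; have := Real.pi_pos; positivity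

theorem pt_norm (x : ℝ) (j : ℕ) : ‖pt x j‖ ≤ |x| + yj j := by
  refine (norm_add_le _ _).trans ?_
  rw [norm_mul, Complex.norm_I, Complex.norm_real, Complex.norm_real, mul_one, Real.norm_eq_abs, Real.norm_eq_abs, abs_of_nonneg (yj_nonneg j)]

theorem EE_en (l : ℝ) (s : ℂ) : ‖EE l s‖ = en l s.re := EE_norm l s

theorem en_deriv (l x : ℝ) : HasDerivAt (en l) (en l x / 2) x := by
  have h := (((Real.hasDerivAt_exp (x/2)).comp x ((hasDerivAt_id x).div_const 2)).const_mul (Real.sqrt l)).const_mul 2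
  refine h.congr_deriv ?_
  unfold en; ring

theorem en_pos {l : ℝ} (hl : 0 < l) (x : ℝ) : 0 < en l x := by unfold en; have := Real.sqrt_pos.2 hl; positivity

theorem en_add (l x y : ℝ) : en l (x + y) = en l x * Real.exp (y/2) := by
  unfold en; rw [add_div, Real.exp_add]; ring

theorem EE_pt (l x : ℝ) (j : ℕ) : EE l (pt x j) = ((-(sg j * en l x) : ℝ) : ℂ) := by
  have h : Complex.exp (pt x j / 2) = Real.exp (x/2) * (Complex.I * (sg j : ℂ)) := by
    have e : pt x j / 2 = ((x/2 : ℝ) : ℂ) + (Real.pi / 2 * Complex.I + j * (Real.pi * Complex.I)) := by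
      unfold pt yj; push_cast; ring
    rw [e, Complex.exp_add, Complex.exp_add, Complex.exp_nat_mul, Complex.exp_pi_mul_I, Complex.exp_pi_div_two_mul_I]
    unfold sg; push_cast; ring
  unfold EE ee en
  rw [h]
  push_cast
  linear_combination (2 * (Real.sqrt l : ℂ) * (Complex.exp (x/2)) * (sg j : ℂ)) * Complex.I_sq

theorem exp20 : (4 * 10^8 : ℝ) ≤ Real.exp 20 := by
  have h : Real.exp 20 = Real.exp 1 ^ 20 := by rw [← Real.exp_nat_mul]; norm_num
  rw [h]
  have := Real.exp_one_gt_d9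
  calc (4 * 10^8 : ℝ) ≤ 2.7 ^ 20 := by norm_num
    _ ≤ _ := by gcongr; linarith

section
variable {F : ℂ → ℂ} {P Sing : Set ℂ} {M : ℕ} {z0 : ℂ} {N l L κ ε r g Dm : ℝ} {a b s1 s : ℂ} {σ : ℝ}

theorem Cx.hor (hC : Cx F P Sing M z0 N l L κ ε r g Dm) {η x1 d : ℝ} {j : ℕ} (hη : η = 1 ∨ η = -1) (hd : 0 ≤ η * d)
    (h1 : |x1| ≤ 100) (h2 : |x1 + d| ≤ 100) (hL : 100 + yj j ≤ L) (ha : a ∈ Sing) (hD : Deep F P z0 N l r a (η * sg j) (pt x1 j))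
    (h0 : ‖F (zz z0 N (pt x1 j)) - a‖ ≤ r / 2) : Deep F P z0 N l r a (η * sg j) (pt (x1 + d) j) ∧
      Real.log ‖F (zz z0 N (pt (x1 + d) j)) - a‖ ≤ Real.log (r/2) - (2 - 2 * e3) * (η * (en l (x1 + d) - en l x1)) := by
  have hσ : η * sg j = 1 ∨ η * sg j = -1 := by
    rcases hη with rfl | rfl <;> rcases sg_or j with h | h <;> rw [h] <;> norm_num
  have hpt : ∀ τ : ℝ, pt x1 j + τ * (d:ℂ) = pt (x1 + τ * d) j := fun τ => by unfold pt; push_cast; ring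
  have hmono : ∀ τ : ℝ, 0 ≤ τ → 0 ≤ η * (en l (x1 + τ * d) - en l x1) := by
    intro τ hτ
    have hm : Monotone (en l) := fun x y h => by unfold en; gcongr
    have : 0 ≤ η * (τ * d) := by nlinarith
    rcases hη with rfl | rfl
    · linarith [hm (show x1 ≤ x1 + τ * d by linarith)]
    · linarith [hm (show x1 + τ * d ≤ x1 by linarith)]
  have hZ : ∀ τ : ℝ, η * sg j * (Zt l (pt x1 j + τ * (d:ℂ)) - Zt l (pt x1 j)).re = - (2 * (η * (en l (x1 + τ * d) - en l x1))) := by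
    intro τ
    rw [hpt, Zt_EE, Zt_EE, EE_pt, EE_pt, ← mul_sub, ← Complex.ofReal_sub, Complex.mul_re, Complex.ofReal_im, Complex.ofReal_re]
    norm_num
    linear_combination (-2 * η * (en l (x1 + τ * d) - en l x1)) * sg_sq j
  have h0' : Real.log ‖F (zz z0 N (pt x1 j)) - a‖ ≤ Real.log (r/2) := Real.log_le_log (norm_pos_iff.2 (sub_ne_zero.2 hD.2.1)) h0
  have key := hC.CL hσ ha (s1 := pt x1 j) (d := (d:ℂ)) (fun τ t0 t1 => ?_) hD (B := fun τ => 2 * (η * (en l (x1 + τ * d) - en l x1)))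
    (B' := fun τ => en l (x1 + τ * d) * (η * d)) (by simp) (fun τ => ?_) (fun τ t0 t1 => ?_) (fun τ t0 t1 => ?_) 1 zero_le_one le_rfl
  · simp only [hZ 1] at key
    rw [hpt, one_mul] at key
    refine ⟨key.1, ?_⟩
    have := (abs_le.1 key.2).2
    linarith
  · rw [hpt]
    refine (pt_norm _ _).trans ?_
    have : |x1 + τ * d| ≤ 100 := by
      rw [abs_le] at *
      constructor <;> nlinarith
    linarith
  · refine (((((en_deriv l (x1 + τ * d)).comp τ (((hasDerivAt_id τ).mul_const d).const_add x1)).sub_const (en l x1)).const_mul η).const_mul 2).congr_deriv ?_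
    ring
  · have : |d| = η * d := by
      rcases hη with rfl | rfl
      · rw [one_mul] at *; exact abs_of_nonneg hd
      · rw [neg_one_mul] at *; exact abs_of_nonpos (by linarith)
    rw [hpt, EE_en, pt_re, Complex.norm_real, Real.norm_eq_abs, this]
  · have := hmono τ t0
    rw [hZ]
    unfold e3
    linarith

theorem Dx.T1 (hX : Dx F P Sing M z0 N l L κ ε r g Dm) (j : ℕ) (hL : 115 + yj j ≤ L) : ∃ a ∈ Sing, ∀ x : ℝ, 10 ≤ x → x ≤ 100 →
    Deep F P z0 N l r a (sg j) (pt x j) ∧ Real.log ‖F (zz z0 N (pt x j)) - a‖ ≤ -en l x := by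
  have hC := hX.cx
  have hs1 : ‖pt 0 j‖ ≤ L := (pt_norm _ _).trans (by simp; linarith)
  obtain ⟨a, ha, b, hb, hab, h⟩ := hC.exLC hs1 (sg_or j)
  have hE := en_pos hC.bx.lpos 0
  obtain ⟨-, bk, -, -⟩ := hX.big1 hs1
  have bl := hX.big _ hs1
  rw [EE_en, pt_re] at bk bl
  have bl2 : |Real.log (r/2)| ≤ e3 * en l 0 := by
    have := abs_nonneg (Real.log (r * g ^ 2 / (1000 * Dm ^ 2)))
    have : (0:ℝ) ≤ 7 * M := by positivity
    linarith [hC.κpos]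
  rw [abs_le] at bl2
  have hκ := hX.κ1
  have h0 : ‖pt 0 j - pt 0 j‖ * ‖EE l (pt 0 j)‖ < κ := by simpa using hC.κpos
  by_cases hk : Real.log ‖kf a b F P (zz z0 N (pt 0 j))‖ ≤ κ / 2
  · refine ⟨a, ha, fun x hx1 hx2 => ?_⟩
    set d : ℝ := 9/10 * κ / en l 0 with hd
    have hdE : d * en l 0 = 9/10 * κ := by rw [hd]; field_simp
    have hd0 : 0 ≤ d := by positivity
    have hd1 : d ≤ e3 := by
      by_contra hc
      push Not at hc
      nlinarith
    have hs2 : pt 0 j + (d:ℂ) = pt d j := by unfold pt; push_cast; ring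
    have hdn : ‖(d:ℂ)‖ * ‖EE l (pt 0 j)‖ = 9/10 * κ := by
      rw [Complex.norm_real, Real.norm_eq_abs, abs_of_nonneg hd0, EE_en, pt_re, hdE]
    have hm := hX.move (sg_or j) hs1 h (d := (d:ℂ)) (by rw [hdn]; linarith)
    have e1 : sg j * (EE l (pt 0 j) * (d:ℂ)).re = -(9/10 * κ) := by
      rw [EE_pt, ← Complex.ofReal_mul, Complex.ofReal_re]
      linear_combination (-(en l 0) * d) * sg_sq j - hdE
    have e2 : 2 * e3 * ‖EE l (pt 0 j)‖ * ‖(d:ℂ)‖ = 2 * e3 * (9/10*κ) := by rw [← hdn]; ring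
    rw [e1, e2, hs2] at hm
    obtain ⟨q1, q2⟩ := hX.kdeep (sg_or j) ha hb hab h (s := pt d j) (by rw [← hs2, add_sub_cancel_left, hdn]; linarith) (by
      have := (abs_le.1 hm).2
      unfold e3 at this
      linarith)
    have hd1' : d ≤ 1/10 := by unfold e3 at hd1; linarith
    have hh := hC.hor (η := 1) (x1 := d) (d := x - d) (Or.inl rfl) (by linarith) (by rw [abs_le]; constructor <;> linarith) (by rw [abs_le]; constructor <;> linarith)
      (by linarith) ha (by rwa [one_mul]) q2
    rw [one_mul, one_mul, add_sub_cancel] at hh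
    refine ⟨hh.1, hh.2.trans ?_⟩
    have e3' : en l x = en l d * Real.exp ((x - d)/2) := by rw [← en_add]; congr 1; ring
    have e4 := Real.add_one_le_exp ((x-d)/2)
    have e5 : en l 0 ≤ en l d := by unfold en; gcongr
    have e6 : en l d * 5 ≤ en l x := by rw [e3']; exact mul_le_mul_of_nonneg_left (by linarith) (en_pos hC.bx.lpos d).le
    unfold e3 at *
    linarith
  · exfalso
    push Not at hk
    have hσ' : -sg j = 1 ∨ -sg j = -1 := by rcases sg_or j with h | h <;> rw [h] <;> norm_num
    obtain ⟨q1, q2⟩ := hX.kdeep hσ' hb ha hab.symm h.swap h0 (by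
      rw [kf_swap, norm_inv, Real.log_inv]; linarith)
    have hh := hC.hor (η := -1) (x1 := 0) (d := -40) (j := j) (Or.inr rfl) (by linarith) (by simp) (by rw [abs_le]; constructor <;> linarith)
      (by linarith) hb (by rwa [neg_one_mul]) q2
    rw [neg_one_mul] at hh
    have hv := hX.SV hσ' hb ((pt_norm _ _).trans (by rw [zero_add, abs_neg, abs_of_pos (by norm_num)]; linarith)) hh.1
    rw [EE_en, pt_re, en_add] at hv
    rw [en_add] at hh
    have hx := hh.2
    have e7 : Real.exp (-40/2) ≤ 1 / (4 * 10^8) := by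
      rw [show (-40:ℝ)/2 = -20 by norm_num, Real.exp_neg, ← one_div]
      exact one_div_le_one_div_of_le (by norm_num) exp20
    have e8 : en l 0 * Real.exp (-40/2) ≤ en l 0 * (1 / (4 * 10^8)) := by gcongr
    have e9 : 0 < Real.exp (-40/2) := Real.exp_pos _
    unfold e3 at *
    linarith

end
end

section
theorem sin_low {m c : ℝ} (h1 : c ≤ m) (h2 : m ≤ Real.pi - c) (h0 : 0 ≤ c) : 63/100 * c ≤ Real.sin m := by
  have hp : 63/100 ≤ 2 / Real.pi := by
    rw [le_div_iff₀ Real.pi_pos]; linarith [Real.pi_lt_d2]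
  rcases le_total m (Real.pi/2) with h | h
  · have := Real.mul_le_sin (x := m) (by linarith) h
    nlinarith
  · have := Real.mul_le_sin (x := Real.pi - m) (by linarith) (by linarith)
    rw [Real.sin_pi_sub] at this
    nlinarith

theorem cos_low {α φ : ℝ} (h1 : 1 ≤ α) (h2 : α ≤ φ) (h3 : φ ≤ 2 * Real.pi) (h4 : α ≤ 2 * Real.pi - 34/100) :
    e3 * (φ - α) ≤ 2 * (Real.cos (α/2) - Real.cos (φ/2)) := by
  have e6 := Real.cos_sub_cos (α/2) (φ/2)
  have hpi := Real.pi_gt_three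
  have s1 := sin_low (m := (α/2 + φ/2)/2) (c := 8/100) (by linarith) (by linarith) (by norm_num)
  have s2 := sin_low (m := (φ/2 - α/2)/2) (c := (φ/2 - α/2)/2) le_rfl (by linarith) (by linarith)
  rw [show (α/2 - φ/2)/2 = -((φ/2 - α/2)/2) by ring, Real.sin_neg] at e6
  have e7 : 63/100 * (8/100) * (63/100 * ((φ/2 - α/2)/2)) ≤ Real.sin ((α/2 + φ/2)/2) * Real.sin ((φ/2 - α/2)/2) :=
    mul_le_mul s1 s2 (by linarith) (by linarith)
  rw [e6]; unfold e3; linarith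

def vs (j : ℕ) (θ : ℝ) : ℂ := pt 10 j + (θ : ℂ) * Complex.I

theorem vs_seg (j : ℕ) (θ φ τ : ℝ) : vs j θ + τ * ((φ : ℂ) * Complex.I) = vs j (θ + τ * φ) := by unfold vs; push_cast; ring

theorem vs_re (j : ℕ) (θ : ℝ) : (vs j θ).re = 10 := by simp [vs, pt_re]

theorem vs_end (j : ℕ) : vs j (2 * Real.pi) = pt 10 (j+1) := by unfold vs pt yj; push_cast; ring

theorem vs_zero (j : ℕ) : vs j 0 = pt 10 j := by simp [vs]

theorem vs_norm {j : ℕ} {θ : ℝ} (h1 : 0 ≤ θ) (h2 : θ ≤ 2 * Real.pi) : ‖vs j θ‖ ≤ 10 + yj (j+1) := by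
  refine (norm_add_le _ _).trans ?_
  have := pt_norm 10 j
  rw [norm_mul, Complex.norm_I, Complex.norm_real, Real.norm_eq_abs, abs_of_nonneg h1, mul_one]
  rw [abs_of_pos (by norm_num : (0:ℝ) < 10)] at this
  have e : yj (j+1) = yj j + 2 * Real.pi := by unfold yj; push_cast; ring
  linarith

theorem sg_succ (j : ℕ) : sg (j+1) = - sg j := by unfold sg; ring

theorem EE_vs (l : ℝ) (j : ℕ) (θ : ℝ) : EE l (vs j θ) = ((-(sg j * en l 10) : ℝ) : ℂ) * (Real.cos (θ/2) + Real.sin (θ/2) * Complex.I) := by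
  rw [EE_exp l (pt 10 j), EE_pt]
  congr 1
  rw [Complex.ofReal_cos, Complex.ofReal_sin, ← Complex.exp_mul_I]
  congr 1; unfold vs; push_cast; ring

section
variable {F : ℂ → ℂ} {P Sing : Set ℂ} {M : ℕ} {z0 : ℂ} {N l L κ ε r g Dm : ℝ} {a b s1 s : ℂ} {σ : ℝ}

theorem Zt_vs (l : ℝ) (j : ℕ) (θ φ : ℝ) : sg j * (Zt l (vs j φ) - Zt l (vs j θ)).re = 2 * en l 10 * (Real.cos (θ/2) - Real.cos (φ/2)) := by
  rw [Zt_EE, Zt_EE, EE_vs, EE_vs]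
  have : ∀ p q c d : ℝ, (2 * (((-(sg j * en l 10) : ℝ) : ℂ) * (p + q * Complex.I)) - 2 * (((-(sg j * en l 10) : ℝ) : ℂ) * (c + d * Complex.I))).re
      = -2 * (sg j * en l 10) * (p - c) := by
    intro p q c d
    simp
    ring
  rw [this]
  linear_combination (2 * en l 10 * (Real.cos (θ/2) - Real.cos (φ/2))) * sg_sq j

theorem Dx.exit (hX : Dx F P Sing M z0 N l L κ ε r g Dm) {j : ℕ} (hL : 115 + yj (j+1) ≤ L) (ha : a ∈ Sing)
    (h1 : Deep F P z0 N l r a (sg j) (pt 10 j)) (h1' : Real.log ‖F (zz z0 N (pt 10 j)) - a‖ ≤ -en l 10)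
    (h2 : Deep F P z0 N l r a (sg (j+1)) (pt 10 (j+1))) (h2' : Real.log ‖F (zz z0 N (pt 10 (j+1))) - a‖ ≤ -en l 10) :
    ∃ θ : ℝ, 1 ≤ θ ∧ θ ≤ 2 * Real.pi - 35/100 ∧ Deep F P z0 N l r a (sg j) (vs j θ) ∧ r/2 < ‖F (zz z0 N (vs j θ)) - a‖ := by
  have hC := hX.cx
  have hE := en_pos hC.bx.lpos 10
  have hpi := Real.pi_gt_three
  have hsign : ∀ s, Deep F P z0 N l r a (sg j) s → Deep F P z0 N l r a (sg (j+1)) s → False := by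
    intro s q1 q2
    have hp := EE_pos hC.bx.lpos s
    have := sign_aux (sg_or j) (sg_or (j+1)) hp q2.2.2.2 (q1.2.2.2.trans (by unfold e3; linarith))
    rw [sg_succ] at this
    rcases sg_or j with h | h <;> rw [h] at this <;> norm_num at this
  have hlogr : -(e3 * en l 10) ≤ Real.log (r/2) := by
    have := (hX.big1 (s := pt 10 j) ((pt_norm _ _).trans (by
      have e : yj (j+1) = yj j + 2 * Real.pi := by unfold yj; push_cast; ring
      rw [abs_of_pos (by norm_num)]; linarith))).1
    rwa [EE_en, pt_re] at this
  by_contra hcon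
  push Not at hcon
  have hv : ∀ τ : ℝ, pt 10 j + τ * (((2 * Real.pi : ℝ) : ℂ) * Complex.I) = vs j (τ * (2 * Real.pi)) := fun τ => by
    rw [← vs_zero, vs_seg, zero_add]
  have key := hC.CL0 (sg_or j) ha (s1 := pt 10 j) (d := ((2 * Real.pi : ℝ) : ℂ) * Complex.I) (fun τ t0 t1 => ?_) h1 (fun τ t0 t1 hall => ?_) 1 zero_le_one le_rfl
  · rw [hv, one_mul, vs_end] at key
    exact hsign _ key h2
  · rw [hv]; exact (vs_norm (by positivity) (by nlinarith)).trans (by linarith)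
  · rw [hv]
    by_contra hc
    push Not at hc
    have hD := hall τ t0 le_rfl
    rw [hv] at hD
    have hl := deep_log hC.bx.nice.mero (d := ((2 * Real.pi : ℝ) : ℂ) * Complex.I) (B := fun τ => en l 10 * (τ * (2 * Real.pi))) (B' := fun _ => en l 10 * (2 * Real.pi))
      (by simp) (fun τ => (((hasDerivAt_id τ).mul_const (2 * Real.pi)).const_mul (en l 10)).congr_deriv (by ring)) t0 (fun τ' a1 a2 => by
        rw [hv, EE_en, vs_re, norm_mul, Complex.norm_I, Complex.norm_real, Real.norm_eq_abs, abs_of_pos (by positivity), mul_one]) hall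
    rw [hv] at hl
    have hz := Zt_vs l j 0 (τ * (2 * Real.pi))
    rw [vs_zero] at hz
    rw [hz] at hl
    generalize hθ : τ * (2 * Real.pi) = θ at *
    have hθ0 : 0 ≤ θ := by rw [← hθ]; positivity
    have hθ1 : θ ≤ 2 * Real.pi := by rw [← hθ]; nlinarith
    refine absurd hc (not_lt.2 (hcon θ ?_ ?_ hD))
    · by_contra hc2
      push Not at hc2
      have c1 := Real.one_sub_sq_div_two_le_cos (x := θ/2)
      have c2 : Real.log (r/2) ≤ Real.log ‖F (zz z0 N (vs j θ)) - a‖ := Real.log_le_log (by linarith [hC.rpos]) hc.le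
      have c3 := (abs_le.1 hl).2
      rw [zero_div, Real.cos_zero] at c3
      have c4 : 2 * en l 10 * (1 - Real.cos (θ/2)) ≤ 2 * en l 10 * (1/8) := by gcongr; nlinarith
      have c5 : e3 * (en l 10 * θ) ≤ e3 * (en l 10 * 1) := by
        have : 0 ≤ e3 := by unfold e3; norm_num
        gcongr
      unfold e3 at *
      linarith
    · by_contra hc2
      push Not at hc2
      have hball : vs j θ ∈ Metric.ball (pt 10 (j+1)) (35/100) := by
        rw [Metric.mem_ball, dist_eq_norm, ← vs_end]
        have : vs j θ - vs j (2 * Real.pi) = ((θ - 2 * Real.pi : ℝ) : ℂ) * Complex.I := by unfold vs; push_cast; ring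
        rw [this, norm_mul, Complex.norm_I, mul_one, Complex.norm_real, Real.norm_eq_abs, abs_lt]
        constructor <;> linarith
      refine hsign _ hD (hC.CLball (sg_or (j+1)) ha (Mx := en l 10 * (100/82)) (fun s hs => ?_) h2 (fun s hs => ?_) ?_ _ hball)
      · have q1 := norm_le_norm_add_norm_sub (pt 10 (j+1)) s
        have q2 : ‖s - pt 10 (j+1)‖ < 35/100 := by simpa [dist_eq_norm] using hs
        have q3 := pt_norm 10 (j+1)
        rw [norm_sub_rev] at q1
        rw [abs_of_pos (by norm_num : (0:ℝ) < 10)] at q3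
        linarith
      · have q2 : ‖s - pt 10 (j+1)‖ < 35/100 := by simpa [dist_eq_norm] using hs
        have q3 := EE_ratio l q2.le
        rw [EE_en l (pt 10 (j+1)), pt_re] at q3
        refine q3.trans ?_
        gcongr
        refine (Real.exp_bound_div_one_sub_of_interval (by norm_num) (by norm_num)).trans (by norm_num)
      · unfold e3 at *; linarith

set_option maxHeartbeats 400000 in
theorem Dx.T2 (hX : Dx F P Sing M z0 N l L κ ε r g Dm) {j : ℕ} (hL : 115 + yj (j+1) ≤ L) (ha : a ∈ Sing)
    (h1 : Deep F P z0 N l r a (sg j) (pt 10 j)) (h1' : Real.log ‖F (zz z0 N (pt 10 j)) - a‖ ≤ -en l 10)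
    (h2 : Deep F P z0 N l r a (sg (j+1)) (pt 10 (j+1))) (h2' : Real.log ‖F (zz z0 N (pt 10 (j+1))) - a‖ ≤ -en l 10) : False := by
  have hC := hX.cx
  have hE := en_pos hC.bx.lpos 10
  have hpi := Real.pi_gt_three
  have hκ := hX.κ1
  obtain ⟨θ, t1, t2, hD, hr⟩ := hX.exit hL ha h1 h1' h2 h2'
  have hsL : ‖vs j θ‖ ≤ L := (vs_norm (by linarith) (by linarith)).trans (by linarith)
  obtain ⟨b, hb, hab, h⟩ := hC.deep_LC (sg_or j) ha hsL hD
  obtain ⟨g1, g2⟩ := hC.gap a ha b hb hab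
  have hg := hC.gpos
  have hr0 := hC.rpos
  have hrg := hC.hrg
  have bk := (hX.big1 hsL).2.1
  rw [EE_en, vs_re] at bk
  have hk : -(κ/32) ≤ Real.log ‖kf a b F P (zz z0 N (vs j θ))‖ := by
    rw [Real.le_log_iff_exp_le (norm_pos_iff.2 (h.kf_ne (by simpa using hC.κpos)))]
    have hb0 : F (zz z0 N (vs j θ)) ≠ b := ((h (vs j θ) (by simpa using hC.κpos)).1 hD.1).2
    simp only [kf, hD.1, if_false]
    rw [norm_div, le_div_iff₀ (norm_pos_iff.2 (sub_ne_zero.2 hb0))]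
    have q1 : ‖F (zz z0 N (vs j θ)) - b‖ ≤ 2 * Dm := by
      have := norm_sub_le_norm_sub_add_norm_sub (F (zz z0 N (vs j θ))) a b
      have := hD.2.2.1
      unfold e3 at hrg
      linarith
    have q2 : Real.exp (-(κ/32)) * ‖F (zz z0 N (vs j θ)) - b‖ ≤ Real.exp (-(κ/32)) * (2 * Dm) := by gcongr
    have := hX.κ2
    linarith
  set t : ℝ := 9/10 * κ / en l 10 with ht
  have htE : t * en l 10 = 9/10 * κ := by rw [ht]; field_simp
  have ht0 : 0 ≤ t := by positivity
  have ht1 : t ≤ e3 := by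
    by_contra hc
    push Not at hc
    nlinarith
  have ht1' : t ≤ 1/100 := by unfold e3 at ht1; linarith
  have hs2 : vs j θ + (t:ℂ) * Complex.I = vs j (θ + t) := by unfold vs; push_cast; ring
  have hdn : ‖(t:ℂ) * Complex.I‖ * ‖EE l (vs j θ)‖ = 9/10 * κ := by
    rw [norm_mul, Complex.norm_I, mul_one, Complex.norm_real, Real.norm_eq_abs, abs_of_nonneg ht0, EE_en, vs_re, htE]
  have hm := hX.move (sg_or j) hsL h (d := (t:ℂ) * Complex.I) (by rw [hdn]; linarith)
  have e1 : sg j * (EE l (vs j θ) * ((t:ℂ) * Complex.I)).re = 9/10 * κ * Real.sin (θ/2) := by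
    rw [EE_vs]
    have : ∀ p q : ℝ, (((-(sg j * en l 10) : ℝ) : ℂ) * (p + q * Complex.I) * (t * Complex.I)).re = sg j * en l 10 * q * t := by
      intro p q
      simp
    rw [this]
    linear_combination (en l 10 * Real.sin (θ/2) * t) * sg_sq j + Real.sin (θ/2) * htE
  have e2 : 2 * e3 * ‖EE l (vs j θ)‖ * ‖(t:ℂ) * Complex.I‖ = 2 * e3 * (9/10*κ) := by rw [← hdn]; ring
  rw [e1, e2, hs2] at hm
  have hsin := sin_low (m := θ/2) (c := 175/1000) (by linarith) (by linarith) (by norm_num)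
  have hσ' : -sg j = 1 ∨ -sg j = -1 := by rcases sg_or j with h | h <;> rw [h] <;> norm_num
  obtain ⟨q1, q2⟩ := hX.kdeep hσ' hb ha hab.symm h.swap (s := vs j (θ + t)) (by rw [← hs2, add_sub_cancel_left, hdn]; linarith) (by
    rw [kf_swap, norm_inv, Real.log_inv]
    have h3 := (abs_le.1 hm).1
    have h4 : 9/10 * κ * (63/100 * (175/1000)) ≤ 9/10 * κ * Real.sin (θ/2) := by gcongr
    unfold e3 at h3
    linarith)
  have hq0 : Real.log ‖F (zz z0 N (vs j (θ+t))) - b‖ ≤ Real.log (r/2) := Real.log_le_log (norm_pos_iff.2 (sub_ne_zero.2 q1.2.1)) q2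
  have hd0 : 0 ≤ 2 * Real.pi - (θ + t) := by linarith
  have hfin := (hC.CL hσ' hb (s1 := vs j (θ+t)) (d := ((2 * Real.pi - (θ + t) : ℝ) : ℂ) * Complex.I) (fun τ t0 t1 => ?_) q1 (B := fun τ => en l 10 * (2 * Real.pi - (θ + t)) * τ)
    (B' := fun _ => en l 10 * (2 * Real.pi - (θ + t))) (by simp) (fun τ => ((hasDerivAt_id τ).const_mul _).congr_deriv (by simp)) (fun τ t0 t1 => ?_)
      (fun τ t0 t1 => ?_) 1 zero_le_one le_rfl).1
  · rw [vs_seg, one_mul, add_sub_cancel, vs_end] at hfin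
    have q3 := hfin.2.2.1
    have q4 := h2.2.2.1
    have q5 := norm_sub_le_norm_sub_add_norm_sub a (F (zz z0 N (pt 10 (j+1)))) b
    rw [norm_sub_rev a (F _)] at q5
    unfold e3 at hrg
    linarith
  · rw [vs_seg]
    have u1 := mul_nonneg t0 hd0
    have u2 := mul_le_of_le_one_left hd0 t1
    exact (vs_norm (by linarith only [u1, ht0, t2, ‹1 ≤ θ›]) (by linarith only [u2])).trans (by linarith)
  · rw [vs_seg, EE_en, vs_re, norm_mul, Complex.norm_I, Complex.norm_real, Real.norm_eq_abs, abs_of_nonneg hd0, mul_one]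
  · rw [vs_seg]
    have z1 := Zt_vs l j (θ + t) (θ + t + τ * (2 * Real.pi - (θ + t)))
    set φ := θ + t + τ * (2 * Real.pi - (θ + t)) with hφ
    have p1 : θ + t ≤ φ := le_add_of_nonneg_right (mul_nonneg t0 hd0)
    have p2 : φ ≤ 2 * Real.pi := by have := mul_le_of_le_one_left hd0 t1; linarith only [this, hφ]
    have e5 : en l 10 * (2 * Real.pi - (θ + t)) * τ = en l 10 * (φ - (θ + t)) := by rw [hφ]; ring
    have e8 := cos_low (α := θ + t) (by linarith) p1 p2 (by linarith)
    have e9 := mul_le_mul_of_nonneg_left e8 hE.le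
    simp only [e5, neg_mul, z1]
    linarith

end
end

section
theorem log_move {K : Set ℂ} {p q : ℂ} (h : ∀ z ∈ K, ‖p - q‖ < ‖z - p‖) (hp : ∃ ℓ : ℂ → ℂ, ContinuousOn ℓ K ∧ ∀ z ∈ K, Complex.exp (ℓ z) = z - p) :
    ∃ ℓ : ℂ → ℂ, ContinuousOn ℓ K ∧ ∀ z ∈ K, Complex.exp (ℓ z) = z - q := by
  obtain ⟨ℓ, h1, h2⟩ := hp
  have h0 : ∀ z ∈ K, z - p ≠ 0 := fun z hz => norm_pos_iff.1 ((norm_nonneg _).trans_lt (h z hz))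
  have h3 : ∀ z ∈ K, 1 + (p - q) / (z - p) ∈ Complex.slitPlane := fun z hz => Complex.mem_slitPlane_of_norm_lt_one (by
    rw [norm_div, div_lt_one (norm_pos_iff.2 (h0 z hz))]; exact h z hz)
  refine ⟨fun z => ℓ z + Complex.log (1 + (p - q) / (z - p)), h1.add (ContinuousOn.clog ?_ h3), fun z hz => ?_⟩
  · exact continuousOn_const.add (continuousOn_const.div (continuousOn_id.sub continuousOn_const) h0)
  · have := h0 z hz
    rw [Complex.exp_add, h2 z hz, Complex.exp_log (Complex.slitPlane_ne_zero (h3 z hz))]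
    field_simp
    ring

theorem lemE {K R : Set ℂ} (hK : IsCompact K) (hR : IsPreconnected R) (hub : ∀ B : ℝ, ∃ z ∈ R, B < ‖z‖) (hd : ∀ z ∈ R, z ∉ K) {p : ℂ} (hp : p ∈ R) :
    ∃ ℓ : ℂ → ℂ, ContinuousOn ℓ K ∧ ∀ z ∈ K, Complex.exp (ℓ z) = z - p := by
  obtain ⟨B, hB⟩ := hK.isBounded.exists_norm_le
  obtain ⟨q, hq, hqB⟩ := hub (max B 0)
  have hq0 : q ≠ 0 := norm_pos_iff.1 ((le_max_right _ _).trans_lt hqB)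
  have hS : ∃ ℓ : ℂ → ℂ, ContinuousOn ℓ K ∧ ∀ z ∈ K, Complex.exp (ℓ z) = z - q := by
    have h3 : ∀ z ∈ K, 1 + (-z / q) ∈ Complex.slitPlane := fun z hz => Complex.mem_slitPlane_of_norm_lt_one (by
      rw [norm_div, div_lt_one (norm_pos_iff.2 hq0), norm_neg]; exact (hB z hz).trans_lt ((le_max_left _ _).trans_lt hqB))
    refine ⟨fun z => Complex.log (-q) + Complex.log (1 + (-z / q)), continuousOn_const.add (ContinuousOn.clog (by fun_prop) h3), fun z hz => ?_⟩
    rw [Complex.exp_add, Complex.exp_log (neg_ne_zero.2 hq0), Complex.exp_log (Complex.slitPlane_ne_zero (h3 z hz))]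
    field_simp
    ring
  refine (hR.induction₂ (fun p q => (∃ ℓ : ℂ → ℂ, ContinuousOn ℓ K ∧ ∀ z ∈ K, Complex.exp (ℓ z) = z - p) ↔
    (∃ ℓ : ℂ → ℂ, ContinuousOn ℓ K ∧ ∀ z ∈ K, Complex.exp (ℓ z) = z - q)) (fun x hx => ?_) (fun x y z _ _ _ a b => a.trans b) (fun x y _ _ h => h.symm) hp hq).2 hS
  obtain ⟨δ, hδ, hb⟩ := Metric.mem_nhds_iff.1 (hK.isClosed.isOpen_compl.mem_nhds (hd x hx))
  have hb' : ∀ z ∈ K, δ ≤ ‖z - x‖ := fun z hz => by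
    by_contra hc
    push Not at hc
    exact hb (by simpa [dist_eq_norm] using hc) hz
  refine mem_nhdsWithin_of_mem_nhds (Filter.mem_of_superset (Metric.ball_mem_nhds x (half_pos hδ)) fun y hy => ?_)
  have hy' : ‖y - x‖ < δ/2 := by simpa [dist_eq_norm] using hy
  refine ⟨log_move fun z hz => ?_, log_move fun z hz => ?_⟩
  · rw [norm_sub_rev]; linarith [hb' z hz]
  · have := norm_sub_le_norm_sub_add_norm_sub z y x
    linarith [hb' z hz]

theorem planar {J Rp Rm : Set ℂ} {p q c : ℂ} (hJ : IsCompact J) (h1 : IsPreconnected Rp) (h2 : ∀ B : ℝ, ∃ z ∈ Rp, B < ‖z‖) (h3 : ∀ z ∈ Rp, z ∉ J) (h4 : p ∈ Rp)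
    (k1 : IsPreconnected Rm) (k2 : ∀ B : ℝ, ∃ z ∈ Rm, B < ‖z‖) (k3 : ∀ z ∈ Rm, z ∉ J) (k4 : q ∈ Rm) (hc : c ∈ J) (hcon : IsPreconnected (J \ {c}))
    (hs : ∀ z ∈ J, z ≠ c → (z - p) / (z - q) ∈ Complex.slitPlane) (hcs : (c - p) / (c - q) ∉ Complex.slitPlane)
    (hp : c ∈ closure {z | z ∈ J \ {c} ∧ 0 < ((z - p) / (z - q)).im}) (hm : c ∈ closure {z | z ∈ J \ {c} ∧ ((z - p) / (z - q)).im < 0}) : False := by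
  obtain ⟨ℓ1, a1, a2⟩ := lemE hJ h1 h2 h3 h4
  obtain ⟨ℓ2, b1, b2⟩ := lemE hJ k1 k2 k3 k4
  have hq0 : ∀ z ∈ J, z - q ≠ 0 := fun z hz h => by rw [← b2 z hz] at h; exact Complex.exp_ne_zero _ h
  have hm' : ∀ z ∈ J, Complex.exp (ℓ1 z - ℓ2 z) = (z - p) / (z - q) := fun z hz => by rw [Complex.exp_sub, a2 z hz, b2 z hz]
  have hmc : ContinuousOn (fun z => ℓ1 z - ℓ2 z) J := a1.sub b1
  set f : ℂ → ℂ := fun z => ℓ1 z - ℓ2 z - Complex.log ((z - p) / (z - q)) with hf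
  have hfe : ∀ z ∈ J \ {c}, Complex.exp (f z) = 1 := by
    intro z hz
    have h0 := Complex.slitPlane_ne_zero (hs z hz.1 hz.2)
    rw [hf]; dsimp only
    rw [Complex.exp_sub, hm' z hz.1, Complex.exp_log h0, div_self h0]
  have hfc : ContinuousOn f (J \ {c}) := (hmc.mono sdiff_subset).sub (ContinuousOn.clog
    (ContinuousOn.div (by fun_prop) (by fun_prop) fun z hz => hq0 z hz.1) fun z hz => hs z hz.1 hz.2)
  obtain ⟨y, hy⟩ : (J \ {c}).Nonempty := by
    obtain ⟨y, hy⟩ := closure_nonempty_iff.1 ⟨c, hp⟩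
    exact ⟨y, hy.1⟩
  have hconst : ∀ z ∈ J \ {c}, f z = f y := fun z hz => by
    refine hcon.induction₂ (fun z w => f z = f w) (fun x hx => ?_) (fun x y z _ _ _ a b => a.trans b) (fun x y _ _ h => h.symm) hz hy
    have h5 := (hfc x hx).eventually (Metric.ball_mem_nhds (f x) one_pos)
    filter_upwards [h5, self_mem_nhdsWithin] with w hw hwJ
    have h6 : Complex.exp (f w) = Complex.exp (f x) := by rw [hfe w hwJ, hfe x hx]
    obtain ⟨n, hn⟩ := Complex.exp_eq_exp_iff_exists_int.1 h6
    have h7 : ‖f w - f x‖ < 1 := by simpa [dist_eq_norm] using hw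
    rw [hn, add_sub_cancel_left, norm_mul, Complex.norm_intCast, norm_mul, norm_mul, Complex.norm_I, Complex.norm_real] at h7
    have hn0 : n = 0 := by
      by_contra hne
      have h8 : (1:ℝ) ≤ |(n:ℝ)| := by exact_mod_cast Int.one_le_abs hne
      have := Real.pi_gt_three
      rw [Real.norm_eq_abs, abs_of_pos Real.pi_pos] at h7
      norm_num at h7
      nlinarith
    rw [hn, hn0]; simp
  have hval : ∀ z ∈ J \ {c}, ((ℓ1 z - ℓ2 z) - f y).im = ((z - p) / (z - q)).arg := fun z hz => by
    rw [← hconst z hz, hf]; dsimp only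
    rw [sub_sub_cancel, Complex.log_im]
  have hcl : ∀ S : Set ℂ, S ⊆ J → ContinuousWithinAt (fun z => ((ℓ1 z - ℓ2 z) - f y).im) S c := fun S hS =>
    Complex.continuous_im.continuousAt.comp_continuousWithinAt (((hmc c hc).mono hS).sub continuousWithinAt_const)
  have i1 : ((ℓ1 c - ℓ2 c) - f y).im ∈ Ici (0:ℝ) := by
    refine isClosed_Ici.closure_subset_iff.2 Subset.rfl ((hcl {z | z ∈ J \ {c} ∧ 0 < ((z - p) / (z - q)).im} (fun z hz => hz.1.1)).mem_closure hp fun z hz => ?_)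
    dsimp only
    rw [hval z hz.1]; exact Complex.arg_nonneg_iff.2 hz.2.le
  have i2 : ((ℓ1 c - ℓ2 c) - f y).im ∈ Iic (0:ℝ) := by
    refine isClosed_Iic.closure_subset_iff.2 Subset.rfl ((hcl {z | z ∈ J \ {c} ∧ ((z - p) / (z - q)).im < 0} (fun z hz => hz.1.1)).mem_closure hm fun z hz => ?_)
    dsimp only
    rw [hval z hz.1]; exact (Complex.arg_neg_iff.2 hz.2).le
  have i3 : ((ℓ1 c - ℓ2 c) - f y).im = 0 := le_antisymm i2 i1
  apply hcs
  rw [← hm' c hc, show ℓ1 c - ℓ2 c = (ℓ1 c - ℓ2 c - f y) + f y by ring, Complex.exp_add, hfe y hy, mul_one]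
  refine Or.inl ?_
  rw [Complex.exp_re, i3, Real.cos_zero, mul_one]
  exact Real.exp_pos _
end

section
theorem chord_alg (ζ : ℂ) (c s : ℝ) :
    ((ζ - (c + s * Complex.I)) / (ζ - (c - s * Complex.I))).im * Complex.normSq (ζ - (c - s * Complex.I)) = -2 * (ζ.re - c) * s ∧
    ((ζ - (c + s * Complex.I)) / (ζ - (c - s * Complex.I))).re * Complex.normSq (ζ - (c - s * Complex.I)) = (ζ.re - c)^2 + ζ.im^2 - s^2 := by
  by_cases h : Complex.normSq (ζ - (c - s * Complex.I)) = 0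
  · have h2 := Complex.normSq_eq_zero.1 h
    have hr := congrArg Complex.re h2
    have hi := congrArg Complex.im h2
    simp at hr hi
    rw [h, hr]
    have : ζ.im = -s := by linarith
    rw [this]; constructor <;> ring
  · rw [Complex.div_im, Complex.div_re]
    constructor
    · field_simp; simp; ring
    · field_simp; simp; ring

theorem zz_chord {z0 s0 : ℂ} {N : ℝ} (h0 : z0 ≠ 0) (z : ℂ) :
    (z - zz z0 N (s0 + 2 * Real.pi * Complex.I)) / (z - zz z0 N (s0 - 2 * Real.pi * Complex.I)) =
    (z / zz z0 N s0 - (((Real.cos (2 * Real.pi / N) : ℝ) : ℂ) + ((Real.sin (2 * Real.pi / N) : ℝ) : ℂ) * Complex.I)) /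
    (z / zz z0 N s0 - (((Real.cos (2 * Real.pi / N) : ℝ) : ℂ) - ((Real.sin (2 * Real.pi / N) : ℝ) : ℂ) * Complex.I)) := by
  have hz : zz z0 N s0 ≠ 0 := mul_ne_zero h0 (Complex.exp_ne_zero _)
  have e1 : zz z0 N (s0 + 2 * Real.pi * Complex.I) = zz z0 N s0 * (((Real.cos (2 * Real.pi / N) : ℝ) : ℂ) + ((Real.sin (2 * Real.pi / N) : ℝ) : ℂ) * Complex.I) := by
    rw [Complex.ofReal_cos, Complex.ofReal_sin, ← Complex.exp_mul_I]
    unfold zz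
    rw [mul_assoc z0 (Complex.exp _), ← Complex.exp_add]; congr 2; push_cast; ring
  have e2 : zz z0 N (s0 - 2 * Real.pi * Complex.I) = zz z0 N s0 * (((Real.cos (2 * Real.pi / N) : ℝ) : ℂ) - ((Real.sin (2 * Real.pi / N) : ℝ) : ℂ) * Complex.I) := by
    have := Complex.exp_mul_I (-((2 * Real.pi / N : ℝ) : ℂ))
    rw [Complex.cos_neg, Complex.sin_neg, neg_mul, neg_mul, ← sub_eq_add_neg] at this
    rw [Complex.ofReal_cos, Complex.ofReal_sin, ← this]
    unfold zz
    rw [mul_assoc z0 (Complex.exp _), ← Complex.exp_add]; congr 2; push_cast; ring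
  rw [e1, e2]
  have : ∀ x, z - zz z0 N s0 * x = zz z0 N s0 * (z / zz z0 N s0 - x) := fun x => by field_simp
  rw [this, this, mul_div_mul_left _ _ hz]

theorem chord_ang {N : ℝ} (hN : 1000 ≤ N) : 0 < Real.sin (2 * Real.pi / N) ∧ Real.sin (2 * Real.pi / N) ≤ 2 * Real.pi / N ∧
    1 - 2 * (Real.pi / N)^2 ≤ Real.cos (2 * Real.pi / N) ∧ Real.pi / N ≤ 1/300 := by
  have hpi := Real.pi_gt_three
  have hpi2 := Real.pi_lt_d2
  have hN0 : 0 < N := by linarith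
  have h1 : Real.pi / N ≤ 1/300 := by rw [div_le_div_iff₀ hN0 (by norm_num)]; linarith
  have e : 2 * Real.pi / N = 2 * (Real.pi / N) := by ring
  have h2 : 0 < Real.pi / N := by positivity
  refine ⟨Real.sin_pos_of_pos_of_lt_pi (by positivity) (by rw [e]; linarith), Real.sin_le (by positivity), ?_, h1⟩
  have := Real.one_sub_sq_div_two_le_cos (x := 2 * Real.pi / N)
  rw [e] at *
  linarith

theorem zz_div {z0 s0 w : ℂ} {N : ℝ} (h0 : z0 ≠ 0) : zz z0 N (s0 + w) / zz z0 N s0 = Complex.exp (w / N) := by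
  unfold zz
  rw [mul_div_mul_left _ _ h0, ← Complex.exp_sub]; congr 1; ring

theorem chord {z0 s0 z : ℂ} {N : ℝ} (h0 : z0 ≠ 0) (hN : 1000 ≤ N)
    (h : (z - zz z0 N (s0 + 2 * Real.pi * Complex.I)) / (z - zz z0 N (s0 - 2 * Real.pi * Complex.I)) ∉ Complex.slitPlane) :
    ∃ w : ℂ, ‖w‖ ≤ 11 ∧ z = zz z0 N (s0 + w) ∧ (Complex.exp (w / N)).re = Real.cos (2 * Real.pi / N) := by
  obtain ⟨s1, s2, c1, c2⟩ := chord_ang hN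
  have hN0 : 0 < N := by linarith
  have hz : zz z0 N s0 ≠ 0 := mul_ne_zero h0 (Complex.exp_ne_zero _)
  rw [zz_chord h0] at h
  set ζ := z / zz z0 N s0 with hζ
  obtain ⟨A, B⟩ := chord_alg ζ (Real.cos (2 * Real.pi / N)) (Real.sin (2 * Real.pi / N))
  rw [Complex.mem_slitPlane_iff] at h
  push Not at h
  rw [h.2, zero_mul] at A
  have hre : ζ.re = Real.cos (2 * Real.pi / N) := by
    rcases mul_eq_zero.1 A.symm with h | h
    · linarith
    · exact absurd h s1.ne'
  rw [hre] at B
  have him : ζ.im ^ 2 ≤ Real.sin (2 * Real.pi / N) ^ 2 := by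
    have := mul_nonpos_of_nonpos_of_nonneg h.1 (Complex.normSq_nonneg (ζ - (↑(Real.cos (2 * Real.pi / N)) - ↑(Real.sin (2 * Real.pi / N)) * Complex.I)))
    linarith
  have him2 := abs_le_of_sq_le_sq' him s1.le
  have him3 : |ζ.im| ≤ Real.sin (2 * Real.pi / N) := abs_le.2 him2
  have hc1 := Real.cos_le_one (2 * Real.pi / N)
  have hp0 : 0 < Real.pi / N := by have := Real.pi_pos; positivity
  have e : 2 * Real.pi / N = 2 * (Real.pi / N) := by ring
  have hv : ‖ζ - 1‖ ≤ 2 * (Real.pi / N)^2 + 2 * (Real.pi / N) := by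
    refine (Complex.norm_le_abs_re_add_abs_im _).trans ?_
    rw [Complex.sub_re, Complex.sub_im, Complex.one_re, Complex.one_im, sub_zero, hre, abs_of_nonpos (by linarith)]
    linarith
  have hv1 : ‖ζ - 1‖ ≤ 2.01 * (Real.pi / N) := by nlinarith
  have hl := Complex.norm_log_one_add_half_le_self (z := ζ - 1) (by linarith)
  rw [add_sub_cancel] at hl
  have hζ0 : ζ ≠ 0 := by
    intro h; rw [h, zero_sub, norm_neg, norm_one] at hv1; linarith
  have hew : Complex.exp ((N * Complex.log ζ) / N) = ζ := by
    rw [mul_div_cancel_left₀ _ (Complex.ofReal_ne_zero.2 hN0.ne'), Complex.exp_log hζ0]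
  refine ⟨N * Complex.log ζ, ?_, ?_, by rw [hew, hre]⟩
  · rw [norm_mul, Complex.norm_real, Real.norm_eq_abs, abs_of_pos hN0]
    calc N * ‖Complex.log ζ‖ ≤ N * (3/2 * (2.01 * (Real.pi / N))) := by gcongr; linarith
      _ = 3.015 * Real.pi := by field_simp; norm_num
      _ ≤ 11 := by linarith [Real.pi_lt_d2]
  · have := zz_div (w := N * Complex.log ζ) (s0 := s0) (N := N) h0
    rw [hew, hζ, div_eq_div_iff hz hz] at this
    exact (mul_right_cancel₀ hz this).symm

theorem chord_sgn {z0 s0 : ℂ} {N : ℝ} (h0 : z0 ≠ 0) (hN : 1000 ≤ N) (x : ℝ) {Θ : ℂ}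
    (hΘ : Θ = (zz z0 N (s0 + x) - zz z0 N (s0 + 2 * Real.pi * Complex.I)) / (zz z0 N (s0 + x) - zz z0 N (s0 - 2 * Real.pi * Complex.I))) :
    (Real.exp (x/N) < Real.cos (2 * Real.pi / N) → 0 < Θ.im) ∧ (Real.cos (2 * Real.pi / N) < Real.exp (x/N) → Θ.im < 0) ∧
    (Real.exp (x/N) = Real.cos (2 * Real.pi / N) → Θ ∉ Complex.slitPlane) := by
  obtain ⟨s1, s2, c1, c2⟩ := chord_ang hN
  rw [zz_chord h0, zz_div h0] at hΘ
  have e : Complex.exp (x / N) = ((Real.exp (x/N) : ℝ) : ℂ) := by push_cast; rfl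
  rw [e] at hΘ
  obtain ⟨A, B⟩ := chord_alg ((Real.exp (x/N) : ℝ) : ℂ) (Real.cos (2 * Real.pi / N)) (Real.sin (2 * Real.pi / N))
  rw [← hΘ] at A B
  rw [Complex.ofReal_re] at A B
  rw [Complex.ofReal_im] at B
  have hD : 0 < Complex.normSq (((Real.exp (x/N) : ℝ) : ℂ) - (↑(Real.cos (2 * Real.pi / N)) - ↑(Real.sin (2 * Real.pi / N)) * Complex.I)) := by
    rw [Complex.normSq_pos]
    intro h
    have := congrArg Complex.im h
    simp only [Complex.sub_im, Complex.ofReal_im, Complex.mul_im, Complex.ofReal_re, Complex.I_im, Complex.I_re, Complex.zero_im] at this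
    linarith
  refine ⟨fun h => ?_, fun h => ?_, fun h => ?_⟩
  · by_contra hc
    push Not at hc
    nlinarith
  · by_contra hc
    push Not at hc
    nlinarith
  · rw [h] at A B hD
    rw [sub_self] at A B
    rw [Complex.mem_slitPlane_iff]
    push Not
    constructor
    · by_contra hc
      push Not at hc
      nlinarith
    · rw [mul_zero, zero_mul] at A
      exact (mul_eq_zero.1 A).resolve_right hD.ne'
end

section
structure Tr (F : ℂ → ℂ) (P Sing : Set ℂ) (z0 : ℂ) (N l r : ℝ) (j : ℕ) (a : ℂ) (G : ℂ → ℂ) (u : ℂ) : Prop where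
  ha : a ∈ Sing
  deep : ∀ x : ℝ, 10 ≤ x → x ≤ 100 → Deep F P z0 N l r a (sg j) (pt x j) ∧ Real.log ‖F (zz z0 N (pt x j)) - a‖ ≤ -en l x
  lift : TractLift F P a r G
  prop : ProperLift r G
  hu : u ∈ HL r
  hue : Complex.exp u = F (zz z0 N (pt 90 j)) - a
  hGu : G u = zz z0 N (pt 90 j)

theorem pt_cont (j : ℕ) : Continuous fun x : ℝ => pt x j := by unfold pt; fun_prop

section
variable {F : ℂ → ℂ} {P Sing : Set ℂ} {M : ℕ} {z0 : ℂ} {N l L κ ε r g Dm : ℝ} {a b s1 s u v : ℂ} {σ : ℝ} {j i : ℕ} {G Gi Gj : ℂ → ℂ}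

theorem Dx.exTr (hX : Dx F P Sing M z0 N l L κ ε r g Dm) (j : ℕ) (hL : 115 + yj j ≤ L) : ∃ a G u, Tr F P Sing z0 N l r j a G u := by
  obtain ⟨a, ha, h⟩ := hX.T1 j hL
  obtain ⟨h1, h2⟩ := h 90 (by norm_num) (by norm_num)
  obtain ⟨u, G, k1, k2, k3, k4, k5⟩ := hX.proper (sg_or j) ha ((pt_norm 90 j).trans (by rw [abs_of_pos (by norm_num)]; linarith)) h1 (by rwa [EE_en, pt_re])
  exact ⟨a, G, u, ha, h, k1, k2, k3, k4, k5⟩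

theorem Tr.ure (T : Tr F P Sing z0 N l r j a G u) : u.re ≤ -en l 90 := by
  have := (T.deep 90 (by norm_num) (by norm_num)).2
  rwa [← T.hue, Complex.norm_exp, Real.log_exp] at this

theorem Dx.inHL (hX : Dx F P Sing M z0 N l L κ ε r g Dm) (hL : 115 + yj 0 ≤ L) (hv : v.re ≤ -en l 90) : v ∈ HL r := by
  have h := (hX.big1 (s := pt 90 0) ((pt_norm 90 0).trans (by rw [abs_of_pos (by norm_num)]; linarith))).1
  rw [EE_en, pt_re] at h
  have h2 := en_pos hX.cx.bx.lpos 90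
  have h3 : Real.log (r/2) < Real.log r := Real.log_lt_log (by linarith [hX.cx.rpos]) (by linarith [hX.cx.rpos])
  change v.re < Real.log r
  unfold e3 at h
  linarith

theorem Tr.val (hr : 0 < r) (T : Tr F P Sing z0 N l r j a G u) (hv : v ∈ HL r) : ‖F (G v) - a‖ < r := by
  rw [T.lift.eq v hv, add_sub_cancel_left]
  exact (HL_norm hr).1 hv

theorem Tr.nobox (hX : Dx F P Sing M z0 N l L κ ε r g Dm) (hL : 115 + yj 0 ≤ L) (T : Tr F P Sing z0 N l r j a G u) (hv : v.re ≤ -en l 90)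
    (hs : ‖s‖ ≤ L - 15) (hre : s.re ≤ 61) : G v ≠ zz z0 N s := by
  intro h
  have hH := hX.inHL hL hv
  have h1 := hX.DB T.ha hs T.lift T.prop ⟨v, hH, h⟩
  rw [← h, T.lift.eq v hH, add_sub_cancel_left, Complex.norm_exp, Real.log_exp, EE_en] at h1
  have h2 : en l s.re ≤ en l 61 := by unfold en; gcongr
  have h3 : en l 90 = en l 61 * Real.exp (29/2) := by rw [← en_add]; norm_num
  have h4 : (10^5 : ℝ) ≤ Real.exp (29/2) := by
    have h : Real.exp 14 = Real.exp 1 ^ 14 := by rw [← Real.exp_nat_mul]; norm_num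
    have := Real.exp_one_gt_d9
    calc (10^5 : ℝ) ≤ 2.7 ^ 14 := by norm_num
      _ ≤ Real.exp 1 ^ 14 := by gcongr; linarith
      _ ≤ _ := by rw [← h]; exact Real.exp_le_exp.2 (by norm_num)
  have h5 := mul_le_mul_of_nonneg_left h4 (en_pos hX.cx.bx.lpos 61).le
  linarith

theorem Tr.same (hX : Dx F P Sing M z0 N l L κ ε r g Dm) {ui uj : ℂ} (Ti : Tr F P Sing z0 N l r i a Gi ui) (Tj : Tr F P Sing z0 N l r j a Gj uj)
    {C : Set ℂ} (hC : IsPreconnected C) (hCs : ∀ z ∈ C, z ∉ P ∧ ‖F z - a‖ < r) {t t' : ℝ} (ht : 0 ≤ t) (ht' : 0 ≤ t') (h1 : Gi (ui - t) ∈ C) (h2 : Gj (uj - t') ∈ C) :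
    ∃ u' : ℂ, u'.re ≤ -en l 90 ∧ Gi u' = zz z0 N (pt 90 j) := by
  have hN := hX.cx.bx.nice
  have hsub : ∀ {u : ℂ} {t : ℝ}, u ∈ HL r → 0 ≤ t → u - t ∈ HL r := fun {u t} hu ht => by
    change (u - t).re < _
    rw [Complex.sub_re, Complex.ofReal_re]
    have : u.re < Real.log r := hu
    linarith
  obtain ⟨v, hv, hGv⟩ := comp_lemma hN (hX.cx.isol Ti.ha) Ti.lift Ti.prop hC hCs ⟨_, h1, ⟨_, hsub Ti.hu ht, rfl⟩⟩ h2
  have hj := hsub Tj.hu ht'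
  have e1 := Ti.lift.eq v hv
  rw [hGv, Tj.lift.eq _ hj, add_right_inj] at e1
  obtain ⟨k, hk⟩ := Complex.exp_eq_exp_iff_exists_int.1 e1.symm
  have hsh := Ti.lift.shift k
  have := TractLift.uniq hN.mero hsh Tj.lift hj (by rw [← hGv, hk])
  refine ⟨uj + k * (2 * Real.pi * Complex.I), ?_, ?_⟩
  · have := Tj.ure
    simpa using this
  · rw [← Tj.hGu, ← this uj Tj.hu]

theorem Tr.ray (hX : Dx F P Sing M z0 N l L κ ε r g Dm) (hL : 115 + yj j ≤ L) (T : Tr F P Sing z0 N l r j a G u) :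
    ∃ R : Set ℂ, IsPreconnected R ∧ (∀ B : ℝ, ∃ z ∈ R, B < ‖z‖) ∧ zz z0 N (pt 50 j) ∈ R ∧ ∀ z ∈ R, ‖F z - a‖ < r ∧
      ∀ s : ℂ, ‖s‖ ≤ L - 15 → s.re = 10 → z ≠ zz z0 N s := by
  have hL0 : 115 + yj 0 ≤ L := by
    have : yj 0 ≤ yj j := by unfold yj; have := Real.pi_pos; simp; positivity
    linarith
  have hre : ∀ t : ℝ, 0 ≤ t → (u - t).re ≤ -en l 90 := fun t ht => by
    rw [Complex.sub_re, Complex.ofReal_re]; linarith [T.ure]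
  have hH := fun t ht => hX.inHL hL0 (hre t ht)
  refine ⟨(fun x : ℝ => zz z0 N (pt x j)) '' Icc 50 90 ∪ (fun t : ℝ => G (u - t)) '' Ici 0, ?_, ?_, ?_, ?_⟩
  · refine IsPreconnected.union (zz z0 N (pt 90 j)) ⟨90, ⟨by norm_num, by norm_num⟩, rfl⟩ ⟨0, self_mem_Ici, ?_⟩ ?_ ?_
    · simp [T.hGu]
    · exact isPreconnected_Icc.image _ ((zz_cont z0 N).comp (pt_cont j)).continuousOn
    · exact isPreconnected_Ici.image _ (T.lift.cont.comp (by fun_prop) fun t ht => hH t ht)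
  · intro B
    obtain ⟨ρ, hρ⟩ := T.prop B
    have h0 : 0 ≤ max 0 (u.re - ρ + 1) := le_max_left _ _
    refine ⟨_, Or.inr ⟨max 0 (u.re - ρ + 1), h0, rfl⟩, hρ _ (hH _ h0) ?_⟩
    rw [Complex.sub_re, Complex.ofReal_re]
    linarith [le_max_right 0 (u.re - ρ + 1)]
  · exact Or.inl ⟨50, ⟨by norm_num, by norm_num⟩, rfl⟩
  · rintro z (⟨x, hx, rfl⟩ | ⟨t, ht, rfl⟩)
    · refine ⟨(T.deep x (by linarith [hx.1]) (by linarith [hx.2])).1.2.2.1, fun s hs hsr h => ?_⟩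
      have := hX.cx.bx.inj _ _ ((pt_norm x j).trans (by rw [abs_of_pos (by linarith [hx.1])]; linarith [hx.2])) (by linarith) h
      rw [← this, pt_re] at hsr
      linarith [hx.1]
    · exact ⟨T.val hX.cx.rpos (hH t ht), fun s hs hsr => T.nobox hX hL0 (hre t ht) hs (by linarith)⟩

end
end

section
theorem yj_mono {i j : ℕ} (h : i ≤ j) : yj i ≤ yj j := by
  unfold yj
  have := Real.pi_pos
  have : (i : ℝ) ≤ j := by exact_mod_cast h
  gcongr

theorem yj_succ (j : ℕ) : yj (j+1) = yj j + 2 * Real.pi := by unfold yj; push_cast; ring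

theorem xc_exists {N : ℝ} (hN : 1000 ≤ N) : ∃ xc : ℝ, 10 < xc ∧ xc < 61 ∧ ∀ x : ℝ, (x < xc → Real.exp ((x - 50)/N) < Real.cos (2 * Real.pi / N)) ∧
    (xc < x → Real.cos (2 * Real.pi / N) < Real.exp ((x - 50)/N)) ∧ (Real.exp ((x - 50)/N) = Real.cos (2 * Real.pi / N) ↔ x = xc) := by
  obtain ⟨-, -, h3, h4⟩ := chord_ang hN
  have hN0 : 0 < N := by linarith
  have hp := Real.pi_pos
  have hq : 0 < Real.pi / N := by positivity
  have e : N * (Real.pi / N) = Real.pi := by field_simp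
  have h1 := Real.cos_le_one (2 * Real.pi / N)
  set c := Real.cos (2 * Real.pi / N)
  have h5 : (Real.pi / N)^2 ≤ (1/300)*(Real.pi/N) := by rw [sq]; exact mul_le_mul_of_nonneg_right h4 hq.le
  have hc : 1/2 ≤ c := by linarith
  have hc0 : 0 < c := by linarith
  have hl := Real.one_sub_inv_le_log_of_pos hc0
  have hl2 : Real.log c ≤ 0 := Real.log_nonpos hc0.le h1
  have hi : c⁻¹ ≤ 1 + 2 * (1 - c) := by
    rw [inv_le_iff_one_le_mul₀ hc0]
    nlinarith only [hc, h1]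
  have hb : -(Real.pi / N) ≤ Real.log c := by linarith
  have hb2 := mul_le_mul_of_nonneg_left hb hN0.le
  have hb3 := mul_le_mul_of_nonneg_left hl2 hN0.le
  have := Real.pi_lt_four
  have ec : Real.exp ((50 + N * Real.log c - 50)/N) = c := by
    rw [add_sub_cancel_left, mul_div_cancel_left₀ _ hN0.ne', Real.exp_log hc0]
  have mono : ∀ x y : ℝ, x < y → Real.exp ((x-50)/N) < Real.exp ((y-50)/N) := fun x y h => by
    apply Real.exp_lt_exp.2; gcongr
  refine ⟨50 + N * Real.log c, by linarith, by linarith, fun x => ⟨fun h => ?_, fun h => ?_, ⟨fun h => ?_, fun h => by rw [h, ec]⟩⟩⟩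
  · exact (mono _ _ h).trans_eq ec
  · exact ec.symm.trans_lt (mono _ _ h)
  · rcases lt_trichotomy x (50 + N * Real.log c) with h' | h' | h'
    · have := mono _ _ h'; linarith
    · exact h'
    · have := mono _ _ h'; linarith

section
variable {F : ℂ → ℂ} {P Sing : Set ℂ} {M : ℕ} {z0 : ℂ} {N l L κ ε r g Dm : ℝ} {a b b' s1 s u v : ℂ} {σ : ℝ} {k i : ℕ} {G Gi Gp Gm : ℂ → ℂ}

theorem Dx.sep (hX : Dx F P Sing M z0 N l L κ ε r g Dm) (ha : a ∈ Sing) (hb : b ∈ Sing) (hab : b ≠ a) (h1 : ‖v - b‖ < r) (h2 : ‖v - a‖ < r) : False := by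
  have h3 := (hX.cx.gap b hb a ha hab).1
  have h4 := hX.cx.hrg
  have h5 := hX.cx.gpos
  have h6 : ‖b - a‖ ≤ ‖v - a‖ + ‖v - b‖ := by
    calc ‖b - a‖ = ‖(v - a) - (v - b)‖ := by congr 1; ring
      _ ≤ _ := norm_sub_le _ _
  unfold e3 at h4
  linarith

set_option maxHeartbeats 800000 in
theorem Dx.no_connect (hX : Dx F P Sing M z0 N l L κ ε r g Dm) (h0 : z0 ≠ 0) (hN : 1000 ≤ N) (hik : i < k) (hL : 115 + yj (k+2) ≤ L)
    {ui uj up um u' : ℂ} {Gj : ℂ → ℂ}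
    (Ti : Tr F P Sing z0 N l r i a Gi ui) (Tj : Tr F P Sing z0 N l r (k+1) a Gj uj)
    (Tp : Tr F P Sing z0 N l r (k+2) b Gp up) (Tm : Tr F P Sing z0 N l r k b' Gm um) (hb : b ≠ a) (hb' : b' ≠ a)
    (hu1 : u'.re ≤ -en l 90) (hu2 : Gi u' = zz z0 N (pt 90 (k+1))) : False := by
  have hp := Real.pi_pos
  have hp3 := Real.pi_gt_three
  have y1 := yj_succ k
  have y2 := yj_succ (k+1)
  have y3 : yj (i+1) ≤ yj k := yj_mono hik
  rw [yj_succ] at y3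
  have yi := yj_nonneg i
  have hL0 : 115 + yj 0 ≤ L := by have := yj_mono (Nat.zero_le (k+2)); linarith
  obtain ⟨Rp, p1, p2, p4, p3⟩ := Tp.ray hX hL
  obtain ⟨Rm, m1, m2, m4, m3⟩ := Tm.ray hX (by linarith [show yj (k+1+1) = yj (k+2) from rfl])
  rw [show yj (k+1+1) = yj (k+2) from rfl] at y2
  obtain ⟨xc, hx1, hx2, hx⟩ := xc_exists hN
  have hseg : ∀ v ∈ segment ℝ ui u', v.re ≤ -en l 90 := by
    intro v hv
    have : Convex ℝ {v : ℂ | v.re ≤ -en l 90} := convex_halfSpace_re_le _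
    exact this.segment_subset Ti.ure hu1 hv
  have hsH := fun v hv => hX.inHL hL0 (hseg v hv)
  have ptn : ∀ x : ℝ, 10 ≤ x → x ≤ 90 → ∀ m ≤ k+1, ‖pt x m‖ ≤ L := by
    intro x h1 h2 m hm
    have := yj_mono hm
    exact (pt_norm x m).trans (by rw [abs_of_pos (by linarith)]; linarith)
  have cZ : ∀ m, Continuous fun x : ℝ => zz z0 N (pt x m) := fun m => (zz_cont z0 N).comp (pt_cont m)
  have cV : Continuous fun t : ℝ => zz z0 N (10 + t * Complex.I) := (zz_cont z0 N).comp (by fun_prop)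
  have nV : ∀ t : ℝ, t ∈ Icc (yj i) (yj (k+1)) → ‖(10 + t * Complex.I : ℂ)‖ ≤ L - 15 := by
    intro t ht
    refine (norm_add_le _ _).trans ?_
    rw [norm_mul, Complex.norm_I, Complex.norm_real, mul_one, Real.norm_eq_abs, abs_of_nonneg (by linarith [ht.1])]
    norm_num
    linarith [ht.2]
  have hpt10 : ∀ m, pt 10 m = 10 + (yj m : ℂ) * Complex.I := fun m => by simp [pt]
  have eSH : ∀ x y : ℝ, 10 ≤ x → x ≤ 90 → 10 ≤ y → y ≤ 90 → zz z0 N (pt x (k+1)) = zz z0 N (pt y (k+1)) → x = y := by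
    intro x y h1 h2 h3 h4 h
    have := hX.cx.bx.inj _ _ (ptn x h1 h2 _ le_rfl) (ptn y h3 h4 _ le_rfl) h
    have := congrArg Complex.re this
    simpa [pt_re] using this
  -- key: points on the chord
  have key : ∀ w : ℂ, ‖w‖ ≤ 11 → ‖pt 50 (k+1) + w‖ ≤ L - 15 := by
    intro w hw
    refine (norm_add_le _ _).trans ?_
    have := pt_norm 50 (k+1)
    rw [abs_of_pos (by norm_num)] at this
    linarith
  obtain ⟨c, hcdef⟩ : ∃ c, c = zz z0 N (pt xc (k+1)) := ⟨_, rfl⟩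
  obtain ⟨SV, hSV⟩ : ∃ S, S = (fun t : ℝ => zz z0 N (10 + t * Complex.I)) '' Icc (yj i) (yj (k+1)) := ⟨_, rfl⟩
  obtain ⟨SI, hSI⟩ : ∃ S, S = (fun x : ℝ => zz z0 N (pt x i)) '' Icc 10 90 := ⟨_, rfl⟩
  obtain ⟨SG, hSG⟩ : ∃ S, S = Gi '' segment ℝ ui u' := ⟨_, rfl⟩
  obtain ⟨SH, hSH⟩ : ∃ S, S = (fun x : ℝ => zz z0 N (pt x (k+1))) '' Icc 10 90 := ⟨_, rfl⟩
  obtain ⟨A1, hA1⟩ : ∃ S, S = (fun x : ℝ => zz z0 N (pt x (k+1))) '' Ico 10 xc := ⟨_, rfl⟩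
  obtain ⟨A2, hA2⟩ : ∃ S, S = (fun x : ℝ => zz z0 N (pt x (k+1))) '' Ioc xc 90 := ⟨_, rfl⟩
  have near : ∀ z ∈ SI ∪ SG ∪ SH, ‖F z - a‖ < r := by
    rintro z ((h | h) | h)
    · rw [hSI] at h; obtain ⟨x, hx, rfl⟩ := h
      exact (Ti.deep x hx.1 (by linarith [hx.2])).1.2.2.1
    · rw [hSG] at h; obtain ⟨v, hv, rfl⟩ := h
      exact Ti.val hX.cx.rpos (hsH v hv)
    · rw [hSH] at h; obtain ⟨x, hx, rfl⟩ := h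
      exact (Tj.deep x hx.1 (by linarith [hx.2])).1.2.2.1
  have notJ : ∀ (b : ℂ) (R : Set ℂ), b ∈ Sing → b ≠ a → (∀ z ∈ R, ‖F z - b‖ < r ∧ ∀ s : ℂ, ‖s‖ ≤ L - 15 → s.re = 10 → z ≠ zz z0 N s) →
      ∀ z ∈ R, z ∉ SV ∪ (SI ∪ SG ∪ SH) := by
    rintro b R hbS hba hR z hz (h | h)
    · rw [hSV] at h; obtain ⟨t, ht, rfl⟩ := h
      exact (hR _ hz).2 _ (nV t ht) (by simp) rfl
    · exact hX.sep Ti.ha hbS hba (hR z hz).1 (near z h)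
  -- chord exclusions
  have nSV : ∀ w : ℂ, ‖w‖ ≤ 11 → zz z0 N (pt 50 (k+1) + w) ∉ SV := by
    intro w hw h
    rw [hSV] at h; obtain ⟨t, ht, h⟩ := h
    have := hX.cx.bx.inj _ _ ((nV t ht).trans (by linarith)) ((key w hw).trans (by linarith)) h
    have := congrArg Complex.re this
    simp [pt_re] at this
    have h2 := (abs_le.1 (Complex.abs_re_le_norm w)).1
    linarith
  have nSG : ∀ w : ℂ, ‖w‖ ≤ 11 → zz z0 N (pt 50 (k+1) + w) ∉ SG := by
    intro w hw h
    rw [hSG] at h; obtain ⟨v, hv, h⟩ := h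
    refine Ti.nobox hX hL0 (hseg v hv) (key w hw) ?_ h
    rw [Complex.add_re, pt_re]
    linarith [(abs_le.1 (Complex.abs_re_le_norm w)).2]
  have nSI : ∀ w : ℂ, ‖w‖ ≤ 11 → zz z0 N (pt 50 (k+1) + w) ∉ SI := by
    intro w hw h
    rw [hSI] at h; obtain ⟨x, hx, h⟩ := h
    have := hX.cx.bx.inj _ _ (ptn x hx.1 hx.2 i (by omega)) ((key w hw).trans (by linarith)) h
    have := congrArg Complex.im this
    simp [pt_im] at this
    have h2 := (abs_le.1 (Complex.abs_im_le_norm w)).1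
    linarith
  have ptadd : ∀ x : ℝ, pt x (k+1) = pt 50 (k+1) + ((x - 50 : ℝ) : ℂ) := fun x => by unfold pt; push_cast; ring
  have hcw : ‖((xc - 50 : ℝ) : ℂ)‖ ≤ 11 ∨ True := Or.inr trivial
  have ep : pt 50 (k+2) = pt 50 (k+1) + 2 * Real.pi * Complex.I := by unfold pt yj; push_cast; ring
  have em : pt 50 k = pt 50 (k+1) - 2 * Real.pi * Complex.I := by unfold pt yj; push_cast; ring
  have sgn := fun x : ℝ => chord_sgn (s0 := pt 50 (k+1)) h0 hN (x - 50) rfl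
  simp only [← ptadd, ← ep, ← em] at sgn
  have hcs : (c - zz z0 N (pt 50 (k+2)))/(c - zz z0 N (pt 50 k)) ∉ Complex.slitPlane := by
    rw [hcdef]; exact (sgn xc).2.2 ((hx xc).2.2.2 rfl)
  have ch : ∀ z : ℂ, (z - zz z0 N (pt 50 (k+2)))/(z - zz z0 N (pt 50 k)) ∉ Complex.slitPlane →
    ∃ w : ℂ, ‖w‖ ≤ 11 ∧ z = zz z0 N (pt 50 (k+1) + w) ∧ (Complex.exp (w/N)).re = Real.cos (2 * Real.pi / N) := by
    intro z hz
    rw [ep, em] at hz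
    exact chord h0 hN hz
  obtain ⟨wc, hwc, hwc2, -⟩ := ch c hcs
  have split : (SV ∪ (SI ∪ SG ∪ SH)) \ {c} = A1 ∪ SV ∪ SI ∪ SG ∪ A2 := by
    ext z
    constructor
    · rintro ⟨h | (h | h) | h, hc⟩
      · exact Or.inl (Or.inl (Or.inl (Or.inr h)))
      · exact Or.inl (Or.inl (Or.inr h))
      · exact Or.inl (Or.inr h)
      · rw [hSH] at h; obtain ⟨x, hxx, rfl⟩ := h
        rcases lt_trichotomy x xc with h' | h' | h'
        · exact Or.inl (Or.inl (Or.inl (Or.inl (by rw [hA1]; exact ⟨x, ⟨hxx.1, h'⟩, rfl⟩))))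
        · exact absurd (by rw [h', hcdef]; rfl) hc
        · exact Or.inr (by rw [hA2]; exact ⟨x, ⟨h', hxx.2⟩, rfl⟩)
    · rintro ((((h | h) | h) | h) | h)
      · rw [hA1] at h; obtain ⟨x, hxx, rfl⟩ := h
        refine ⟨Or.inr (Or.inr (by rw [hSH]; exact ⟨x, ⟨hxx.1, by linarith [hxx.2]⟩, rfl⟩)), fun hc => ?_⟩
        rw [mem_singleton_iff, hcdef] at hc
        linarith [eSH x xc hxx.1 (by linarith [hxx.2]) (by linarith) (by linarith) hc, hxx.2]
      · exact ⟨Or.inl h, fun hc => nSV wc hwc (by rw [← hwc2, ← mem_singleton_iff.1 hc]; exact h)⟩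
      · exact ⟨Or.inr (Or.inl (Or.inl h)), fun hc => nSI wc hwc (by rw [← hwc2, ← mem_singleton_iff.1 hc]; exact h)⟩
      · exact ⟨Or.inr (Or.inl (Or.inr h)), fun hc => nSG wc hwc (by rw [← hwc2, ← mem_singleton_iff.1 hc]; exact h)⟩
      · rw [hA2] at h; obtain ⟨x, hxx, rfl⟩ := h
        refine ⟨Or.inr (Or.inr (by rw [hSH]; exact ⟨x, ⟨by linarith [hxx.1], hxx.2⟩, rfl⟩)), fun hc => ?_⟩
        rw [mem_singleton_iff, hcdef] at hc
        linarith [eSH x xc (by linarith [hxx.1]) hxx.2 (by linarith) (by linarith) hc, hxx.1]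
  have cG : ContinuousOn Gi (segment ℝ ui u') := Ti.lift.cont.mono hsH
  refine planar (J := SV ∪ (SI ∪ SG ∪ SH)) (c := c) ?_ p1 p2 (notJ b Rp Tp.ha hb p3) p4 m1 m2 (notJ b' Rm Tm.ha hb' m3) m4 ?_ ?_ ?_ hcs ?_ ?_
  · rw [hSV, hSI, hSG, hSH]
    refine (isCompact_Icc.image cV).union (((isCompact_Icc.image (cZ i)).union (IsCompact.image_of_continuousOn ?_ cG)).union (isCompact_Icc.image (cZ _)))
    rw [segment_eq_image]
    exact isCompact_Icc.image (by fun_prop)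
  · refine Or.inr (Or.inr ?_)
    rw [hSH, hcdef]; exact ⟨xc, ⟨by linarith, by linarith⟩, rfl⟩
  · rw [split]
    have k1 : IsPreconnected A1 := by rw [hA1]; exact isPreconnected_Ico.image _ (cZ _).continuousOn
    have k2 : IsPreconnected SV := by rw [hSV]; exact isPreconnected_Icc.image _ cV.continuousOn
    have k3 : IsPreconnected SI := by rw [hSI]; exact isPreconnected_Icc.image _ (cZ _).continuousOn
    have k4 : IsPreconnected SG := by rw [hSG]; exact (convex_segment ui u').isPreconnected.image _ cG
    have k5 : IsPreconnected A2 := by rw [hA2]; exact isPreconnected_Ioc.image _ (cZ _).continuousOn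
    refine IsPreconnected.union (zz z0 N (pt 90 (k+1))) ?_ ?_ (IsPreconnected.union (zz z0 N (pt 90 i)) ?_ ?_ (IsPreconnected.union (zz z0 N (pt 10 i)) ?_ ?_ (IsPreconnected.union (zz z0 N (pt 10 (k+1))) ?_ ?_ k1 k2) k3) k4) k5
    · exact Or.inr (by rw [hSG]; exact ⟨u', right_mem_segment _ _ _, hu2⟩)
    · rw [hA2]; exact ⟨90, ⟨by linarith, le_rfl⟩, rfl⟩
    · exact Or.inr (by rw [hSI]; exact ⟨90, ⟨by norm_num, le_rfl⟩, rfl⟩)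
    · rw [hSG]; exact ⟨ui, left_mem_segment _ _ _, Ti.hGu⟩
    · exact Or.inr (by rw [hSV, hpt10]; exact ⟨yj i, ⟨le_rfl, by linarith⟩, rfl⟩)
    · rw [hSI]; exact ⟨10, ⟨le_rfl, by norm_num⟩, rfl⟩
    · rw [hA1]; exact ⟨10, ⟨le_rfl, hx1⟩, rfl⟩
    · rw [hSV, hpt10]; exact ⟨yj (k+1), ⟨by linarith, le_rfl⟩, rfl⟩
  · intro z hz hzc
    by_contra hns
    obtain ⟨w, hw, rfl, hw2⟩ := ch z hns
    rcases hz with h | (h | h) | h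
    · exact nSV w hw h
    · exact nSI w hw h
    · exact nSG w hw h
    · rw [hSH] at h; obtain ⟨x, hxx, h⟩ := h
      have h1 := hX.cx.bx.inj _ _ (ptn x hxx.1 hxx.2 _ le_rfl) ((key w hw).trans (by linarith)) h
      rw [ptadd, add_right_inj] at h1
      rw [← h1] at hw2
      have h3 : (Complex.exp (((x - 50 : ℝ) : ℂ)/N)).re = Real.exp ((x-50)/N) := by
        rw [← Complex.ofReal_div, Complex.exp_ofReal_re]
      rw [h3] at hw2
      have := (hx x).2.2.1 hw2
      exact hzc (by rw [hcdef, ← this, ← h])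
  · have h1 : c ∈ closure ((fun x : ℝ => zz z0 N (pt x (k+1))) '' Ico 10 xc) := by
      rw [hcdef]
      refine image_closure_subset_closure_image (cZ _) ⟨xc, ?_, rfl⟩
      rw [closure_Ico hx1.ne]; exact ⟨hx1.le, le_rfl⟩
    refine closure_mono ?_ h1
    rintro _ ⟨x, hxx, rfl⟩
    refine ⟨?_, (sgn x).1 ((hx x).1 hxx.2)⟩
    rw [split, hA1]
    exact Or.inl (Or.inl (Or.inl (Or.inl ⟨x, hxx, rfl⟩)))
  · have h1 : c ∈ closure ((fun x : ℝ => zz z0 N (pt x (k+1))) '' Ioc xc 90) := by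
      rw [hcdef]
      refine image_closure_subset_closure_image (cZ _) ⟨xc, ?_, rfl⟩
      rw [closure_Ioc (by linarith)]; exact ⟨le_rfl, by linarith⟩
    refine closure_mono ?_ h1
    rintro _ ⟨x, hxx, rfl⟩
    refine ⟨?_, (sgn x).2.1 ((hx x).2.1 hxx.1)⟩
    rw [split, hA2]
    exact Or.inr ⟨x, hxx, rfl⟩

end
end

section
def FinSing (F : ℂ → ℂ) (P : Set ℂ) (n : ℕ) : Prop :=
  ∀ (m : ℕ) (a : Fin m → ℂ) (γ : Fin m → ℝ → ℂ),
    (∀ i, ContinuousOn (γ i) (Ici 0) ∧ (∀ t, 0 ≤ t → γ i t ∉ P) ∧ Tendsto (fun t => ‖γ i t‖) atTop atTop ∧ Tendsto (fun t => F (γ i t)) atTop (𝓝 (a i))) →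
    (∀ i j, i < j → a i ≠ a j ∨ ∃ ε : ℝ, 0 < ε ∧ ∀ C : Set ℂ, IsPreconnected C → (∀ z ∈ C, z ∉ P ∧ ‖F z - a i‖ < ε) →
      ∀ t t' : ℝ, 0 ≤ t → 0 ≤ t' → γ i t ∈ C → γ j t' ∈ C → False) → m ≤ n

theorem gap_exists {Sing : Set ℂ} (h : Sing.Finite) : ∃ g Dm : ℝ, 0 < g ∧ 0 < Dm ∧ ∀ a ∈ Sing, ∀ b ∈ Sing, a ≠ b → g ≤ ‖a - b‖ ∧ ‖a - b‖ ≤ Dm := by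
  by_cases hs : Sing.Nontrivial
  · refine ⟨Sing.infsep, max 1 (Metric.diam Sing), (h.infsep_pos_iff_nontrivial).2 hs, lt_max_of_lt_left one_pos, fun a ha b hb hab => ?_⟩
    rw [← dist_eq_norm]
    exact ⟨Set.infsep_le_dist_of_mem ha hb hab, le_max_of_le_right (Metric.dist_le_diam_of_mem h.isBounded ha hb)⟩
  · rw [not_nontrivial_iff] at hs
    exact ⟨1, 1, one_pos, one_pos, fun a ha b hb hab => absurd (hs ha hb) hab⟩

section
variable {F A : ℂ → ℂ} {P Sing : Set ℂ} {M n : ℕ} {R0 : ℝ} {z0 : ℂ} {N l L κ ε r g Dm : ℝ} {a u : ℂ} {j : ℕ} {G : ℂ → ℂ}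

theorem exDx (hS : Setup F A P Sing M R0) (hT : ∀ (m : ℕ) (ρ : ℝ), ∃ z : ℂ, ρ < ‖z‖ ∧ ‖z‖^m < ‖A z‖) (hfin : Sing.Finite) (hL : 0 < L) :
    ∃ z0 N l κ ε r g Dm, z0 ≠ 0 ∧ 1000 ≤ N ∧ Dx F P Sing M z0 N l L κ ε r g Dm := by
  obtain ⟨g, Dm, hg, hD, hgap⟩ := gap_exists hfin
  have he : 0 < e3 := by unfold e3; norm_num
  obtain ⟨r, hr, hr1, hr2⟩ : ∃ r : ℝ, 0 < r ∧ r ≤ g * (e3/4) ∧ 64 * Dm * r ≤ g^2 := by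
    refine ⟨min (g * (e3/4)) (g^2/(64*Dm)), lt_min (by positivity) (by positivity), min_le_left _ _, ?_⟩
    have := min_le_right (g * (e3/4)) (g^2/(64*Dm))
    rw [le_div_iff₀ (by positivity)] at this
    linarith
  obtain ⟨κ, hκ1, hκ2⟩ : ∃ κ : ℝ, 4 ≤ κ ∧ Real.exp (-(κ/32)) * (8 * Dm) ≤ r := by
    refine ⟨max 4 (32 * Real.log (8 * Dm / r)), le_max_left _ _, ?_⟩
    have h1 := le_max_right 4 (32 * Real.log (8 * Dm / r))
    have h2 : Real.exp (-(max 4 (32 * Real.log (8 * Dm / r))/32)) ≤ Real.exp (-Real.log (8 * Dm / r)) := Real.exp_le_exp.2 (by linarith)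
    rw [Real.exp_neg (Real.log _), Real.exp_log (by positivity)] at h2
    refine (mul_le_mul_of_nonneg_right h2 (by positivity)).trans (le_of_eq ?_)
    field_simp
  obtain ⟨B, hB⟩ : ∃ B, B = |Real.log (r/2)| + κ + 7 * M + |Real.log (r * g^2 / (1000 * Dm^2))| := ⟨_, rfl⟩
  obtain ⟨z0, N, l, h0, -, h2, h3, h4⟩ := BOX hS hT (κ2 := κ) (ε2 := e3/4) (L := L) (Λ0 := max 1000 ((B/(2*e3*Real.exp (-L/2)))^2)) (by positivity) hL
  refine ⟨z0, N, l, κ, e3/4, r, g, Dm, h0, (le_max_left _ _).trans h2, ⟨h4, hr, hg, hgap, hr1, hr2, le_rfl, by linarith⟩, fun s hs => ?_, hκ1, hκ2⟩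
  rw [← hB, EE_norm]
  have h5 : Real.exp (-L/2) ≤ Real.exp (s.re/2) := Real.exp_le_exp.2 (by linarith [(abs_le.1 (Complex.abs_re_le_norm s)).1])
  have h6 : B/(2*e3*Real.exp (-L/2)) ≤ Real.sqrt l := Real.le_sqrt_of_sq_le ((le_max_right _ _).trans h3)
  rw [div_le_iff₀ (by positivity)] at h6
  have h7 := mul_le_mul_of_nonneg_left h5 (show 0 ≤ Real.sqrt l * (2 * e3) by positivity)
  linarith

theorem Tr.path (hX : Dx F P Sing M z0 N l L κ ε r g Dm) (hL : 115 + yj 0 ≤ L) (T : Tr F P Sing z0 N l r j a G u) :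
    ContinuousOn (fun t : ℝ => G (u - t)) (Ici 0) ∧ (∀ t : ℝ, 0 ≤ t → G (u - t) ∉ P) ∧ Tendsto (fun t : ℝ => ‖G (u - t)‖) atTop atTop ∧
      Tendsto (fun t : ℝ => F (G (u - t))) atTop (𝓝 a) := by
  have hH : ∀ t : ℝ, 0 ≤ t → u - t ∈ HL r := fun t ht => hX.inHL hL (by
    rw [Complex.sub_re, Complex.ofReal_re]; linarith [T.ure])
  refine ⟨T.lift.cont.comp (by fun_prop) fun t ht => hH t ht, fun t ht => (T.lift.good _ (hH t ht)).1, ?_, ?_⟩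
  · rw [tendsto_atTop]
    intro B
    obtain ⟨ρ, hρ⟩ := T.prop B
    filter_upwards [eventually_gt_atTop (u.re - ρ), eventually_ge_atTop 0] with t h1 h2
    refine (hρ _ (hH t h2) ?_).le
    rw [Complex.sub_re, Complex.ofReal_re]
    linarith
  · have h1 : Tendsto (fun t : ℝ => a + Complex.exp (u - t)) atTop (𝓝 (a + 0)) := by
      refine tendsto_const_nhds.add (Complex.tendsto_exp_comap_re_atBot.comp ?_)
      rw [tendsto_comap_iff]
      have : Complex.re ∘ (fun t : ℝ => u - (t : ℂ)) = fun t : ℝ => -t + u.re := by ext t; simp; ring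
      rw [this]
      exact tendsto_atBot_add_const_right _ _ tendsto_neg_atTop_atBot
    rw [add_zero] at h1
    refine h1.congr' ?_
    filter_upwards [eventually_ge_atTop 0] with t ht
    rw [T.lift.eq _ (hH t ht)]

theorem main_false (hS : Setup F A P Sing M R0) (hT : ∀ (m : ℕ) (ρ : ℝ), ∃ z : ℂ, ρ < ‖z‖ ∧ ‖z‖^m < ‖A z‖) (hfin : Sing.Finite) (hn : FinSing F P n) : False := by
  obtain ⟨L, hL⟩ : ∃ L, L = 115 + yj (n+2) := ⟨_, rfl⟩
  have hL0 : 0 < L := by have := yj_nonneg (n+2); linarith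
  obtain ⟨z0, N, l, κ, ε, r, g, Dm, h0, hN, hX⟩ := exDx hS hT hfin hL0
  have hLj : ∀ j ≤ n+2, 115 + yj j ≤ L := fun j hj => by have := yj_mono hj; linarith
  have ex : ∀ j : ℕ, ∃ (a : ℂ) (G : ℂ → ℂ) (u : ℂ), j ≤ n+2 → Tr F P Sing z0 N l r j a G u := by
    intro j
    by_cases hj : j ≤ n+2
    · obtain ⟨a, G, u, h⟩ := hX.exTr j (hLj j hj)
      exact ⟨a, G, u, fun _ => h⟩
    · exact ⟨0, 0, 0, fun h => absurd h hj⟩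
  choose a G u T using ex
  have adj : ∀ j, j + 1 ≤ n+2 → a j ≠ a (j+1) := by
    intro j hj h
    have T1 := (T j (by omega)).deep 10 le_rfl (by norm_num)
    have T2 := (T (j+1) hj).deep 10 le_rfl (by norm_num)
    rw [← h] at T2
    exact hX.T2 (hLj _ hj) (T j (by omega)).ha T1.1 T1.2 T2.1 T2.2
  have key := hn (n+1) (fun i => a (i.1+1)) (fun i t => G (i.1+1) (u (i.1+1) - t)) (fun i => (T (i.1+1) (by omega)).path hX (hLj 0 (by omega))) ?_
  · omega
  · intro i j hij
    by_cases hne : a (i.1+1) = a (j.1+1)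
    · refine Or.inr ⟨r, hX.cx.rpos, fun C hC hCs t t' ht ht' h1 h2 => ?_⟩
      have Ti := T (i.1+1) (by omega)
      have Tj := T (j.1+1) (by omega)
      have hij' : i.1 < j.1 := hij
      have h3 : i.1 + 1 < j.1 := by
        rcases Nat.lt_or_ge (i.1+1) j.1 with h | h
        · exact h
        · have e : j.1 = i.1 + 1 := by omega
          exact absurd (by rw [hne, e]) (adj (i.1+1) (by omega))
      have n1 : a (j.1+2) ≠ a (i.1+1) := by rw [hne]; exact (adj (j.1+1) (by omega)).symm
      have n2 : a j.1 ≠ a (i.1+1) := by rw [hne]; exact adj j.1 (by omega)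
      rw [← hne] at Tj
      obtain ⟨u', hu1, hu2⟩ := Ti.same hX Tj hC hCs ht ht' h1 h2
      exact hX.no_connect h0 hN h3 (hLj _ (by omega)) Ti Tj (T (j.1+2) (by omega)) (T j.1 (by omega)) n1 n2 hu1 hu2
    · exact Or.inl hne

end
end

section
open scoped Classical in
def nF (f : ℂ → ℂ) (Pf : Set ℂ) (c z : ℂ) : ℂ := if z ∈ Pf then 0 else (f z - c)⁻¹
def nP (f : ℂ → ℂ) (Pf : Set ℂ) (c : ℂ) : Set ℂ := {z | z ∉ Pf ∧ f z = c}

section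
variable {f : ℂ → ℂ} {Pf : Set ℂ} {c z : ℂ}

theorem nF_pole (hz : z ∈ Pf) : nF f Pf c z = 0 := by rw [nF, if_pos hz]
theorem nF_reg (hz : z ∉ Pf) : nF f Pf c z = (f z - c)⁻¹ := by rw [nF, if_neg hz]

theorem MeroPlane.ev_not (hm : MeroPlane f Pf) (hz : z ∉ Pf) : ∀ᶠ w in 𝓝 z, w ∉ Pf := hm.isClosed.isOpen_compl.mem_nhds hz

theorem MeroPlane.tend (hm : MeroPlane f Pf) (hz : z ∈ Pf) : Tendsto (fun w => ‖f w‖) (𝓝[≠] z) atTop := by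
  refine (hm.2.2 z hz).mono_left ?_
  rw [nhdsWithin, nhdsWithin, le_inf_iff]
  refine ⟨inf_le_left, ?_⟩
  rw [le_principal_iff]
  exact hm.isolated z

theorem TranscMeroPlane.noncst (hf : TranscMeroPlane f Pf) (hz : z ∉ Pf) (b : ℂ) : ∀ᶠ w in 𝓝[≠] z, f w ≠ b := by
  have hm := hf.1
  have han := (hm.2.1 z hz).sub (analyticAt_const (v := b))
  rcases han.eventually_eq_zero_or_eventually_ne_zero with h | h
  · exfalso
    have hc : Pf.Countable := by
      have : Pf = ⋃ n : ℕ, Pf ∩ Metric.closedBall 0 n := by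
        ext w; simp only [mem_iUnion, mem_inter_iff, Metric.mem_closedBall, dist_zero_right]
        exact ⟨fun h => let ⟨n, hn⟩ := exists_nat_ge ‖w‖; ⟨n, h, hn⟩, fun ⟨n, h, _⟩ => h⟩
      rw [this]
      exact countable_iUnion fun n => (hm.1 _ (isCompact_closedBall _ _)).countable
    have hcon := (hc.isConnected_compl_of_one_lt_rank (by rw [Complex.rank_real_complex]; norm_num)).isPreconnected
    have := AnalyticOnNhd.eqOn_of_preconnected_of_eventuallyEq (f := f) (g := fun _ => b) (fun w hw => hm.2.1 w hw) (fun w hw => analyticAt_const) hcon hz (h.mono fun w hw => sub_eq_zero.1 hw)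
    exact hf.2 ⟨Polynomial.C b, 1, one_ne_zero, fun w hw _ => by simpa using this hw⟩
  · exact h.mono fun w hw e => hw (by simp [e])

theorem nP_iso (hf : TranscMeroPlane f Pf) (c z : ℂ) : ∀ᶠ w in 𝓝[≠] z, w ∉ nP f Pf c := by
  by_cases hz : z ∈ Pf
  · filter_upwards [(hf.1.tend hz).eventually_gt_atTop ‖c‖] with w hw h
    rw [h.2] at hw; exact lt_irrefl _ hw
  · filter_upwards [hf.noncst hz c] with w hw h using hw h.2

theorem nF_an (hf : TranscMeroPlane f Pf) (hz : z ∉ nP f Pf c) : AnalyticAt ℂ (nF f Pf c) z := by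
  have hm := hf.1
  have reg : ∀ w, w ∉ Pf → w ∉ nP f Pf c → AnalyticAt ℂ (nF f Pf c) w := by
    intro w hw hwP
    refine (((hm.2.1 w hw).sub analyticAt_const).inv ?_).congr ((hm.ev_not hw).mono fun x hx => (nF_reg hx).symm)
    exact fun h => hwP ⟨hw, sub_eq_zero.1 h⟩
  by_cases hp : z ∈ Pf
  · refine Complex.analyticAt_of_differentiable_on_punctured_nhds_of_continuousAt ?_ ?_
    · filter_upwards [hm.isolated z, nP_iso hf c z] with w h1 h2 using (reg w h1 h2).differentiableAt
    · rw [continuousAt_iff_punctured_nhds, nF_pole hp]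
      have h1 : Tendsto (fun w => f w - c) (𝓝[≠] z) (cobounded ℂ) := by
        rw [← tendsto_norm_atTop_iff_cobounded]
        refine tendsto_atTop_mono (f := fun w => ‖f w‖ - ‖c‖) (fun w => norm_sub_norm_le _ _) ?_
        exact tendsto_atTop_add_const_right _ _ (hm.tend hp)
      refine (tendsto_inv₀_cobounded.comp h1).congr' ?_
      filter_upwards [hm.isolated z] with w h using (nF_reg h).symm
  · exact reg z hp hz

theorem nF_mero (hf : TranscMeroPlane f Pf) (c : ℂ) : MeroPlane (nF f Pf c) (nP f Pf c) := by
  refine ⟨finite_of_isolated (nP_iso hf c), fun z hz => nF_an hf hz, fun p hp => ?_⟩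
  have h1 : Tendsto (fun z => f z - c) (𝓝[(nP f Pf c)ᶜ] p) (𝓝[≠] 0) := by
    rw [tendsto_nhdsWithin_iff]
    have h2 : Tendsto (fun z => f z - c) (𝓝 p) (𝓝 (f p - c)) := Tendsto.sub_const (hf.1.contAt hp.1) c
    rw [hp.2, sub_self] at h2
    refine ⟨h2.mono_left nhdsWithin_le_nhds, ?_⟩
    filter_upwards [self_mem_nhdsWithin, nhdsWithin_le_nhds (hf.1.ev_not hp.1)] with w hw hw2 h
    exact hw ⟨hw2, sub_eq_zero.1 h⟩
  have h3 := tendsto_norm_atTop_iff_cobounded.2 (tendsto_inv₀_nhdsNE_zero.comp h1)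
  refine h3.congr' ?_
  filter_upwards [nhdsWithin_le_nhds (hf.1.ev_not hp.1)] with w hw
  rw [nF_reg hw]; rfl

theorem mult_reg (hf : TranscMeroPlane f Pf) (hz : z ∉ Pf) (hd : deriv f z = 0) : MultiplePoint f z := by
  have han := hf.1.2.1 z hz
  have hnz : ¬ ∀ᶠ w in 𝓝 z, deriv f w = 0 := by
    intro h
    obtain ⟨e, he, h2⟩ := Metric.eventually_nhds_iff_ball.1 (h.and han.eventually_analyticAt)
    have hcst : ∀ w ∈ Metric.ball z e, f w = f z := fun w hw =>
      (convex_ball z e).is_const_of_fderivWithin_eq_zero (𝕜 := ℂ) (f := f) (fun x hx => (h2 x hx).2.differentiableAt.differentiableWithinAt) (fun x hx => by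
        rw [fderivWithin_of_isOpen Metric.isOpen_ball hx]; ext; simp [(h2 x hx).1]) hw (Metric.mem_ball_self he)
    have h3 : ∀ᶠ w in 𝓝[≠] z, f w = f z := nhdsWithin_le_nhds (by filter_upwards [Metric.ball_mem_nhds z he] with w hw using hcst w hw)
    obtain ⟨w, h4, h5⟩ := ((hf.noncst hz (f z)).and h3).exists
    exact h4 h5
  obtain ⟨n, g, hg, hg0, hgw⟩ := han.deriv.exists_eventuallyEq_pow_smul_nonzero_iff.2 hnz
  have hn : n ≠ 0 := by
    rintro rfl
    have := hgw.self_of_nhds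
    rw [hd] at this
    simp at this
    exact hg0 this.symm
  exact ⟨n+1, by omega, Or.inr ⟨han, by simpa using Nat.pos_of_ne_zero hn, g, hg, hg0, by simpa using hgw⟩⟩

end
end

section
section
variable {f : ℂ → ℂ} {Pf : Set ℂ} {c z : ℂ}

theorem nF_ne (hz : z ∉ Pf) (hP : z ∉ nP f Pf c) : nF f Pf c z ≠ 0 := by
  rw [nF_reg hz]
  exact inv_ne_zero fun h => hP ⟨hz, sub_eq_zero.1 h⟩

theorem nF_inv (hz : z ∉ Pf) : f z = c + (nF f Pf c z)⁻¹ := by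
  rw [nF_reg hz, inv_inv]; ring

theorem nF_mult (hf : TranscMeroPlane f Pf) (hz : z ∉ nP f Pf c) : ∃ k : ℕ, 1 ≤ k ∧ (2 ≤ k → MultiplePointWithMult f z k) ∧
    ∃ g : ℂ → ℂ, AnalyticAt ℂ g z ∧ g z ≠ 0 ∧ ∀ᶠ w in 𝓝 z, nF f Pf c w = nF f Pf c z + (w - z) ^ k * g w := by
  have han := nF_an hf hz
  have hnz : ¬ ∀ᶠ w in 𝓝 z, nF f Pf c w - nF f Pf c z = 0 := by
    intro h
    by_cases hp : z ∈ Pf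
    · obtain ⟨w, h1, h2, h3⟩ := ((hf.1.isolated z).and ((nP_iso hf c z).and (h.filter_mono nhdsWithin_le_nhds))).exists
      rw [nF_pole hp, sub_zero] at h3
      exact nF_ne h1 h2 h3
    · obtain ⟨w, h1, h2, h3⟩ := ((hf.1.isolated z).and ((hf.noncst hp (f z)).and (h.filter_mono nhdsWithin_le_nhds))).exists
      apply h2
      rw [nF_inv (f := f) (c := c) h1, nF_inv (f := f) (c := c) hp, sub_eq_zero.1 h3]
  obtain ⟨k, g, hg, hg0, hgw⟩ := (han.sub (analyticAt_const (v := nF f Pf c z))).exists_eventuallyEq_pow_smul_nonzero_iff.2 hnz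
  replace hgw : ∀ᶠ w in 𝓝 z, nF f Pf c w - nF f Pf c z = (w - z)^k * g w := hgw
  have hk : k ≠ 0 := by
    rintro rfl
    have := hgw.self_of_nhds
    simp at this
    exact hg0 this.symm
  refine ⟨k, Nat.pos_of_ne_zero hk, fun hk2 => ⟨hk2, ?_⟩, g, hg, hg0, hgw.mono fun w hw => by rw [← hw]; ring⟩
  by_cases hp : z ∈ Pf
  · refine Or.inl ⟨by omega, fun w => c * (w - z)^k + (g w)⁻¹, ?_, ?_, ?_⟩
    · exact (analyticAt_const.mul ((analyticAt_id.sub analyticAt_const).pow k)).add (hg.inv hg0)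
    · simpa [hk] using hg0
    · filter_upwards [hf.1.isolated z, nhdsWithin_le_nhds hgw, nhdsWithin_le_nhds (hg.continuousAt.eventually_ne hg0), self_mem_nhdsWithin] with w h1 h2 h3 h4
      rw [nF_pole hp, sub_zero] at h2
      have h5 : w - z ≠ 0 := sub_ne_zero.2 h4
      rw [nF_inv (f := f) (c := c) h1, h2]
      field_simp
  · refine Or.inr ⟨hf.1.2.1 z hp, by omega, ?_⟩
    obtain ⟨h, hh⟩ : ∃ h : ℂ → ℂ, h = fun w => -g w / (nF f Pf c w * nF f Pf c z) := ⟨_, rfl⟩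
    have hne := nF_ne hp hz
    have hha : AnalyticAt ℂ h z := by rw [hh]; exact hg.neg.div (han.mul analyticAt_const) (mul_ne_zero hne hne)
    have hh0 : h z ≠ 0 := by rw [hh]; exact div_ne_zero (neg_ne_zero.2 hg0) (mul_ne_zero hne hne)
    have hfe : f =ᶠ[𝓝 z] fun w => f z + (w - z)^k * h w := by
      filter_upwards [hf.1.ev_not hp, hgw, han.continuousAt.eventually_ne hne] with w h1 h2 h3
      rw [nF_inv (f := f) (c := c) h1, nF_inv (f := f) (c := c) hp, hh]
      have e : (w - z)^k * (-g w / (nF f Pf c w * nF f Pf c z)) = -(nF f Pf c w - nF f Pf c z) / (nF f Pf c w * nF f Pf c z) := by rw [h2]; ring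
      simp only [e]
      generalize nF f Pf c w = x at *
      generalize nF f Pf c z = y at *
      field_simp
      ring
    refine ⟨fun w => k * h w + (w - z) * deriv h w, (analyticAt_const.mul hha).add ((analyticAt_id.sub analyticAt_const).mul hha.deriv), by simpa [hk] using hh0, ?_⟩
    filter_upwards [hfe.eventuallyEq_nhds, hha.eventually_analyticAt] with w h1 h2
    rw [h1.deriv_eq]
    have h3 := ((((hasDerivAt_id w).sub_const z).pow k).mul h2.differentiableAt.hasDerivAt).const_add (f z)
    refine h3.deriv.trans ?_
    obtain ⟨m, rfl⟩ : ∃ m, k = m + 1 := ⟨k-1, by omega⟩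
    simp only [Nat.add_sub_cancel, id, Pi.pow_apply]
    push_cast
    ring

theorem nF_deriv0 (hf : TranscMeroPlane f Pf) (hz : z ∉ nP f Pf c) (hd : deriv (nF f Pf c) z = 0) : MultiplePoint f z := by
  obtain ⟨k, hk, h2, g, hg, hg0, hgw⟩ := nF_mult hf hz
  rcases Nat.lt_or_ge 1 k with h | h
  · exact ⟨k, h2 h⟩
  · exfalso
    obtain rfl : k = 1 := by omega
    have e : nF f Pf c =ᶠ[𝓝 z] fun w => nF f Pf c z + (w - z)^1 * g w := hgw
    rw [e.deriv_eq] at hd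
    have h3 := ((((hasDerivAt_id z).sub_const z).pow 1).mul hg.differentiableAt.hasDerivAt).const_add (nF f Pf c z)
    have := h3.deriv.symm.trans hd
    simp at this
    exact hg0 this

end

/-! chordal -/

open scoped Classical in
def Tv (c a : ℂ) : Option ℂ := if a = 0 then none else some (c + a⁻¹)

theorem Tv_inj (c : ℂ) : Function.Injective (Tv c) := by
  intro a b h
  unfold Tv at h
  split_ifs at h with h1 h2 h2
  · rw [h1, h2]
  · simpa using h

theorem Tv_val {f : ℂ → ℂ} {Pf : Set ℂ} {c z : ℂ} (hz : z ∉ nP f Pf c) : valueAt f Pf z = Tv c (nF f Pf c z) := by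
  unfold valueAt Tv
  by_cases hp : z ∈ Pf
  · simp [hp, nF_pole hp]
  · rw [if_neg hp, if_neg (nF_ne hp hz), ← nF_inv hp]

theorem chordal_le (z w : ℂ) : chordal (some z) (some w) ≤ ‖z - w‖ := by
  unfold chordal
  refine div_le_self (norm_nonneg _) (Real.one_le_sqrt.2 ?_)
  nlinarith [sq_nonneg ‖z‖, sq_nonneg ‖w‖, mul_nonneg (sq_nonneg ‖z‖) (sq_nonneg ‖w‖)]

theorem chordal_nonneg (z w : Option ℂ) : 0 ≤ chordal z w := by
  rcases z with _ | z <;> rcases w with _ | w <;> simp only [chordal] <;> positivity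

theorem Tv_cont (c a : ℂ) : Tendsto (fun v => chordal (Tv c v) (Tv c a)) (𝓝 a) (𝓝 0) := by
  by_cases ha : a = 0
  · subst ha
    have h2 : Tendsto (fun v : ℂ => 2 * ‖v‖) (𝓝 0) (𝓝 0) := by
      have : Continuous fun v : ℂ => 2 * ‖v‖ := by fun_prop
      simpa using this.tendsto 0
    refine squeeze_zero' (Eventually.of_forall fun v => chordal_nonneg _ _) ?_ h2
    have h3 : ∀ᶠ v : ℂ in 𝓝 0, ‖v‖ < 1/(2*(‖c‖+1)) := by
      have : ContinuousAt (fun v : ℂ => ‖v‖) 0 := by fun_prop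
      refine this.eventually_lt continuousAt_const ?_
      simp; positivity
    filter_upwards [h3] with v hv
    by_cases hv0 : v = 0
    · simp [Tv, hv0, chordal]
    · have hp : 0 < ‖v‖ := norm_pos_iff.2 hv0
      simp only [Tv, hv0, if_true, if_false, chordal]
      rw [lt_div_iff₀ (by positivity)] at hv
      have h4 : ‖v‖⁻¹ - ‖c‖ ≤ ‖c + v⁻¹‖ := by
        have := norm_sub_norm_le v⁻¹ (-c)
        rw [norm_neg, norm_inv, sub_neg_eq_add, add_comm] at this
        exact this
      have h5 : ‖c‖ ≤ ‖v‖⁻¹ / 2 := by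
        rw [le_div_iff₀ two_pos, ← one_div, le_div_iff₀ hp]
        linarith only [hv, hp]
      have h6 : ‖v‖⁻¹ / 2 ≤ Real.sqrt (1 + ‖c + v⁻¹‖^2) := Real.le_sqrt_of_sq_le (by
        have h7 : ‖v‖⁻¹/2 ≤ ‖c + v⁻¹‖ := by linarith only [h4, h5]
        have := pow_le_pow_left₀ (by positivity) h7 2
        linarith only [this])
      refine (one_div_le_one_div_of_le (by positivity) h6).trans (le_of_eq ?_)
      field_simp
  · have h1 : Tendsto (fun v : ℂ => ‖(c + v⁻¹) - (c + a⁻¹)‖) (𝓝 a) (𝓝 0) := by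
      have : ContinuousAt (fun v : ℂ => ‖(c + v⁻¹) - (c + a⁻¹)‖) a := by fun_prop (disch := exact ha)
      simpa [ContinuousAt] using this
    refine squeeze_zero' (Eventually.of_forall fun v => chordal_nonneg _ _) ?_ h1
    filter_upwards [isOpen_ne.mem_nhds ha] with v hv
    have hv' : v ≠ 0 := hv
    simp only [Tv, hv', ha, if_false]
    exact chordal_le _ _
end

section
section
variable {f : ℂ → ℂ} {Pf : Set ℂ} {c z a : ℂ} {M : ℕ} {γ : ℝ → ℂ}

theorem sqrt_le_one_add (x : ℝ) (hx : 0 ≤ x) : Real.sqrt (1 + x^2) ≤ 1 + x := by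
  rw [Real.sqrt_le_left (by linarith)]; nlinarith only [hx]

theorem Tv_conv (f : ℂ → ℂ) (Pf : Set ℂ) (c a : ℂ) {ε : ℝ} (hε : 0 < ε) :
    ∃ t : ℝ, 0 < t ∧ ∀ z, chordal (valueAt f Pf z) (Tv c a) < t → z ∉ nP f Pf c ∧ ‖nF f Pf c z - a‖ < ε := by
  by_cases ha : a = 0
  · subst ha
    refine ⟨1/(2 + ‖c‖ + 1/ε), by positivity, fun z hz => ?_⟩
    by_cases hp : z ∈ Pf
    · exact ⟨fun h => h.1 hp, by simpa [nF_pole hp] using hε⟩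
    · simp only [valueAt, Tv, hp, if_true, if_false, chordal] at hz
      rw [one_div_lt_one_div (by positivity) (by positivity)] at hz
      have h1 := sqrt_le_one_add ‖f z‖ (norm_nonneg _)
      have h2 := norm_sub_norm_le (f z) c
      have h3 : 1/ε < ‖f z - c‖ := by linarith
      have h4 : 0 < 1/ε := by positivity
      refine ⟨fun h => ?_, ?_⟩
      · rw [h.2, sub_self, norm_zero] at h3; linarith
      · rw [nF_reg hp, sub_zero, norm_inv]
        have := one_div_lt_one_div_of_lt h4 h3
        simpa using this
  · have hi : a⁻¹ ≠ 0 := inv_ne_zero ha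
    have hc : ContinuousAt (fun y : ℂ => y⁻¹) a⁻¹ := continuousAt_inv₀ hi
    obtain ⟨δ, hδ, h1⟩ := Metric.eventually_nhds_iff.1 ((hc.eventually (Metric.ball_mem_nhds _ hε)).and (isOpen_ne.mem_nhds hi))
    obtain ⟨w, hw⟩ : ∃ w, w = c + a⁻¹ := ⟨_, rfl⟩
    obtain ⟨W, hW⟩ : ∃ W, W = Real.sqrt (1 + ‖w‖^2) := ⟨_, rfl⟩
    have hW0 : 0 < W := by rw [hW]; positivity
    have hw1 : 0 < 1 + ‖w‖ := by positivity
    refine ⟨min (1/W) (min (1/(2*W)) (δ/(2*W*(1+‖w‖)))), by positivity, fun z hz => ?_⟩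
    obtain ⟨k1, k2⟩ := lt_min_iff.1 hz
    obtain ⟨k2, k3⟩ := lt_min_iff.1 k2
    clear hz
    by_cases hp : z ∈ Pf
    · simp only [valueAt, Tv, hp, ha, if_true, if_false, chordal, ← hw, ← hW] at k1
      exact absurd k1 (lt_irrefl _)
    · simp only [valueAt, Tv, hp, ha, if_false, chordal, ← hw] at k2 k3
      rw [Real.sqrt_mul (by positivity), ← hW] at k2 k3
      have h2 := sqrt_le_one_add ‖f z‖ (norm_nonneg _)
      have hs : 0 < Real.sqrt (1 + ‖f z‖^2) := by positivity
      generalize Real.sqrt (1 + ‖f z‖^2) = S at *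
      have h3 : ‖f z‖ ≤ ‖w‖ + ‖f z - w‖ := by
        have := norm_sub_norm_le (f z) w; linarith
      rw [div_lt_div_iff₀ (by positivity) (by positivity)] at k2 k3
      have k2' : ‖f z - w‖ * 2 < S := by
        have : (‖f z - w‖ * 2) * W < S * W := by linarith only [k2]
        exact lt_of_mul_lt_mul_right this hW0.le
      have k3' : ‖f z - w‖ * 2 * (1 + ‖w‖) < δ * S := by
        have : (‖f z - w‖ * 2 * (1+‖w‖)) * W < (δ * S) * W := by linarith only [k3]
        exact lt_of_mul_lt_mul_right this hW0.le
      have h4 : S ≤ 2 * (1 + ‖w‖) := by linarith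
      have h5 : ‖f z - w‖ < δ := by
        have := mul_le_mul_of_nonneg_left h4 hδ.le
        have : ‖f z - w‖ * (2 * (1+‖w‖)) < δ * (2 * (1 + ‖w‖)) := by linarith
        exact lt_of_mul_lt_mul_right this (by positivity)
      have h6 := h1 (y := f z - c) (by rw [dist_eq_norm, sub_sub, ← hw]; exact h5)
      refine ⟨fun h => h6.2 (by rw [h.2, sub_self]), ?_⟩
      rw [nF_reg hp]
      simpa [dist_eq_norm] using h6.1

theorem asym (h1 : ContinuousOn γ (Ici 0)) (h2 : ∀ t, 0 ≤ t → γ t ∉ nP f Pf c) (h3 : Tendsto (fun t => ‖γ t‖) atTop atTop)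
    (h4 : Tendsto (fun t => nF f Pf c (γ t)) atTop (𝓝 a)) : AsymptoticPath f Pf (Tv c a) γ := by
  refine ⟨h1, h3, ((Tv_cont c a).comp h4).congr' ?_⟩
  filter_upwards [eventually_ge_atTop 0] with t ht
  rw [Tv_val (h2 t ht)]; rfl

theorem AV_fin (h : FinitelyManyTranscSing f Pf) : {w | ∃ γ, AsymptoticPath f Pf w γ}.Finite := by
  obtain ⟨n, hn⟩ := h
  by_contra hinf
  obtain ⟨t, ht, hc⟩ := Set.Infinite.exists_subset_card_eq hinf (n+1)
  let e := (Finset.equivFinOfCardEq hc).symm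
  have hex : ∀ i, ∃ γ, AsymptoticPath f Pf (e i).1 γ := fun i => ht (e i).2
  choose γ hγ using hex
  have := hn (n+1) (fun i => (e i).1) γ hγ fun i j hij => Or.inl fun he => hij (e.injective (Subtype.ext he))
  omega

theorem fin_fin (h : FinitelyManyTranscSing f Pf) (c : ℂ) : ∃ n, FinSing (nF f Pf c) (nP f Pf c) n := by
  obtain ⟨n, hn⟩ := h
  refine ⟨n, fun m a γ h1 h2 => hn m (fun i => Tv c (a i)) γ (fun i => asym (h1 i).1 (h1 i).2.1 (h1 i).2.2.1 (h1 i).2.2.2) ?_⟩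
  have key : ∀ i j, i < j → DistinctSingularities f Pf (Tv c (a i)) (Tv c (a j)) (γ i) (γ j) := by
    intro i j hij
    by_cases hne : a i = a j
    · rcases h2 i j hij with h | ⟨ε, hε, h⟩
      · exact absurd hne h
      · right
        obtain ⟨t, ht, hz⟩ := Tv_conv f Pf c (a i) hε
        obtain ⟨S, hS⟩ : ∃ S, S = {z | chordal (valueAt f Pf z) (Tv c (a i)) < t} := ⟨_, rfl⟩
        have ev : ∀ l, a l = a i → ∀ᶠ s in atTop, γ l s ∈ S := by
          intro l hl
          have := (asym (h1 l).1 (h1 l).2.1 (h1 l).2.2.1 (h1 l).2.2.2).2.2.eventually_lt_const ht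
          rw [hl] at this
          rw [hS]; exact this
        obtain ⟨T, hT⟩ := eventually_atTop.1 ((ev i rfl).and (ev j hne.symm))
        obtain ⟨T0, hT0, hTT⟩ : ∃ T0 : ℝ, 0 ≤ T0 ∧ T ≤ T0 := ⟨max 0 T, le_max_left _ _, le_max_right _ _⟩
        have sub : ∀ l, (∀ s, T0 ≤ s → γ l s ∈ S) → IsBounded (γ l '' Ici 0 \ connectedComponentIn S (γ l T0)) := by
          intro l hl
          have hpre : IsPreconnected (γ l '' Ici T0) := isPreconnected_Ici.image _ ((h1 l).1.mono (Ici_subset_Ici.2 hT0))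
          have hsub := hpre.subset_connectedComponentIn (mem_image_of_mem _ self_mem_Ici) (by rintro _ ⟨s, hs, rfl⟩; exact hl s hs)
          refine ((isCompact_Icc (a := (0:ℝ)) (b := T0)).image_of_continuousOn ((h1 l).1.mono fun x hx => hx.1)).isBounded.subset ?_
          rintro _ ⟨⟨s, hs, rfl⟩, hn⟩
          refine ⟨s, ⟨hs, ?_⟩, rfl⟩
          by_contra hlt
          exact hn (hsub ⟨s, (not_le.1 hlt).le, rfl⟩)
        have mi := fun s (hs : T0 ≤ s) => (hT s (hTT.trans hs)).1
        have mj := fun s (hs : T0 ≤ s) => (hT s (hTT.trans hs)).2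
        refine ⟨t, ht, connectedComponentIn S (γ i T0), connectedComponentIn S (γ j T0), ?_, ?_, ?_, sub i mi, sub j mj⟩
        · rw [← hS]; exact ⟨_, mi _ le_rfl, rfl⟩
        · rw [← hne, ← hS]; exact ⟨_, mj _ le_rfl, rfl⟩
        · rw [Set.disjoint_left]
          intro z k1 k2
          have e := (connectedComponentIn_eq k1).trans (connectedComponentIn_eq k2).symm
          refine h (connectedComponentIn S (γ i T0)) isPreconnected_connectedComponentIn (fun w hw => hz w ?_) T0 T0 hT0 hT0 (mem_connectedComponentIn (mi _ le_rfl)) (by rw [e]; exact mem_connectedComponentIn (mj _ le_rfl))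
          have := connectedComponentIn_subset _ _ hw
          rw [hS] at this; exact this
    · exact Or.inl fun h => hne (Tv_inj c h)
  intro i j hij
  rcases lt_or_gt_of_ne hij with h | h
  · exact key i j h
  · rcases key j i h with h | ⟨t, ht, C1, C2, k1, k2, k3, k4, k5⟩
    · exact Or.inl h.symm
    · exact Or.inr ⟨t, ht, C2, C1, k2, k1, k3.symm, k5, k4⟩

theorem nice_nF (hf : TranscMeroPlane f Pf) (hM : 0 < M) (hmult : ∀ z μ, MultiplePointWithMult f z μ → μ ≤ M)
    (hc1 : some c ∉ CriticalValues f Pf) (hc2 : ¬ ∃ γ, AsymptoticPath f Pf (some c) γ) :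
    Nice (nF f Pf c) (nP f Pf c) {a | Tv c a ∈ CriticalValues f Pf ∪ {w | ∃ γ, AsymptoticPath f Pf w γ}} M := by
  refine ⟨nF_mero hf c, ?_, ?_, ?_, ?_⟩
  · intro a ha
    refine ⟨fun z hz hza hd => ha (Or.inl ⟨z, nF_deriv0 hf hz hd, ?_⟩), fun γ h1 h2 h3 h4 => ha (Or.inr ⟨γ, asym h1 h2 h3 h4⟩)⟩
    rw [Tv_val hz, hza]
  · intro p hp
    refine ⟨fun z => f z - c, (hf.1.2.1 p hp.1).sub analyticAt_const, by simp [hp.2], ?_, ?_⟩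
    · rw [deriv_sub_const]
      intro hd
      exact hc1 ⟨p, mult_reg hf hp.1 hd, by rw [valueAt, if_neg hp.1, hp.2]⟩
    · filter_upwards [hf.1.isolated p] with z hz
      rw [nF_reg hz, one_div]
  · intro γ h1 h2 h3
    refine hc2 ⟨γ, h1, h2, ?_⟩
    rw [Metric.tendsto_nhds]
    intro ε hε
    filter_upwards [h3 (1/ε)] with t ht
    have hp : 0 < 1/ε := by positivity
    have : γ t ∉ Pf ∧ ‖f (γ t) - c‖ < ε := by
      rcases ht with h | h
      · exact ⟨h.1, by rw [h.2]; simpa using hε⟩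
      · have hn : γ t ∉ Pf := fun hh => by rw [nF_pole hh, norm_zero] at h; linarith
        refine ⟨hn, ?_⟩
        rw [nF_reg hn, norm_inv] at h
        have h0 : 0 < ‖f (γ t) - c‖ := inv_pos.1 (hp.trans h)
        rw [one_div] at h
        exact (inv_lt_inv₀ hε h0).1 h
    rw [Real.dist_eq, sub_zero, abs_of_nonneg (chordal_nonneg _ _), valueAt, if_neg this.1]
    exact (chordal_le _ _).trans_lt this.2
  · intro z hz
    obtain ⟨k, hk, h2, g, hg⟩ := nF_mult hf hz
    refine ⟨k, hk, ?_, g, hg⟩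
    rcases Nat.lt_or_ge 1 k with h | h
    · exact hmult z k (h2 h)
    · omega

end
end

section
theorem SA.schw {φ A : ℂ → ℂ} {z : ℂ} (h : SA φ A z) : schwarzian φ z = 2 * A z := by
  have h1 := (SA_of_schwarzian (A := fun w => schwarzian φ w / 2) h.an h.ne (by ring)).pre
  have h2 := h1.unique h.pre
  have h3 := add_left_cancel h2
  rw [← h3]; ring

theorem Aext {h A : ℂ → ℂ} {PA : Set ℂ} {z : ℂ} (hA : MeroPlane A PA) (han : AnalyticAt ℂ h z) (hd : deriv h z ≠ 0)
    (he : ∀ᶠ w in 𝓝[≠] z, schwarzian h w = 2 * A w) : z ∉ PA ∧ schwarzian h z = 2 * A z := by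
  have hs : AnalyticAt ℂ (schwarzian h) z :=
    (han.deriv.deriv.deriv.div han.deriv hd).sub (analyticAt_const.mul ((han.deriv.deriv.div han.deriv hd).pow 2))
  have h1 : Tendsto (schwarzian h) (𝓝[≠] z) (𝓝 (schwarzian h z)) := hs.continuousAt.tendsto.mono_left nhdsWithin_le_nhds
  have h2 : Tendsto (fun w => 2 * A w) (𝓝[≠] z) (𝓝 (schwarzian h z)) := h1.congr' he
  have hz : z ∉ PA := by
    intro hz
    have h3 : Tendsto (fun w => ‖A w‖) (𝓝[≠] z) (𝓝 (‖schwarzian h z‖ / 2)) := by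
      refine (h2.norm.div_const 2).congr fun w => ?_
      rw [norm_mul]; norm_num
    exact not_tendsto_nhds_of_tendsto_atTop (hA.tend hz) _ h3
  refine ⟨hz, tendsto_nhds_unique h2 ?_⟩
  exact ((hA.contAt hz).tendsto.const_mul 2).mono_left nhdsWithin_le_nhds

theorem setup_nF {f A : ℂ → ℂ} {Pf PA Sing : Set ℂ} {c : ℂ} {M : ℕ} {R0 : ℝ} (hf : TranscMeroPlane f Pf) (hA : MeroPlane A PA)
    (hSf : ∀ z, z ∉ Pf → deriv f z ≠ 0 → schwarzian f z = 2 * A z) (hN : Nice (nF f Pf c) (nP f Pf c) Sing M)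
    (hR : ∀ z, MultiplePoint f z → ‖z‖ ≤ R0) : Setup (nF f Pf c) A (nP f Pf c) Sing M R0 ∧ ∀ z, R0 < ‖z‖ → z ∉ PA := by
  have hd : ∀ z, R0 < ‖z‖ → z ∉ Pf → deriv f z ≠ 0 := fun z hz hp h => not_le.2 hz (hR z (mult_reg hf hp h))
  have ev : ∀ z : ℂ, R0 < ‖z‖ → ∀ᶠ w in 𝓝 z, R0 < ‖w‖ := fun z hz => (continuous_norm.continuousAt (x := z)).eventually_const_lt hz
  have fin : ∀ z, R0 < ‖z‖ → z ∉ nP f Pf c → z ∉ PA ∧ deriv (nF f Pf c) z ≠ 0 ∧ schwarzian (nF f Pf c) z = 2 * A z := by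
    intro z hz hzP
    have hd' : deriv (nF f Pf c) z ≠ 0 := fun h => not_le.2 hz (hR z (nF_deriv0 hf hzP h))
    have := Aext hA (nF_an hf hzP) hd' ?_
    · exact ⟨this.1, hd', this.2⟩
    · filter_upwards [nhdsWithin_le_nhds (ev z hz), hf.1.isolated z, nP_iso hf c z] with w h1 h2 h3
      refine (SA_mob (h := nF f Pf c) (α := 0) (β := 1) (γ := 1) (δ := -c) (SA_of_schwarzian (hf.1.2.1 w h2) (hd w h1 h2) (hSf w h2 (hd w h1 h2))) (by norm_num) ?_ ?_).1.schw
      · exact fun h => h3 ⟨h2, by linear_combination h⟩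
      · filter_upwards [hf.1.ev_not h2] with x hx
        rw [nF_reg hx, inv_eq_one_div]; congr 1 <;> ring
  have all : ∀ z, R0 < ‖z‖ → z ∉ PA := by
    intro z hz
    by_cases hzP : z ∈ nP f Pf c
    · refine (Aext hA (hf.1.2.1 z hzP.1) (hd z hz hzP.1) ?_).1
      filter_upwards [nhdsWithin_le_nhds (ev z hz), hf.1.isolated z] with w h1 h2 using hSf w h2 (hd w h1 h2)
    · exact (fin z hz hzP).1
  exact ⟨⟨hN, fun z hz => hA.2.1 z (all z hz), fun z hz hzP => (fin z hz hzP).2⟩, all⟩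

theorem poly_bound (D : Polynomial ℂ) : ∃ C : ℝ, 0 ≤ C ∧ ∀ z : ℂ, 1 ≤ ‖z‖ → ‖D.eval z‖ ≤ C * ‖z‖ ^ D.natDegree := by
  refine ⟨∑ i ∈ Finset.range (D.natDegree + 1), ‖D.coeff i‖, Finset.sum_nonneg fun _ _ => norm_nonneg _, fun z hz => ?_⟩
  rw [Polynomial.eval_eq_sum_range, Finset.sum_mul]
  refine (norm_sum_le _ _).trans (Finset.sum_le_sum fun i hi => ?_)
  rw [norm_mul, norm_pow]
  gcongr
  exact Nat.lt_succ_iff.1 (Finset.mem_range.1 hi)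

theorem entire_poly {B : ℂ → ℂ} (hB : Differentiable ℂ B) {C ρ : ℝ} {m : ℕ} (h : ∀ z, ρ < ‖z‖ → ‖B z‖ ≤ C * ‖z‖^m) :
    ∃ Q : Polynomial ℂ, ∀ z, B z = Q.eval z := by
  have hz : ∀ n, m < n → iteratedDeriv n B 0 = 0 := by
    intro n hn
    rw [← norm_le_zero_iff]
    have hlim : Tendsto (fun R : ℝ => (n.factorial * C) * (R ^ (n - m))⁻¹) atTop (𝓝 ((n.factorial * C) * 0)) :=
      (tendsto_inv_atTop_zero.comp (tendsto_pow_atTop (by omega))).const_mul _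
    rw [mul_zero] at hlim
    refine ge_of_tendsto hlim ?_
    filter_upwards [eventually_gt_atTop 0, eventually_gt_atTop ρ] with R hR hR2
    refine (Complex.norm_iteratedDeriv_le_of_forall_mem_sphere_norm_le n (C := C * R^m) hR hB.diffContOnCl fun z hz => ?_).trans (le_of_eq ?_)
    · have : ‖z‖ = R := by simpa using hz
      rw [← this]; exact h z (by rw [this]; exact hR2)
    · obtain ⟨k, rfl⟩ : ∃ k, n = m + k := ⟨n - m, by omega⟩
      rw [Nat.add_sub_cancel_left, pow_add]
      field_simp
  refine ⟨∑ i ∈ Finset.range (m+1), Polynomial.C ((i.factorial : ℂ)⁻¹ * iteratedDeriv i B 0) * Polynomial.X ^ i, fun z => ?_⟩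
  have := Complex.taylorSeries_eq_of_entire' (f := B) (c := 0) (z := z) hB
  rw [← this, tsum_eq_sum (s := Finset.range (m+1))]
  · rw [Polynomial.eval_finsetSum]
    refine Finset.sum_congr rfl fun i _ => ?_
    simp
  · intro i hi
    rw [hz i (by simpa using hi)]; ring

theorem rational_of_growth {A : ℂ → ℂ} {PA : Set ℂ} (hA : TranscMeroPlane A PA) (hfin : PA.Finite) {ρ : ℝ} {m : ℕ}
    (hg : ∀ z, ρ < ‖z‖ → ‖A z‖ ≤ ‖z‖^m) : False := by
  have loc : ∀ p ∈ PA, ∃ (k : ℕ) (h : ℂ → ℂ), AnalyticAt ℂ h p ∧ ∀ᶠ w in 𝓝[≠] p, (w - p)^k * A w = h w := by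
    intro p hp
    obtain ⟨k, -, -, g, hg, hg0, hgw⟩ := nF_mult (c := 0) hA (z := p) fun h => h.1 hp
    refine ⟨k, fun w => (g w)⁻¹, hg.inv hg0, ?_⟩
    filter_upwards [nhdsWithin_le_nhds hgw, hA.1.isolated p, nhdsWithin_le_nhds (hg.continuousAt.eventually_ne hg0), self_mem_nhdsWithin] with w h1 h2 h3 h4
    have h5 : w - p ≠ 0 := sub_ne_zero.2 h4
    rw [nF_inv (f := A) (c := 0) h2, h1, nF_pole hp]
    field_simp
    ring
  choose! k h hh1 hh2 using loc
  obtain ⟨D, hD⟩ : ∃ D : Polynomial ℂ, D = ∏ p ∈ hfin.toFinset, (Polynomial.X - Polynomial.C p)^(k p) := ⟨_, rfl⟩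
  have hD0 : D ≠ 0 := by
    rw [hD]; exact Finset.prod_ne_zero_iff.2 fun p _ => pow_ne_zero _ (Polynomial.X_sub_C_ne_zero p)
  have ext : ∀ z, ∃ H : ℂ → ℂ, AnalyticAt ℂ H z ∧ ∀ᶠ w in 𝓝[≠] z, D.eval w * A w = H w := by
    intro z
    have pan : ∀ E : Polynomial ℂ, AnalyticAt ℂ (fun w => E.eval w) z := fun E => by
      have := (E.differentiable).analyticAt z; exact this
    by_cases hz : z ∈ PA
    · have e : D = (Polynomial.X - Polynomial.C z)^(k z) * ∏ p ∈ hfin.toFinset.erase z, (Polynomial.X - Polynomial.C p)^(k p) := by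
        rw [hD]; exact (Finset.mul_prod_erase _ _ (by simpa using hz)).symm
      obtain ⟨E, hE⟩ : ∃ E, E = ∏ p ∈ hfin.toFinset.erase z, (Polynomial.X - Polynomial.C p)^(k p) := ⟨_, rfl⟩
      rw [← hE] at e
      refine ⟨fun w => E.eval w * h z w, (pan E).mul (hh1 z hz), ?_⟩
      filter_upwards [hh2 z hz] with w hw
      rw [← hw, e]; simp; ring
    · exact ⟨fun w => D.eval w * A w, (pan D).mul (hA.1.2.1 z hz), Eventually.of_forall fun _ => rfl⟩
  choose H hH1 hH2 using ext
  obtain ⟨B, hB⟩ : ∃ B : ℂ → ℂ, B = fun z => H z z := ⟨_, rfl⟩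
  have hBA : ∀ z ∉ PA, B z = D.eval z * A z := by
    intro z hz
    have h1 : Tendsto (fun w => D.eval w * A w) (𝓝[≠] z) (𝓝 (D.eval z * A z)) :=
      ((D.continuous.tendsto z).mul (hA.1.contAt hz)).mono_left nhdsWithin_le_nhds
    have h2 := ((hH1 z).continuousAt.tendsto.mono_left (nhdsWithin_le_nhds (s := {z}ᶜ))).congr' ((hH2 z).mono fun w hw => hw.symm)
    rw [hB]; exact tendsto_nhds_unique h2 h1
  have hBd : Differentiable ℂ B := by
    intro z
    refine ((hH1 z).congr ?_).differentiableAt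
    have := (hH2 z).and (hA.1.isolated z)
    rw [eventually_nhdsWithin_iff] at this
    filter_upwards [this] with w hw
    by_cases hwz : w = z
    · rw [hwz, hB]
    · obtain ⟨h1, h2⟩ := hw hwz
      rw [hBA w h2, h1]
  obtain ⟨C, hC0, hC⟩ := poly_bound D
  obtain ⟨R, hR⟩ := hfin.isBounded.exists_norm_le
  obtain ⟨Q, hQ⟩ := entire_poly hBd (C := C) (ρ := max (max 1 ρ) R) (m := D.natDegree + m) fun z hz => by
    obtain ⟨h1, h2⟩ := max_lt_iff.1 hz
    obtain ⟨h3, h4⟩ := max_lt_iff.1 h1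
    rw [hBA z fun h => not_le.2 h2 (hR z h), norm_mul, pow_add, ← mul_assoc]
    exact mul_le_mul (hC z h3.le) (hg z h4) (norm_nonneg _) (by positivity)
  refine hA.2 ⟨Q, D, hD0, fun z hz hd => ?_⟩
  rw [← hQ, hBA z hz]; field_simp

theorem final_thm (M : ℕ) (hM : 0 < M)
    (f A : ℂ → ℂ) (Pf PA : Set ℂ)
    (hf : TranscMeroPlane f Pf)
    (hSf : ∀ z, z ∉ Pf → deriv f z ≠ 0 → schwarzian f z = 2 * A z)
    (hcrit : (CriticalValues f Pf).Finite)
    (hmult : ∀ z μ, MultiplePointWithMult f z μ → μ ≤ M)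
    (hsing : FinitelyManyTranscSing f Pf)
    (hA : TranscMeroPlane A PA) :
    {z : ℂ | MultiplePoint f z}.Infinite := by
  intro hfin
  have hU : (CriticalValues f Pf ∪ {w | ∃ γ, AsymptoticPath f Pf w γ}).Finite := hcrit.union (AV_fin hsing)
  obtain ⟨c, hc⟩ := (hU.preimage (Option.some_injective ℂ).injOn).exists_notMem
  obtain ⟨R0, hR0⟩ := hfin.isBounded.exists_norm_le
  have hN := nice_nF hf hM hmult (fun h => hc (Or.inl h)) (fun h => hc (Or.inr h))
  obtain ⟨hS, hPA⟩ := setup_nF hf hA.1 hSf hN hR0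
  obtain ⟨n, hn⟩ := fin_fin hsing c
  refine main_false hS ?_ (hU.preimage (Tv_inj c).injOn) hn
  intro m ρ
  by_contra hcon
  push Not at hcon
  refine rational_of_growth hA ?_ hcon
  refine (hA.1.1 (Metric.closedBall 0 R0) (isCompact_closedBall _ _)).subset fun z hz => ⟨hz, ?_⟩
  rw [Metric.mem_closedBall, dist_zero_right]
  by_contra h
  exact hPA z (not_le.1 h) hz
end

/-- Theorem 1.2(a): if `f` is transcendental meromorphic in the plane with
finitely many critical values, all multiple points of multiplicity at most `M`, and finitely
many transcendental singularities of the inverse, and if `A = S_f/2` is transcendental,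
then `f` has infinitely many multiple points. -/
theorem schwarzian_wiman_valiron_infinitely_many_multiple_points
    (M : ℕ) (hM : 0 < M)
    (f A : ℂ → ℂ) (Pf PA : Set ℂ)
    (hf : TranscMeroPlane f Pf)
    (hSf : ∀ z, z ∉ Pf → deriv f z ≠ 0 → schwarzian f z = 2 * A z)
    (hcrit : (CriticalValues f Pf).Finite)
    (hmult : ∀ z μ, MultiplePointWithMult f z μ → μ ≤ M)
    (hsing : FinitelyManyTranscSing f Pf)
    (hA : TranscMeroPlane A PA) :
    {z : ℂ | MultiplePoint f z}.Infinite := by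
  exact final_thm M hM f A Pf PA hf hSf hcrit hmult hsing hA

end
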